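/- (Gradient estimate in the forward variable.) Assume σ satisfies hypothesis (H^σ_α) for some α ∈ (0,1), b satisfies hypothesis (H^b_β) for some β ∈ (0,1], and in addition σ is differentiable in space with ‖∇_x σ‖_∞ ≤ κ₂ and |∇_x σ(t,x) − ∇_x σ(t,y)| ≤ κ₂·|x−y|^α for all t ≥ 0, x,y ∈ ℝ^d, for some κ₂ > 0. Fix T > 0 and (s,t) ∈ 𝔻^T_0. Let (ℙ_{s,x})_{x∈ℝ^d} be a family of solutions of the martingale problem for (b,σ) started at (s,x), and let p(s,·,t,·) : ℝ^d×ℝ^d → ℝ be jointly continuous and such that for every x, p(s,x,t,·) is a density of the law of X_t under ℙ_{s,x}. Then for every x ∈ ℝ^d the map y ↦ p(s,x,t,y) is continuously differentiable, and there exist constants λ₃ ∈ (0,1] and C₃ ≥ 1 depending only on Θ = (T,α,β,κ₀,κ₁,d) and κ₂ such that |∇_y p(s,x,t,y)| ≤ C₃·(t−s)^{−1/2}·g_{λ₃}(t−s, θ^{(1)}_{t,s}(x)−y) for all x,y ∈ ℝ^d. -/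

import Mathlib

noncomputable section

open MeasureTheory Matrix Set

/-- The state space `ℝ^d`. -/
abbrev Vec (d : ℕ) := EuclideanSpace ℝ (Fin d)

/-- Hypothesis (H^b_β): `b` is measurable, bounded at the origin uniformly in time
and Hölder/Lipschitz in space uniformly in time. -/
def HolderDrift (d : ℕ) (b : ℝ → Vec d → Vec d) (κ₁ β : ℝ) : Prop :=
  Measurable (Function.uncurry b) ∧
  (∀ t : ℝ, 0 ≤ t → ‖b t 0‖ ≤ κ₁) ∧
  (∀ t : ℝ, 0 ≤ t → ∀ x y : Vec d, ‖b t x - b t y‖ ≤ κ₁ * max (‖x - y‖ ^ β) ‖x - y‖)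

/-- A smooth nonnegative mollifier supported in the closed unit ball with total mass one. -/
structure IsMollifier (d : ℕ) (ρ : Vec d → ℝ) : Prop where
  smooth : ContDiff ℝ (⊤ : ℕ∞) ρ
  nonneg : ∀ x, 0 ≤ ρ x
  support_subset : Function.support ρ ⊆ Metric.closedBall 0 1
  integral_eq_one : ∫ x, ρ x = 1

/-- The spatially mollified drift `b_ε(t,x) = ∫ b(t,y) ρ_ε(x-y) dy`. -/
def mollifiedDrift (d : ℕ) (ρ : Vec d → ℝ) (ε : ℝ) (b : ℝ → Vec d → Vec d)
    (t : ℝ) (x : Vec d) : Vec d :=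
  ∫ y : Vec d, (ε ^ (-(d : ℝ)) * ρ (ε⁻¹ • (x - y))) • b t y

/-- `θ` is the flow of the (time-dependent) vector field `f`:
`θ t s x = x + ∫_s^t f(r, θ r s x) dr` for all nonnegative times. -/
def IsFlow (d : ℕ) (f : ℝ → Vec d → Vec d) (θ : ℝ → ℝ → Vec d → Vec d) : Prop :=
  ∀ s t : ℝ, 0 ≤ s → 0 ≤ t → ∀ x : Vec d,
    θ t s x = x + ∫ r in s..t, f r (θ r s x)

/-- The Gaussian kernel `g_λ(t,x) = t^{-d/2} exp(-λ |x|²/t)`. -/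
def gaussk (d : ℕ) (l t : ℝ) (x : Vec d) : ℝ :=
  t ^ (-(d : ℝ) / 2) * Real.exp (-l * ‖x‖ ^ 2 / t)

/-- A drift which is measurable, bounded at the origin uniformly in time, and Lipschitz in
space with constant `κ` uniformly in time. -/
def LipschitzDrift (d : ℕ) (b : ℝ → Vec d → Vec d) (κ : ℝ) : Prop :=
  Measurable (Function.uncurry b) ∧
  (∃ M : ℝ, ∀ t : ℝ, 0 ≤ t → ‖b t 0‖ ≤ M) ∧
  (∀ t : ℝ, 0 ≤ t → ∀ x y : Vec d, ‖b t x - b t y‖ ≤ κ * ‖x - y‖)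

/-- The diffusion matrix `σσ*`. -/
def sqMat (d : ℕ) (σ : ℝ → Vec d → Matrix (Fin d) (Fin d) ℝ) (t : ℝ) (x : Vec d) :
    Matrix (Fin d) (Fin d) ℝ :=
  σ t x * (σ t x)ᵀ

/-- Hypothesis (H^σ_α): measurability, uniform ellipticity with constant `κ₀`
and spatial α-Hölder continuity with constant `κ₀`. -/
def EllipticHolder (d : ℕ) (σ : ℝ → Vec d → Matrix (Fin d) (Fin d) ℝ) (κ₀ α : ℝ) : Prop :=
  (∀ i j : Fin d, Measurable fun p : ℝ × Vec d => σ p.1 p.2 i j) ∧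
  (∀ t : ℝ, 0 ≤ t → ∀ x : Vec d, ∀ ξ : Fin d → ℝ,
    κ₀⁻¹ * (ξ ⬝ᵥ ξ) ≤ (sqMat d σ t x).mulVec ξ ⬝ᵥ ξ ∧
      (sqMat d σ t x).mulVec ξ ⬝ᵥ ξ ≤ κ₀ * (ξ ⬝ᵥ ξ)) ∧
  (∀ t : ℝ, 0 ≤ t → ∀ x y : Vec d, ∀ i j : Fin d,
    |σ t x i j - σ t y i j| ≤ κ₀ * ‖x - y‖ ^ α)

/-- `b` is smooth in the space variable, with spatial derivatives of every order
bounded uniformly in time and space. -/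
def SmoothVecBounded (d : ℕ) (b : ℝ → Vec d → Vec d) : Prop :=
  (∀ t : ℝ, ContDiff ℝ (⊤ : ℕ∞) (b t)) ∧
  ∀ n : ℕ, 1 ≤ n → ∃ M : ℝ, ∀ t : ℝ, 0 ≤ t → ∀ x : Vec d,
    ‖iteratedFDeriv ℝ n (b t) x‖ ≤ M

/-- `σ` is smooth in the space variable, with spatial derivatives of every order
bounded uniformly in time and space. -/
def SmoothMatBounded (d : ℕ) (σ : ℝ → Vec d → Matrix (Fin d) (Fin d) ℝ) : Prop :=
  (∀ t : ℝ, ∀ i j : Fin d, ContDiff ℝ (⊤ : ℕ∞) fun x => σ t x i j) ∧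
  ∀ n : ℕ, 1 ≤ n → ∃ M : ℝ, ∀ t : ℝ, 0 ≤ t → ∀ x : Vec d, ∀ i j : Fin d,
    ‖iteratedFDeriv ℝ n (fun z => σ t z i j) x‖ ≤ M

/-- The mean shift `ϑ^{(τ,ξ)}_{t,s} = ∫_s^t b(r, θ_{r,τ}(ξ)) dr` of the frozen process. -/
def freezeMean (d : ℕ) (b : ℝ → Vec d → Vec d) (θ : ℝ → ℝ → Vec d → Vec d)
    (τ : ℝ) (ξ : Vec d) (s t : ℝ) : Vec d :=
  ∫ r in s..t, b r (θ r τ ξ)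

/-- The covariance `𝒞^{(τ,ξ)}_{t,s} = ∫_s^t (σσ*)(r, θ_{r,τ}(ξ)) dr` of the frozen process. -/
def freezeCov (d : ℕ) (σ : ℝ → Vec d → Matrix (Fin d) (Fin d) ℝ)
    (θ : ℝ → ℝ → Vec d → Vec d) (τ : ℝ) (ξ : Vec d) (s t : ℝ) :
    Matrix (Fin d) (Fin d) ℝ :=
  Matrix.of fun i j => ∫ r in s..t, sqMat d σ r (θ r τ ξ) i j

/-- The frozen Gaussian density
`p̃^{(τ,ξ)}(s,x,t,y) = ((2π)^d det 𝒞)^{-1/2} exp(−½ ⟨𝒞⁻¹ m, m⟩)`, `m = ϑ + x − y`. -/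
def frozenDensity (d : ℕ) (b : ℝ → Vec d → Vec d)
    (σ : ℝ → Vec d → Matrix (Fin d) (Fin d) ℝ) (θ : ℝ → ℝ → Vec d → Vec d)
    (τ : ℝ) (ξ : Vec d) (s : ℝ) (x : Vec d) (t : ℝ) (y : Vec d) : ℝ :=
  (Real.sqrt ((2 * Real.pi) ^ d * (freezeCov d σ θ τ ξ s t).det))⁻¹ *
    Real.exp (-(1 / 2) *
      ((freezeCov d σ θ τ ξ s t)⁻¹.mulVec (fun i => (freezeMean d b θ τ ξ s t + x - y) i) ⬝ᵥ
        fun i => (freezeMean d b θ τ ξ s t + x - y) i))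

/-- The generator `L_{r} f(z) = ⟨b(r,z), ∇f(z)⟩ + ½ tr(σσ*(r,z) ∇²f(z))`. -/
def genApply (d : ℕ) (b : ℝ → Vec d → Vec d)
    (σ : ℝ → Vec d → Matrix (Fin d) (Fin d) ℝ) (r : ℝ) (f : Vec d → ℝ) (z : Vec d) : ℝ :=
  (∑ i, b r z i * fderiv ℝ f z (EuclideanSpace.single i (1 : ℝ))) +
    (1 / 2) * ∑ i, ∑ j, sqMat d σ r z i j *
      iteratedFDeriv ℝ 2 f z
        ![EuclideanSpace.single i (1 : ℝ), EuclideanSpace.single j (1 : ℝ)]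

/-- The natural σ-algebra of the process `X` on the time interval `[s,u]`. -/
def pathSigma (d : ℕ) {Ω : Type*} [MeasurableSpace Ω] (X : ℝ → Ω → Vec d)
    (s u : ℝ) : MeasurableSpace Ω :=
  ⨆ r ∈ Set.Icc s u, MeasurableSpace.comap (X r) inferInstance

/-- A solution of the martingale problem for `(b,σ)` started at `(s,x)`:
a probability measure `P` together with a process `X` with continuous paths on `[s,∞)`,
`X_s = x` a.s., such that for every `f ∈ C_c^∞(ℝ^d)` the process
`t ↦ f(X_t) − ∫_s^t (L_r f)(X_r) dr` is a martingale w.r.t. the natural filtration. -/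
structure MartingaleProblemSolution (d : ℕ) (b : ℝ → Vec d → Vec d)
    (σ : ℝ → Vec d → Matrix (Fin d) (Fin d) ℝ) (s : ℝ) (x : Vec d)
    {Ω : Type*} [MeasurableSpace Ω] (P : MeasureTheory.Measure Ω)
    (X : ℝ → Ω → Vec d) : Prop where
  isProb : MeasureTheory.IsProbabilityMeasure P
  measurable_X : ∀ t : ℝ, Measurable (X t)
  cont_paths : ∀ ω : Ω, ContinuousOn (fun t => X t ω) (Set.Ici s)
  start : ∀ᵐ ω ∂P, X s ω = x
  integrable : ∀ f : Vec d → ℝ, ContDiff ℝ (⊤ : ℕ∞) f → HasCompactSupport f →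
    ∀ t : ℝ, s ≤ t →
      MeasureTheory.Integrable
        (fun ω => f (X t ω) - ∫ r in s..t, genApply d b σ r f (X r ω)) P
  martingale : ∀ f : Vec d → ℝ, ContDiff ℝ (⊤ : ℕ∞) f → HasCompactSupport f →
    ∀ u v : ℝ, s ≤ u → u ≤ v → ∀ A : Set Ω, MeasurableSet[pathSigma d X s u] A →
      ∫ ω in A, (f (X v ω) - ∫ r in s..v, genApply d b σ r f (X r ω)) ∂P =
      ∫ ω in A, (f (X u ω) - ∫ r in s..u, genApply d b σ r f (X r ω)) ∂P

/-! ### Gaussian kernels and their derivatives as Fourier integrals -/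

/-- The quadratic form attached to a matrix of coefficients. -/
def quadForm {d : ℕ} (C : Fin d → Fin d → ℝ) (k : Vec d) : ℝ := ∑ i, ∑ j, C i j * k i * k j

/-- The Fourier multiplier `∏ (I kᵢ)`. -/
def symbProd {d : ℕ} : List (Fin d) → Vec d → ℂ
  | [], _ => 1
  | i :: L, k => Complex.I * (k i : ℂ) * symbProd L k

/-- The Fourier phase `exp (i⟨k,m⟩ - ½⟨Ck,k⟩)`. -/
def gaussPhase {d : ℕ} (C : Fin d → Fin d → ℝ) (m k : Vec d) : ℂ :=
  Complex.exp (Complex.I * ((∑ i, k i * m i : ℝ) : ℂ) - ((quadForm C k / 2 : ℝ) : ℂ))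

/-- Derivative of order `L` of the unnormalized Gaussian density with covariance `C`. -/
def gaussD {d : ℕ} (L : List (Fin d)) (C : Fin d → Fin d → ℝ) (m : Vec d) : ℝ :=
  (∫ k : Vec d, symbProd L k * gaussPhase C m k).re

/-- The list of all lists obtained by deleting one occurrence of `l`. -/
def removals {d : ℕ} (l : Fin d) : List (Fin d) → List (List (Fin d))
  | [] => []
  | i :: L => (if i = l then [L] else []) ++ (removals l L).map (i :: ·)

lemma removals_length {d : ℕ} (l : Fin d) (L : List (Fin d)) :
    ∀ M ∈ removals l L, M.length + 1 = L.length := by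
  induction L with
  | nil => simp [removals]
  | cons i L ih =>
    intro M hM
    simp only [removals, List.mem_append, List.mem_map] at hM
    rcases hM with hM | ⟨N, hN, rfl⟩
    · split_ifs at hM
      · simp at hM; subst hM; rfl
      · simp at hM
    · simp [← ih N hN]

lemma length_removals_le {d : ℕ} (l : Fin d) (L : List (Fin d)) :
    (removals l L).length ≤ L.length := by
  induction L with
  | nil => simp [removals]
  | cons i L ih =>
    simp only [removals, List.length_append, List.length_map, List.length_cons]
    split_ifs <;> simp <;> omega

lemma norm_symbProd_le {d : ℕ} (L : List (Fin d)) (k : Vec d) :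
    ‖symbProd L k‖ ≤ ‖k‖ ^ L.length := by
  induction L with
  | nil => simp [symbProd]
  | cons i L ih =>
    simp only [symbProd, norm_mul, Complex.norm_I, one_mul, List.length_cons, pow_succ',
      Complex.norm_real]
    gcongr
    exact PiLp.norm_apply_le k i

lemma continuous_symbProd {d : ℕ} (L : List (Fin d)) :
    Continuous (symbProd L : Vec d → ℂ) := by
  induction L with
  | nil => exact continuous_const
  | cons i L ih =>
    change Continuous fun k : Vec d => Complex.I * (k i : ℂ) * symbProd L k
    fun_prop

lemma continuous_quadForm {d : ℕ} (C : Fin d → Fin d → ℝ) :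
    Continuous (quadForm C : Vec d → ℝ) := by
  unfold quadForm; fun_prop

lemma continuous_gaussPhase {d : ℕ} (C : Fin d → Fin d → ℝ) (m : Vec d) :
    Continuous (gaussPhase C m) := by
  have := continuous_quadForm C
  unfold gaussPhase; fun_prop

lemma norm_gaussPhase {d : ℕ} (C : Fin d → Fin d → ℝ) (m k : Vec d) :
    ‖gaussPhase C m k‖ = Real.exp (-(quadForm C k / 2)) := by
  simp [gaussPhase, Complex.norm_exp]

/-- Powers are absorbed by Gaussians. -/
lemma exists_rpow_mul_exp_le (γ l : ℝ) (hγ : 0 ≤ γ) (hl : 0 < l) :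
    ∃ K : ℝ, 0 < K ∧ ∀ x : ℝ, 0 ≤ x → x ^ γ * Real.exp (-l * x ^ 2) ≤ K := by
  obtain ⟨N, hN⟩ := exists_nat_ge γ
  refine ⟨1 + N.factorial * Real.exp (1 / (4 * l)), by positivity, fun x hx => ?_⟩
  have h1 : x ^ γ ≤ 1 + x ^ N := by
    rcases le_total x 1 with h | h
    · have : x ^ γ ≤ 1 := Real.rpow_le_one hx h hγ
      have := pow_nonneg hx N
      linarith
    · have : x ^ γ ≤ x ^ (N : ℝ) := Real.rpow_le_rpow_of_exponent_le h hN
      rw [Real.rpow_natCast] at this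
      linarith
  have h2 : x ^ N ≤ N.factorial * Real.exp x := by
    have := Real.pow_div_factorial_le_exp x hx N
    rwa [div_le_iff₀' (by positivity)] at this
  have h3 : x ≤ 1 / (4 * l) + l * x ^ 2 := by
    have h : 1 / (4 * l) + l * x ^ 2 - x = (2 * l * x - 1) ^ 2 / (4 * l) := by
      field_simp; ring
    have : 0 ≤ (2 * l * x - 1) ^ 2 / (4 * l) := by positivity
    linarith
  have h4 : Real.exp x * Real.exp (-l * x ^ 2) ≤ Real.exp (1 / (4 * l)) := by
    rw [← Real.exp_add]
    exact Real.exp_le_exp.2 (by linarith)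
  have h5 : Real.exp (-l * x ^ 2) ≤ 1 := by
    rw [Real.exp_le_one_iff]; nlinarith [sq_nonneg x]
  calc x ^ γ * Real.exp (-l * x ^ 2) ≤ (1 + N.factorial * Real.exp x) * Real.exp (-l * x ^ 2) := by
        gcongr; linarith
    _ = Real.exp (-l * x ^ 2) + N.factorial * (Real.exp x * Real.exp (-l * x ^ 2)) := by ring
    _ ≤ 1 + N.factorial * Real.exp (1 / (4 * l)) := by gcongr

lemma integrable_exp_neg_mul_norm_sq {d : ℕ} {c : ℝ} (hc : 0 < c) :
    Integrable fun k : Vec d => Real.exp (-c * ‖k‖ ^ 2) := by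
  have h := (GaussianFourier.integrable_cexp_neg_mul_sq_norm_add (V := Vec d) (b := (c : ℂ))
    (by simpa using hc) 0 0).norm
  refine h.congr (Filter.Eventually.of_forall fun k => ?_)
  simp only [zero_mul, add_zero, Complex.norm_exp]
  congr 1
  norm_cast

lemma integrable_pow_mul_exp {d : ℕ} (n : ℕ) {c : ℝ} (hc : 0 < c) :
    Integrable fun k : Vec d => ‖k‖ ^ n * Real.exp (-c * ‖k‖ ^ 2) := by
  obtain ⟨K, hK, h⟩ := exists_rpow_mul_exp_le n (c / 2) (by positivity) (by positivity)
  refine ((integrable_exp_neg_mul_norm_sq (d := d) (half_pos hc)).const_mul K).mono'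
    (by fun_prop) (Filter.Eventually.of_forall fun k => ?_)
  have := h ‖k‖ (norm_nonneg k)
  rw [Real.rpow_natCast] at this
  rw [Real.norm_of_nonneg (by positivity)]
  have e : Real.exp (-c * ‖k‖ ^ 2) = Real.exp (-(c / 2) * ‖k‖ ^ 2) * Real.exp (-(c / 2) * ‖k‖ ^ 2) := by
    rw [← Real.exp_add]; ring_nf
  rw [e, ← mul_assoc]
  gcongr

lemma norm_symbProd_mul_gaussPhase_le {d : ℕ} {c : ℝ} {C : Fin d → Fin d → ℝ}
    (hC : ∀ k : Vec d, c * ‖k‖ ^ 2 ≤ quadForm C k) (L : List (Fin d)) (m k : Vec d) :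
    ‖symbProd L k * gaussPhase C m k‖ ≤ ‖k‖ ^ L.length * Real.exp (-(c / 2) * ‖k‖ ^ 2) := by
  rw [norm_mul, norm_gaussPhase]
  gcongr
  · exact norm_symbProd_le L k
  · have := hC k
    linarith

lemma integrable_symbProd_mul_gaussPhase {d : ℕ} {c : ℝ} (hc : 0 < c) {C : Fin d → Fin d → ℝ}
    (hC : ∀ k : Vec d, c * ‖k‖ ^ 2 ≤ quadForm C k) (L : List (Fin d)) (m : Vec d) :
    Integrable fun k : Vec d => symbProd L k * gaussPhase C m k :=
  (integrable_pow_mul_exp (d := d) L.length (half_pos hc)).mono'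
    ((continuous_symbProd L).mul (continuous_gaussPhase C m)).aestronglyMeasurable
    (Filter.Eventually.of_forall (norm_symbProd_mul_gaussPhase_le hC L m))

/-- The coordinate functional, complex valued. -/
def coordC {d : ℕ} (i : Fin d) : Vec d →L[ℝ] ℂ :=
  Complex.ofRealCLM.comp (EuclideanSpace.proj i : Vec d →L[ℝ] ℝ)

lemma hasFDerivAt_gaussPhase_left {d : ℕ} (C : Fin d → Fin d → ℝ) (m k : Vec d) :
    HasFDerivAt (fun m => gaussPhase C m k)
      (∑ i, (Complex.I * (k i : ℂ) * gaussPhase C m k) • coordC i) m := by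
  have h1 : HasFDerivAt (fun m : Vec d => Complex.I * ((∑ i, k i * m i : ℝ) : ℂ)
      - ((quadForm C k / 2 : ℝ) : ℂ)) (∑ i, (Complex.I * (k i : ℂ)) • coordC i) m := by
    have e : (fun m : Vec d => Complex.I * ((∑ i, k i * m i : ℝ) : ℂ)
      - ((quadForm C k / 2 : ℝ) : ℂ)) = fun m => (∑ i, (Complex.I * (k i : ℂ)) • coordC i : Vec d →L[ℝ] ℂ) m
        - ((quadForm C k / 2 : ℝ) : ℂ) := by
      ext m
      simp [coordC, Finset.mul_sum, mul_assoc]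
    rw [e]
    exact (ContinuousLinearMap.hasFDerivAt _).sub_const _
  refine h1.cexp.congr_fderiv ?_
  rw [Finset.smul_sum]
  refine Finset.sum_congr rfl fun i _ => ?_
  rw [smul_smul, mul_comm]; rfl

/-- The coordinate functional. -/
abbrev coordR {d : ℕ} (i : Fin d) : Vec d →L[ℝ] ℝ := EuclideanSpace.proj i

lemma norm_coordC_le {d : ℕ} (i : Fin d) : ‖(coordC i : Vec d →L[ℝ] ℂ)‖ ≤ 1 :=
  ContinuousLinearMap.opNorm_le_bound _ zero_le_one fun x => by
    simpa [coordC] using PiLp.norm_apply_le x i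

lemma hasFDerivAt_gaussD {d : ℕ} {c : ℝ} (hc : 0 < c) {C : Fin d → Fin d → ℝ}
    (hC : ∀ k : Vec d, c * ‖k‖ ^ 2 ≤ quadForm C k) (L : List (Fin d)) (m : Vec d) :
    HasFDerivAt (gaussD L C) (∑ i, gaussD (i :: L) C m • coordR i) m := by
  have hF : ∀ i k, symbProd L k * (Complex.I * (k i : ℂ) * gaussPhase C m k)
      = symbProd (i :: L) k * gaussPhase C m k := fun i k => by simp only [symbProd]; ring
  have key := hasFDerivAt_integral_of_dominated_of_fderiv_le (𝕜 := ℝ) (μ := volume)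
    (F := fun m (k : Vec d) => symbProd L k * gaussPhase C m k)
    (F' := fun m k => ∑ i, (symbProd (i :: L) k * gaussPhase C m k) • coordC i) (x₀ := m)
    (s := univ) (bound := fun k => ∑ i : Fin d, ‖k‖ ^ (L.length + 1) * Real.exp (-(c / 2) * ‖k‖ ^ 2))
    Filter.univ_mem
    (Filter.Eventually.of_forall fun m =>
      (integrable_symbProd_mul_gaussPhase hc hC L m).aestronglyMeasurable)
    (integrable_symbProd_mul_gaussPhase hc hC L m)
    (by
      have h : ∀ i, Continuous fun k => symbProd (i :: L) k * gaussPhase C m k := fun i =>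
        ((continuous_symbProd _).mul (continuous_gaussPhase C m))
      exact (by fun_prop : Continuous _).aestronglyMeasurable)
    (Filter.Eventually.of_forall fun k m _ => by
      refine (norm_sum_le _ _).trans (Finset.sum_le_sum fun i _ => ?_)
      refine (norm_smul_le (symbProd (i :: L) k * gaussPhase C m k)
        (coordC i : Vec d →L[ℝ] ℂ)).trans ?_
      have := norm_symbProd_mul_gaussPhase_le hC (i :: L) m k
      rw [List.length_cons] at this
      exact (mul_le_of_le_one_right (norm_nonneg _) (norm_coordC_le i)).trans this)
    (integrable_finsetSum _ fun i _ => integrable_pow_mul_exp (L.length + 1) (half_pos hc))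
    (Filter.Eventually.of_forall fun k m _ => by
      refine ((hasFDerivAt_gaussPhase_left C m k).const_mul (symbProd L k)).congr_fderiv ?_
      rw [Finset.smul_sum]
      refine Finset.sum_congr rfl fun i _ => ?_
      rw [smul_smul]; simp only [symbProd]; congr 1; ring)
  have key2 := (Complex.reCLM.hasFDerivAt.comp m key)
  refine key2.congr_fderiv ?_
  rw [integral_finsetSum]
  · ext v
    simp only [ContinuousLinearMap.comp_apply, FunLike.coe_sum, Finset.sum_apply, map_sum]
    refine Finset.sum_congr rfl fun i _ => ?_
    rw [integral_smul_const]
    simp [coordC, gaussD]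
  · intro i _
    exact (integrable_symbProd_mul_gaussPhase hc hC (i :: L) m).smul_const _

lemma hasLineDerivAt_symbProd {d : ℕ} (L : List (Fin d)) (l : Fin d) (k : Vec d) :
    HasLineDerivAt ℝ (symbProd L) (Complex.I * ((removals l L).map fun M => symbProd M k).sum) k
      (EuclideanSpace.single l (1 : ℝ)) := by
  induction L with
  | nil =>
    simp only [removals, List.map_nil, List.sum_nil, mul_zero]
    exact hasDerivAt_const _ _
  | cons i L ih =>
    have h1 : HasDerivAt (fun s : ℝ => Complex.I * (((k + s • EuclideanSpace.single l (1 : ℝ) : Vec d) i : ℝ) : ℂ))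
        (Complex.I * (if i = l then 1 else 0)) 0 := by
      refine HasDerivAt.const_mul _ ?_
      have : HasDerivAt (fun s : ℝ => (k + s • EuclideanSpace.single l (1 : ℝ) : Vec d) i)
          (if i = l then 1 else 0) 0 := by
        simp only [PiLp.add_apply, PiLp.smul_apply, PiLp.single_apply, smul_eq_mul]
        simpa using ((hasDerivAt_id (0:ℝ)).mul_const (if i = l then (1:ℝ) else 0)).const_add (k i)
      refine this.ofReal_comp.congr_deriv ?_
      split_ifs <;> simp
    have h2 := h1.mul ih
    refine HasDerivAt.congr_deriv (f := fun s : ℝ => symbProd (i :: L) (k + s • EuclideanSpace.single l (1 : ℝ))) h2 ?_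
    simp only [zero_smul, add_zero, removals, List.map_append, List.sum_append, List.map_map,
      Function.comp_def, symbProd, List.sum_map_mul_left]
    split_ifs <;> simp <;> ring

lemma hasLineDerivAt_gaussPhase {d : ℕ} {C : Fin d → Fin d → ℝ} (hs : ∀ i j, C i j = C j i)
    (l : Fin d) (m k : Vec d) :
    HasLineDerivAt ℝ (gaussPhase C m)
      ((Complex.I * (m l : ℂ) - ((∑ j, C l j * k j : ℝ) : ℂ)) * gaussPhase C m k) k
      (EuclideanSpace.single l (1 : ℝ)) := by
  have hco : ∀ i, HasDerivAt (fun s : ℝ => (k + s • EuclideanSpace.single l (1 : ℝ) : Vec d) i)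
      (if i = l then 1 else 0) 0 := fun i => by
    simp only [PiLp.add_apply, PiLp.smul_apply, PiLp.single_apply, smul_eq_mul]
    simpa using ((hasDerivAt_id (0:ℝ)).mul_const (if i = l then (1:ℝ) else 0)).const_add (k i)
  have h1 : HasDerivAt (fun s : ℝ => ∑ i, (k + s • EuclideanSpace.single l (1 : ℝ) : Vec d) i * m i)
      (m l) 0 := by
    have := HasDerivAt.fun_sum (u := Finset.univ) fun i _ => (hco i).mul_const (m i)
    refine this.congr_deriv ?_
    simp
  have h2 : HasDerivAt (fun s : ℝ => quadForm C (k + s • EuclideanSpace.single l (1 : ℝ)) / 2)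
      (∑ j, C l j * k j) 0 := by
    have := HasDerivAt.fun_sum (u := Finset.univ) fun i _ =>
      HasDerivAt.fun_sum (u := Finset.univ) fun j _ => ((hco i).const_mul (C i j)).mul (hco j)
    refine (this.div_const 2).congr_deriv ?_
    simp only [zero_smul, add_zero, mul_ite, mul_one, mul_zero, ite_mul, zero_mul,
      Finset.sum_add_distrib, Finset.sum_ite_irrel, Finset.sum_const_zero, Finset.sum_ite_eq', Finset.mem_univ, if_true]
    rw [div_eq_iff two_ne_zero, mul_two]
    congr 1
    exact Finset.sum_congr rfl fun i _ => by rw [hs]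
  have h3 := ((h1.ofReal_comp.const_mul Complex.I).sub h2.ofReal_comp).cexp
  refine HasDerivAt.congr_deriv (f := fun s : ℝ => gaussPhase C m (k + s • EuclideanSpace.single l (1 : ℝ))) h3 ?_
  simp only [Pi.sub_apply, zero_smul, add_zero, gaussPhase]
  rw [mul_comm]

/-- Multiplication by `m l` in terms of derivatives. -/
lemma coord_mul_gaussD {d : ℕ} {c : ℝ} (hc : 0 < c) {C : Fin d → Fin d → ℝ}
    (hs : ∀ i j, C i j = C j i)
    (hC : ∀ k : Vec d, c * ‖k‖ ^ 2 ≤ quadForm C k) (L : List (Fin d)) (l : Fin d) (m : Vec d) :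
    m l * gaussD L C m = -(∑ j, C l j * gaussD (j :: L) C m)
      - ((removals l L).map fun M => gaussD M C m).sum := by
  have hI := fun L => integrable_symbProd_mul_gaussPhase hc hC L m
  have hsum : ∀ R : List (List (Fin d)), (Integrable fun k : Vec d =>
      (R.map fun M => symbProd M k).sum * gaussPhase C m k) ∧
      ∫ k : Vec d, (R.map fun M => symbProd M k).sum * gaussPhase C m k
        = (R.map fun M => ∫ k : Vec d, symbProd M k * gaussPhase C m k).sum := by
    intro R
    induction R with
    | nil => simp
    | cons M R ih =>
      simp only [List.map_cons, List.sum_cons, add_mul]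
      exact ⟨(hI M).add ih.1, by rw [integral_add (hI M) ih.1, ih.2]⟩
  have e1 : ∀ k : Vec d, symbProd L k *
        ((Complex.I * (m l : ℂ) - ((∑ j, C l j * k j : ℝ) : ℂ)) * gaussPhase C m k)
      = Complex.I * ((m l : ℂ) * (symbProd L k * gaussPhase C m k) +
        ∑ j, (C l j : ℂ) * (symbProd (j :: L) k * gaussPhase C m k)) := by
    intro k
    have : Complex.I * ∑ j, (C l j : ℂ) * (symbProd (j :: L) k * gaussPhase C m k)
      = - (((∑ j, C l j * k j : ℝ) : ℂ)) * (symbProd L k * gaussPhase C m k) := by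
      push_cast
      rw [Finset.mul_sum, neg_mul, Finset.sum_mul, ← Finset.sum_neg_distrib]
      refine Finset.sum_congr rfl fun j _ => ?_
      simp only [symbProd]
      linear_combination (C l j * k j * symbProd L k * gaussPhase C m k : ℂ) * Complex.I_mul_I
    rw [mul_add, this]; ring
  have hi1 : Integrable fun k : Vec d => (m l : ℂ) * (symbProd L k * gaussPhase C m k) +
        ∑ j, (C l j : ℂ) * (symbProd (j :: L) k * gaussPhase C m k) :=
    ((hI L).const_mul _).add (integrable_finsetSum _ fun j _ => (hI (j :: L)).const_mul _)
  have key := integral_bilinear_hasLineDerivAt_right_eq_neg_left_of_integrable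
    (μ := (volume : Measure (Vec d)))
    (B := ContinuousLinearMap.mul ℝ ℂ) (f := symbProd L) (g := gaussPhase C m)
    (f' := fun k => Complex.I * ((removals l L).map fun M => symbProd M k).sum)
    (g' := fun k => (Complex.I * (m l : ℂ) - ((∑ j, C l j * k j : ℝ) : ℂ)) * gaussPhase C m k)
    (v := EuclideanSpace.single l (1 : ℝ))
    (by
      simp only [ContinuousLinearMap.mul_apply', mul_assoc]
      exact (hsum _).1.const_mul _)
    (by
      simp only [ContinuousLinearMap.mul_apply', e1]
      exact hi1.const_mul _)
    (by simpa using hI L)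
    (fun k _ => hasLineDerivAt_symbProd L l k) (fun k _ => hasLineDerivAt_gaussPhase hs l m k)
  simp only [ContinuousLinearMap.mul_apply', e1, mul_assoc] at key
  rw [integral_const_mul, integral_const_mul, ← mul_neg, (hsum _).2,
    integral_add ((hI L).const_mul _) (integrable_finsetSum _ fun j _ => (hI (j :: L)).const_mul _),
    integral_finsetSum _ (fun j _ => (hI (j :: L)).const_mul _)] at key
  simp only [integral_const_mul] at key
  have key2 := congrArg Complex.re (mul_left_cancel₀ Complex.I_ne_zero key)
  have hre : ∀ R : List (List (Fin d)),
      ((R.map fun M => ∫ k : Vec d, symbProd M k * gaussPhase C m k).sum).re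
        = (R.map fun M => gaussD M C m).sum := by
    intro R
    induction R with
    | nil => simp
    | cons M R ih => simp only [List.map_cons, List.sum_cons, Complex.add_re, ih]; rfl
  simp only [Complex.add_re, Complex.neg_re, Complex.re_sum, Complex.re_ofReal_mul, hre] at key2
  unfold gaussD at key2 ⊢
  linarith

lemma gaussD_nil_eq {d : ℕ} {c : ℝ} (hc : 0 < c) {C : Fin d → Fin d → ℝ}
    (hs : ∀ i j, C i j = C j i) (hC : ∀ k : Vec d, c * ‖k‖ ^ 2 ≤ quadForm C k)
    (w m : Vec d) (hw : ∀ l, ∑ j, C l j * w j = m l) :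
    gaussD [] C m = gaussD [] C 0 * Real.exp (-(∑ l, w l * m l) / 2) := by
  set q := ∑ l, w l * m l with hq
  have h1 : ∀ r : ℝ, HasDerivAt (fun r : ℝ => gaussD [] C (r • m)) (-(r * q) * gaussD [] C (r • m)) r := by
    intro r
    have hp : HasDerivAt (fun r : ℝ => r • m) m r := by
      simpa using (hasDerivAt_id r).smul_const m
    refine ((hasFDerivAt_gaussD hc hC [] (r • m)).comp_hasDerivAt r hp).congr_deriv ?_
    have e : ∀ l, (r * m l) * gaussD [] C (r • m) = -(∑ j, C l j * gaussD [j] C (r • m)) := fun l => by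
      have := coord_mul_gaussD hc hs hC [] l (r • m)
      simpa [removals] using this
    calc _ = ∑ i, gaussD [i] C (r • m) * m i := by simp
      _ = ∑ i, ∑ j, gaussD [i] C (r • m) * (C i j * w j) :=
        Finset.sum_congr rfl fun i _ => by rw [← Finset.mul_sum, hw]
      _ = ∑ j, w j * ∑ i, C j i * gaussD [i] C (r • m) := by
        rw [Finset.sum_comm]
        refine Finset.sum_congr rfl fun j _ => ?_
        rw [Finset.mul_sum]
        refine Finset.sum_congr rfl fun i _ => ?_
        rw [hs j i]; ring
      _ = ∑ j, w j * (-((r * m j) * gaussD [] C (r • m))) :=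
        Finset.sum_congr rfl fun j _ => by rw [e j, neg_neg]
      _ = _ := by
        rw [hq, Finset.mul_sum, ← Finset.sum_neg_distrib, Finset.sum_mul]
        exact Finset.sum_congr rfl fun j _ => by ring
  have h2 : ∀ r : ℝ, HasDerivAt (fun r : ℝ => gaussD [] C (r • m) * Real.exp (r ^ 2 * q / 2)) 0 r := by
    intro r
    have h3 : HasDerivAt (fun r : ℝ => r ^ 2 * q / 2) (r * q) r := by
      refine (((hasDerivAt_pow 2 r).mul_const q).div_const 2).congr_deriv ?_
      simp; ring
    refine ((h1 r).mul h3.exp).congr_deriv ?_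
    ring
  have h4 := is_const_of_deriv_eq_zero (fun r => (h2 r).differentiableAt) (fun r => (h2 r).deriv) 1 0
  simp only [one_smul, zero_smul, one_pow, one_mul] at h4
  norm_num at h4
  rw [← h4, mul_assoc, ← Real.exp_add]
  ring_nf
  simp

/-- The covariance `C` is comparable to `δ` times the identity. -/
structure CovBetween {d : ℕ} (κ δ : ℝ) (C : Fin d → Fin d → ℝ) : Prop where
  symm : ∀ i j, C i j = C j i
  lower : ∀ k : Vec d, δ / κ * ‖k‖ ^ 2 ≤ quadForm C k
  bound : ∀ i j, |C i j| ≤ κ * δ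

/-- The matrix `q I`. -/
def scalCov (d : ℕ) (q : ℝ) : Fin d → Fin d → ℝ := fun i j => if i = j then q else 0

lemma quadForm_scalCov {d : ℕ} (q : ℝ) (k : Vec d) : quadForm (scalCov d q) k = q * ‖k‖ ^ 2 := by
  simp only [quadForm, scalCov, EuclideanSpace.real_norm_sq_eq, Finset.mul_sum, ite_mul, zero_mul]
  refine Finset.sum_congr rfl fun i _ => ?_
  simp; ring

lemma covBetween_scalCov {d : ℕ} {κ q : ℝ} (hκ : 1 ≤ κ) (hq : 0 < q) : CovBetween κ q (scalCov d q) where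
  symm i j := by simp [scalCov, eq_comm]
  lower k := by
    rw [quadForm_scalCov]
    gcongr
    exact div_le_self hq.le hκ
  bound i j := by
    unfold scalCov
    split_ifs
    · rw [abs_of_pos hq]; nlinarith
    · simp; positivity

lemma symm_scalCov {d : ℕ} (q : ℝ) (i j : Fin d) : scalCov d q i j = scalCov d q j i := by
  simp [scalCov, eq_comm]

lemma gaussD_nil_scalCov {d : ℕ} {q : ℝ} (hq : 0 < q) (m : Vec d) :
    gaussD [] (scalCov d q) m = (2 * Real.pi / q) ^ ((d : ℝ) / 2) * Real.exp (-‖m‖ ^ 2 / (2 * q)) := by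
  rw [gaussD_nil_eq hq (symm_scalCov q) (fun k => (quadForm_scalCov q k).ge) (q⁻¹ • m) m]
  · congr 1
    · have h := GaussianFourier.integral_rexp_neg_mul_sq_norm (V := Vec d) (half_pos hq)
      have e : Real.pi / (q / 2) = 2 * Real.pi / q := by field_simp
      rw [finrank_euclideanSpace_fin, e] at h
      rw [← h, gaussD]
      rw [← RCLike.re_eq_complex_re, ← integral_re]
      · refine integral_congr_ae (Filter.Eventually.of_forall fun k => ?_)
        simp only [symbProd, gaussPhase, quadForm_scalCov, RCLike.re_eq_complex_re]
        simp only [PiLp.zero_apply, mul_zero, Finset.sum_const_zero, Complex.ofReal_zero, zero_sub,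
          one_mul, ← Complex.ofReal_neg, Complex.exp_ofReal_re]
        congr 1; ring
      · exact integrable_symbProd_mul_gaussPhase hq (fun k => (quadForm_scalCov q k).ge) [] 0
    · congr 1
      rw [EuclideanSpace.real_norm_sq_eq]
      simp only [PiLp.smul_apply, smul_eq_mul, mul_assoc, ← Finset.mul_sum, ← sq]
      field_simp
  · intro l
    simp [scalCov, hq.ne']

lemma gaussD_one_scalCov {d : ℕ} {q : ℝ} (hq : 0 < q) (i : Fin d) (m : Vec d) :
    gaussD [i] (scalCov d q) m = -(m i / q) * gaussD [] (scalCov d q) m := by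
  have h := coord_mul_gaussD hq (symm_scalCov q) (fun k => (quadForm_scalCov q k).ge) [] i m
  simp [removals, scalCov] at h
  change _ = -(q * gaussD [i] (scalCov d q) m) at h
  field_simp
  change m i * gaussD [] (scalCov d q) m = _ at h
  linarith

lemma gaussD_two_scalCov {d : ℕ} {q : ℝ} (hq : 0 < q) (i j : Fin d) (m : Vec d) :
    gaussD [i, j] (scalCov d q) m
      = (m i * m j / q ^ 2 - (if i = j then 1 / q else 0)) * gaussD [] (scalCov d q) m := by
  have h := coord_mul_gaussD hq (symm_scalCov q) (fun k => (quadForm_scalCov q k).ge) [j] i m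
  rw [gaussD_one_scalCov hq] at h
  have e : ∑ l, scalCov d q i l * gaussD [l, j] (scalCov d q) m = q * gaussD [i, j] (scalCov d q) m := by
    rw [Finset.sum_eq_single i]
    · simp [scalCov]
    · intro b _ hb; simp [scalCov, hb.symm]
    · simp
  rw [e] at h
  by_cases hij : i = j
  · subst hij
    simp [removals] at h
    simp only [if_true]
    field_simp at h ⊢
    linarith
  · have hij' : ¬ j = i := fun h => hij h.symm
    simp [removals, hij'] at h
    simp only [hij, if_false]
    field_simp at h ⊢
    linarith

lemma exists_weight_absorb (γ l : ℝ) (hγ : 0 ≤ γ) (hl : 0 < l) :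
    ∃ K : ℝ, 0 < K ∧ ∀ δ r : ℝ, 0 < δ → 0 ≤ r →
      r ^ γ * Real.exp (-l * r ^ 2 / δ) ≤ K * δ ^ (γ / 2) * Real.exp (-(l / 2) * r ^ 2 / δ) := by
  obtain ⟨K, hK, h⟩ := exists_rpow_mul_exp_le γ (l / 2) hγ (half_pos hl)
  refine ⟨K, hK, fun δ r hδ hr => ?_⟩
  have h1 := h (r / √δ) (by positivity)
  rw [Real.div_rpow hr (Real.sqrt_nonneg _), div_pow, Real.sq_sqrt hδ.le, Real.sqrt_eq_rpow,
    ← Real.rpow_mul hδ.le] at h1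
  have e : Real.exp (-l * r ^ 2 / δ) = Real.exp (-(l / 2) * (r ^ 2 / δ)) * Real.exp (-(l / 2) * r ^ 2 / δ) := by
    rw [← Real.exp_add]; ring_nf
  have e2 : r ^ γ = r ^ γ / δ ^ (1 / 2 * γ) * δ ^ (γ / 2) := by
    rw [show 1 / 2 * γ = γ / 2 by ring, div_mul_cancel₀]
    positivity
  rw [e, e2]
  calc _ = (r ^ γ / δ ^ (1 / 2 * γ) * Real.exp (-(l / 2) * (r ^ 2 / δ))) * δ ^ (γ / 2) *
      Real.exp (-(l / 2) * r ^ 2 / δ) := by ring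
    _ ≤ _ := by gcongr

lemma exists_inverse_image {d : ℕ} {c : ℝ} (hc : 0 < c) {C : Fin d → Fin d → ℝ}
    (hC : ∀ k : Vec d, c * ‖k‖ ^ 2 ≤ quadForm C k) (m : Vec d) :
    ∃ w : Vec d, ∀ l, ∑ j, C l j * w j = m l := by
  let T : (Fin d → ℝ) →ₗ[ℝ] (Fin d → ℝ) := Matrix.mulVecLin (Matrix.of C)
  have hinj : Function.Injective T := by
    rw [injective_iff_map_eq_zero]
    intro v hv
    have h1 := hC (WithLp.toLp 2 v)
    have h2 : quadForm C (WithLp.toLp 2 v) = 0 := by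
      have : ∀ i, ∑ j, C i j * v j = 0 := fun i => by
        have := congrFun hv i
        simpa [T, Matrix.mulVec, dotProduct] using this
      unfold quadForm
      refine Finset.sum_eq_zero fun i _ => ?_
      calc ∑ j, C i j * v i * v j = v i * ∑ j, C i j * v j := by
            rw [Finset.mul_sum]; exact Finset.sum_congr rfl fun j _ => by ring
        _ = 0 := by rw [this, mul_zero]
    rw [h2] at h1
    have h3 : ‖(WithLp.toLp 2 v : Vec d)‖ ^ 2 = 0 := by
      by_contra hne
      have : 0 < ‖(WithLp.toLp 2 v : Vec d)‖ ^ 2 := by positivity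
      nlinarith
    have h4 : (WithLp.toLp 2 v : Vec d) = 0 := by simpa using h3
    simpa using congrArg WithLp.ofLp h4
  obtain ⟨v, hv⟩ := (LinearMap.injective_iff_surjective.1 hinj) (fun i => m i)
  exact ⟨WithLp.toLp 2 v, fun l => by simpa [T, Matrix.mulVec, dotProduct] using congrFun hv l⟩

lemma exists_gaussD_nil_le (d : ℕ) (κ : ℝ) (hκ : 1 ≤ κ) :
    ∃ K l : ℝ, 0 < K ∧ 0 < l ∧ ∀ (δ : ℝ) (C : Fin d → Fin d → ℝ), 0 < δ → CovBetween κ δ C →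
      ∀ m : Vec d, |gaussD [] C m| ≤ K * δ ^ (-(d : ℝ) / 2) * Real.exp (-l * ‖m‖ ^ 2 / δ) := by
  have hκ0 : 0 < κ := by linarith
  refine ⟨(2 * Real.pi * κ) ^ ((d : ℝ) / 2), 1 / (2 * (d ^ 2 + 1) * κ ^ 3), by positivity, by positivity,
    fun δ C hδ hC m => ?_⟩
  have hc : 0 < δ / κ := by positivity
  obtain ⟨w, hw⟩ := exists_inverse_image hc hC.lower m
  rw [gaussD_nil_eq hc hC.symm hC.lower w m hw, abs_mul, Real.abs_exp]
  refine mul_le_mul ?_ (Real.exp_le_exp.2 ?_) (by positivity) (by positivity)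
  · calc |gaussD [] C 0| ≤ ‖∫ k : Vec d, symbProd [] k * gaussPhase C 0 k‖ := Complex.abs_re_le_norm _
      _ ≤ ∫ k : Vec d, Real.exp (-(δ / κ / 2) * ‖k‖ ^ 2) := by
        refine norm_integral_le_of_norm_le (integrable_exp_neg_mul_norm_sq (by positivity))
          (Filter.Eventually.of_forall fun k => ?_)
        simpa using norm_symbProd_mul_gaussPhase_le hC.lower [] 0 k
      _ = (2 * Real.pi * κ) ^ ((d : ℝ) / 2) * δ ^ (-(d : ℝ) / 2) := by
        rw [GaussianFourier.integral_rexp_neg_mul_sq_norm (half_pos hc), finrank_euclideanSpace_fin,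
          show Real.pi / (δ / κ / 2) = (2 * Real.pi * κ) * δ⁻¹ by field_simp,
          Real.mul_rpow (by positivity) (by positivity), Real.inv_rpow hδ.le, ← Real.rpow_neg hδ.le, neg_div]
  · have hq : ∑ l, w l * m l = quadForm C w := by
      unfold quadForm
      refine Finset.sum_congr rfl fun i _ => ?_
      rw [← hw i, Finset.mul_sum]
      exact Finset.sum_congr rfl fun j _ => by ring
    have h1 := hC.lower w
    have h2 : ‖m‖ ^ 2 ≤ quadForm C w * (d * κ ^ 3 * δ) * d := by
      have hcoord : ∀ l, (m l) ^ 2 ≤ (κ * δ) ^ 2 * (d * ‖w‖ ^ 2) := by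
        intro l
        rw [← hw l]
        calc (∑ j, C l j * w j) ^ 2 ≤ (∑ j, C l j ^ 2) * ∑ j, w j ^ 2 :=
              Finset.sum_mul_sq_le_sq_mul_sq _ _ _
          _ ≤ (∑ j : Fin d, (κ * δ) ^ 2) * ∑ j, w j ^ 2 := by
              refine mul_le_mul_of_nonneg_right (Finset.sum_le_sum fun j _ => ?_) (by positivity)
              exact sq_le_sq' (abs_le.1 (hC.bound l j)).1 (abs_le.1 (hC.bound l j)).2
          _ = _ := by rw [EuclideanSpace.real_norm_sq_eq]; simp; ring
      have hw2 : ‖w‖ ^ 2 ≤ quadForm C w * κ / δ := by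
        rw [le_div_iff₀ hδ]
        have : δ / κ * ‖w‖ ^ 2 * κ = ‖w‖ ^ 2 * δ := by field_simp
        rw [← this]; gcongr
      rw [EuclideanSpace.real_norm_sq_eq]
      calc ∑ l, (m l) ^ 2 ≤ ∑ l : Fin d, (κ * δ) ^ 2 * (d * (quadForm C w * κ / δ)) := by
            refine Finset.sum_le_sum fun l _ => (hcoord l).trans ?_
            gcongr
        _ = _ := by simp; field_simp
    have h0 : 0 ≤ quadForm C w := le_trans (by positivity) h1
    rw [hq, neg_div, neg_mul, neg_div, neg_le_neg_iff, div_mul_eq_mul_div, one_mul, div_div,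
      div_le_div_iff₀ (by positivity) two_pos]
    have h3 : 0 ≤ quadForm C w * (κ ^ 3 * δ) := by positivity
    nlinarith

lemma list_abs_sum_le (L : List ℝ) : |L.sum| ≤ (L.map abs).sum := by
  induction L with
  | nil => simp
  | cons a L ih =>
    simp only [List.sum_cons, List.map_cons]
    exact (abs_add_le _ _).trans (by linarith)

lemma exists_gaussD_le (d : ℕ) (κ : ℝ) (hκ : 1 ≤ κ) (n : ℕ) :
    ∃ K l : ℝ, 0 < K ∧ 0 < l ∧ ∀ (δ : ℝ) (C : Fin d → Fin d → ℝ), 0 < δ → CovBetween κ δ C →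
      ∀ (L : List (Fin d)), L.length = n → ∀ m : Vec d,
        |gaussD L C m| ≤ K * δ ^ (-((n : ℝ) + d) / 2) * Real.exp (-l * ‖m‖ ^ 2 / δ) := by
  induction n using Nat.strong_induction_on with
  | _ n ih =>
  rcases n with _ | n
  · obtain ⟨K, l, hK, hl, h⟩ := exists_gaussD_nil_le d κ hκ
    refine ⟨K, l, hK, hl, fun δ C hδ hC L hL m => ?_⟩
    rw [List.length_eq_zero_iff] at hL
    subst hL
    simpa using h δ C hδ hC m
  have hκ0 : 0 < κ := by linarith
  obtain ⟨K₁, l₁, hK₁, hl₁, h₁⟩ := ih n (by omega)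
  have h₂ : ∃ K l : ℝ, 0 < K ∧ 0 < l ∧ ∀ (δ : ℝ) (C : Fin d → Fin d → ℝ), 0 < δ → CovBetween κ δ C →
      ∀ (L : List (Fin d)), L.length + 1 = n → ∀ m : Vec d,
        |gaussD L C m| ≤ K * δ ^ (-((n : ℝ) - 1 + d) / 2) * Real.exp (-l * ‖m‖ ^ 2 / δ) := by
    rcases n with _ | n
    · exact ⟨1, 1, one_pos, one_pos, fun δ C hδ hC L hL => by omega⟩
    · obtain ⟨K, l, hK, hl, h⟩ := ih n (by omega)
      refine ⟨K, l, hK, hl, fun δ C hδ hC L hL m => ?_⟩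
      convert h δ C hδ hC L (by omega) m using 5
      push_cast; ring
  obtain ⟨K₂, l₂, hK₂, hl₂, h₂⟩ := h₂
  obtain ⟨A, hA, hA'⟩ := exists_weight_absorb 1 l₁ zero_le_one hl₁
  set l := min (l₁ / 2) l₂ with hl
  have hl0 : 0 < l := by positivity
  refine ⟨κ * (d * (A * K₁ + n * K₂)) + 1, l, by positivity, hl0, fun δ C hδ hC L hL m => ?_⟩
  obtain ⟨i, L', rfl⟩ : ∃ i L', L = i :: L' := by
    cases L with
    | nil => simp at hL
    | cons i L' => exact ⟨i, L', rfl⟩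
  have hL' : L'.length = n := by simpa using hL
  have hc : 0 < δ / κ := by positivity
  set G : Vec d := WithLp.toLp 2 fun j => gaussD (j :: L') C m with hG
  set B : ℝ := (A * K₁ + n * K₂) * δ ^ (-((n : ℝ) - 1 + d) / 2) * Real.exp (-l * ‖m‖ ^ 2 / δ) with hB
  have hexp : ∀ l', l ≤ l' → Real.exp (-l' * ‖m‖ ^ 2 / δ) ≤ Real.exp (-l * ‖m‖ ^ 2 / δ) := fun l' h => by
    gcongr
  have hv : ∀ j, |∑ j', C j j' * G j'| ≤ B := by
    intro j
    have e := coord_mul_gaussD hc hC.symm hC.lower L' j m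
    have e' : ∑ j', C j j' * G j' = -(m j * gaussD L' C m)
        - ((removals j L').map fun M => gaussD M C m).sum := by
      rw [e]; simp [hG]
    have hr : |((removals j L').map fun M => gaussD M C m).sum| ≤
        n * (K₂ * δ ^ (-((n : ℝ) - 1 + d) / 2) * Real.exp (-l * ‖m‖ ^ 2 / δ)) := by
      refine (list_abs_sum_le _).trans ?_
      rw [List.map_map]
      refine (List.sum_le_card_nsmul _ (K₂ * δ ^ (-((n : ℝ) - 1 + d) / 2) * Real.exp (-l * ‖m‖ ^ 2 / δ)) ?_).trans ?_
      · intro x hx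
        obtain ⟨M, hM, rfl⟩ := List.mem_map.1 hx
        refine (h₂ δ C hδ hC M (by rw [removals_length j L' M hM, hL']) m).trans ?_
        exact mul_le_mul_of_nonneg_left (hexp _ (min_le_right _ _)) (by positivity)
      · rw [List.length_map, nsmul_eq_mul]
        gcongr
        exact hL' ▸ length_removals_le j L'
    have hm : |m j * gaussD L' C m| ≤ A * K₁ * δ ^ (-((n : ℝ) - 1 + d) / 2) * Real.exp (-l * ‖m‖ ^ 2 / δ) := by
      rw [abs_mul]
      calc |m j| * |gaussD L' C m| ≤ ‖m‖ * (K₁ * δ ^ (-((n : ℝ) + d) / 2) * Real.exp (-l₁ * ‖m‖ ^ 2 / δ)) := by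
            gcongr
            · exact PiLp.norm_apply_le m j
            · exact h₁ δ C hδ hC L' hL' m
        _ = K₁ * δ ^ (-((n : ℝ) + d) / 2) * (‖m‖ ^ (1:ℝ) * Real.exp (-l₁ * ‖m‖ ^ 2 / δ)) := by
            rw [Real.rpow_one]; ring
        _ ≤ K₁ * δ ^ (-((n : ℝ) + d) / 2) * (A * δ ^ ((1:ℝ) / 2) * Real.exp (-(l₁ / 2) * ‖m‖ ^ 2 / δ)) := by
            exact mul_le_mul_of_nonneg_left (hA' δ ‖m‖ hδ (norm_nonneg m)) (by positivity)
        _ ≤ K₁ * δ ^ (-((n : ℝ) + d) / 2) * (A * δ ^ ((1:ℝ) / 2) * Real.exp (-l * ‖m‖ ^ 2 / δ)) := by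
            exact mul_le_mul_of_nonneg_left (mul_le_mul_of_nonneg_left (hexp _ (min_le_left _ _))
              (by positivity)) (by positivity)
        _ = A * K₁ * (δ ^ (-((n : ℝ) + d) / 2) * δ ^ ((1:ℝ) / 2)) * Real.exp (-l * ‖m‖ ^ 2 / δ) := by ring
        _ = _ := by rw [← Real.rpow_add hδ]; congr 3; ring
    rw [e', hB]
    calc _ ≤ |-(m j * gaussD L' C m)| + |((removals j L').map fun M => gaussD M C m).sum| := abs_sub _ _
      _ ≤ _ := by rw [abs_neg]; linarith
  have hquad : δ / κ * ‖G‖ ^ 2 ≤ (d * B) * ‖G‖ := by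
    refine (hC.lower G).trans ?_
    have : quadForm C G = ∑ j, (∑ j', C j j' * G j') * G j := by
      unfold quadForm
      refine Finset.sum_congr rfl fun j _ => ?_
      rw [Finset.sum_mul]
      exact Finset.sum_congr rfl fun j' _ => by ring
    rw [this]
    calc _ ≤ ∑ j : Fin d, B * ‖G‖ := Finset.sum_le_sum fun j _ => by
          refine (le_abs_self _).trans ?_
          rw [abs_mul]
          exact mul_le_mul (hv j) (PiLp.norm_apply_le G j) (abs_nonneg _)
            ((abs_nonneg _).trans (hv j))
      _ = _ := by simp; ring
  have hGn : ‖G‖ ≤ κ / δ * (d * B) := by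
    rcases eq_or_lt_of_le (norm_nonneg G) with h0 | h0
    · rw [← h0]; positivity
    · rw [sq, ← mul_assoc] at hquad
      have := le_of_mul_le_mul_right hquad h0
      rw [div_mul_eq_mul_div, le_div_iff₀ hδ, mul_comm ‖G‖]
      rw [div_mul_eq_mul_div, div_le_iff₀ hκ0] at this
      linarith
  calc |gaussD (i :: L') C m| = ‖G i‖ := by simp [hG]
    _ ≤ ‖G‖ := PiLp.norm_apply_le G i
    _ ≤ κ / δ * (d * B) := hGn
    _ = κ * (d * (A * K₁ + n * K₂)) * (δ ^ (-((n : ℝ) - 1 + d) / 2) * δ ^ (-1 : ℝ)) * Real.exp (-l * ‖m‖ ^ 2 / δ) := by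
        rw [hB, Real.rpow_neg_one]; ring
    _ = κ * (d * (A * K₁ + n * K₂)) * δ ^ (-(((n + 1 : ℕ) : ℝ) + d) / 2) * Real.exp (-l * ‖m‖ ^ 2 / δ) := by
        rw [← Real.rpow_add hδ]; congr 3; push_cast; ring
    _ ≤ _ := by gcongr; linarith

/-- Weighted Gaussian bounds for the derivatives of the kernel. -/
lemma exists_weight_mul_gaussD_le (d : ℕ) (κ : ℝ) (hκ : 1 ≤ κ) (n : ℕ) (γ : ℝ) (hγ : 0 ≤ γ) :
    ∃ K l : ℝ, 0 < K ∧ 0 < l ∧ ∀ (δ : ℝ) (C : Fin d → Fin d → ℝ), 0 < δ → CovBetween κ δ C →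
      ∀ (L : List (Fin d)), L.length = n → ∀ m : Vec d,
        ‖m‖ ^ γ * |gaussD L C m| ≤ K * δ ^ ((γ - n - d) / 2) * Real.exp (-l * ‖m‖ ^ 2 / δ) := by
  obtain ⟨K, l, hK, hl, h⟩ := exists_gaussD_le d κ hκ n
  obtain ⟨A, hA, hA'⟩ := exists_weight_absorb γ l hγ hl
  refine ⟨A * K, l / 2, by positivity, by positivity, fun δ C hδ hC L hL m => ?_⟩
  calc ‖m‖ ^ γ * |gaussD L C m|
      ≤ ‖m‖ ^ γ * (K * δ ^ (-((n : ℝ) + d) / 2) * Real.exp (-l * ‖m‖ ^ 2 / δ)) := by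
        gcongr
        exact h δ C hδ hC L hL m
    _ = K * δ ^ (-((n : ℝ) + d) / 2) * (‖m‖ ^ γ * Real.exp (-l * ‖m‖ ^ 2 / δ)) := by ring
    _ ≤ K * δ ^ (-((n : ℝ) + d) / 2) * (A * δ ^ (γ / 2) * Real.exp (-(l / 2) * ‖m‖ ^ 2 / δ)) := by
        exact mul_le_mul_of_nonneg_left (hA' δ ‖m‖ hδ (norm_nonneg m)) (by positivity)
    _ = A * K * (δ ^ (-((n : ℝ) + d) / 2) * δ ^ (γ / 2)) * Real.exp (-(l / 2) * ‖m‖ ^ 2 / δ) := by ring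
    _ = _ := by rw [← Real.rpow_add hδ]; congr 3; ring

lemma lipschitzWith_integral_of_bounded {E : Type*} [NormedAddCommGroup E] [NormedSpace ℝ E]
    {f : ℝ → E} {N : ℝ} (hf : AEStronglyMeasurable f) (hN : ∀ u, ‖f u‖ ≤ N) (s : ℝ) :
    LipschitzWith N.toNNReal fun v => ∫ u in s..v, f u := by
  have hi : ∀ a b, IntervalIntegrable f volume a b := fun a b =>
    (intervalIntegrable_const (c := N)).mono_fun hf.restrict
      (Filter.Eventually.of_forall fun u => (hN u).trans (le_abs_self N))
  refine LipschitzWith.of_dist_le_mul fun v w => ?_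
  rw [dist_eq_norm, intervalIntegral.integral_interval_sub_left (hi _ _) (hi _ _), Real.dist_eq,
    Real.coe_toNNReal _ ((norm_nonneg _).trans (hN 0))]
  exact intervalIntegral.norm_integral_le_of_norm_le_const fun u _ => hN u

/-- Chain rule for a `C¹` function along a path with bounded measurable velocity. -/
lemma comp_sub_eq_integral_fderiv {E F : Type*} [NormedAddCommGroup E] [NormedSpace ℝ E]
    [CompleteSpace E] [NormedAddCommGroup F] [NormedSpace ℝ F] [CompleteSpace F]
    {Φ : E → F} (hΦ : ContDiff ℝ 1 Φ) {y y' : ℝ → E} {s r N : ℝ} (hsr : s ≤ r)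
    (hy' : AEStronglyMeasurable y') (hN : ∀ u ∈ Icc s r, ‖y' u‖ ≤ N)
    (hy : ∀ v ∈ Icc s r, y v = y s + ∫ u in s..v, y' u) :
    Φ (y r) - Φ (y s) = ∫ u in s..r, fderiv ℝ Φ (y u) (y' u) := by
  have hN0 : 0 ≤ N := (norm_nonneg _).trans (hN s ⟨le_rfl, hsr⟩)
  set z' : ℝ → E := (Icc s r).indicator y' with hz'
  have hz'm : AEStronglyMeasurable z' := hy'.indicator measurableSet_Icc
  have hz'N : ∀ u, ‖z' u‖ ≤ N := fun u => by
    by_cases hu : u ∈ Icc s r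
    · simpa [hz', hu] using hN u hu
    · simpa [hz', hu] using hN0
  set z : ℝ → E := fun v => y s + ∫ u in s..v, z' u with hz
  have hzL : LipschitzWith N.toNNReal z := by
    have := lipschitzWith_integral_of_bounded hz'm hz'N s
    refine LipschitzWith.of_dist_le_mul fun v w => ?_
    simpa [hz] using this.dist_le_mul v w
  have hzy : ∀ v ∈ Icc s r, z v = y v := fun v hv => by
    rw [hy v hv, hz]
    simp only
    congr 1
    refine intervalIntegral.integral_congr fun u hu => ?_
    rw [uIcc_of_le hv.1] at hu
    simp [hz', indicator_of_mem (show u ∈ Icc s r from ⟨hu.1, hu.2.trans hv.2⟩)]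
  have hzi : ∀ a b, IntervalIntegrable z' volume a b := fun a b =>
    (intervalIntegrable_const (c := N)).mono_fun hz'm.restrict
      (Filter.Eventually.of_forall fun u => (hz'N u).trans (le_abs_self N))
  have hdz : ∀ᵐ v, v ∈ uIcc s r → HasDerivAt z (z' v) v := by
    have := (hzi s r).ae_hasDerivAt_integral
    filter_upwards [this] with v hv hvm
    exact (hv hvm s left_mem_uIcc).const_add _
  have hcd : Continuous fun v => fderiv ℝ Φ (z v) :=
    (hΦ.continuous_fderiv (by norm_num)).comp hzL.continuous
  obtain ⟨M, hM⟩ := (isCompact_Icc (a := s) (b := r)).exists_bound_of_continuousOn hcd.continuousOn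
  have hM0 : 0 ≤ M := (norm_nonneg _).trans (hM s ⟨le_rfl, hsr⟩)
  set h : ℝ → F := (Icc s r).indicator fun u => fderiv ℝ Φ (z u) (z' u) with hh
  have hhm : AEStronglyMeasurable h := by
    refine AEStronglyMeasurable.indicator ?_ measurableSet_Icc
    exact (ContinuousLinearMap.aestronglyMeasurable_comp₂ (ContinuousLinearMap.id ℝ (E →L[ℝ] F))
      hcd.aestronglyMeasurable hz'm)
  have hhN : ∀ u, ‖h u‖ ≤ M * N := fun u => by
    by_cases hu : u ∈ Icc s r
    · simp only [hh, indicator_of_mem hu]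
      exact (ContinuousLinearMap.le_opNorm _ _).trans
        (mul_le_mul (hM u hu) (hz'N u) (norm_nonneg _) hM0)
    · simp only [hh, indicator_of_notMem hu, norm_zero]; positivity
  have hhL := lipschitzWith_integral_of_bounded hhm hhN s
  have hhi : ∀ a b, IntervalIntegrable h volume a b := fun a b =>
    (intervalIntegrable_const (c := M * N)).mono_fun hhm.restrict
      (Filter.Eventually.of_forall fun u => (hhN u).trans (le_abs_self _))
  have hdh : ∀ᵐ v, v ∈ uIcc s r → HasDerivAt (fun v => ∫ u in s..v, h u) (h v) v := by
    filter_upwards [(hhi s r).ae_hasDerivAt_integral] with v hv hvm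
    exact hv hvm s left_mem_uIcc
  obtain ⟨K, hK⟩ := ((hΦ.locallyLipschitz.comp hzL.locallyLipschitz).locallyLipschitzOn
    (s := uIcc s r)).exists_lipschitzOnWith_of_compact isCompact_uIcc
  have hac := hK.absolutelyContinuousOnInterval.sub
    (hhL.lipschitzOnWith (s := uIcc s r)).absolutelyContinuousOnInterval
  obtain ⟨c, hc⟩ := hac.const_of_ae_hasDerivAt_zero (by
    filter_upwards [hdz, hdh] with v h1 h2 hv
    have e : h v = fderiv ℝ Φ (z v) (z' v) := by
      rw [uIcc_of_le hsr] at hv; simp only [hh, indicator_of_mem hv]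
    have h3 := ((hΦ.differentiable (by norm_num) (z v)).hasFDerivAt.comp_hasDerivAt v (h1 hv)).sub (h2 hv)
    rw [e, sub_self] at h3
    exact h3)
  have h1 := hc s left_mem_uIcc
  have h2 := hc r right_mem_uIcc
  rw [Pi.sub_apply] at h1 h2
  simp only [Function.comp, intervalIntegral.integral_same, sub_zero] at h1 h2
  rw [hzy s ⟨le_rfl, hsr⟩] at h1
  rw [hzy r ⟨hsr, le_rfl⟩] at h2
  have h3 : ∫ u in s..r, h u = ∫ u in s..r, fderiv ℝ Φ (y u) (y' u) := by
    refine intervalIntegral.integral_congr fun u hu => ?_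
    rw [uIcc_of_le hsr] at hu
    simp only [hh, hz', indicator_of_mem hu, hzy u hu]
  rw [h1, ← h3, ← h2]; abel

lemma exp_mul_eq_integral {ξ φ ξ' φ' : ℝ → ℂ} {s r N : ℝ} (hsr : s ≤ r)
    (hξ' : AEStronglyMeasurable ξ') (hφ' : AEStronglyMeasurable φ')
    (hξN : ∀ u ∈ Icc s r, ‖ξ' u‖ ≤ N) (hφN : ∀ u ∈ Icc s r, ‖φ' u‖ ≤ N)
    (hξ : ∀ v ∈ Icc s r, ξ v = ξ s + ∫ u in s..v, ξ' u)
    (hφ : ∀ v ∈ Icc s r, φ v = φ s + ∫ u in s..v, φ' u) :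
    Complex.exp (ξ r) * φ r = Complex.exp (ξ s) * φ s
      + ∫ u in s..r, Complex.exp (ξ u) * (ξ' u * φ u + φ' u) := by
  have hcd : ContDiff ℝ 1 fun p : ℂ × ℂ => Complex.exp p.1 * p.2 :=
    (Complex.contDiff_exp.comp contDiff_fst).mul contDiff_snd
  have hii : ∀ (f : ℝ → ℂ), AEStronglyMeasurable f → (∀ u ∈ Icc s r, ‖f u‖ ≤ N) →
      ∀ v ∈ Icc s r, IntervalIntegrable f volume s v := fun f hf hN v hv => by
    rw [intervalIntegrable_iff_integrableOn_Ioc_of_le hv.1]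
    exact Integrable.mono' (integrableOn_const (C := N) (by simp)) hf.restrict
      (ae_restrict_of_forall_mem measurableSet_Ioc fun u hu => hN u ⟨hu.1.le, hu.2.trans hv.2⟩)
  have h := comp_sub_eq_integral_fderiv hcd (y := fun v => (ξ v, φ v)) (y' := fun v => (ξ' v, φ' v))
    (N := N) hsr (hξ'.prodMk hφ') (fun u hu => by
      rw [Prod.norm_def]; exact max_le (hξN u hu) (hφN u hu)) (fun v hv => by
      have e1 : (∫ u in s..v, (ξ' u, φ' u)).1 = ∫ u in s..v, ξ' u := by
        have := (ContinuousLinearMap.fst ℝ ℂ ℂ).intervalIntegral_comp_comm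
          (f := fun u => (ξ' u, φ' u)) (a := s) (b := v) (μ := volume) (by
            rw [intervalIntegrable_iff]
            exact Integrable.prodMk (intervalIntegrable_iff.1 (hii _ hξ' hξN v hv))
              (intervalIntegrable_iff.1 (hii _ hφ' hφN v hv)))
        simpa using this.symm
      have e2 : (∫ u in s..v, (ξ' u, φ' u)).2 = ∫ u in s..v, φ' u := by
        have := (ContinuousLinearMap.snd ℝ ℂ ℂ).intervalIntegral_comp_comm
          (f := fun u => (ξ' u, φ' u)) (a := s) (b := v) (μ := volume) (by
            rw [intervalIntegrable_iff]
            exact Integrable.prodMk (intervalIntegrable_iff.1 (hii _ hξ' hξN v hv))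
              (intervalIntegrable_iff.1 (hii _ hφ' hφN v hv)))
        simpa using this.symm
      ext1
      · simp [e1, ← hξ v hv]
      · simp [e2, ← hφ v hv])
  rw [sub_eq_iff_eq_add'] at h
  refine h.trans ?_
  congr 1
  refine intervalIntegral.integral_congr fun u _ => ?_
  have hd : HasFDerivAt (fun p : ℂ × ℂ => Complex.exp p.1 * p.2) _ (ξ u, φ u) :=
    ((hasFDerivAt_fst (𝕜 := ℝ)).cexp).mul (hasFDerivAt_snd (𝕜 := ℝ))
  rw [hd.fderiv]
  simp
  ring

/-- `f` is a path on `[s,r]` with bounded measurable velocity `f'`. -/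
structure IsPath {E : Type*} [NormedAddCommGroup E] [NormedSpace ℝ E] [MeasurableSpace E]
    (f f' : ℝ → E) (s r : ℝ) : Prop where
  meas : Measurable f
  meas' : Measurable f'
  bdd : ∃ N, ∀ u ∈ Icc s r, ‖f' u‖ ≤ N
  eq : ∀ v ∈ Icc s r, f v = f s + ∫ u in s..v, f' u

namespace IsPath
variable {E F : Type*} [NormedAddCommGroup E] [NormedSpace ℝ E] [MeasurableSpace E]
  [NormedAddCommGroup F] [NormedSpace ℝ F] [MeasurableSpace F]

lemma intervalIntegrable [BorelSpace E] [SecondCountableTopology E] {f f' : ℝ → E} {s r : ℝ}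
    (h : IsPath f f' s r) {v : ℝ} (hv : v ∈ Icc s r) : IntervalIntegrable f' volume s v := by
  obtain ⟨N, hN⟩ := h.bdd
  rw [intervalIntegrable_iff_integrableOn_Ioc_of_le hv.1]
  exact Integrable.mono' (integrableOn_const (C := N) (by simp)) h.meas'.aestronglyMeasurable
    (ae_restrict_of_forall_mem measurableSet_Ioc fun u hu => hN u ⟨hu.1.le, hu.2.trans hv.2⟩)

lemma bounded {f f' : ℝ → E} {s r : ℝ} (h : IsPath f f' s r) :
    ∃ N, ∀ u ∈ Icc s r, ‖f u‖ ≤ N := by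
  obtain ⟨N, hN⟩ := h.bdd
  refine ⟨‖f s‖ + |N| * (r - s), fun v hv => ?_⟩
  rw [h.eq v hv]
  refine (norm_add_le _ _).trans (add_le_add le_rfl ?_)
  have := intervalIntegral.norm_integral_le_of_norm_le_const (a := s) (b := v) (f := f') (C := |N|)
    (fun u hu => by
      rw [uIoc_of_le hv.1] at hu
      exact (hN u ⟨hu.1.le, hu.2.trans hv.2⟩).trans (le_abs_self N))
  refine this.trans (mul_le_mul_of_nonneg_left ?_ (abs_nonneg _))
  rw [abs_of_nonneg (by linarith [hv.1])]
  linarith [hv.2]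

lemma clm [BorelSpace E] [SecondCountableTopology E] [CompleteSpace E] [BorelSpace F]
    [CompleteSpace F] {f f' : ℝ → E} {s r : ℝ}
    (h : IsPath f f' s r) (A : E →L[ℝ] F) : IsPath (fun u => A (f u)) (fun u => A (f' u)) s r where
  meas := A.continuous.measurable.comp h.meas
  meas' := A.continuous.measurable.comp h.meas'
  bdd := by
    obtain ⟨N, hN⟩ := h.bdd
    exact ⟨‖A‖ * N, fun u hu => (A.le_opNorm _).trans
      (mul_le_mul_of_nonneg_left (hN u hu) (norm_nonneg _))⟩
  eq v hv := by
    rw [A.intervalIntegral_comp_comm (h.intervalIntegrable hv), h.eq v hv, map_add]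

lemma add [BorelSpace E] [SecondCountableTopology E] {f f' g g' : ℝ → E} {s r : ℝ}
    (hf : IsPath f f' s r) (hg : IsPath g g' s r) :
    IsPath (fun u => f u + g u) (fun u => f' u + g' u) s r where
  meas := hf.meas.add hg.meas
  meas' := hf.meas'.add hg.meas'
  bdd := by
    obtain ⟨N, hN⟩ := hf.bdd
    obtain ⟨M, hM⟩ := hg.bdd
    exact ⟨N + M, fun u hu => (norm_add_le _ _).trans (add_le_add (hN u hu) (hM u hu))⟩
  eq v hv := by
    rw [intervalIntegral.integral_add (hf.intervalIntegrable hv) (hg.intervalIntegrable hv),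
      hf.eq v hv, hg.eq v hv]; abel

lemma const (x : E) (s r : ℝ) : IsPath (fun _ => x) (fun _ => 0) s r where
  meas := measurable_const
  meas' := measurable_const
  bdd := ⟨0, by simp⟩
  eq v hv := by simp

lemma mono [BorelSpace E] [SecondCountableTopology E] {f f' : ℝ → E} {s r r' : ℝ}
    (h : IsPath f f' s r) (hr : r' ≤ r) : IsPath f f' s r' where
  meas := h.meas
  meas' := h.meas'
  bdd := by
    obtain ⟨N, hN⟩ := h.bdd
    exact ⟨N, fun u hu => hN u ⟨hu.1, hu.2.trans hr⟩⟩
  eq v hv := h.eq v ⟨hv.1, hv.2.trans hr⟩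

end IsPath

/-- The symbol of the operator `w + v·∇ + ½ tr(A∇²)`. -/
def genSymb {d : ℕ} (w : ℝ) (v : Vec d) (A : Fin d → Fin d → ℝ) (k : Vec d) : ℂ :=
  (w : ℂ) + Complex.I * ((∑ i, k i * v i : ℝ) : ℂ) - ((quadForm A k / 2 : ℝ) : ℂ)

/-- The operator `w + v·∇ + ½ tr(A∇²)` applied to a Gaussian derivative. -/
def genD {d : ℕ} (w : ℝ) (v : Vec d) (A : Fin d → Fin d → ℝ) (L : List (Fin d))
    (C : Fin d → Fin d → ℝ) (m : Vec d) : ℝ :=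
  w * gaussD L C m + ∑ i, v i * gaussD (i :: L) C m
    + (1 / 2) * ∑ i, ∑ j, A i j * gaussD (i :: j :: L) C m

lemma abs_quadForm_le {d : ℕ} {A : Fin d → Fin d → ℝ} {N : ℝ} (hA : ∀ i j, |A i j| ≤ N) (k : Vec d) :
    |quadForm A k| ≤ (d : ℝ) ^ 2 * N * ‖k‖ ^ 2 := by
  have h : ∀ i j, |A i j * k i * k j| ≤ N * ‖k‖ ^ 2 := fun i j => by
    rw [abs_mul, abs_mul, mul_assoc, sq]
    exact mul_le_mul (hA i j) (mul_le_mul (PiLp.norm_apply_le k i) (PiLp.norm_apply_le k j)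
      (abs_nonneg _) (norm_nonneg _)) (by positivity) ((abs_nonneg _).trans (hA i j))
  calc |quadForm A k| ≤ ∑ i : Fin d, ∑ j : Fin d, N * ‖k‖ ^ 2 :=
        (Finset.abs_sum_le_sum_abs _ _).trans (Finset.sum_le_sum fun i _ =>
          (Finset.abs_sum_le_sum_abs _ _).trans (Finset.sum_le_sum fun j _ => h i j))
    _ = _ := by simp; ring

lemma abs_sum_mul_le {d : ℕ} (k v : Vec d) : |∑ i, k i * v i| ≤ ‖k‖ * ‖v‖ := by
  have := abs_real_inner_le_norm v k
  rw [PiLp.inner_apply] at this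
  simp only [RCLike.inner_apply, conj_trivial] at this
  linarith

lemma norm_genSymb_le {d : ℕ} {w : ℝ} {v : Vec d} {A : Fin d → Fin d → ℝ} {N₁ N₂ N₃ x : ℝ}
    (hx : 0 ≤ x) (hw : |w| ≤ N₁) (hv : ‖v‖ ≤ N₂ * (1 + x)) (hA : ∀ i j, |A i j| ≤ N₃) (hN₃ : 0 ≤ N₃)
    (k : Vec d) :
    ‖genSymb w v A k‖ ≤ (N₁ + N₂ + d ^ 2 * N₃) * (1 + ‖k‖ + ‖k‖ ^ 2) * (1 + x) := by
  have h1 : ‖genSymb w v A k‖ ≤ |w| + |∑ i, k i * v i| + |quadForm A k / 2| := by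
    unfold genSymb
    refine (norm_sub_le _ _).trans (add_le_add ((norm_add_le _ _).trans (add_le_add ?_ ?_)) ?_)
    · simp
    · rw [norm_mul, Complex.norm_I, one_mul, Complex.norm_real, Real.norm_eq_abs]
    · rw [Complex.norm_real, Real.norm_eq_abs]
  have h2 := abs_sum_mul_le k v
  have h3 := abs_quadForm_le hA k
  have h4 : |quadForm A k / 2| ≤ |quadForm A k| := by
    rw [abs_div, abs_two]; linarith [abs_nonneg (quadForm A k)]
  have h5 : ‖k‖ * ‖v‖ ≤ ‖k‖ * (N₂ * (1 + x)) := mul_le_mul_of_nonneg_left hv (norm_nonneg _)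
  have hN₁ : 0 ≤ N₁ := (abs_nonneg _).trans hw
  have hN₂ : 0 ≤ N₂ := by
    have := (norm_nonneg _).trans hv
    by_contra! hh
    nlinarith
  have hk := norm_nonneg k
  calc ‖genSymb w v A k‖ ≤ N₁ + ‖k‖ * (N₂ * (1 + x)) + d ^ 2 * N₃ * ‖k‖ ^ 2 := by linarith
    _ ≤ N₁ * ((1 + ‖k‖ + ‖k‖ ^ 2) * (1 + x)) + N₂ * ((1 + ‖k‖ + ‖k‖ ^ 2) * (1 + x))
        + d ^ 2 * N₃ * ((1 + ‖k‖ + ‖k‖ ^ 2) * (1 + x)) := by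
      have e1 : 1 ≤ (1 + ‖k‖ + ‖k‖ ^ 2) * (1 + x) := by nlinarith [mul_nonneg hk hx, mul_nonneg (sq_nonneg ‖k‖) hx]
      have e2 : ‖k‖ * (1 + x) ≤ (1 + ‖k‖ + ‖k‖ ^ 2) * (1 + x) := by nlinarith [mul_nonneg hk hx, mul_nonneg (sq_nonneg ‖k‖) hx]
      have e3 : ‖k‖ ^ 2 ≤ (1 + ‖k‖ + ‖k‖ ^ 2) * (1 + x) := by nlinarith [mul_nonneg hk hx, mul_nonneg (sq_nonneg ‖k‖) hx]
      have a1 := mul_le_mul_of_nonneg_left e1 hN₁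
      have a2 := mul_le_mul_of_nonneg_left e2 hN₂
      have a3 := mul_le_mul_of_nonneg_left e3 (by positivity : (0:ℝ) ≤ d ^ 2 * N₃)
      nlinarith
    _ = _ := by ring

lemma genSymb_mul_symbProd {d : ℕ} (w : ℝ) (v : Vec d) (A : Fin d → Fin d → ℝ) (L : List (Fin d)) (k : Vec d) :
    genSymb w v A k * symbProd L k = (w : ℂ) * symbProd L k + ∑ i, (v i : ℂ) * symbProd (i :: L) k
      + (1 / 2) * ∑ i, ∑ j, (A i j : ℂ) * symbProd (i :: j :: L) k := by
  have e1 : ∑ i, (v i : ℂ) * symbProd (i :: L) k = Complex.I * ((∑ i, k i * v i : ℝ) : ℂ) * symbProd L k := by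
    push_cast
    simp only [symbProd, Finset.mul_sum, Finset.sum_mul]
    exact Finset.sum_congr rfl fun i _ => by ring
  have e2 : (1 / 2 : ℂ) * ∑ i, ∑ j, (A i j : ℂ) * symbProd (i :: j :: L) k
      = -((quadForm A k / 2 : ℝ) : ℂ) * symbProd L k := by
    have : (∑ i, ∑ j, (A i j : ℂ) * symbProd (i :: j :: L) k) = -((quadForm A k : ℝ) : ℂ) * symbProd L k := by
      simp only [quadForm]
      push_cast
      simp only [symbProd, neg_mul, Finset.sum_mul, ← Finset.sum_neg_distrib]
      refine Finset.sum_congr rfl fun i _ => Finset.sum_congr rfl fun j _ => ?_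
      linear_combination ((A i j : ℂ) * (k i) * (k j) * symbProd L k) * Complex.I_mul_I
    rw [this]
    push_cast
    ring
  rw [e1, e2, genSymb]; ring

lemma re_integral_genSymb {d : ℕ} {c : ℝ} (hc : 0 < c) {C : Fin d → Fin d → ℝ}
    (hC : ∀ k : Vec d, c * ‖k‖ ^ 2 ≤ quadForm C k) (w : ℝ) (v : Vec d) (A : Fin d → Fin d → ℝ)
    (L : List (Fin d)) (m : Vec d) :
    (∫ k : Vec d, genSymb w v A k * (symbProd L k * gaussPhase C m k)).re = genD w v A L C m := by
  have hI := fun L => integrable_symbProd_mul_gaussPhase hc hC L m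
  have e : ∀ k : Vec d, genSymb w v A k * (symbProd L k * gaussPhase C m k)
      = (w : ℂ) * (symbProd L k * gaussPhase C m k)
        + ∑ i, (v i : ℂ) * (symbProd (i :: L) k * gaussPhase C m k)
        + ∑ i, ∑ j, ((1 / 2 * A i j : ℝ) : ℂ) * (symbProd (i :: j :: L) k * gaussPhase C m k) := fun k => by
    rw [← mul_assoc, genSymb_mul_symbProd]
    simp only [add_mul, Finset.mul_sum, Finset.sum_mul, mul_assoc]
    push_cast
    simp only [mul_assoc]
  simp_rw [e]
  rw [integral_add, integral_add, integral_finsetSum, integral_finsetSum, integral_const_mul]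
  · simp only [integral_const_mul]
    rw [Complex.add_re, Complex.add_re, Complex.re_sum, Complex.re_sum]
    simp_rw [integral_finsetSum _ fun j _ => (hI _).const_mul _, integral_const_mul, Complex.re_sum, Complex.re_ofReal_mul]
    simp only [genD, gaussD, Finset.mul_sum, mul_assoc]
  · exact fun i _ => integrable_finsetSum _ fun j _ => (hI _).const_mul _
  · exact fun i _ => (hI _).const_mul _
  · exact (hI _).const_mul _
  · exact integrable_finsetSum _ fun i _ => (hI _).const_mul _
  · exact ((hI _).const_mul _).add (integrable_finsetSum _ fun i _ => (hI _).const_mul _)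
  · exact integrable_finsetSum _ fun i _ => integrable_finsetSum _ fun j _ => (hI _).const_mul _

/-- The Fourier-side description of a diffusion with drift `b` and covariance `a` on `[s,t]`. -/
structure IsDiffusion {d : ℕ} {Ω : Type*} [MeasurableSpace Ω] (P : Measure Ω) (X : ℝ → Ω → Vec d)
    (b : ℝ → Vec d → Vec d) (a : ℝ → Vec d → Fin d → Fin d → ℝ) (s t N : ℝ) : Prop where
  prob : IsProbabilityMeasure P
  meas_X : Measurable (Function.uncurry X)
  meas_b : Measurable (Function.uncurry b)
  meas_a : Measurable (Function.uncurry a)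
  bound_b : ∀ r ∈ Icc s t, ∀ z, ‖b r z‖ ≤ N * (1 + ‖z‖)
  bound_a : ∀ r ∈ Icc s t, ∀ z i j, |a r z i j| ≤ N
  integrable_norm : ∀ r ∈ Icc s t, Integrable (fun ω => ‖X r ω‖) P
  moment : ∀ r ∈ Icc s t, ∫ ω, ‖X r ω‖ ∂P ≤ N
  dyn : ∀ k : Vec d, ∀ v ∈ Icc s t,
    ∫ ω, Complex.exp (Complex.I * ((∑ i, k i * X v ω i : ℝ) : ℂ)) ∂P
      = ∫ ω, Complex.exp (Complex.I * ((∑ i, k i * X s ω i : ℝ) : ℂ)) ∂P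
        + ∫ u in s..v, ∫ ω, genSymb 0 (b u (X u ω)) (a u (X u ω)) k
            * Complex.exp (Complex.I * ((∑ i, k i * X u ω i : ℝ) : ℂ)) ∂P

/-- Quadratic form at `k` as a continuous linear functional of the matrix. -/
def quadFormCLM {d : ℕ} (k : Vec d) : (Fin d → Fin d → ℝ) →L[ℝ] ℝ :=
  LinearMap.toContinuousLinearMap
    { toFun := fun C => quadForm C k
      map_add' := fun A B => by simp [quadForm, add_mul, Finset.sum_add_distrib]
      map_smul' := fun c A => by simp [quadForm, Finset.mul_sum, mul_assoc] }

lemma quadFormCLM_apply {d : ℕ} (k : Vec d) (C : Fin d → Fin d → ℝ) : quadFormCLM k C = quadForm C k := rfl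

/-- Pairing with `k`. -/
def pairCLM {d : ℕ} (k : Vec d) : Vec d →L[ℝ] ℝ :=
  ∑ i, k i • (EuclideanSpace.proj i : Vec d →L[ℝ] ℝ)

lemma pairCLM_apply {d : ℕ} (k v : Vec d) : pairCLM k v = ∑ i, k i * v i := by
  simp [pairCLM]

/-- The logarithm of the deterministic factor. -/
def detPhase {d : ℕ} (w : ℝ) (c : Vec d) (C : Fin d → Fin d → ℝ) (k : Vec d) : ℂ :=
  (w : ℂ) + ((-Complex.I) * ((∑ i, k i * c i : ℝ) : ℂ) + (-(1 / 2)) * ((quadForm C k : ℝ) : ℂ))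

lemma IsPath.detPhase {d : ℕ} {w w' : ℝ → ℝ} {c c' : ℝ → Vec d} {C C' : ℝ → Fin d → Fin d → ℝ}
    {s r : ℝ} (hw : IsPath w w' s r) (hc : IsPath c c' s r) (hC : IsPath C C' s r) (k : Vec d) :
    IsPath (fun u => detPhase (w u) (c u) (C u) k) (fun u => detPhase (w' u) (c' u) (C' u) k) s r := by
  have h1 := hw.clm Complex.ofRealCLM
  have h2 := (hc.clm (pairCLM k)).clm ((-Complex.I) • Complex.ofRealCLM : ℝ →L[ℝ] ℂ)
  have h3 := (hC.clm (quadFormCLM k)).clm ((-(1 / 2) : ℂ) • Complex.ofRealCLM : ℝ →L[ℝ] ℂ)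
  simpa only [_root_.detPhase, _root_.smul_apply, Complex.ofRealCLM_apply, pairCLM_apply,
    quadFormCLM_apply, smul_eq_mul] using h1.add (h2.add h3)

lemma exp_detPhase_mul {d : ℕ} (w : ℝ) (c : Vec d) (C : Fin d → Fin d → ℝ) (k x : Vec d) :
    Complex.exp (detPhase w c C k) * Complex.exp (Complex.I * ((∑ i, k i * x i : ℝ) : ℂ))
      = (Real.exp w : ℂ) * gaussPhase C (x - c) k := by
  rw [gaussPhase, Complex.ofReal_exp, ← Complex.exp_add, ← Complex.exp_add]
  congr 1
  simp only [detPhase, PiLp.sub_apply, mul_sub, Finset.sum_sub_distrib]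
  push_cast
  ring

lemma detPhase_add_genSymb {d : ℕ} (w : ℝ) (c v : Vec d) (C A : Fin d → Fin d → ℝ) (k : Vec d) :
    detPhase w c C k + genSymb 0 v A k = genSymb w (v - c) (A + C) k := by
  simp only [detPhase, genSymb, quadForm, PiLp.sub_apply, Pi.add_apply, mul_sub, add_mul,
    Finset.sum_sub_distrib, Finset.sum_add_distrib]
  push_cast
  ring

lemma continuous_genSymb {d : ℕ} (k : Vec d) :
    Continuous fun p : ℝ × Vec d × (Fin d → Fin d → ℝ) => genSymb p.1 p.2.1 p.2.2 k := by
  have h := (quadFormCLM k).continuous.comp (continuous_snd.comp (continuous_snd (X := ℝ) (Y := Vec d × (Fin d → Fin d → ℝ))))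
  have h2 := (pairCLM k).continuous.comp (continuous_fst.comp (continuous_snd (X := ℝ) (Y := Vec d × (Fin d → Fin d → ℝ))))
  have e : (fun p : ℝ × Vec d × (Fin d → Fin d → ℝ) => genSymb p.1 p.2.1 p.2.2 k)
      = fun p => (p.1 : ℂ) + Complex.I * ((pairCLM k p.2.1 : ℝ) : ℂ) - ((quadFormCLM k p.2.2 / 2 : ℝ) : ℂ) := by
    ext p; rw [genSymb, pairCLM_apply, quadFormCLM_apply]
  rw [e]
  simp only [Function.comp_def] at h h2
  fun_prop

lemma continuous_genSymb' {d : ℕ} :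
    Continuous fun p : (ℝ × Vec d × (Fin d → Fin d → ℝ)) × Vec d => genSymb p.1.1 p.1.2.1 p.1.2.2 p.2 := by
  unfold genSymb quadForm
  fun_prop

lemma continuous_gaussPhase' {d : ℕ} :
    Continuous fun p : ((Fin d → Fin d → ℝ) × Vec d) × Vec d => gaussPhase p.1.1 p.1.2 p.2 := by
  unfold gaussPhase quadForm
  fun_prop

namespace IsDiffusion
variable {d : ℕ} {Ω : Type*} [MeasurableSpace Ω] {P : Measure Ω} {X : ℝ → Ω → Vec d}
    {b : ℝ → Vec d → Vec d} {a : ℝ → Vec d → Fin d → Fin d → ℝ} {s t N : ℝ}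

lemma N_nonneg (h : IsDiffusion P X b a s t N) (hst : s ≤ t) : 0 ≤ N := by
  have := (norm_nonneg _).trans (h.bound_b s ⟨le_rfl, hst⟩ 0)
  simpa using this

lemma meas_bX (h : IsDiffusion P X b a s t N) :
    Measurable fun p : ℝ × Ω => b p.1 (X p.1 p.2) :=
  h.meas_b.comp (measurable_fst.prodMk h.meas_X)

lemma meas_aX (h : IsDiffusion P X b a s t N) :
    Measurable fun p : ℝ × Ω => a p.1 (X p.1 p.2) :=
  h.meas_a.comp (measurable_fst.prodMk h.meas_X)

lemma meas_Xt (h : IsDiffusion P X b a s t N) (u : ℝ) : Measurable (X u) :=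
  h.meas_X.comp measurable_prodMk_left

lemma integral_gaussPhase (h : IsDiffusion P X b a s t N) {r : ℝ} (hr : r ∈ Icc s t)
    {w w' : ℝ → ℝ} {c c' : ℝ → Vec d} {C C' : ℝ → Fin d → Fin d → ℝ}
    (hw : IsPath w w' s r) (hc : IsPath c c' s r) (hC : IsPath C C' s r) (k : Vec d) :
    ∫ ω, (Real.exp (w r) : ℂ) * gaussPhase (C r) (X r ω - c r) k ∂P
      = ∫ ω, (Real.exp (w s) : ℂ) * gaussPhase (C s) (X s ω - c s) k ∂P
        + ∫ u in s..r, ∫ ω, (Real.exp (w u) : ℂ) *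
            (genSymb (w' u) (b u (X u ω) - c' u) (a u (X u ω) + C' u) k
              * gaussPhase (C u) (X u ω - c u) k) ∂P := by
  have := h.prob
  have hN0 := h.N_nonneg (hr.1.trans hr.2)
  have hξ := hw.detPhase hc hC k
  obtain ⟨N1, hN1⟩ := hξ.bdd
  have hpm : Measurable fun p : ℝ × Ω => Complex.exp (Complex.I * ((∑ i, k i * X p.1 p.2 i : ℝ) : ℂ)) := by
    have hc : Continuous fun x : Vec d => Complex.exp (Complex.I * ((∑ i, k i * x i : ℝ) : ℂ)) := by fun_prop
    exact hc.measurable.comp h.meas_X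
  have hnorm : ∀ x : Vec d, ‖Complex.exp (Complex.I * ((∑ i, k i * x i : ℝ) : ℂ))‖ = 1 := fun x => by
    simp [Complex.norm_exp]
  have hgm : Measurable fun p : ℝ × Ω => genSymb 0 (b p.1 (X p.1 p.2)) (a p.1 (X p.1 p.2)) k :=
    (continuous_genSymb k).measurable.comp (measurable_const.prodMk (h.meas_bX.prodMk h.meas_aX))
  set B := (0 + N + d ^ 2 * N) * (1 + ‖k‖ + ‖k‖ ^ 2) with hB
  have hgb : ∀ u ∈ Icc s t, ∀ ω, ‖genSymb 0 (b u (X u ω)) (a u (X u ω)) k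
      * Complex.exp (Complex.I * ((∑ i, k i * X u ω i : ℝ) : ℂ))‖ ≤ B * (1 + ‖X u ω‖) := fun u hu ω => by
    rw [norm_mul, hnorm, mul_one]
    exact norm_genSymb_le (norm_nonneg _) (by simp) (h.bound_b u hu _) (h.bound_a u hu _) hN0 k
  have hint1 : ∀ u ∈ Icc s t, Integrable (fun ω => B * (1 + ‖X u ω‖)) P := fun u hu =>
    ((integrable_const _).add (h.integrable_norm u hu)).const_mul _
  have hB0 : 0 ≤ B := by positivity
  have hφb : ∀ u ∈ Icc s t, ‖∫ ω, genSymb 0 (b u (X u ω)) (a u (X u ω)) k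
            * Complex.exp (Complex.I * ((∑ i, k i * X u ω i : ℝ) : ℂ)) ∂P‖ ≤ B * (1 + N) := fun u hu => by
    refine (norm_integral_le_of_norm_le (hint1 u hu) (Filter.Eventually.of_forall (hgb u hu))).trans ?_
    rw [integral_const_mul, integral_add (integrable_const _) (h.integrable_norm u hu)]
    refine mul_le_mul_of_nonneg_left ?_ hB0
    simpa using h.moment u hu
  have key := exp_mul_eq_integral (N := max N1 (B * (1 + N))) hr.1 hξ.meas'.aestronglyMeasurable
    (φ := fun v => ∫ ω, Complex.exp (Complex.I * ((∑ i, k i * X v ω i : ℝ) : ℂ)) ∂P)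
    (φ' := fun u => ∫ ω, genSymb 0 (b u (X u ω)) (a u (X u ω)) k
            * Complex.exp (Complex.I * ((∑ i, k i * X u ω i : ℝ) : ℂ)) ∂P)
    ((hgm.mul hpm).stronglyMeasurable.integral_prod_right' (ν := P)).aestronglyMeasurable
    (fun u hu => (hN1 u hu).trans (le_max_left _ _))
    (fun u hu => (hφb u ⟨hu.1, hu.2.trans hr.2⟩).trans (le_max_right _ _))
    hξ.eq (fun v hv => h.dyn k v ⟨hv.1, hv.2.trans hr.2⟩)
  simp only [← integral_const_mul, exp_detPhase_mul] at key
  rw [key]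
  congr 1
  refine intervalIntegral.integral_congr fun u hu => ?_
  rw [uIcc_of_le hr.1] at hu
  have hu' : u ∈ Icc s t := ⟨hu.1, hu.2.trans hr.2⟩
  have i1 : Integrable (fun ω => Complex.exp (Complex.I * ((∑ i, k i * X u ω i : ℝ) : ℂ))) P :=
    Integrable.mono' (integrable_const 1) (hpm.comp measurable_prodMk_left).aestronglyMeasurable
      (Filter.Eventually.of_forall fun ω => (hnorm _).le)
  have i2 : Integrable (fun ω => genSymb 0 (b u (X u ω)) (a u (X u ω)) k
      * Complex.exp (Complex.I * ((∑ i, k i * X u ω i : ℝ) : ℂ))) P :=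
    (hint1 u hu').mono' ((hgm.mul hpm).comp measurable_prodMk_left).aestronglyMeasurable
      (Filter.Eventually.of_forall (hgb u hu'))
  rw [← integral_add (i1.const_mul _) i2, ← integral_const_mul]
  refine integral_congr_ae (Filter.Eventually.of_forall fun ω => ?_)
  simp only
  rw [← detPhase_add_genSymb, mul_left_comm, ← exp_detPhase_mul]
  ring

end IsDiffusion

lemma Measurable.gaussPhase {α : Type*} [MeasurableSpace α] {d : ℕ} {f : α → Fin d → Fin d → ℝ}
    {g h : α → Vec d} (hf : Measurable f) (hg : Measurable g) (hh : Measurable h) :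
    Measurable fun p => gaussPhase (f p) (g p) (h p) := by
  have e := (continuous_gaussPhase' (d := d)).measurable.comp ((hf.prodMk hg).prodMk hh)
  simpa only [Function.comp_def] using e

lemma Measurable.genSymb {α : Type*} [MeasurableSpace α] {d : ℕ} {w : α → ℝ} {f : α → Fin d → Fin d → ℝ}
    {g h : α → Vec d} (hw : Measurable w) (hg : Measurable g) (hf : Measurable f) (hh : Measurable h) :
    Measurable fun p => genSymb (w p) (g p) (f p) (h p) := by
  have e := (continuous_genSymb' (d := d)).measurable.comp ((hw.prodMk (hg.prodMk hf)).prodMk hh)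
  simpa only [Function.comp_def] using e

lemma integral_gaussD_eq_re {d : ℕ} {Ω : Type*} [MeasurableSpace Ω] {P : Measure Ω}
    [IsProbabilityMeasure P] {c : ℝ} (hc : 0 < c) {C : Fin d → Fin d → ℝ}
    (hC : ∀ k : Vec d, c * ‖k‖ ^ 2 ≤ quadForm C k) {Y : Ω → Vec d} (hY : Measurable Y)
    (L : List (Fin d)) (w : ℝ) :
    (Integrable fun k : Vec d => symbProd L k * ∫ ω, (w : ℂ) * gaussPhase C (Y ω) k ∂P) ∧
    ∫ ω, w * gaussD L C (Y ω) ∂P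
      = (∫ k : Vec d, symbProd L k * ∫ ω, (w : ℂ) * gaussPhase C (Y ω) k ∂P).re := by
  have hm : Measurable fun p : Ω × Vec d => symbProd L p.2 * ((w : ℂ) * gaussPhase C (Y p.1) p.2) := by
    refine ((continuous_symbProd L).measurable.comp measurable_snd).mul (measurable_const.mul ?_)
    exact Measurable.gaussPhase measurable_const (hY.comp measurable_fst) measurable_snd
  have hi : Integrable (fun p : Ω × Vec d => symbProd L p.2 * ((w : ℂ) * gaussPhase C (Y p.1) p.2))
      (P.prod volume) := by
    refine Integrable.mono' ((integrable_const (μ := P) (1 : ℝ)).mul_prod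
      ((integrable_pow_mul_exp (d := d) L.length (half_pos hc)).const_mul |w|)) hm.aestronglyMeasurable
      (Filter.Eventually.of_forall fun p => ?_)
    have := norm_symbProd_mul_gaussPhase_le hC L (Y p.1) p.2
    rw [mul_left_comm, norm_mul, one_mul, Complex.norm_real, Real.norm_eq_abs]
    exact mul_le_mul_of_nonneg_left this (abs_nonneg _)
  constructor
  · have := hi.integral_prod_right
    simpa only [integral_const_mul] using this
  · simp only [← integral_const_mul (symbProd L _)]
    rw [← integral_integral_swap hi, ← RCLike.re_eq_complex_re, ← integral_re hi.integral_prod_left]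
    refine integral_congr_ae (Filter.Eventually.of_forall fun ω => ?_)
    simp only [mul_left_comm _ (w : ℂ), integral_const_mul, RCLike.re_eq_complex_re, Complex.re_ofReal_mul]
    rfl

namespace IsDiffusion
variable {d : ℕ} {Ω : Type*} [MeasurableSpace Ω] {P : Measure Ω} {X : ℝ → Ω → Vec d}
    {b : ℝ → Vec d → Vec d} {a : ℝ → Vec d → Fin d → Fin d → ℝ} {s t N : ℝ}

lemma integrable_prod_norm (h : IsDiffusion P X b a s t N) {r : ℝ} (hr : r ∈ Icc s t) :
    Integrable (fun p : ℝ × Ω => 1 + ‖X p.1 p.2‖) ((volume.restrict (Ioc s r)).prod P) := by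
  have := h.prob
  refine (integrable_const _).add ?_
  refine (integrable_prod_iff (f := fun p : ℝ × Ω => ‖X p.1 p.2‖) h.meas_X.norm.aestronglyMeasurable).2 ?_
  refine ⟨ae_restrict_of_forall_mem measurableSet_Ioc fun u hu =>
    h.integrable_norm u ⟨hu.1.le, hu.2.trans hr.2⟩, ?_⟩
  refine Integrable.mono' (integrable_const N)
    (h.meas_X.norm.norm.stronglyMeasurable.integral_prod_right' (ν := P)).aestronglyMeasurable
    (ae_restrict_of_forall_mem measurableSet_Ioc fun u hu => ?_)
  have h1 := h.moment u ⟨hu.1.le, hu.2.trans hr.2⟩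
  simp only [norm_norm]
  rwa [Real.norm_of_nonneg (integral_nonneg fun _ => norm_nonneg _)]

/-- Evolution of the expectation of a Gaussian derivative along deterministic paths of
weights, centres and covariances. -/
lemma integral_gaussD (h : IsDiffusion P X b a s t N) {r : ℝ} (hr : r ∈ Icc s t)
    {w w' : ℝ → ℝ} {c c' : ℝ → Vec d} {C C' : ℝ → Fin d → Fin d → ℝ}
    (hw : IsPath w w' s r) (hc : IsPath c c' s r) (hC : IsPath C C' s r)
    {c₀ : ℝ} (hc₀ : 0 < c₀) (hlow : ∀ u ∈ Icc s r, ∀ k : Vec d, c₀ * ‖k‖ ^ 2 ≤ quadForm (C u) k)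
    (L : List (Fin d)) :
    ∫ ω, Real.exp (w r) * gaussD L (C r) (X r ω - c r) ∂P
      = ∫ ω, Real.exp (w s) * gaussD L (C s) (X s ω - c s) ∂P
        + ∫ u in s..r, ∫ ω, Real.exp (w u) *
            genD (w' u) (b u (X u ω) - c' u) (a u (X u ω) + C' u) L (C u) (X u ω - c u) ∂P := by
  have := h.prob
  have hN0 := h.N_nonneg (hr.1.trans hr.2)
  obtain ⟨N1, hN1⟩ := hw.bdd
  obtain ⟨N2, hN2⟩ := hc.bdd
  obtain ⟨N3, hN3⟩ := hC.bdd
  obtain ⟨N4, hN4⟩ := hw.bounded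
  have hN20 := (norm_nonneg _).trans (hN2 s ⟨le_rfl, hr.1⟩)
  have hN10 := (norm_nonneg _).trans (hN1 s ⟨le_rfl, hr.1⟩)
  have hN30 := (norm_nonneg _).trans (hN3 s ⟨le_rfl, hr.1⟩)
  set ν := (volume.restrict (Ioc s r)).prod P with hν
  let G : (ℝ × Ω) × Vec d → ℂ := fun p => symbProd L p.2 * ((Real.exp (w p.1.1) : ℂ) *
    (genSymb (w' p.1.1) (b p.1.1 (X p.1.1 p.1.2) - c' p.1.1) (a p.1.1 (X p.1.1 p.1.2) + C' p.1.1) p.2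
      * gaussPhase (C p.1.1) (X p.1.1 p.1.2 - c p.1.1) p.2))
  have hGm : Measurable G := by
    refine ((continuous_symbProd L).measurable.comp measurable_snd).mul (Measurable.mul ?_ (Measurable.mul ?_ ?_))
    · exact Complex.measurable_ofReal.comp (Real.measurable_exp.comp
        (hw.meas.comp (measurable_fst.comp measurable_fst)))
    · refine Measurable.genSymb ?_ ?_ ?_ measurable_snd
      · exact hw.meas'.comp (measurable_fst.comp measurable_fst)
      · exact (h.meas_bX.comp measurable_fst).sub (hc.meas'.comp (measurable_fst.comp measurable_fst))
      · exact (h.meas_aX.comp measurable_fst).add (hC.meas'.comp (measurable_fst.comp measurable_fst))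
    · refine Measurable.gaussPhase ?_ ?_ measurable_snd
      · exact hC.meas.comp (measurable_fst.comp measurable_fst)
      · exact (h.meas_X.comp measurable_fst).sub (hc.meas.comp (measurable_fst.comp measurable_fst))
  set B := N1 + (N + N2) + d ^ 2 * (N + N3) with hB
  have hB0 : 0 ≤ B := by positivity
  set A : Vec d → ℝ := fun k => Real.exp N4 * B * ((1 + ‖k‖ + ‖k‖ ^ 2) *
    (‖k‖ ^ L.length * Real.exp (-(c₀ / 2) * ‖k‖ ^ 2))) with hA
  have hAi : Integrable A := by
    refine Integrable.const_mul ?_ _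
    have h0 := integrable_pow_mul_exp (d := d) L.length (half_pos hc₀)
    have h1 := integrable_pow_mul_exp (d := d) (L.length + 1) (half_pos hc₀)
    have h2 := integrable_pow_mul_exp (d := d) (L.length + 2) (half_pos hc₀)
    refine ((h0.add h1).add h2).congr (Filter.Eventually.of_forall fun k => ?_)
    simp only [Pi.add_apply, pow_succ]
    ring
  have hGb : ∀ u ∈ Ioc s r, ∀ ω k, ‖G ((u, ω), k)‖ ≤ (1 + ‖X u ω‖) * A k := fun u hu ω k => by
    have hu' : u ∈ Icc s r := ⟨hu.1.le, hu.2⟩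
    have hu'' : u ∈ Icc s t := ⟨hu.1.le, hu.2.trans hr.2⟩
    have e1 : ‖genSymb (w' u) (b u (X u ω) - c' u) (a u (X u ω) + C' u) k‖
        ≤ B * (1 + ‖k‖ + ‖k‖ ^ 2) * (1 + ‖X u ω‖) := by
      refine norm_genSymb_le (norm_nonneg _) (hN1 u hu') ?_ ?_ (by positivity) k
      · refine (norm_sub_le _ _).trans ?_
        have := h.bound_b u hu'' (X u ω)
        have := hN2 u hu'
        nlinarith [norm_nonneg (X u ω)]
      · intro i j
        refine (abs_add_le _ _).trans (add_le_add (h.bound_a u hu'' _ i j) ?_)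
        exact ((norm_le_pi_norm (C' u i) j).trans (norm_le_pi_norm (C' u) i)).trans (hN3 u hu')
    have e2 := norm_symbProd_mul_gaussPhase_le (hlow u hu') L (X u ω - c u) k
    have e3 : ‖(Real.exp (w u) : ℂ)‖ ≤ Real.exp N4 := by
      rw [Complex.norm_real, Real.norm_of_nonneg (Real.exp_pos _).le]
      exact Real.exp_le_exp.2 ((le_abs_self _).trans (hN4 u hu'))
    calc ‖G ((u, ω), k)‖ = ‖(Real.exp (w u) : ℂ)‖
          * (‖genSymb (w' u) (b u (X u ω) - c' u) (a u (X u ω) + C' u) k‖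
            * ‖symbProd L k * gaussPhase (C u) (X u ω - c u) k‖) := by
            simp only [G, norm_mul]; ring
      _ ≤ Real.exp N4 * ((B * (1 + ‖k‖ + ‖k‖ ^ 2) * (1 + ‖X u ω‖)) *
          (‖k‖ ^ L.length * Real.exp (-(c₀ / 2) * ‖k‖ ^ 2))) := by
          refine mul_le_mul e3 (mul_le_mul e1 e2 (norm_nonneg _) (by positivity)) (by positivity) (by positivity)
      _ = _ := by simp only [hA]; ring
  have hGi : Integrable G (ν.prod volume) := by
    refine Integrable.mono' ((h.integrable_prod_norm hr).mul_prod hAi) hGm.aestronglyMeasurable ?_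
    have h1 : ∀ᵐ p ∂ν, p.1 ∈ Ioc s r :=
      Measure.quasiMeasurePreserving_fst.ae (ae_restrict_mem measurableSet_Ioc)
    have h2 : ∀ᵐ p ∂(ν.prod (volume : Measure (Vec d))), p.1.1 ∈ Ioc s r :=
      Measure.quasiMeasurePreserving_fst.ae h1
    filter_upwards [h2] with p hp
    exact hGb _ hp _ _
  have hGk : ∀ᵐ k : Vec d, Integrable (fun p => G (p, k)) ν := hGi.prod_left_ae
  have key : ∀ k, ∫ ω, (Real.exp (w r) : ℂ) * gaussPhase (C r) (X r ω - c r) k ∂P = _ :=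
    h.integral_gaussPhase hr hw hc hC
  obtain ⟨i1, e1⟩ := integral_gaussD_eq_re (P := P) hc₀ (hlow r ⟨hr.1, le_rfl⟩)
    (Y := fun ω => X r ω - c r) ((h.meas_Xt r).sub_const _) L (Real.exp (w r))
  obtain ⟨i2, e2⟩ := integral_gaussD_eq_re (P := P) hc₀ (hlow s ⟨le_rfl, hr.1⟩)
    (Y := fun ω => X s ω - c s) ((h.meas_Xt s).sub_const _) L (Real.exp (w s))
  have e3 : ∀ᵐ k : Vec d, symbProd L k * ∫ ω, (Real.exp (w r) : ℂ) * gaussPhase (C r) (X r ω - c r) k ∂P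
      = symbProd L k * ∫ ω, (Real.exp (w s) : ℂ) * gaussPhase (C s) (X s ω - c s) k ∂P
        + ∫ p, G (p, k) ∂ν := by
    filter_upwards [hGk] with k hk
    rw [key k, mul_add, hν, integral_prod _ hk, intervalIntegral.integral_of_le hr.1,
      ← integral_const_mul (symbProd L k) (μ := volume.restrict (Ioc s r))]
    simp only [← integral_const_mul (symbProd L k) (μ := P)]
    rfl
  rw [e1, e2, integral_congr_ae e3, integral_add i2 hGi.integral_prod_right, Complex.add_re]
  congr 1
  rw [← integral_integral_swap (f := fun p k => G (p, k)) hGi]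
  have i4 := hGi.integral_prod_left
  rw [hν, integral_prod _ i4, intervalIntegral.integral_of_le hr.1,
    ← RCLike.re_eq_complex_re, ← integral_re i4.integral_prod_left]
  refine integral_congr_ae ?_
  have i5 : ∀ᵐ u ∂(volume.restrict (Ioc s r)), Integrable (fun ω => ∫ k : Vec d, G ((u, ω), k)) P := i4.prod_right_ae
  filter_upwards [i5, ae_restrict_mem measurableSet_Ioc] with u hu hum
  rw [← integral_re hu]
  refine integral_congr_ae (Filter.Eventually.of_forall fun ω => ?_)
  have e6 := re_integral_genSymb hc₀ (hlow u ⟨hum.1.le, hum.2⟩) (w' u) (b u (X u ω) - c' u)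
    (a u (X u ω) + C' u) L (X u ω - c u)
  have e7 : ∀ k, G ((u, ω), k) = (Real.exp (w u) : ℂ) * (genSymb (w' u) (b u (X u ω) - c' u) (a u (X u ω) + C' u) k
      * (symbProd L k * gaussPhase (C u) (X u ω - c u) k)) := fun k => by
    simp only [G]; ring
  simp only [e7, integral_const_mul, RCLike.re_eq_complex_re, Complex.re_ofReal_mul, e6]

end IsDiffusion

lemma IsPath.of_hasDerivAt {f f' : ℝ → ℝ} (h : ∀ u, HasDerivAt f (f' u) u) (hf' : Continuous f')
    (s r : ℝ) : IsPath f f' s r where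
  meas := (continuous_iff_continuousAt.2 fun u => (h u).continuousAt).measurable
  meas' := hf'.measurable
  bdd := isCompact_Icc.exists_bound_of_continuousOn hf'.continuousOn
  eq v _ := by
    rw [intervalIntegral.integral_eq_sub_of_hasDerivAt (fun u _ => h u) (hf'.intervalIntegrable _ _)]
    ring

lemma IsPath.comp_real {f f' g g' : ℝ → ℝ} {s r : ℝ} (h : ∀ u ∈ Icc s r, HasDerivAt g (g' u) u)
    (hg : Measurable g) (hgm : Measurable g') (hg' : ContinuousOn g' (Icc s r)) : IsPath g g' s r where
  meas := hg
  meas' := hgm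
  bdd := isCompact_Icc.exists_bound_of_continuousOn hg'
  eq v hv := by
    have hsub : uIcc s v ⊆ Icc s r := by
      rw [uIcc_of_le hv.1]; exact Icc_subset_Icc le_rfl hv.2
    rw [intervalIntegral.integral_eq_sub_of_hasDerivAt (fun u hu => h u (hsub hu))
      (hg'.mono hsub).intervalIntegrable]
    ring

/-- `scalCov` as a continuous linear map. -/
def scalCovCLM (d : ℕ) : ℝ →L[ℝ] (Fin d → Fin d → ℝ) :=
  LinearMap.toContinuousLinearMap
    { toFun := scalCov d
      map_add' := fun p q => by ext i j; simp only [scalCov, Pi.add_apply]; split_ifs <;> simp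
      map_smul' := fun c q => by ext i j; simp [scalCov] }

lemma IsPath.scalCov {d : ℕ} {q q' : ℝ → ℝ} {s r : ℝ} (h : IsPath q q' s r) :
    IsPath (fun u => scalCov d (q u)) (fun u => scalCov d (q' u)) s r :=
  h.clm (scalCovCLM d)

lemma quadForm_add {d : ℕ} (A B : Fin d → Fin d → ℝ) (k : Vec d) :
    quadForm (A + B) k = quadForm A k + quadForm B k := by
  simp [quadForm, add_mul, Finset.sum_add_distrib]

lemma genD_nil_scalCov {d : ℕ} {q : ℝ} (hq : 0 < q) (w q' : ℝ) (v : Vec d) (A : Fin d → Fin d → ℝ) (m : Vec d) :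
    genD (w + d / 2 * (q' / q)) v (A + scalCov d q') [] (scalCov d q) m
      = gaussD [] (scalCov d q) m * (w - (∑ i, m i * v i) / q
        + (quadForm A m / q ^ 2 + q' * ‖m‖ ^ 2 / q ^ 2 - (∑ i, A i i) / q) / 2) := by
  have e1 : ∑ i, v i * gaussD [i] (scalCov d q) m = -((∑ i, m i * v i) / q) * gaussD [] (scalCov d q) m := by
    simp only [gaussD_one_scalCov hq]
    rw [Finset.sum_div, ← Finset.sum_neg_distrib, Finset.sum_mul]
    exact Finset.sum_congr rfl fun i _ => by ring
  have e2 : ∀ B : Fin d → Fin d → ℝ, ∑ i, ∑ j, B i j * gaussD [i, j] (scalCov d q) m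
      = (quadForm B m / q ^ 2 - (∑ i, B i i) / q) * gaussD [] (scalCov d q) m := fun B => by
    simp only [gaussD_two_scalCov hq]
    simp only [sub_mul, mul_sub, Finset.sum_sub_distrib, ite_mul, mul_ite, zero_mul, mul_zero,
      Finset.sum_ite_eq, Finset.mem_univ, if_true, quadForm, Finset.sum_div, Finset.sum_mul]
    congr 1
    · exact Finset.sum_congr rfl fun i _ => Finset.sum_congr rfl fun j _ => by ring
    · exact Finset.sum_congr rfl fun i _ => by ring
  rw [genD, e1, e2, quadForm_add, quadForm_scalCov]
  have e3 : ∑ i, (A + scalCov d q') i i = ∑ i, A i i + d * q' := by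
    simp [Finset.sum_add_distrib, scalCov]
  rw [e3]
  field_simp
  ring

/-- A diffusion on `[s,t]` started at `x`, together with a reference path `θ`, with
quantitative regularity of the coefficients. -/
structure Setup (d : ℕ) (T K α β : ℝ) where
  Ω : Type
  mΩ : MeasurableSpace Ω
  P : Measure Ω
  X : ℝ → Ω → Vec d
  b : ℝ → Vec d → Vec d
  a : ℝ → Vec d → Fin d → Fin d → ℝ
  s : ℝ
  t : ℝ
  N : ℝ
  x : Vec d
  θ : ℝ → Vec d
  θ' : ℝ → Vec d
  diff : IsDiffusion P X b a s t N
  hst : s < t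
  hT : t - s ≤ T
  start : ∀ᵐ ω ∂P, X s ω = x
  path : IsPath θ θ' s t
  drift_path : ∀ r ∈ Icc s t, ∀ z, ‖b r z - θ' r‖ ≤ K * (1 + ‖z - θ r‖)
  drift_holder : ∀ r ∈ Icc s t, ∀ z w, ‖b r z - b r w‖ ≤ K * max (‖z - w‖ ^ β) ‖z - w‖
  symm : ∀ r ∈ Icc s t, ∀ z i j, a r z i j = a r z j i
  ell : ∀ r ∈ Icc s t, ∀ z, ∀ k : Vec d, K⁻¹ * ‖k‖ ^ 2 ≤ quadForm (a r z) k
  bd : ∀ r ∈ Icc s t, ∀ z i j, |a r z i j| ≤ K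
  lip : ∀ r ∈ Icc s t, ∀ z w i j, |a r z i j - a r w i j| ≤ K * ‖z - w‖
  expansion : ∀ r ∈ Icc s t, ∃ D : Fin d → Fin d → Fin d → ℝ, (∀ i j l, |D i j l| ≤ K) ∧
    ∀ z i j, |a r z i j - a r (θ r) i j - ∑ l, D i j l * (z - θ r) l| ≤ K * ‖z - θ r‖ ^ (1 + α)

attribute [instance] Setup.mΩ

namespace Setup
variable {d : ℕ} {T K α β : ℝ}

instance (S : Setup d T K α β) : IsProbabilityMeasure S.P := S.diff.prob

/-- Distance of the starting point to the reference path. -/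
def dist (S : Setup d T K α β) : ℝ := ‖S.x - S.θ S.s‖

/-- Smoothed occupation of the reference path. -/
def occ (S : Setup d T K α β) (r δ : ℝ) : ℝ :=
  ∫ ω, Real.exp (-‖S.X r ω - S.θ r‖ ^ 2 / (2 * δ)) ∂S.P

lemma trace_nonneg (S : Setup d T K α β) (hK : 1 ≤ K) {r : ℝ} (hr : r ∈ Icc S.s S.t) (z : Vec d) :
    0 ≤ ∑ i, S.a r z i i := by
  refine Finset.sum_nonneg fun i _ => ?_
  have h := S.ell r hr z (EuclideanSpace.single i 1)
  have e : quadForm (S.a r z) (EuclideanSpace.single i 1) = S.a r z i i := by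
    simp [quadForm]
  rw [e] at h
  exact le_trans (by positivity) h

lemma exp_log_mul_gaussD {q : ℝ} (hq : 0 < q) (w : ℝ) (m : Vec d) :
    Real.exp (w + d / 2 * Real.log q) * gaussD [] (scalCov d q) m
      = (2 * Real.pi) ^ ((d : ℝ) / 2) * Real.exp w * Real.exp (-‖m‖ ^ 2 / (2 * q)) := by
  rw [gaussD_nil_scalCov hq, Real.exp_add, Real.div_rpow (by positivity) hq.le,
    mul_comm ((d : ℝ) / 2) (Real.log q), ← Real.rpow_def_of_pos hq]
  have : 0 < q ^ ((d : ℝ) / 2) := by positivity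
  field_simp

lemma measurable_center (S : Setup d T K α β) (r : ℝ) (c : Vec d) : Measurable fun ω => S.X r ω - c :=
  (S.diff.meas_Xt r).sub_const _

lemma integral_start (S : Setup d T K α β) (f : Vec d → ℝ) : ∫ ω, f (S.X S.s ω) ∂S.P = f S.x := by
  rw [integral_congr_ae (g := fun _ => f S.x) (by filter_upwards [S.start] with ω h; rw [h])]
  simp

/-- Gaussian concentration around the reference path. -/
theorem exists_occ_le (d : ℕ) (T K α β : ℝ) (hT : 0 < T) (hK : 1 ≤ K) :
    ∃ M l : ℝ, 0 < M ∧ 0 < l ∧ ∀ S : Setup d T K α β, ∀ r ∈ Icc S.s S.t, ∀ δ, 0 < δ →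
      S.occ r δ ≤ M * Real.exp (-l * S.dist ^ 2 / (δ + (r - S.s))) := by
  set A : ℝ := d ^ 2 * K + 1 with hA
  set k : ℝ := 2 * K with hk
  have hK0 : 0 < K := by linarith
  have hA1 : 1 ≤ A := by rw [hA]; have : 0 ≤ (d:ℝ) ^ 2 * K := by positivity
                         linarith
  have hk0 : 0 < k := by positivity
  refine ⟨Real.exp (K ^ 2 / 2 * T), 1 / (2 * (Real.exp (k * T) * A)), by positivity, by positivity,
    fun S r hr δ hδ => ?_⟩
  set q : ℝ → ℝ := fun u => (δ + A / k) * Real.exp (k * (r - u)) - A / k with hq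
  set q' : ℝ → ℝ := fun u => -(k * q u) - A with hq'
  have hqd : ∀ u, HasDerivAt q (q' u) u := fun u => by
    have h1 : HasDerivAt (fun u => k * (r - u)) (-k) u := by
      simpa using ((hasDerivAt_id u).const_sub r).const_mul k
    refine ((h1.exp.const_mul (δ + A / k)).sub_const (A / k)).congr_deriv ?_
    simp only [hq', hq]; field_simp; ring
  have hqc : Continuous q := continuous_iff_continuousAt.2 fun u => (hqd u).continuousAt
  have hq'c : Continuous q' := by simp only [hq']; fun_prop
  have hqr : q r = δ := by simp [hq]
  have hqδ : ∀ u ∈ Icc S.s r, δ ≤ q u := fun u hu => by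
    have : 1 ≤ Real.exp (k * (r - u)) := Real.one_le_exp (mul_nonneg hk0.le (by linarith [hu.2]))
    have : (δ + A / k) * 1 ≤ (δ + A / k) * Real.exp (k * (r - u)) :=
      mul_le_mul_of_nonneg_left this (by positivity)
    simp only [hq]; linarith
  have hqs : q S.s ≤ Real.exp (k * T) * A * (δ + (r - S.s)) := by
    set h := r - S.s with hh
    have hh0 : 0 ≤ h := by linarith [hr.1]
    have hhT : h ≤ T := by linarith [hr.2, S.hT]
    have e1 : Real.exp (k * h) - 1 ≤ k * h * Real.exp (k * h) := by
      have := Real.add_one_le_exp (-(k * h))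
      have h2 := mul_le_mul_of_nonneg_right this (Real.exp_pos (k * h)).le
      rw [← Real.exp_add] at h2
      simp at h2; linarith
    have e2 : Real.exp (k * h) ≤ Real.exp (k * T) := Real.exp_le_exp.2 (by nlinarith)
    have e3 : q S.s = δ * Real.exp (k * h) + A / k * (Real.exp (k * h) - 1) := by simp only [hq, hh]; ring
    have e4 : A / k * (Real.exp (k * h) - 1) ≤ A * h * Real.exp (k * h) := by
      calc _ ≤ A / k * (k * h * Real.exp (k * h)) := mul_le_mul_of_nonneg_left e1 (by positivity)
        _ = _ := by field_simp
    rw [e3]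
    calc _ ≤ (δ + A * h) * Real.exp (k * h) := by linarith
      _ ≤ (A * (δ + h)) * Real.exp (k * T) := by
        refine mul_le_mul ?_ e2 (Real.exp_pos _).le (by positivity)
        nlinarith
      _ = _ := by ring
  set w : ℝ → ℝ := fun u => K ^ 2 / 2 * (r - u) + d / 2 * Real.log (q u) with hw
  set w' : ℝ → ℝ := fun u => -(K ^ 2 / 2) + d / 2 * (q' u / q u) with hw'
  have hwp : IsPath w w' S.s r := by
    refine IsPath.comp_real (f := w) (f' := w') (fun u hu => ?_) ?_ ?_ ?_
    · have h1 : HasDerivAt (fun u => K ^ 2 / 2 * (r - u)) (-(K ^ 2 / 2)) u := by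
        simpa using ((hasDerivAt_id u).const_sub r).const_mul (K ^ 2 / 2)
      exact h1.add (((hqd u).log (hδ.trans_le (hqδ u hu)).ne').const_mul _)
    · have := hqc.measurable; fun_prop
    · have := hqc.measurable; have := hq'c.measurable; fun_prop
    · refine ContinuousOn.add continuousOn_const (ContinuousOn.mul continuousOn_const ?_)
      exact hq'c.continuousOn.div hqc.continuousOn fun u hu => (hδ.trans_le (hqδ u hu)).ne'
  have key := S.diff.integral_gaussD hr hwp (S.path.mono hr.2)
    ((IsPath.of_hasDerivAt hqd hq'c S.s r).scalCov (d := d)) hδ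
    (fun u hu k => by rw [quadForm_scalCov]; exact mul_le_mul_of_nonneg_right (hqδ u hu) (sq_nonneg _)) []
  have hneg : ∫ u in S.s..r, ∫ ω, Real.exp (w u) *
            genD (w' u) (S.b u (S.X u ω) - S.θ' u) (S.a u (S.X u ω) + scalCov d (q' u)) [] (scalCov d (q u))
              (S.X u ω - S.θ u) ∂S.P ≤ 0 := by
    rw [intervalIntegral.integral_of_le hr.1]
    refine setIntegral_nonpos measurableSet_Ioc fun u hu => integral_nonpos fun ω => ?_
    have hu' : u ∈ Icc S.s r := ⟨hu.1.le, hu.2⟩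
    have hu'' : u ∈ Icc S.s S.t := ⟨hu.1.le, hu.2.trans hr.2⟩
    have hqu : 0 < q u := hδ.trans_le (hqδ u hu')
    simp only [hw']
    rw [genD_nil_scalCov hqu]
    set m := S.X u ω - S.θ u with hm
    have hg : 0 ≤ gaussD [] (scalCov d (q u)) m := by rw [gaussD_nil_scalCov hqu]; positivity
    refine mul_nonpos_of_nonneg_of_nonpos (Real.exp_pos _).le (mul_nonpos_of_nonneg_of_nonpos hg ?_)
    have b1 : |∑ i, m i * (S.b u (S.X u ω) - S.θ' u) i| ≤ ‖m‖ * (K * (1 + ‖m‖)) :=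
      (abs_sum_mul_le _ _).trans (mul_le_mul_of_nonneg_left (S.drift_path u hu'' _) (norm_nonneg _))
    have b2 : quadForm (S.a u (S.X u ω)) m ≤ d ^ 2 * K * ‖m‖ ^ 2 :=
      (le_abs_self _).trans (abs_quadForm_le (S.bd u hu'' _) m)
    have b3 := S.trace_nonneg hK hu'' (S.X u ω)
    have b4 : 0 ≤ (∑ i, S.a u (S.X u ω) i i) / q u := div_nonneg b3 hqu.le
    have b5 : -(∑ i, m i * (S.b u (S.X u ω) - S.θ' u) i) / q u ≤ (‖m‖ * (K * (1 + ‖m‖))) / q u := by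
      refine div_le_div_of_nonneg_right ?_ hqu.le
      linarith [neg_abs_le (∑ i, m i * (S.b u (S.X u ω) - S.θ' u) i)]
    have b6 : quadForm (S.a u (S.X u ω)) m / q u ^ 2 ≤ d ^ 2 * K * ‖m‖ ^ 2 / q u ^ 2 :=
      div_le_div_of_nonneg_right b2 (by positivity)
    have e1 : q' u * ‖m‖ ^ 2 / q u ^ 2 = -(2 * K) * (‖m‖ ^ 2 / q u) - A * (‖m‖ / q u) ^ 2 := by
      simp only [hq', hk]; field_simp
    have e2 : (‖m‖ * (K * (1 + ‖m‖))) / q u = K * (‖m‖ / q u) + K * (‖m‖ ^ 2 / q u) := by ring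
    have e3 : d ^ 2 * K * ‖m‖ ^ 2 / q u ^ 2 = d ^ 2 * K * (‖m‖ / q u) ^ 2 := by ring
    rw [e2] at b5
    rw [e3] at b6
    rw [e1, hA]
    rw [neg_div] at b5
    nlinarith [sq_nonneg (‖m‖ / q u - K)]
  rw [hqr] at key
  have e1 : w r = 0 + d / 2 * Real.log δ := by simp [hw, hqr]
  have hqs0 : 0 < q S.s := hδ.trans_le (hqδ _ ⟨le_rfl, hr.1⟩)
  have e2 : ∫ ω, Real.exp (w r) * gaussD [] (scalCov d δ) (S.X r ω - S.θ r) ∂S.P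
      = (2 * Real.pi) ^ ((d : ℝ) / 2) * S.occ r δ := by
    simp only [e1, exp_log_mul_gaussD hδ, Real.exp_zero, mul_one, integral_const_mul, occ]
  have e3 : ∫ ω, Real.exp (w S.s) * gaussD [] (scalCov d (q S.s)) (S.X S.s ω - S.θ S.s) ∂S.P
      = (2 * Real.pi) ^ ((d : ℝ) / 2) * (Real.exp (K ^ 2 / 2 * (r - S.s)) * Real.exp (-S.dist ^ 2 / (2 * q S.s))) := by
    rw [S.integral_start fun z => Real.exp (w S.s) * gaussD [] (scalCov d (q S.s)) (z - S.θ S.s)]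
    simp only [hw, exp_log_mul_gaussD hqs0, dist]; ring
  rw [e2, e3] at key
  have hpi : (0:ℝ) < (2 * Real.pi) ^ ((d : ℝ) / 2) := by positivity
  have h5 : S.occ r δ ≤ Real.exp (K ^ 2 / 2 * (r - S.s)) * Real.exp (-S.dist ^ 2 / (2 * q S.s)) := by
    refine le_of_mul_le_mul_left ?_ hpi
    linarith
  refine h5.trans (mul_le_mul ?_ ?_ (Real.exp_pos _).le (Real.exp_pos _).le)
  · exact Real.exp_le_exp.2 (mul_le_mul_of_nonneg_left (by linarith [hr.2, S.hT]) (by positivity))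
  · refine Real.exp_le_exp.2 ?_
    have hpos : 0 < δ + (r - S.s) := by linarith [hr.1]
    have e4 : -(1 / (2 * (Real.exp (k * T) * A))) * S.dist ^ 2 / (δ + (r - S.s))
        = -(S.dist ^ 2 / (2 * (Real.exp (k * T) * A * (δ + (r - S.s))))) := by
      field_simp
    rw [e4, neg_div]
    refine neg_le_neg (div_le_div_of_nonneg_left (sq_nonneg _) (by positivity) ?_)
    linarith

end Setup

lemma exists_gaussD_le_of_length_le (d : ℕ) (κ : ℝ) (hκ : 1 ≤ κ) (N : ℕ) :
    ∃ K l : ℝ, 0 < K ∧ 0 < l ∧ ∀ (δ : ℝ) (C : Fin d → Fin d → ℝ), 0 < δ → CovBetween κ δ C →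
      ∀ (L : List (Fin d)), L.length ≤ N → ∀ m : Vec d,
        |gaussD L C m| ≤ K * δ ^ ((-(L.length : ℝ) - d) / 2) * Real.exp (-l * ‖m‖ ^ 2 / δ) := by
  induction N with
  | zero =>
    obtain ⟨K, l, hK, hl, h⟩ := exists_weight_mul_gaussD_le d κ hκ 0 0 le_rfl
    refine ⟨K, l, hK, hl, fun δ C hδ hC L hL m => ?_⟩
    have := h δ C hδ hC L (by omega) m
    rw [Real.rpow_zero, one_mul] at this
    rw [show L.length = 0 by omega]
    simpa using this
  | succ N ih =>
    obtain ⟨K, l, hK, hl, h⟩ := exists_weight_mul_gaussD_le d κ hκ (N + 1) 0 le_rfl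
    obtain ⟨K', l', hK', hl', h'⟩ := ih
    refine ⟨K + K', min l l', by positivity, by positivity, fun δ C hδ hC L hL m => ?_⟩
    have mono : ∀ l₀, min l l' ≤ l₀ →
        Real.exp (-l₀ * ‖m‖ ^ 2 / δ) ≤ Real.exp (-(min l l') * ‖m‖ ^ 2 / δ) := fun l₀ h₀ => by
      refine Real.exp_le_exp.2 (div_le_div_of_nonneg_right ?_ hδ.le)
      nlinarith [sq_nonneg ‖m‖]
    have hp : 0 < δ ^ ((-(L.length : ℝ) - d) / 2) := by positivity
    rcases Nat.lt_or_ge L.length (N + 1) with hlt | hge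
    · refine (h' δ C hδ hC L (by omega) m).trans ?_
      exact mul_le_mul (mul_le_mul_of_nonneg_right (by linarith) hp.le) (mono _ (min_le_right _ _))
        (by positivity) (by positivity)
    · have e : L.length = N + 1 := by omega
      have := h δ C hδ hC L e m
      rw [Real.rpow_zero, one_mul, ← e, zero_sub] at this
      refine this.trans ?_
      exact mul_le_mul (mul_le_mul_of_nonneg_right (by linarith) hp.le) (mono _ (min_le_left _ _))
        (by positivity) (by positivity)

lemma exp_sq_shift_le {d : ℕ} {l δ k : ℝ} (hl : 0 < l) (hδ : 0 < δ) {z c θ : Vec d}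
    (h : ‖c - θ‖ ≤ k * √δ) :
    Real.exp (-l * ‖z - c‖ ^ 2 / δ) ≤ Real.exp (l * k ^ 2) * Real.exp (-(l / 2) * ‖z - θ‖ ^ 2 / δ) := by
  rw [← Real.exp_add]
  refine Real.exp_le_exp.2 ?_
  have h1 : ‖z - θ‖ ≤ ‖z - c‖ + ‖c - θ‖ := by
    rw [show z - θ = (z - c) + (c - θ) by abel]; exact norm_add_le _ _
  have h2 : ‖z - θ‖ ^ 2 ≤ 2 * ‖z - c‖ ^ 2 + 2 * ‖c - θ‖ ^ 2 := by
    nlinarith [norm_nonneg (z - θ), norm_nonneg (z - c), norm_nonneg (c - θ), sq_nonneg (‖z - c‖ - ‖c - θ‖)]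
  have h3 : ‖c - θ‖ ^ 2 ≤ k ^ 2 * δ := by
    calc ‖c - θ‖ ^ 2 ≤ (k * √δ) ^ 2 := by gcongr
      _ = k ^ 2 * δ := by rw [mul_pow, Real.sq_sqrt hδ.le]
  rw [div_le_iff₀ hδ, add_mul, div_mul_cancel₀ _ hδ.ne']
  nlinarith

/-- Weighted Gaussian bounds for derivatives of Gaussians whose centre is `O(√δ)` off. -/
lemma exists_kernel_bound (d : ℕ) (κ : ℝ) (hκ : 1 ≤ κ) (k : ℝ) (N : ℕ) :
    ∃ K l : ℝ, 0 < K ∧ 0 < l ∧ l ≤ 1 ∧ ∀ (δ : ℝ) (C : Fin d → Fin d → ℝ), 0 < δ → CovBetween κ δ C →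
      ∀ (L : List (Fin d)), L.length ≤ N → ∀ γ : ℝ, 0 ≤ γ → γ ≤ 4 → ∀ z c θ : Vec d, ‖c - θ‖ ≤ k * √δ →
        ‖z - θ‖ ^ γ * |gaussD L C (z - c)|
          ≤ K * δ ^ ((γ - L.length - d) / 2) * Real.exp (-l * ‖z - θ‖ ^ 2 / δ) := by
  obtain ⟨K, l, hK, hl, h⟩ := exists_gaussD_le_of_length_le d κ hκ N
  obtain ⟨A, hA, hA'⟩ := exists_weight_absorb 4 (l / 2) (by norm_num) (half_pos hl)
  refine ⟨K * Real.exp (l * k ^ 2) * (1 + A), min (l / 4) 1, by positivity, by positivity,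
    min_le_right _ _, fun δ C hδ hC L hL γ hγ hγ4 z c θ hc => ?_⟩
  set r := ‖z - θ‖ with hr
  have hr0 : 0 ≤ r := norm_nonneg _
  have hw : r ^ γ ≤ δ ^ (γ / 2) * (1 + r ^ (4:ℝ) * δ ^ (-2:ℝ)) := by
    have hs : 0 < √δ := Real.sqrt_pos.2 hδ
    have e1 : r ^ γ = δ ^ (γ / 2) * (r / √δ) ^ γ := by
      rw [Real.div_rpow hr0 hs.le, Real.sqrt_eq_rpow, ← Real.rpow_mul hδ.le,
        show (1 / 2 : ℝ) * γ = γ / 2 by ring]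
      have : 0 < δ ^ (γ / 2) := by positivity
      field_simp
    have e2 : r ^ (4:ℝ) * δ ^ (-2:ℝ) = (r / √δ) ^ (4:ℝ) := by
      rw [Real.div_rpow hr0 hs.le, Real.sqrt_eq_rpow, ← Real.rpow_mul hδ.le, Real.rpow_neg hδ.le]
      norm_num; rfl
    rw [e1, e2]
    refine mul_le_mul_of_nonneg_left ?_ (by positivity)
    have hx : 0 ≤ r / √δ := by positivity
    rcases le_total (r / √δ) 1 with h1 | h1
    · have := Real.rpow_le_one hx h1 hγ
      have h2 : 0 ≤ (r / √δ) ^ (4:ℝ) := by positivity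
      linarith
    · have := Real.rpow_le_rpow_of_exponent_le h1 hγ4
      linarith
  have hE : Real.exp (-(l / 2) * r ^ 2 / δ) ≤ Real.exp (-(min (l / 4) 1) * r ^ 2 / δ) := by
    refine Real.exp_le_exp.2 (div_le_div_of_nonneg_right ?_ hδ.le)
    nlinarith [sq_nonneg r, min_le_left (l / 4) 1]
  have hE' : Real.exp (-(l / 2 / 2) * r ^ 2 / δ) ≤ Real.exp (-(min (l / 4) 1) * r ^ 2 / δ) := by
    refine Real.exp_le_exp.2 (div_le_div_of_nonneg_right ?_ hδ.le)
    nlinarith [sq_nonneg r, min_le_left (l / 4) 1]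
  have h4 : δ ^ (-2:ℝ) * δ ^ ((4:ℝ) / 2) = 1 := by rw [← Real.rpow_add hδ]; norm_num
  have key : (1 + r ^ (4:ℝ) * δ ^ (-2:ℝ)) * Real.exp (-(l / 2) * r ^ 2 / δ)
      ≤ (1 + A) * Real.exp (-(min (l / 4) 1) * r ^ 2 / δ) := by
    have := hA' δ r hδ hr0
    calc (1 + r ^ (4:ℝ) * δ ^ (-2:ℝ)) * Real.exp (-(l / 2) * r ^ 2 / δ)
        = Real.exp (-(l / 2) * r ^ 2 / δ) + δ ^ (-2:ℝ) * (r ^ (4:ℝ) * Real.exp (-(l / 2) * r ^ 2 / δ)) := by ring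
      _ ≤ Real.exp (-(l / 2) * r ^ 2 / δ) + δ ^ (-2:ℝ) * (A * δ ^ ((4:ℝ) / 2) * Real.exp (-(l / 2 / 2) * r ^ 2 / δ)) :=
          add_le_add le_rfl (mul_le_mul_of_nonneg_left this (by positivity))
      _ = Real.exp (-(l / 2) * r ^ 2 / δ) + A * Real.exp (-(l / 2 / 2) * r ^ 2 / δ) * (δ ^ (-2:ℝ) * δ ^ ((4:ℝ) / 2)) := by ring
      _ ≤ _ := by rw [h4, mul_one, add_mul, one_mul]
                  exact add_le_add hE (mul_le_mul_of_nonneg_left hE' hA.le)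
  have hg := (h δ C hδ hC L hL (z - c)).trans
    (mul_le_mul_of_nonneg_left (exp_sq_shift_le hl hδ hc) (by positivity))
  rw [← hr] at hg
  calc r ^ γ * |gaussD L C (z - c)|
      ≤ (δ ^ (γ / 2) * (1 + r ^ (4:ℝ) * δ ^ (-2:ℝ))) * (K * δ ^ ((-(L.length : ℝ) - d) / 2) *
        (Real.exp (l * k ^ 2) * Real.exp (-(l / 2) * r ^ 2 / δ))) :=
        mul_le_mul hw hg (abs_nonneg _) (by positivity)
    _ = K * Real.exp (l * k ^ 2) * (δ ^ (γ / 2) * δ ^ ((-(L.length : ℝ) - d) / 2)) *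
        ((1 + r ^ (4:ℝ) * δ ^ (-2:ℝ)) * Real.exp (-(l / 2) * r ^ 2 / δ)) := by ring
    _ ≤ K * Real.exp (l * k ^ 2) * (δ ^ (γ / 2) * δ ^ ((-(L.length : ℝ) - d) / 2)) *
        ((1 + A) * Real.exp (-(min (l / 4) 1) * r ^ 2 / δ)) :=
        mul_le_mul_of_nonneg_left key (by positivity)
    _ = _ := by
      rw [← Real.rpow_add hδ, show γ / 2 + (-(L.length : ℝ) - d) / 2 = (γ - L.length - d) / 2 by ring]
      ring

/-- A bounded measurable velocity yields a path with prescribed endpoint. -/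
lemma IsPath.primitive {E : Type*} [NormedAddCommGroup E] [NormedSpace ℝ E] [MeasurableSpace E]
    [BorelSpace E] [SecondCountableTopology E] [CompleteSpace E] {g : ℝ → E} {N : ℝ}
    (hg : Measurable g) (hN : ∀ u, ‖g u‖ ≤ N) (x : E) (s r : ℝ) :
    IsPath (fun u => x + ∫ v in u..r, g v) (fun u => -g u) s r := by
  have hi : ∀ a b, IntervalIntegrable g volume a b := fun a b =>
    intervalIntegrable_iff.2 (Integrable.mono' (integrableOn_const (C := N) (by simp)) hg.aestronglyMeasurable
      (Filter.Eventually.of_forall hN))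
  refine ⟨?_, hg.neg, ⟨N, fun u _ => by rw [norm_neg]; exact hN u⟩, fun v hv => ?_⟩
  · have : Continuous fun u => ∫ v in u..r, g v := by
      have := (intervalIntegral.continuous_primitive hi r).neg
      refine this.congr fun u => ?_
      exact (intervalIntegral.integral_symm r u).symm
    exact (continuous_const.add this).measurable
  · rw [intervalIntegral.integral_neg, ← intervalIntegral.integral_add_adjacent_intervals (hi s v) (hi v r)]
    abel

lemma integral_apply₂ {d : ℕ} {g : ℝ → Fin d → Fin d → ℝ} {a b : ℝ} (hg : IntervalIntegrable g volume a b)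
    (i j : Fin d) : (∫ u in a..b, g u) i j = ∫ u in a..b, g u i j := by
  have := ((ContinuousLinearMap.proj (R := ℝ) (φ := fun _ : Fin d => ℝ) j).comp
    (ContinuousLinearMap.proj (R := ℝ) (φ := fun _ : Fin d => Fin d → ℝ) i)).intervalIntegral_comp_comm hg
  simpa using this.symm

lemma CovBetween.add_integral {d : ℕ} {κ δ : ℝ} (hκ : 1 ≤ κ) {C : Fin d → Fin d → ℝ} (hC : CovBetween κ δ C)
    {g : ℝ → Fin d → Fin d → ℝ} {u r : ℝ} (hur : u ≤ r) (hg : IntervalIntegrable g volume u r)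
    (hs : ∀ v ∈ Icc u r, ∀ i j, g v i j = g v j i)
    (hl : ∀ v ∈ Icc u r, ∀ k : Vec d, κ⁻¹ * ‖k‖ ^ 2 ≤ quadForm (g v) k)
    (hb : ∀ v ∈ Icc u r, ∀ i j, |g v i j| ≤ κ) :
    CovBetween κ (δ + r - u) (C + ∫ v in u..r, g v) where
  symm i j := by
    rw [Pi.add_apply, Pi.add_apply, Pi.add_apply, Pi.add_apply, hC.symm i j, integral_apply₂ hg, integral_apply₂ hg]
    congr 1
    refine intervalIntegral.integral_congr fun v hv => ?_
    rw [uIcc_of_le hur] at hv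
    exact hs v hv i j
  lower k := by
    rw [quadForm_add]
    have e : quadForm (∫ v in u..r, g v) k = ∫ v in u..r, quadForm (g v) k :=
      ((quadFormCLM k).intervalIntegral_comp_comm hg).symm
    have h1 : ∫ v in u..r, κ⁻¹ * ‖k‖ ^ 2 ≤ ∫ v in u..r, quadForm (g v) k := by
      refine intervalIntegral.integral_mono_on hur (by simp) ?_ fun v hv => hl v hv k
      have := hg.norm
      rw [intervalIntegrable_iff_integrableOn_Ioc_of_le hur] at hg ⊢
      exact (quadFormCLM k).integrable_comp hg
    rw [intervalIntegral.integral_const, smul_eq_mul] at h1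
    rw [e, show (δ + r - u) / κ * ‖k‖ ^ 2 = δ / κ * ‖k‖ ^ 2 + (r - u) * (κ⁻¹ * ‖k‖ ^ 2) by field_simp; ring]
    exact add_le_add (hC.lower k) h1
  bound i j := by
    rw [Pi.add_apply, Pi.add_apply, integral_apply₂ hg]
    have := intervalIntegral.norm_integral_le_of_norm_le_const (a := u) (b := r) (f := fun v => g v i j) (C := κ)
      (fun v hv => by
        rw [uIoc_of_le hur] at hv
        exact hb v ⟨hv.1.le, hv.2⟩ i j)
    rw [abs_of_nonneg (sub_nonneg.2 hur), Real.norm_eq_abs] at this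
    refine (abs_add_le _ _).trans ?_
    have := hC.bound i j
    linarith

lemma integrable_gaussD_comp {d : ℕ} {Ω : Type*} [MeasurableSpace Ω] {P : Measure Ω} [IsProbabilityMeasure P]
    {κ δ : ℝ} (hκ : 1 ≤ κ) (hδ : 0 < δ) {C : Fin d → Fin d → ℝ} (hC : CovBetween κ δ C) {Y : Ω → Vec d}
    (hY : Measurable Y) (L : List (Fin d)) : Integrable (fun ω => gaussD L C (Y ω)) P := by
  obtain ⟨K, l, hK, hl, h⟩ := exists_gaussD_le_of_length_le d κ hκ L.length
  have hm : Continuous (gaussD L C) := continuous_iff_continuousAt.2 fun m =>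
    (hasFDerivAt_gaussD (by positivity : 0 < δ / κ) hC.lower L m).continuousAt
  refine Integrable.mono' (integrable_const (K * δ ^ ((-(L.length : ℝ) - d) / 2)))
    (hm.measurable.comp hY).aestronglyMeasurable (Filter.Eventually.of_forall fun ω => ?_)
  refine (h δ C hδ hC L le_rfl (Y ω)).trans (mul_le_of_le_one_right (by positivity) (Real.exp_le_one_iff.2 ?_))
  rw [neg_mul, neg_div]
  exact neg_nonpos.2 (by positivity)

lemma abs_genD_le {d : ℕ} {v : Vec d} {A : Fin d → Fin d → ℝ} {V B : ℝ} (hv : ∀ i, |v i| ≤ V)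
    (hA : ∀ i j, |A i j| ≤ B) (L : List (Fin d)) (C : Fin d → Fin d → ℝ) (m : Vec d) :
    |genD 0 v A L C m| ≤ ∑ i, V * |gaussD (i :: L) C m| + ∑ i, ∑ j, B * |gaussD (i :: j :: L) C m| := by
  rw [genD, zero_mul, zero_add]
  refine (abs_add_le _ _).trans (add_le_add ?_ ?_)
  · refine (Finset.abs_sum_le_sum_abs _ _).trans (Finset.sum_le_sum fun i _ => ?_)
    rw [abs_mul]; exact mul_le_mul_of_nonneg_right (hv i) (abs_nonneg _)
  · have h : |∑ i, ∑ j, A i j * gaussD (i :: j :: L) C m| ≤ ∑ i, ∑ j, B * |gaussD (i :: j :: L) C m| := by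
      refine (Finset.abs_sum_le_sum_abs _ _).trans (Finset.sum_le_sum fun i _ => ?_)
      refine (Finset.abs_sum_le_sum_abs _ _).trans (Finset.sum_le_sum fun j _ => ?_)
      rw [abs_mul]; exact mul_le_mul_of_nonneg_right (hA i j) (abs_nonneg _)
    rw [abs_mul, abs_of_pos (by norm_num : (0:ℝ) < 1 / 2)]
    linarith [abs_nonneg (∑ i, ∑ j, A i j * gaussD (i :: j :: L) C m)]

namespace Setup
variable {d : ℕ} {T K α β : ℝ}

/-- Diffusion matrix frozen along the reference path. -/
def frozen (S : Setup d T K α β) (u : ℝ) : Fin d → Fin d → ℝ :=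
  (Icc S.s S.t).indicator (fun v => S.a v (S.θ v)) u

/-- Covariance accumulated along the reference path. -/
def cov (S : Setup d T K α β) (C : Fin d → Fin d → ℝ) (r u : ℝ) : Fin d → Fin d → ℝ :=
  C + ∫ v in u..r, S.frozen v

lemma measurable_frozen (S : Setup d T K α β) : Measurable S.frozen := by
  have e := S.diff.meas_a.comp (measurable_id.prodMk S.path.meas)
  refine Measurable.indicator ?_ measurableSet_Icc
  simpa only [Function.comp_def, Function.uncurry, id] using e

lemma frozen_of_mem (S : Setup d T K α β) {u : ℝ} (hu : u ∈ Icc S.s S.t) : S.frozen u = S.a u (S.θ u) :=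
  indicator_of_mem hu _

lemma norm_frozen_le (S : Setup d T K α β) (hK : 1 ≤ K) (u : ℝ) : ‖S.frozen u‖ ≤ K := by
  by_cases hu : u ∈ Icc S.s S.t
  · rw [S.frozen_of_mem hu]
    refine (pi_norm_le_iff_of_nonneg (by linarith)).2 fun i => (pi_norm_le_iff_of_nonneg (by linarith)).2 fun j => ?_
    exact S.bd u hu _ i j
  · rw [frozen, indicator_of_notMem hu]; simp; linarith

lemma intervalIntegrable_frozen (S : Setup d T K α β) (hK : 1 ≤ K) (a b : ℝ) :
    IntervalIntegrable S.frozen volume a b :=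
  intervalIntegrable_iff.2 (Integrable.mono' (integrableOn_const (C := K) (by simp))
    S.measurable_frozen.aestronglyMeasurable (Filter.Eventually.of_forall (S.norm_frozen_le hK)))

lemma isPath_cov (S : Setup d T K α β) (hK : 1 ≤ K) (C : Fin d → Fin d → ℝ) (r : ℝ) :
    IsPath (S.cov C r) (fun u => -S.frozen u) S.s r :=
  IsPath.primitive S.measurable_frozen (S.norm_frozen_le hK) C S.s r

lemma covBetween_cov (S : Setup d T K α β) (hK : 1 ≤ K) {δ : ℝ} {C : Fin d → Fin d → ℝ}
    (hC : CovBetween K δ C) {r u : ℝ} (hr : r ∈ Icc S.s S.t) (hu : u ∈ Icc S.s r) :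
    CovBetween K (δ + r - u) (S.cov C r u) := by
  have hm : ∀ v ∈ Icc u r, v ∈ Icc S.s S.t := fun v hv => ⟨hu.1.trans hv.1, hv.2.trans hr.2⟩
  refine hC.add_integral hK hu.2 (S.intervalIntegrable_frozen hK u r) ?_ ?_ ?_
  · intro v hv i j
    rw [S.frozen_of_mem (hm v hv)]; exact S.symm v (hm v hv) _ i j
  · intro v hv k
    rw [S.frozen_of_mem (hm v hv)]; exact S.ell v (hm v hv) _ k
  · intro v hv i j
    rw [S.frozen_of_mem (hm v hv)]; exact S.bd v (hm v hv) _ i j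

@[simp] lemma cov_self (S : Setup d T K α β) (C : Fin d → Fin d → ℝ) (r : ℝ) : S.cov C r r = C := by
  simp [cov]

/-- Duhamel bound: comparison of the diffusion with the frozen Gaussian. -/
lemma abs_integral_gaussD_le (S : Setup d T K α β) (hK : 1 ≤ K) {r δ : ℝ} (hr : r ∈ Icc S.s S.t) (hδ : 0 < δ)
    {C : Fin d → Fin d → ℝ} (hC : CovBetween K δ C) {c c' : ℝ → Vec d} (hc : IsPath c c' S.s r)
    (L : List (Fin d)) {G : ℝ → ℝ} (hG : IntervalIntegrable G volume S.s r)
    (h : ∀ u ∈ Ioc S.s r, |∫ ω, genD 0 (S.b u (S.X u ω) - c' u) (S.a u (S.X u ω) - S.a u (S.θ u)) L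
      (S.cov C r u) (S.X u ω - c u) ∂S.P| ≤ G u) :
    |∫ ω, gaussD L C (S.X r ω - c r) ∂S.P|
      ≤ |gaussD L (S.cov C r S.s) (S.x - c S.s)| + ∫ u in S.s..r, G u := by
  have hK0 : 0 < K := by linarith
  have := S.diff.integral_gaussD hr (IsPath.const 0 S.s r) hc (S.isPath_cov hK C r)
    (c₀ := δ / K) (by positivity) (fun u hu k => by
      refine le_trans ?_ ((S.covBetween_cov hK hC hr hu).lower k)
      refine mul_le_mul_of_nonneg_right (div_le_div_of_nonneg_right ?_ hK0.le) (sq_nonneg _)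
      linarith [hu.2]) L
  simp only [Real.exp_zero, one_mul, cov_self] at this
  rw [this, S.integral_start (fun z => gaussD L (S.cov C r S.s) (z - c S.s))]
  refine (abs_add_le _ _).trans (add_le_add le_rfl ?_)
  rw [← Real.norm_eq_abs]
  refine intervalIntegral.norm_integral_le_of_norm_le hr.1 ?_ hG
  refine Filter.Eventually.of_forall fun u hu => ?_
  rw [Real.norm_eq_abs]
  refine le_trans (le_of_eq ?_) (h u hu)
  congr 2
  ext ω
  rw [sub_eq_add_neg (S.a u (S.X u ω)), S.frozen_of_mem ⟨hu.1.le, hu.2.trans hr.2⟩]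

lemma integrable_occ (S : Setup d T K α β) (u : ℝ) (c : Vec d) {l τ : ℝ} (hl : 0 ≤ l) (hτ : 0 < τ) :
    Integrable (fun ω => Real.exp (-l * ‖S.X u ω - c‖ ^ 2 / τ)) S.P := by
  refine Integrable.mono' (integrable_const 1) ?_ (Filter.Eventually.of_forall fun ω => ?_)
  · have hm : Measurable fun z : Vec d => Real.exp (-l * ‖z‖ ^ 2 / τ) := by fun_prop
    exact (hm.comp (S.measurable_center u c)).aestronglyMeasurable
  · rw [Real.norm_of_nonneg (Real.exp_pos _).le]
    refine Real.exp_le_one_iff.2 ?_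
    rw [neg_mul, neg_div]
    exact neg_nonpos.2 (by positivity)

lemma integral_exp_eq_occ (S : Setup d T K α β) (u : ℝ) {l τ : ℝ} (hl : 0 < l) (hτ : 0 < τ) :
    ∫ ω, Real.exp (-l * ‖S.X u ω - S.θ u‖ ^ 2 / τ) ∂S.P = S.occ u (τ / (2 * l)) := by
  rw [occ]
  congr 1; ext ω; congr 1
  field_simp

/-- Perturbation estimate around the reference path, given a bound on the occupation. -/
theorem exists_perturb (d : ℕ) (T K α β : ℝ) (hT : 0 < T) (hK : 1 ≤ K) (k : ℝ) (hk : 0 ≤ k) (N : ℕ) :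
    ∃ M l : ℝ, 0 < M ∧ 0 < l ∧ l ≤ 1 ∧ ∀ S : Setup d T K α β, ∀ r ∈ Icc S.s S.t, ∀ δ, 0 < δ → δ ≤ 2 * T →
      ∀ C, CovBetween K δ C → ∀ c : Vec d, ‖c - S.θ r‖ ≤ k * √δ → ∀ L : List (Fin d), L.length ≤ N →
      ∀ G : ℝ → ℝ, ContinuousOn G (Icc S.s r) →
        (∀ u ∈ Ioc S.s r, S.occ u ((δ + r - u) / (2 * l)) ≤ G u) →
        |∫ ω, gaussD L C (S.X r ω - c) ∂S.P|
          ≤ M * (δ + (r - S.s)) ^ ((-(L.length : ℝ) - d) / 2) * Real.exp (-l * S.dist ^ 2 / (δ + (r - S.s)))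
            + ∫ u in S.s..r, M * (δ + r - u) ^ ((-(L.length : ℝ) - 1 - d) / 2) * G u := by
  obtain ⟨A, l, hA, hl, hl1, h⟩ := exists_kernel_bound d K hK k (N + 2)
  have hK0 : 0 < K := by linarith
  set B : ℝ := √(3 * T) with hB
  have hB0 : 0 ≤ B := Real.sqrt_nonneg _
  refine ⟨A * (1 + d * (K * (1 + B)) + d * (d * K)), l, by positivity, hl, hl1,
    fun S r hr δ hδ hδT C hC c hc L hL G hG hocc => ?_⟩
  set M := A * (1 + d * (K * (1 + B)) + d * (d * K)) with hM
  have hAM : A ≤ M := by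
    rw [hM]; nlinarith [show 0 ≤ d * (K * (1 + B)) + d * (d * K) by positivity]
  have hτ : ∀ u ∈ Icc S.s r, δ ≤ δ + r - u ∧ δ + r - u ≤ 3 * T := fun u hu =>
    ⟨by linarith [hu.2], by linarith [hu.1, S.hT, hr.2]⟩
  have hsq : ∀ u ∈ Icc S.s r, ∀ y : Vec d, y = c - S.θ r → ‖y‖ ≤ k * √(δ + r - u) := fun u hu y hy => by
    rw [hy]
    exact hc.trans (mul_le_mul_of_nonneg_left (Real.sqrt_le_sqrt (hτ u hu).1) hk)
  have hpath : IsPath (fun u => S.θ u + (c - S.θ r)) (fun u => S.θ' u + 0) S.s r :=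
    (S.path.mono hr.2).add (IsPath.const _ _ _)
  have hmain := S.abs_integral_gaussD_le hK hr hδ hC hpath L
    (G := fun u => M * (δ + r - u) ^ ((-(L.length : ℝ) - 1 - d) / 2) * G u) ?_ ?_
  · simp only [add_sub_cancel] at hmain
    refine hmain.trans (add_le_add ?_ le_rfl)
    have h0 := h _ _ (by linarith [hr.1]) (S.covBetween_cov hK hC hr ⟨le_rfl, hr.1⟩) L (by omega) 0 le_rfl
      (by norm_num) S.x (S.θ S.s + (c - S.θ r)) (S.θ S.s) (hsq _ ⟨le_rfl, hr.1⟩ _ (by abel))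
    rw [Real.rpow_zero, one_mul, zero_sub] at h0
    rw [← add_sub_assoc δ]
    refine h0.trans ?_
    rw [dist]
    have : 0 < δ + r - S.s := by linarith [hr.1]
    exact mul_le_mul_of_nonneg_right (mul_le_mul_of_nonneg_right hAM (by positivity)) (by positivity)
  · refine ContinuousOn.intervalIntegrable ?_
    rw [uIcc_of_le hr.1]
    refine ContinuousOn.mul (ContinuousOn.mul continuousOn_const ?_) hG
    refine ContinuousOn.rpow_const (by fun_prop) fun u hu => Or.inl ?_
    linarith [hu.2]
  · intro u hu
    have hu' : u ∈ Icc S.s r := ⟨hu.1.le, hu.2⟩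
    have hut : u ∈ Icc S.s S.t := ⟨hu.1.le, hu.2.trans hr.2⟩
    have hτ0 : 0 < δ + r - u := by linarith [hu.2]
    set τ := δ + r - u with hτd
    have hCu := S.covBetween_cov hK hC hr hu'
    have hw : ∀ ω, |genD 0 (S.b u (S.X u ω) - (S.θ' u + 0)) (S.a u (S.X u ω) - S.a u (S.θ u)) L
        (S.cov C r u) (S.X u ω - (S.θ u + (c - S.θ r)))|
        ≤ M * τ ^ ((-(L.length : ℝ) - 1 - d) / 2) * Real.exp (-l * ‖S.X u ω - S.θ u‖ ^ 2 / τ) := fun ω => by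
      set z := S.X u ω
      set R := ‖z - S.θ u‖ with hR
      set E := Real.exp (-l * R ^ 2 / τ) with hE
      have hcu : ‖(S.θ u + (c - S.θ r)) - S.θ u‖ ≤ k * √τ := hsq u hu' _ (by abel)
      have g0 : ∀ L' : List (Fin d), L'.length ≤ N + 2 → |gaussD L' (S.cov C r u) (z - (S.θ u + (c - S.θ r)))|
          ≤ A * τ ^ ((-(L'.length : ℝ) - d) / 2) * E := fun L' hL' => by
        have := h τ _ hτ0 hCu L' hL' 0 le_rfl (by norm_num) z _ _ hcu
        rwa [Real.rpow_zero, one_mul, zero_sub] at this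
      have g1 : ∀ L' : List (Fin d), L'.length ≤ N + 2 → R * |gaussD L' (S.cov C r u) (z - (S.θ u + (c - S.θ r)))|
          ≤ A * τ ^ ((1 - (L'.length : ℝ) - d) / 2) * E := fun L' hL' => by
        have := h τ _ hτ0 hCu L' hL' 1 (by norm_num) (by norm_num) z _ _ hcu
        rwa [Real.rpow_one] at this
      have hb := S.drift_path u hut z
      have ha := S.lip u hut z (S.θ u)
      refine (abs_genD_le (V := K * (1 + R)) (B := K * R) (fun i => ?_) (fun i j => ?_) L _ _).trans ?_
      · rw [add_zero, ← Real.norm_eq_abs]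
        exact (PiLp.norm_apply_le _ i).trans hb
      · exact ha i j
      set p := τ ^ ((-(L.length : ℝ) - 1 - d) / 2) with hp
      have hp0 : 0 < p := by positivity
      have hs1 : √τ ≤ B := Real.sqrt_le_sqrt (hτ u hu').2
      have t1 : ∀ i, K * (1 + R) * |gaussD (i :: L) (S.cov C r u) (z - (S.θ u + (c - S.θ r)))|
          ≤ K * (1 + B) * A * p * E := fun i => by
        have e0 := g0 (i :: L) (by simp; omega)
        have e1 := g1 (i :: L) (by simp; omega)
        have x0 : (-(((i :: L).length : ℕ) : ℝ) - d) / 2 = (-(L.length : ℝ) - 1 - d) / 2 := by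
          push_cast [List.length_cons]; ring
        have x1 : τ ^ ((1 - (((i :: L).length : ℕ) : ℝ) - d) / 2) = √τ * p := by
          rw [hp, Real.sqrt_eq_rpow, ← Real.rpow_add hτ0]; congr 1
          push_cast [List.length_cons]; ring
        rw [x0] at e0
        rw [x1] at e1
        calc _ = K * (|gaussD (i :: L) (S.cov C r u) (z - (S.θ u + (c - S.θ r)))|
              + R * |gaussD (i :: L) (S.cov C r u) (z - (S.θ u + (c - S.θ r)))|) := by ring
          _ ≤ K * (A * p * E + A * (B * p) * E) := by
              refine mul_le_mul_of_nonneg_left (add_le_add e0 (e1.trans ?_)) hK0.le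
              exact mul_le_mul_of_nonneg_right (mul_le_mul_of_nonneg_left
                (mul_le_mul_of_nonneg_right hs1 hp0.le) hA.le) (Real.exp_pos _).le
          _ = _ := by ring
      have t2 : ∀ i j, K * R * |gaussD (i :: j :: L) (S.cov C r u) (z - (S.θ u + (c - S.θ r)))|
          ≤ K * A * p * E := fun i j => by
        have e1 := g1 (i :: j :: L) (by simp; omega)
        have x1 : (1 - (((i :: j :: L).length : ℕ) : ℝ) - d) / 2 = (-(L.length : ℝ) - 1 - d) / 2 := by
          push_cast [List.length_cons]; ring
        rw [x1] at e1
        calc _ = K * (R * |gaussD (i :: j :: L) (S.cov C r u) (z - (S.θ u + (c - S.θ r)))|) := by ring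
          _ ≤ K * (A * p * E) := mul_le_mul_of_nonneg_left e1 hK0.le
          _ = _ := by ring
      refine (add_le_add (Finset.sum_le_sum fun i _ => t1 i)
        (Finset.sum_le_sum fun i _ => Finset.sum_le_sum fun j _ => t2 i j)).trans ?_
      simp only [Finset.sum_const, Finset.card_univ, Fintype.card_fin, nsmul_eq_mul]
      have hpE : 0 ≤ A * p * E := by positivity
      rw [hM]; nlinarith
    rw [← Real.norm_eq_abs]
    refine (norm_integral_le_of_norm_le
      ((S.integrable_occ u (S.θ u) hl.le hτ0).const_mul (M * τ ^ ((-(L.length : ℝ) - 1 - d) / 2)))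
      (Filter.Eventually.of_forall fun ω => hw ω)).trans ?_
    rw [integral_const_mul, S.integral_exp_eq_occ u hl hτ0]
    exact mul_le_mul_of_nonneg_left (hocc u hu) (by positivity)

end Setup

lemma integral_rpow_shift {s r δ p : ℝ} (hδ : 0 < δ) (hsr : s ≤ r) (hp : p ≠ -1) :
    ∫ u in s..r, (δ + r - u) ^ p = ((δ + (r - s)) ^ (p + 1) - δ ^ (p + 1)) / (p + 1) := by
  rw [intervalIntegral.integral_comp_sub_left (fun u => u ^ p), integral_rpow]
  · rw [add_sub_cancel_right, add_sub_assoc]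
  · refine Or.inr ⟨hp, ?_⟩
    rw [uIcc_of_le (by linarith)]
    intro h
    linarith [h.1]

lemma integral_rpow_shift_le_of_gt {s r δ p : ℝ} (hδ : 0 < δ) (hsr : s ≤ r) (hp : -1 < p) :
    ∫ u in s..r, (δ + r - u) ^ p ≤ (δ + (r - s)) ^ (p + 1) / (p + 1) := by
  rw [integral_rpow_shift hδ hsr hp.ne']
  refine div_le_div_of_nonneg_right ?_ (by linarith)
  have : 0 ≤ δ ^ (p + 1) := by positivity
  linarith

lemma integral_rpow_shift_le_of_lt {s r δ p : ℝ} (hδ : 0 < δ) (hsr : s ≤ r) (hp : p < -1) :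
    ∫ u in s..r, (δ + r - u) ^ p ≤ δ ^ (p + 1) / (-(p + 1)) := by
  rw [integral_rpow_shift hδ hsr hp.ne, div_neg, ← neg_div, ← neg_sub, neg_div, neg_div]
  have h : 0 ≤ -(p + 1) := by linarith
  have h2 : 0 < δ + (r - s) := by linarith
  have : 0 ≤ (δ + (r - s)) ^ (p + 1) / (-(p + 1)) := by positivity
  rw [div_neg] at this
  rw [sub_div]
  linarith

lemma continuousOn_rpow_shift {s r δ : ℝ} (hδ : 0 < δ) (p : ℝ) :
    ContinuousOn (fun u => (δ + r - u) ^ p) (Icc s r) :=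
  ContinuousOn.rpow_const (by fun_prop) fun u hu => Or.inl (by linarith [hu.2])

namespace Setup
variable {d : ℕ} {T K α β : ℝ}

lemma dist_nonneg (S : Setup d T K α β) : 0 ≤ S.dist := norm_nonneg _

lemma occ_le_integral_gaussD (S : Setup d T K α β) {r δ : ℝ} (hδ : 0 < δ) :
    S.occ r δ ≤ δ ^ ((d : ℝ) / 2) * |∫ ω, gaussD [] (scalCov d δ) (S.X r ω - S.θ r) ∂S.P| := by
  have e : ∫ ω, gaussD [] (scalCov d δ) (S.X r ω - S.θ r) ∂S.P = (2 * Real.pi / δ) ^ ((d : ℝ) / 2) * S.occ r δ := by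
    rw [occ, ← integral_const_mul]
    congr 1; ext ω
    rw [gaussD_nil_scalCov hδ]
  have h0 : 0 ≤ S.occ r δ := integral_nonneg fun ω => (Real.exp_pos _).le
  rw [e, abs_of_nonneg (by positivity), ← mul_assoc, ← Real.mul_rpow hδ.le (by positivity)]
  refine le_mul_of_one_le_left h0 (Real.one_le_rpow ?_ (by positivity))
  rw [mul_div_cancel₀ _ hδ.ne']
  linarith [Real.pi_gt_three]

/-- Intermediate upper bound with a defect of order `δ ^ (-q)`. -/
def OccBound (d : ℕ) (T K α β q : ℝ) : Prop :=
  ∃ M l : ℝ, 0 < M ∧ 0 < l ∧ ∀ S : Setup d T K α β, ∀ r ∈ Icc S.s S.t, ∀ δ, 0 < δ →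
    S.occ r δ ≤ M * (δ ^ ((d : ℝ) / 2) * ((δ + (r - S.s)) ^ (-(d : ℝ) / 2) + δ ^ (-q))) *
      Real.exp (-l * S.dist ^ 2 / (δ + (r - S.s)))

lemma exp_dist_mono {l l' D τ τ' : ℝ} (hl : 0 ≤ l) (hτ : 0 < τ) (h : l' * τ' ≤ l * τ) (hτ' : 0 < τ') :
    Real.exp (-l * D ^ 2 / τ') ≤ Real.exp (-l' * D ^ 2 / τ) := by
  refine Real.exp_le_exp.2 ?_
  rw [div_le_div_iff₀ hτ' hτ]
  nlinarith [sq_nonneg D]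

set_option maxHeartbeats 1000000 in
lemma occBound_step (hT : 0 < T) (hK : 1 ≤ K) {q : ℝ} (hq : 1 / 4 ≤ q) (h : OccBound d T K α β q) :
    OccBound d T K α β (q - 1 / 4) := by
  obtain ⟨M₀, l₀, hM₀, hl₀, h₀⟩ := exists_occ_le d T K α β hT hK
  obtain ⟨M₁, l₁, hM₁, hl₁, hl₁1, h₁⟩ := exists_perturb d T K α β hT hK 0 le_rfl 0
  obtain ⟨M, l, hM, hl, hocc⟩ := h
  set ρ : ℝ := 1 / (2 * l₁) with hρ
  have hρ0 : 0 < ρ := by positivity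
  have hρ2 : 1 / 2 ≤ ρ := by
    rw [hρ]; refine one_div_le_one_div_of_le (by positivity) (by linarith)
  set l₂ := l / (ρ + 1) with hl₂
  have hl₂0 : 0 < l₂ := by positivity
  set M₂ := M * ρ ^ ((d : ℝ) / 2) * (2 ^ ((d : ℝ) / 2) + 2 ^ q) with hM₂
  have hM₂0 : 0 < M₂ := by positivity
  set B := (3 * T) ^ (1 / 4 : ℝ) with hB
  have hB0 : 0 < B := by positivity
  set M₃ := M₁ + M₁ * M₂ * (B + 1) * (4 * B) + M₀ * 2 ^ ((d : ℝ) / 2) with hM₃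
  set l₃ := min l₀ (min l₁ l₂) with hl₃
  have hl₃0 : 0 < l₃ := by positivity
  have l30 : l₃ ≤ l₀ := min_le_left _ _
  have l31 : l₃ ≤ l₁ := (min_le_right _ _).trans (min_le_left _ _)
  have l32 : l₃ ≤ l₂ := (min_le_right _ _).trans (min_le_right _ _)
  refine ⟨M₃, l₃, by positivity, hl₃0, fun S r hr δ hδ => ?_⟩
  have hrs : 0 ≤ r - S.s := by linarith [hr.1]
  have hrT : r - S.s ≤ T := by linarith [hr.2, S.hT]
  set τs := δ + (r - S.s) with hτs
  have hτs0 : 0 < τs := by linarith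
  set E := Real.exp (-l₃ * S.dist ^ 2 / τs) with hE
  have hE0 : 0 < E := Real.exp_pos _
  have hmono : ∀ l', l₃ ≤ l' → Real.exp (-l' * S.dist ^ 2 / τs) ≤ E := fun l' hl' =>
    exp_dist_mono (hl₃0.le.trans hl') hτs0 (mul_le_mul_of_nonneg_right hl' hτs0.le) hτs0
  set W := τs ^ (-(d : ℝ) / 2) with hW
  have hW0 : 0 < W := by positivity
  set V := δ ^ (-(q - 1 / 4)) with hV
  have hV0 : 0 < V := by positivity
  have hδd : 0 < δ ^ ((d : ℝ) / 2) := by positivity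
  rcases le_or_gt δ T with hδT | hδT
  swap
  · refine (h₀ S r hr δ hδ).trans ?_
    have h1 : 1 ≤ 2 ^ ((d : ℝ) / 2) * (δ ^ ((d : ℝ) / 2) * W) := by
      rw [hW, neg_div, Real.rpow_neg hτs0.le, ← div_eq_mul_inv, ← Real.div_rpow hδ.le hτs0.le,
        ← Real.mul_rpow (by norm_num) (by positivity)]
      refine Real.one_le_rpow ?_ (by positivity)
      rw [← mul_div_assoc, one_le_div hτs0]; linarith
    calc M₀ * Real.exp (-l₀ * S.dist ^ 2 / τs) ≤ M₀ * E := mul_le_mul_of_nonneg_left (hmono _ l30) hM₀.le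
      _ ≤ M₀ * E * (2 ^ ((d : ℝ) / 2) * (δ ^ ((d : ℝ) / 2) * W)) := le_mul_of_one_le_right (by positivity) h1
      _ = M₀ * 2 ^ ((d : ℝ) / 2) * (δ ^ ((d : ℝ) / 2) * W) * E := by ring
      _ ≤ M₃ * (δ ^ ((d : ℝ) / 2) * (W + V)) * E := by
        refine mul_le_mul_of_nonneg_right (mul_le_mul ?_ ?_ (by positivity) (by positivity)) hE0.le
        · rw [hM₃]; have : 0 ≤ M₁ + M₁ * M₂ * (B + 1) * (4 * B) := by positivity
          linarith
        · exact mul_le_mul_of_nonneg_left (by linarith) hδd.le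
  have hG := h₁ S r hr δ hδ (by linarith) _ (covBetween_scalCov hK hδ) (S.θ r) (by simp) [] (by simp)
    (fun u => M₂ * (δ + r - u) ^ ((d : ℝ) / 2) * (W + (δ + r - u) ^ (-q)) * E) ?_ ?_
  · refine (S.occ_le_integral_gaussD hδ).trans ?_
    have e1 : (-(([] : List (Fin d)).length : ℝ) - d) / 2 = -(d : ℝ) / 2 := by simp
    have e2 : (-(([] : List (Fin d)).length : ℝ) - 1 - d) / 2 = -1 / 2 + -((d : ℝ) / 2) := by simp; ring
    rw [e1, e2] at hG
    have hI : ∫ u in S.s..r, M₁ * (δ + r - u) ^ (-1 / 2 + -((d : ℝ) / 2)) *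
        (M₂ * (δ + r - u) ^ ((d : ℝ) / 2) * (W + (δ + r - u) ^ (-q)) * E)
        ≤ M₁ * M₂ * (B + 1) * (W + V) * E * (4 * B) := by
      have hc : ∀ p : ℝ, IntervalIntegrable (fun u => (δ + r - u) ^ p) volume S.s r := fun p =>
        ContinuousOn.intervalIntegrable (by rw [uIcc_of_le hr.1]; exact continuousOn_rpow_shift hδ p)
      refine (intervalIntegral.integral_mono_on (g := fun u => M₁ * M₂ * (B + 1) * (W + V) * E *
        (δ + r - u) ^ (-3 / 4 : ℝ)) hr.1 ?_ ((hc _).const_mul _) fun u hu => ?_).trans ?_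
      · refine ContinuousOn.intervalIntegrable ?_
        rw [uIcc_of_le hr.1]
        have k1 := continuousOn_rpow_shift (s := S.s) (r := r) hδ (-1 / 2 + -((d : ℝ) / 2))
        have k2 := continuousOn_rpow_shift (s := S.s) (r := r) hδ ((d : ℝ) / 2)
        have k3 := continuousOn_rpow_shift (s := S.s) (r := r) hδ (-q)
        fun_prop
      · have hτ0 : 0 < δ + r - u := by linarith [hu.2]
        have hτδ : δ ≤ δ + r - u := by linarith [hu.2]
        have hτT : δ + r - u ≤ 3 * T := by linarith [hu.1]
        set τ := δ + r - u
        have f1 : τ ^ (-1 / 2 + -((d : ℝ) / 2)) * τ ^ ((d : ℝ) / 2) = τ ^ (-3 / 4 : ℝ) * τ ^ (1 / 4 : ℝ) := by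
          rw [← Real.rpow_add hτ0, ← Real.rpow_add hτ0]; congr 1; ring
        have f2 : τ ^ (1 / 4 : ℝ) ≤ B := Real.rpow_le_rpow hτ0.le hτT (by norm_num)
        have f3 : τ ^ (1 / 4 : ℝ) * τ ^ (-q) ≤ V := by
          rw [← Real.rpow_add hτ0, hV, show 1 / 4 + -q = -(q - 1 / 4) by ring]
          exact Real.rpow_le_rpow_of_nonpos hδ hτδ (by linarith)
        have f4 : 0 < τ ^ (-3 / 4 : ℝ) := by positivity
        calc _ = M₁ * M₂ * E * (τ ^ (-1 / 2 + -((d : ℝ) / 2)) * τ ^ ((d : ℝ) / 2)) * (W + τ ^ (-q)) := by ring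
          _ = M₁ * M₂ * E * τ ^ (-3 / 4 : ℝ) * (τ ^ (1 / 4 : ℝ) * W + τ ^ (1 / 4 : ℝ) * τ ^ (-q)) := by
              rw [f1]; ring
          _ ≤ M₁ * M₂ * E * τ ^ (-3 / 4 : ℝ) * ((B + 1) * (W + V)) := by
              refine mul_le_mul_of_nonneg_left ?_ (by positivity)
              have := mul_le_mul_of_nonneg_right f2 hW0.le
              nlinarith [mul_pos hB0 hV0]
          _ = _ := by ring
      · rw [intervalIntegral.integral_const_mul]
        refine mul_le_mul_of_nonneg_left ?_ (by positivity)
        refine (integral_rpow_shift_le_of_gt hδ hr.1 (by norm_num)).trans ?_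
        norm_num
        have : (δ + (r - S.s)) ^ (1 / 4 : ℝ) ≤ B := Real.rpow_le_rpow hτs0.le (by linarith) (by norm_num)
        linarith
    calc _ ≤ δ ^ ((d : ℝ) / 2) * (M₁ * W * E + M₁ * M₂ * (B + 1) * (W + V) * E * (4 * B)) := by
          refine mul_le_mul_of_nonneg_left (hG.trans (add_le_add ?_ hI)) hδd.le
          exact mul_le_mul_of_nonneg_left (hmono _ l31) (by positivity)
      _ ≤ δ ^ ((d : ℝ) / 2) * (M₃ * (W + V) * E) := by
          refine mul_le_mul_of_nonneg_left ?_ hδd.le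
          rw [hM₃]
          have x1 : 0 ≤ M₁ * V * E := by positivity
          have x2 : 0 ≤ M₀ * 2 ^ ((d : ℝ) / 2) * (W + V) * E := by positivity
          nlinarith
      _ = _ := by ring
  · have k2 := continuousOn_rpow_shift (s := S.s) (r := r) hδ ((d : ℝ) / 2)
    have k3 := continuousOn_rpow_shift (s := S.s) (r := r) hδ (-q)
    fun_prop
  · intro u hu
    have hτ0 : 0 < δ + r - u := by linarith [hu.2]
    have hus : 0 < u - S.s := by linarith [hu.1]
    have e : (δ + r - u) / (2 * l₁) = ρ * (δ + r - u) := by rw [hρ]; ring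
    set τ := δ + r - u with hτ
    have hsum : τ + (u - S.s) = τs := by rw [hτ, hτs]; ring
    rw [e]
    refine (hocc S u ⟨hu.1.le, hu.2.trans hr.2⟩ (ρ * τ) (by positivity)).trans ?_
    have g1 : (ρ * τ + (u - S.s)) ^ (-(d : ℝ) / 2) ≤ 2 ^ ((d : ℝ) / 2) * W := by
      have : (ρ * τ + (u - S.s)) ^ (-(d : ℝ) / 2) ≤ (τs / 2) ^ (-(d : ℝ) / 2) := by
        refine Real.rpow_le_rpow_of_nonpos (by positivity) ?_ ?_
        · rw [← hsum]; nlinarith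
        · rw [neg_div]; exact neg_nonpos.2 (by positivity)
      refine this.trans (le_of_eq ?_)
      rw [hW, Real.div_rpow hτs0.le (by norm_num), neg_div, Real.rpow_neg (by norm_num : (0:ℝ) ≤ 2)]
      field_simp
    have g2 : (ρ * τ) ^ (-q) ≤ 2 ^ q * τ ^ (-q) := by
      rw [Real.mul_rpow hρ0.le hτ0.le]
      refine mul_le_mul_of_nonneg_right ?_ (by positivity)
      refine (Real.rpow_le_rpow_of_nonpos (by norm_num) hρ2 (by linarith)).trans (le_of_eq ?_)
      rw [one_div, Real.inv_rpow (by norm_num), Real.rpow_neg (by norm_num), inv_inv]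
    have g3 : Real.exp (-l * S.dist ^ 2 / (ρ * τ + (u - S.s))) ≤ E := by
      refine exp_dist_mono hl.le hτs0 ?_ (by positivity)
      have : l₃ * (ρ + 1) ≤ l := by
        have := mul_le_mul_of_nonneg_right l32 (by positivity : 0 ≤ ρ + 1)
        rwa [hl₂, div_mul_cancel₀ _ (by positivity)] at this
      have h2 : ρ * τ + (u - S.s) ≤ (ρ + 1) * τs := by rw [← hsum]; nlinarith
      calc l₃ * (ρ * τ + (u - S.s)) ≤ l₃ * ((ρ + 1) * τs) := mul_le_mul_of_nonneg_left h2 hl₃0.le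
        _ = l₃ * (ρ + 1) * τs := by ring
        _ ≤ _ := mul_le_mul_of_nonneg_right this hτs0.le
    rw [Real.mul_rpow hρ0.le hτ0.le]
    have g4 : 0 < τ ^ (-q) := by positivity
    calc _ ≤ M * (ρ ^ ((d : ℝ) / 2) * τ ^ ((d : ℝ) / 2) * (2 ^ ((d : ℝ) / 2) * W + 2 ^ q * τ ^ (-q))) * E := by
          refine mul_le_mul ?_ g3 (Real.exp_pos _).le (by positivity)
          exact mul_le_mul_of_nonneg_left (mul_le_mul_of_nonneg_left (add_le_add g1 g2) (by positivity)) hM.le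
      _ ≤ M * (ρ ^ ((d : ℝ) / 2) * τ ^ ((d : ℝ) / 2) * ((2 ^ ((d : ℝ) / 2) + 2 ^ q) * (W + τ ^ (-q)))) * E := by
          refine mul_le_mul_of_nonneg_right (mul_le_mul_of_nonneg_left (mul_le_mul_of_nonneg_left ?_ (by positivity)) hM.le) hE0.le
          have y1 : 0 < (2:ℝ) ^ ((d : ℝ) / 2) * τ ^ (-q) := by positivity
          have y2 : 0 < (2:ℝ) ^ q * W := by positivity
          rw [add_mul, mul_add, mul_add]
          linarith
      _ = _ := by rw [hM₂]; ring

/-- Gaussian upper bound for the smoothed transition density along the reference path. -/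
theorem exists_occ_upper (d : ℕ) (T K α β : ℝ) (hT : 0 < T) (hK : 1 ≤ K) :
    ∃ M l : ℝ, 0 < M ∧ 0 < l ∧ ∀ S : Setup d T K α β, ∀ r ∈ Icc S.s S.t, ∀ δ, 0 < δ →
      S.occ r δ ≤ M * (δ ^ ((d : ℝ) / 2) * (δ + (r - S.s)) ^ (-(d : ℝ) / 2)) *
        Real.exp (-l * S.dist ^ 2 / (δ + (r - S.s))) := by
  obtain ⟨M₀, l₀, hM₀, hl₀, h₀⟩ := exists_occ_le d T K α β hT hK
  have h : ∀ j : ℕ, j ≤ 2 * d → OccBound d T K α β ((d : ℝ) / 2 - j / 4) := by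
    intro j
    induction j with
    | zero =>
      intro _
      refine ⟨M₀, l₀, hM₀, hl₀, fun S r hr δ hδ => (h₀ S r hr δ hδ).trans ?_⟩
      have hp : 0 < δ + (r - S.s) := by linarith [hr.1]
      refine mul_le_mul_of_nonneg_right (le_mul_of_one_le_right hM₀.le ?_) (Real.exp_pos _).le
      have e : δ ^ ((d : ℝ) / 2) * δ ^ (-((d : ℝ) / 2 - (0 : ℕ) / 4)) = 1 := by
        rw [← Real.rpow_add hδ]; simp
      rw [mul_add, e]
      have : 0 ≤ δ ^ ((d : ℝ) / 2) * (δ + (r - S.s)) ^ (-(d : ℝ) / 2) := by positivity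
      linarith
    | succ j ih =>
      intro hj
      have hj' : (j : ℝ) + 1 ≤ 2 * d := by exact_mod_cast hj
      have := occBound_step hT hK (by linarith) (ih (by omega))
      convert this using 1
      push_cast; ring
  obtain ⟨M, l, hM, hl, h⟩ := h (2 * d) le_rfl
  refine ⟨M * (1 + (2 * T) ^ ((d : ℝ) / 2)) + M₀ * 2 ^ ((d : ℝ) / 2), min l l₀, by positivity, by positivity,
    fun S r hr δ hδ => ?_⟩
  have hp : 0 < δ + (r - S.s) := by linarith [hr.1]
  have hmono : ∀ l', min l l₀ ≤ l' → Real.exp (-l' * S.dist ^ 2 / (δ + (r - S.s)))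
      ≤ Real.exp (-(min l l₀) * S.dist ^ 2 / (δ + (r - S.s))) := fun l' hl' =>
    exp_dist_mono ((lt_min hl hl₀).le.trans hl') hp (mul_le_mul_of_nonneg_right hl' hp.le) hp
  have hw : 0 < δ ^ ((d : ℝ) / 2) * (δ + (r - S.s)) ^ (-(d : ℝ) / 2) := by positivity
  rcases le_or_gt δ T with hδT | hδT
  · refine (h S r hr δ hδ).trans (mul_le_mul ?_ (hmono _ (min_le_left _ _)) (Real.exp_pos _).le (by positivity))
    have e : δ ^ (-((d : ℝ) / 2 - ((2 * d : ℕ) : ℝ) / 4)) = 1 := by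
      push_cast; rw [show -((d : ℝ) / 2 - 2 * d / 4) = 0 by ring, Real.rpow_zero]
    rw [e]
    have h1 : 1 ≤ (2 * T) ^ ((d : ℝ) / 2) * (δ + (r - S.s)) ^ (-(d : ℝ) / 2) := by
      rw [neg_div, Real.rpow_neg hp.le, ← div_eq_mul_inv, ← Real.div_rpow (by positivity) hp.le]
      refine Real.one_le_rpow ?_ (by positivity)
      rw [one_le_div hp]; linarith [hr.2, S.hT]
    calc M * (δ ^ ((d : ℝ) / 2) * ((δ + (r - S.s)) ^ (-(d : ℝ) / 2) + 1))
        ≤ M * (δ ^ ((d : ℝ) / 2) * ((δ + (r - S.s)) ^ (-(d : ℝ) / 2)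
          + (2 * T) ^ ((d : ℝ) / 2) * (δ + (r - S.s)) ^ (-(d : ℝ) / 2))) :=
          mul_le_mul_of_nonneg_left (mul_le_mul_of_nonneg_left (add_le_add le_rfl h1) (by positivity)) hM.le
      _ = M * (1 + (2 * T) ^ ((d : ℝ) / 2)) * (δ ^ ((d : ℝ) / 2) * (δ + (r - S.s)) ^ (-(d : ℝ) / 2)) := by ring
      _ ≤ _ := mul_le_mul_of_nonneg_right (le_add_of_nonneg_right (by positivity)) hw.le
  · refine (h₀ S r hr δ hδ).trans (mul_le_mul ?_ (hmono _ (min_le_right _ _)) (Real.exp_pos _).le (by positivity))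
    have h1 : 1 ≤ 2 ^ ((d : ℝ) / 2) * (δ ^ ((d : ℝ) / 2) * (δ + (r - S.s)) ^ (-(d : ℝ) / 2)) := by
      rw [neg_div, Real.rpow_neg hp.le, ← div_eq_mul_inv, ← Real.div_rpow hδ.le hp.le,
        ← Real.mul_rpow (by norm_num) (by positivity)]
      refine Real.one_le_rpow ?_ (by positivity)
      rw [← mul_div_assoc, one_le_div hp]; linarith [hr.2, S.hT]
    calc M₀ ≤ M₀ * (2 ^ ((d : ℝ) / 2) * (δ ^ ((d : ℝ) / 2) * (δ + (r - S.s)) ^ (-(d : ℝ) / 2))) :=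
          le_mul_of_one_le_right hM₀.le h1
      _ = M₀ * 2 ^ ((d : ℝ) / 2) * (δ ^ ((d : ℝ) / 2) * (δ + (r - S.s)) ^ (-(d : ℝ) / 2)) := by ring
      _ ≤ _ := mul_le_mul_of_nonneg_right (le_add_of_nonneg_left (by positivity)) hw.le

end Setup

namespace Setup
variable {d : ℕ} {T K α β : ℝ}

/-- Heat kernel at the distance of the starting point from the reference path. -/
def heat (S : Setup d T K α β) (l τ : ℝ) : ℝ := τ ^ (-(d : ℝ) / 2) * Real.exp (-l * S.dist ^ 2 / τ)

lemma heat_pos (S : Setup d T K α β) (l : ℝ) {τ : ℝ} (hτ : 0 < τ) : 0 < S.heat l τ := by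
  unfold heat; positivity

lemma heat_anti (S : Setup d T K α β) {l l' τ : ℝ} (h : l' ≤ l) (hτ : 0 < τ) : S.heat l τ ≤ S.heat l' τ := by
  refine mul_le_mul_of_nonneg_left (Real.exp_le_exp.2 (div_le_div_of_nonneg_right ?_ hτ.le)) (by positivity)
  nlinarith [sq_nonneg S.dist]

lemma exists_occ_scaled (d : ℕ) (T K α β : ℝ) (hT : 0 < T) (hK : 1 ≤ K) (ρ : ℝ) (hρ : 1 / 2 ≤ ρ) :
    ∃ M l : ℝ, 0 < M ∧ 0 < l ∧ ∀ S : Setup d T K α β, ∀ r ∈ Icc S.s S.t, ∀ δ, 0 < δ →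
      S.occ r (ρ * δ) ≤ M * δ ^ ((d : ℝ) / 2) * S.heat l (δ + (r - S.s)) := by
  obtain ⟨M, l, hM, hl, h⟩ := exists_occ_upper d T K α β hT hK
  have hρ0 : 0 < ρ := by linarith
  refine ⟨M * ρ ^ ((d : ℝ) / 2) * 2 ^ ((d : ℝ) / 2), l / (ρ + 1), by positivity, by positivity,
    fun S r hr δ hδ => ?_⟩
  refine (h S r hr (ρ * δ) (by positivity)).trans ?_
  have hrs : 0 ≤ r - S.s := by linarith [hr.1]
  have hτ : 0 < δ + (r - S.s) := by linarith
  have g1 : (ρ * δ + (r - S.s)) ^ (-(d : ℝ) / 2) ≤ 2 ^ ((d : ℝ) / 2) * (δ + (r - S.s)) ^ (-(d : ℝ) / 2) := by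
    have : (ρ * δ + (r - S.s)) ^ (-(d : ℝ) / 2) ≤ ((δ + (r - S.s)) / 2) ^ (-(d : ℝ) / 2) := by
      refine Real.rpow_le_rpow_of_nonpos (by positivity) ?_ ?_
      · nlinarith
      · rw [neg_div]; exact neg_nonpos.2 (by positivity)
    refine this.trans (le_of_eq ?_)
    rw [Real.div_rpow hτ.le (by norm_num), neg_div, Real.rpow_neg (by norm_num : (0:ℝ) ≤ 2)]
    field_simp
  have g3 : Real.exp (-l * S.dist ^ 2 / (ρ * δ + (r - S.s)))
      ≤ Real.exp (-(l / (ρ + 1)) * S.dist ^ 2 / (δ + (r - S.s))) := by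
    refine exp_dist_mono hl.le hτ ?_ (by positivity)
    rw [div_mul_eq_mul_div, div_le_iff₀ (by positivity), mul_assoc]
    refine mul_le_mul_of_nonneg_left ?_ hl.le
    nlinarith [mul_nonneg hρ0.le hrs]
  rw [Real.mul_rpow hρ0.le hδ.le, heat]
  calc _ ≤ M * (ρ ^ ((d : ℝ) / 2) * δ ^ ((d : ℝ) / 2) * (2 ^ ((d : ℝ) / 2) * (δ + (r - S.s)) ^ (-(d : ℝ) / 2)))
        * Real.exp (-(l / (ρ + 1)) * S.dist ^ 2 / (δ + (r - S.s))) := by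
        refine mul_le_mul ?_ g3 (Real.exp_pos _).le (by positivity)
        exact mul_le_mul_of_nonneg_left (mul_le_mul_of_nonneg_left g1 (by positivity)) hM.le
    _ = _ := by ring

/-- Weighted absolute moments of derivatives of Gaussians. -/
theorem exists_abs_moment (d : ℕ) (T K α β : ℝ) (hT : 0 < T) (hK : 1 ≤ K) (k : ℝ) (N : ℕ) :
    ∃ M l : ℝ, 0 < M ∧ 0 < l ∧ ∀ S : Setup d T K α β, ∀ r ∈ Icc S.s S.t, ∀ δ, 0 < δ →
      ∀ C, CovBetween K δ C → ∀ c : Vec d, ‖c - S.θ r‖ ≤ k * √δ → ∀ L : List (Fin d), L.length ≤ N →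
      ∀ γ ∈ Icc (0:ℝ) 4, ∀ γ' ∈ Icc (0:ℝ) 4, ∀ A, 0 ≤ A → ∀ f : S.Ω → ℝ, Measurable f →
      (∀ ω, |f ω| ≤ A * (‖S.X r ω - S.θ r‖ ^ γ + ‖S.X r ω - S.θ r‖ ^ γ') * |gaussD L C (S.X r ω - c)|) →
      Integrable f S.P ∧ |∫ ω, f ω ∂S.P|
        ≤ A * M * (δ ^ ((γ - L.length) / 2) + δ ^ ((γ' - L.length) / 2)) * S.heat l (δ + (r - S.s)) := by
  obtain ⟨B, l, hB, hl, hl1, h⟩ := exists_kernel_bound d K hK k N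
  obtain ⟨M, l', hM, hl', h'⟩ := exists_occ_scaled d T K α β hT hK (1 / (2 * l))
    (one_div_le_one_div_of_le (by positivity) (by linarith))
  refine ⟨B * M, l', by positivity, hl', fun S r hr δ hδ C hC c hc L hL γ hγ γ' hγ' A hA f hf hle => ?_⟩
  have hint := (S.integrable_occ r (S.θ r) hl.le hδ).const_mul
    (A * B * (δ ^ ((γ - L.length - d) / 2) + δ ^ ((γ' - L.length - d) / 2)))
  have hfle : ∀ ω, ‖f ω‖ ≤ A * B * (δ ^ ((γ - L.length - d) / 2) + δ ^ ((γ' - L.length - d) / 2)) *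
      Real.exp (-l * ‖S.X r ω - S.θ r‖ ^ 2 / δ) := fun ω => by
    have e1 := h δ C hδ hC L hL γ hγ.1 hγ.2 (S.X r ω) c (S.θ r) hc
    have e2 := h δ C hδ hC L hL γ' hγ'.1 hγ'.2 (S.X r ω) c (S.θ r) hc
    refine (hle ω).trans ?_
    rw [mul_assoc, add_mul]
    refine (mul_le_mul_of_nonneg_left (add_le_add e1 e2) hA).trans (le_of_eq ?_)
    ring
  refine ⟨hint.mono' hf.aestronglyMeasurable (Filter.Eventually.of_forall hfle), ?_⟩
  rw [← Real.norm_eq_abs]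
  refine (norm_integral_le_of_norm_le hint (Filter.Eventually.of_forall hfle)).trans ?_
  rw [integral_const_mul, S.integral_exp_eq_occ r hl hδ, show δ / (2 * l) = 1 / (2 * l) * δ by ring]
  refine (mul_le_mul_of_nonneg_left (h' S r hr δ hδ) (by positivity)).trans (le_of_eq ?_)
  have e : ∀ γ : ℝ, δ ^ ((γ - L.length - d) / 2) * δ ^ ((d : ℝ) / 2) = δ ^ ((γ - L.length) / 2) := fun γ => by
    rw [← Real.rpow_add hδ]; congr 1; ring
  rw [← e γ, ← e γ']
  ring

/-- Signed moments of derivatives of Gaussians of order at least two. -/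
theorem exists_signed_moment (d : ℕ) (T K α β : ℝ) (hT : 0 < T) (hK : 1 ≤ K) (k : ℝ) (hk : 0 ≤ k) (N : ℕ) :
    ∃ M l : ℝ, 0 < M ∧ 0 < l ∧ ∀ S : Setup d T K α β, ∀ r ∈ Icc S.s S.t, ∀ δ, 0 < δ → δ ≤ 2 * T →
      ∀ C, CovBetween K δ C → ∀ c : Vec d, ‖c - S.θ r‖ ≤ k * √δ → ∀ L : List (Fin d), L.length ≤ N →
      2 ≤ L.length →
      |∫ ω, gaussD L C (S.X r ω - c) ∂S.P|
        ≤ M * (δ ^ ((1 - (L.length : ℝ)) / 2) * (δ + (r - S.s)) ^ (-(1:ℝ) / 2)) * S.heat l (δ + (r - S.s)) := by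
  obtain ⟨M₁, l₁, hM₁, hl₁, hl₁1, h₁⟩ := exists_perturb d T K α β hT hK k hk N
  obtain ⟨M₂, l₂, hM₂, hl₂, h₂⟩ := exists_occ_scaled d T K α β hT hK (1 / (2 * l₁))
    (one_div_le_one_div_of_le (by positivity) (by linarith))
  set B := (3 * T) ^ ((1:ℝ) / 2) with hB
  have hB0 : 0 < B := by positivity
  refine ⟨M₁ + M₁ * M₂ * 2 * B, min l₁ l₂, by positivity, by positivity,
    fun S r hr δ hδ hδT C hC c hc L hL hL2 => ?_⟩
  have hrs : 0 ≤ r - S.s := by linarith [hr.1]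
  have hrT : r - S.s ≤ T := by linarith [hr.2, S.hT]
  set τs := δ + (r - S.s) with hτs
  have hτs0 : 0 < τs := by linarith
  set l := min l₁ l₂ with hl
  set H := S.heat l τs with hH
  have hH0 : 0 < H := S.heat_pos _ hτs0
  have hL2' : (2:ℝ) ≤ L.length := by exact_mod_cast hL2
  set n : ℝ := (L.length : ℝ) with hn
  have hc1 : ∀ p : ℝ, IntervalIntegrable (fun u => (δ + r - u) ^ p) volume S.s r := fun p =>
    ContinuousOn.intervalIntegrable (by rw [uIcc_of_le hr.1]; exact continuousOn_rpow_shift hδ p)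
  have hmain := h₁ S r hr δ hδ hδT C hC c hc L hL (fun u => M₂ * (δ + r - u) ^ ((d : ℝ) / 2) * H) ?_ ?_
  · refine hmain.trans ?_
    have a1 : M₁ * τs ^ ((-n - d) / 2) * Real.exp (-l₁ * S.dist ^ 2 / τs)
        ≤ M₁ * (δ ^ ((1 - n) / 2) * τs ^ (-(1:ℝ) / 2)) * H := by
      have e : τs ^ ((-n - d) / 2) * Real.exp (-l₁ * S.dist ^ 2 / τs)
          = (τs ^ ((1 - n) / 2) * τs ^ (-(1:ℝ) / 2)) * S.heat l₁ τs := by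
        rw [heat, ← mul_assoc, ← Real.rpow_add hτs0, ← Real.rpow_add hτs0]; congr 2; ring
      rw [mul_assoc, e]
      refine (mul_le_mul_of_nonneg_left (mul_le_mul ?_ (S.heat_anti (min_le_left _ _) hτs0)
        (S.heat_pos _ hτs0).le (by positivity)) hM₁.le).trans (le_of_eq (mul_assoc _ _ _).symm)
      refine mul_le_mul_of_nonneg_right (Real.rpow_le_rpow_of_nonpos hδ (by linarith) (by linarith)) (by positivity)
    have a2 : ∫ u in S.s..r, M₁ * (δ + r - u) ^ ((-n - 1 - d) / 2) * (M₂ * (δ + r - u) ^ ((d : ℝ) / 2) * H)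
        ≤ M₁ * M₂ * 2 * B * (δ ^ ((1 - n) / 2) * τs ^ (-(1:ℝ) / 2)) * H := by
      have e : ∫ u in S.s..r, M₁ * (δ + r - u) ^ ((-n - 1 - d) / 2) * (M₂ * (δ + r - u) ^ ((d : ℝ) / 2) * H)
          = M₁ * M₂ * H * ∫ u in S.s..r, (δ + r - u) ^ ((-n - 1) / 2) := by
        rw [← intervalIntegral.integral_const_mul]
        refine intervalIntegral.integral_congr fun u hu => ?_
        rw [uIcc_of_le hr.1] at hu
        have : 0 < δ + r - u := by linarith [hu.2]
        show _ = M₁ * M₂ * H * (δ + r - u) ^ ((-n - 1) / 2)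
        rw [show (-n - 1) / 2 = (-n - 1 - d) / 2 + (d : ℝ) / 2 by ring, Real.rpow_add this]
        ring
      rw [e]
      have i1 := integral_rpow_shift_le_of_lt (p := (-n - 1) / 2) hδ hr.1 (by linarith)
      have i2 : δ ^ ((-n - 1) / 2 + 1) / (-((-n - 1) / 2 + 1)) ≤ 2 * δ ^ ((1 - n) / 2) := by
        rw [show (-n - 1) / 2 + 1 = (1 - n) / 2 by ring, div_le_iff₀ (by linarith)]
        have : 0 < δ ^ ((1 - n) / 2) := by positivity
        nlinarith
      have i3 : 1 ≤ B * τs ^ (-(1:ℝ) / 2) := by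
        rw [neg_div, Real.rpow_neg hτs0.le, ← div_eq_mul_inv, hB, ← Real.div_rpow (by positivity) hτs0.le]
        refine Real.one_le_rpow ?_ (by norm_num)
        rw [one_le_div hτs0]; linarith
      calc _ ≤ M₁ * M₂ * H * (2 * δ ^ ((1 - n) / 2)) :=
            mul_le_mul_of_nonneg_left (i1.trans i2) (by positivity)
        _ ≤ M₁ * M₂ * H * (2 * δ ^ ((1 - n) / 2)) * (B * τs ^ (-(1:ℝ) / 2)) :=
            le_mul_of_one_le_right (by positivity) i3
        _ = _ := by ring
    refine (add_le_add a1 a2).trans (le_of_eq ?_)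
    ring
  · have k2 := continuousOn_rpow_shift (s := S.s) (r := r) hδ ((d : ℝ) / 2)
    fun_prop
  · intro u hu
    have hτ0 : 0 < δ + r - u := by linarith [hu.2]
    rw [show (δ + r - u) / (2 * l₁) = 1 / (2 * l₁) * (δ + r - u) by ring]
    refine (h₂ S u ⟨hu.1.le, hu.2.trans hr.2⟩ _ hτ0).trans ?_
    refine mul_le_mul_of_nonneg_left ?_ (by positivity)
    rw [show δ + r - u + (u - S.s) = τs by rw [hτs]; ring]
    exact S.heat_anti (min_le_right _ _) hτs0

lemma abs_integral_list_sum_le {ι Ω : Type*} [MeasurableSpace Ω] {P : Measure Ω} {F : ι → Ω → ℝ} {B : ℝ} (l : List ι)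
    (hF : ∀ i ∈ l, Integrable (F i) P) (hB : ∀ i ∈ l, |∫ ω, F i ω ∂P| ≤ B) :
    Integrable (fun ω => (l.map fun i => F i ω).sum) P ∧
      |∫ ω, (l.map fun i => F i ω).sum ∂P| ≤ l.length * B := by
  induction l with
  | nil => simp
  | cons i l ih =>
    obtain ⟨h1, h2⟩ := ih (fun j hj => hF j (by simp [hj])) (fun j hj => hB j (by simp [hj]))
    simp only [List.map_cons, List.sum_cons, List.length_cons]
    refine ⟨(hF i (by simp)).add h1, ?_⟩
    rw [integral_add (hF i (by simp)) h1]
    refine (abs_add_le _ _).trans ?_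
    have := hB i (by simp)
    push_cast
    linarith

/-- Signed moments carrying one coordinate factor. -/
theorem exists_coord_moment (d : ℕ) (T K α β : ℝ) (hT : 0 < T) (hK : 1 ≤ K) (k : ℝ) (hk : 0 ≤ k) (N : ℕ) :
    ∃ M l : ℝ, 0 < M ∧ 0 < l ∧ ∀ S : Setup d T K α β, ∀ r ∈ Icc S.s S.t, ∀ δ, 0 < δ → δ ≤ 2 * T →
      ∀ C, CovBetween K δ C → ∀ c : Vec d, ‖c - S.θ r‖ ≤ k * √δ → ∀ L : List (Fin d), L.length ≤ N →
      3 ≤ L.length → ∀ i,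
      Integrable (fun ω => (S.X r ω - c) i * gaussD L C (S.X r ω - c)) S.P ∧
      |∫ ω, (S.X r ω - c) i * gaussD L C (S.X r ω - c) ∂S.P|
        ≤ M * (δ ^ ((2 - (L.length : ℝ)) / 2) * (δ + (r - S.s)) ^ (-(1:ℝ) / 2)) * S.heat l (δ + (r - S.s)) := by
  obtain ⟨M, l, hM, hl, h⟩ := exists_signed_moment d T K α β hT hK k hk (N + 1)
  have hK0 : 0 < K := by linarith
  refine ⟨d * K * M + N * M + 1, l, by positivity, hl, fun S r hr δ hδ hδT C hC c hc L hL hL3 i => ?_⟩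
  have hτs0 : 0 < δ + (r - S.s) := by linarith [hr.1]
  set τs := δ + (r - S.s)
  set H := S.heat l τs with hH
  have hH0 : 0 < H := S.heat_pos _ hτs0
  have hi : ∀ L' : List (Fin d), Integrable (fun ω => gaussD L' C (S.X r ω - c)) S.P := fun L' =>
    integrable_gaussD_comp hK hδ hC (S.measurable_center r c) L'
  set n : ℝ := (L.length : ℝ) with hn
  set Q := δ ^ ((2 - n) / 2) * τs ^ (-(1:ℝ) / 2) with hQ
  have hQ0 : 0 < Q := by positivity
  have e : (fun ω => (S.X r ω - c) i * gaussD L C (S.X r ω - c)) = fun ω =>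
      -(∑ j, C i j * gaussD (j :: L) C (S.X r ω - c))
        - ((removals i L).map fun M => gaussD M C (S.X r ω - c)).sum := by
    ext ω
    exact coord_mul_gaussD (by positivity : 0 < δ / K) hC.symm hC.lower L i _
  have hrem : ∀ M' ∈ removals i L, M'.length + 1 = L.length := fun M' hM' => removals_length i L M' hM'
  have s1 : Integrable (fun ω => ∑ j, C i j * gaussD (j :: L) C (S.X r ω - c)) S.P :=
    integrable_finsetSum _ fun j _ => (hi _).const_mul _
  have s2 := abs_integral_list_sum_le (P := S.P) (F := fun M ω => gaussD M C (S.X r ω - c)) (B := M * Q * H)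
    (removals i L) (fun M' _ => hi M') (fun M' hM' => by
      have h1 := hrem M' hM'
      have := h S r hr δ hδ hδT C hC c hc M' (by omega) (by omega)
      rw [show (1 - (M'.length : ℝ)) / 2 = (2 - n) / 2 by rw [hn, ← h1]; push_cast; ring] at this
      exact this)
  have s1n : Integrable (fun ω => -∑ j, C i j * gaussD (j :: L) C (S.X r ω - c)) S.P := s1.neg
  rw [e]
  refine ⟨s1n.sub s2.1, ?_⟩
  rw [integral_sub s1n s2.1, integral_neg, integral_finsetSum _ fun j _ => (hi _).const_mul _]
  simp only [integral_const_mul]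
  have b1 : |∑ j, C i j * ∫ ω, gaussD (j :: L) C (S.X r ω - c) ∂S.P| ≤ d * (K * M * Q * H) := by
    refine (Finset.abs_sum_le_sum_abs _ _).trans ?_
    have : ∀ j ∈ Finset.univ, |C i j * ∫ ω, gaussD (j :: L) C (S.X r ω - c) ∂S.P| ≤ K * M * Q * H := fun j _ => by
      rw [abs_mul]
      have := h S r hr δ hδ hδT C hC c hc (j :: L) (by simp; omega) (by simp; omega)
      have e1 : δ ^ ((1 - ((j :: L).length : ℝ)) / 2) = δ⁻¹ * δ ^ ((2 - n) / 2) := by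
        rw [← Real.rpow_neg_one, ← Real.rpow_add hδ]; congr 1; rw [hn]; push_cast [List.length_cons]; ring
      rw [e1] at this
      change |_| ≤ M * (δ⁻¹ * δ ^ ((2 - n) / 2) * τs ^ (-(1:ℝ) / 2)) * H at this
      refine (mul_le_mul (hC.bound i j) this (abs_nonneg _) (by positivity)).trans (le_of_eq ?_)
      rw [hQ]
      field_simp
    refine (Finset.sum_le_sum this).trans ?_
    simp
  have b2 : ((removals i L).length : ℝ) * (M * Q * H) ≤ N * (M * Q * H) := by
    refine mul_le_mul_of_nonneg_right ?_ (by positivity)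
    have := length_removals_le i L
    exact_mod_cast this.trans hL
  refine (abs_sub _ _).trans ?_
  rw [abs_neg]
  refine (add_le_add b1 (s2.2.trans b2)).trans ?_
  have : 0 < Q * H := by positivity
  nlinarith

end Setup

lemma rpow_le_mul_rpow {B τ p q : ℝ} (hτ : 0 < τ) (hB : τ ≤ B) (hB1 : 1 ≤ B) (hpq : p ≤ q) (hq : q ≤ p + 1) :
    τ ^ q ≤ B * τ ^ p := by
  rw [show q = (q - p) + p by ring, Real.rpow_add hτ]
  refine mul_le_mul_of_nonneg_right ?_ (by positivity)
  refine (Real.rpow_le_rpow hτ.le hB (by linarith)).trans ?_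
  refine (Real.rpow_le_rpow_of_exponent_le hB1 (by linarith : q - p ≤ 1)).trans (le_of_eq (Real.rpow_one B))

namespace Setup
variable {d : ℕ} {T K α β : ℝ}

/-- Reference path moving with the true drift evaluated along `θ`, pinned at the final time. -/
lemma exists_center (S : Setup d T K α β) (hK : 1 ≤ K) :
    ∃ c c' : ℝ → Vec d, IsPath c c' S.s S.t ∧ c S.t = S.θ S.t ∧ (∀ u ∈ Icc S.s S.t, c' u = S.b u (S.θ u)) ∧
      ∀ u ∈ Icc S.s S.t, ‖c u - S.θ u‖ ≤ K * (S.t - u) := by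
  set g : ℝ → Vec d := (Icc S.s S.t).indicator (fun v => -S.b v (S.θ v)) with hg
  have hgm : Measurable g := by
    have e := S.diff.meas_b.comp (measurable_id.prodMk S.path.meas)
    refine Measurable.indicator (Measurable.neg ?_) measurableSet_Icc
    simpa only [Function.comp_def, Function.uncurry, id] using e
  obtain ⟨N, hN⟩ := S.path.bounded
  have hgN : ∀ u, ‖g u‖ ≤ |S.N| * (1 + |N|) := fun u => by
    by_cases hu : u ∈ Icc S.s S.t
    · rw [hg, indicator_of_mem hu, norm_neg]
      refine (S.diff.bound_b u hu _).trans ?_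
      exact mul_le_mul (le_abs_self _) (by linarith [hN u hu, le_abs_self N]) (by positivity) (abs_nonneg _)
    · rw [hg, indicator_of_notMem hu, norm_zero]; positivity
  have hgi : ∀ a b, IntervalIntegrable g volume a b := fun a b =>
    intervalIntegrable_iff.2 (Integrable.mono' (integrableOn_const (C := |S.N| * (1 + |N|)) (by simp))
      hgm.aestronglyMeasurable (Filter.Eventually.of_forall hgN))
  have hst : S.s ≤ S.t := S.hst.le
  refine ⟨_, _, IsPath.primitive hgm hgN (S.θ S.t) S.s S.t, by simp, fun u hu => ?_, fun u hu => ?_⟩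
  · show -g u = _
    rw [hg, indicator_of_mem hu, neg_neg]
  · have i1 := S.path.intervalIntegrable ⟨hst, le_rfl⟩
    have i2 := S.path.intervalIntegrable hu
    have e : (S.θ S.t + ∫ v in u..S.t, g v) - S.θ u = ∫ v in u..S.t, (S.θ' v + g v) := by
      rw [intervalIntegral.integral_add (i2.symm.trans i1) (hgi _ _), S.path.eq S.t ⟨hst, le_rfl⟩, S.path.eq u hu,
        ← intervalIntegral.integral_interval_sub_left i1 i2]
      abel
    show ‖(S.θ S.t + ∫ v in u..S.t, g v) - S.θ u‖ ≤ _
    rw [e]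
    have := intervalIntegral.norm_integral_le_of_norm_le_const (a := u) (b := S.t)
      (f := fun v => S.θ' v + g v) (C := K) (fun v hv => by
        rw [uIoc_of_le hu.2] at hv
        have hv' : v ∈ Icc S.s S.t := ⟨hu.1.trans hv.1.le, hv.2⟩
        have := S.drift_path v hv' (S.θ v)
        rw [hg, indicator_of_mem hv', ← sub_eq_add_neg, norm_sub_rev]
        simpa using this)
    rwa [abs_of_nonneg (by linarith [hu.2])] at this

/-- Splitting the second-order coefficient into remainder, linear and constant contributions. -/
lemma second_order_moment (S : Setup d T K α β) (hK : 1 ≤ K) {r τ M₁ M₂ H B ε Q : ℝ}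
    (hα : 0 < α) (hα1 : α ≤ 1) (hM₁ : 0 < M₁) (hM₂ : 0 < M₂) (hτ : 0 < τ) (hτB : τ ≤ B) (hB1 : 1 ≤ B)
    (hH : 0 < H) (hr : r ∈ Icc S.s S.t) (hε : ε ≤ α / 2) (hε0 : 0 < ε)
    (hQ : τ ^ (-2 + ε) ≤ Q) {Q' : ℝ} (hQ' : Q' ≤ Q)
    (c : Vec d) (hc : ‖c - S.θ r‖ ≤ K * τ) (L : List (Fin d)) (hL : L.length = 5) (g : S.Ω → ℝ) (hg : Measurable g)
    (h₁ : ∀ γ ∈ Icc (0:ℝ) 4, ∀ γ' ∈ Icc (0:ℝ) 4, ∀ A, 0 ≤ A → ∀ f : S.Ω → ℝ, Measurable f →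
      (∀ ω, |f ω| ≤ A * (‖S.X r ω - S.θ r‖ ^ γ + ‖S.X r ω - S.θ r‖ ^ γ') * |g ω|) →
      Integrable f S.P ∧ |∫ ω, f ω ∂S.P| ≤ A * M₁ * (τ ^ ((γ - 5) / 2) + τ ^ ((γ' - 5) / 2)) * H)
    (h₂ : ∀ l, Integrable (fun ω => (S.X r ω - c) l * g ω) S.P ∧
      |∫ ω, (S.X r ω - c) l * g ω ∂S.P| ≤ M₂ * Q' * H) (i j : Fin d) :
    Integrable (fun ω => (S.a r (S.X r ω) - S.a r (S.θ r)) i j * g ω) S.P ∧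
      |∫ ω, (S.a r (S.X r ω) - S.a r (S.θ r)) i j * g ω ∂S.P|
        ≤ (2 * K * M₁ * B + d * K * M₂ + 2 * (d * K * K) * M₁ * B) * Q * H := by
  obtain ⟨D, hD, hDe⟩ := S.expansion r hr
  have hK0 : 0 < K := by linarith
  have hB0 : 0 < B := by linarith
  have hp0 : 0 < τ ^ (-2 + ε) := by positivity
  set rem : S.Ω → ℝ := fun ω => S.a r (S.X r ω) i j - S.a r (S.θ r) i j - ∑ l, D i j l * (S.X r ω - S.θ r) l
    with hrem
  set κ : ℝ := ∑ l, D i j l * (c - S.θ r) l with hκ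
  have hma : Measurable fun ω => S.a r (S.X r ω) i j := by
    have e := S.diff.meas_a.comp (measurable_const (a := r) |>.prodMk (S.diff.meas_Xt r))
    have e' : Measurable fun ω => S.a r (S.X r ω) := by
      simpa only [Function.comp_def, Function.uncurry, id] using e
    exact (measurable_pi_apply j).comp ((measurable_pi_apply i).comp e')
  have hmX : ∀ l, Measurable fun ω => (S.X r ω - S.θ r) l := fun l =>
    (coordR l).continuous.measurable.comp (S.measurable_center r (S.θ r))
  have hmrem : Measurable rem :=
    (hma.sub measurable_const).sub (Finset.measurable_fun_sum _ fun l _ => (hmX l).const_mul _)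
  have r1 := h₁ (1 + α) ⟨by linarith, by linarith⟩ (1 + α) ⟨by linarith, by linarith⟩ K hK0.le
    (fun ω => rem ω * g ω) (hmrem.mul hg) (fun ω => by
      rw [abs_mul]
      refine mul_le_mul_of_nonneg_right ((hDe (S.X r ω) i j).trans ?_) (abs_nonneg _)
      have : 0 ≤ ‖S.X r ω - S.θ r‖ ^ (1 + α) := by positivity
      nlinarith)
  have hκb : |κ| ≤ d * K * K * τ := by
    refine (Finset.abs_sum_le_sum_abs _ _).trans ?_
    refine (Finset.sum_le_sum fun l _ => (?_ : _ ≤ K * (K * τ))).trans (le_of_eq ?_)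
    · rw [abs_mul]
      refine mul_le_mul (hD i j l) ?_ (abs_nonneg _) hK0.le
      rw [← Real.norm_eq_abs]; exact (PiLp.norm_apply_le _ l).trans hc
    · simp; ring
  have r3 := h₁ 0 ⟨le_rfl, by norm_num⟩ 0 ⟨le_rfl, by norm_num⟩ (d * K * K * τ) (by positivity)
    (fun ω => κ * g ω) (hg.const_mul _) (fun ω => by
      rw [abs_mul, Real.rpow_zero]
      refine mul_le_mul_of_nonneg_right (hκb.trans ?_) (abs_nonneg _)
      have : 0 ≤ d * K * K * τ := by positivity
      linarith)
  have i2 : ∀ l ∈ Finset.univ, Integrable (fun ω => D i j l * ((S.X r ω - c) l * g ω)) S.P := fun l _ =>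
    (h₂ l).1.const_mul _
  have e : (fun ω => (S.a r (S.X r ω) - S.a r (S.θ r)) i j * g ω) = fun ω =>
      rem ω * g ω + ∑ l, D i j l * ((S.X r ω - c) l * g ω) + κ * g ω := by
    ext ω
    have : ∑ l, D i j l * (S.X r ω - S.θ r) l = ∑ l, D i j l * (S.X r ω - c) l + κ := by
      rw [hκ, ← Finset.sum_add_distrib]
      refine Finset.sum_congr rfl fun l _ => ?_
      simp only [PiLp.sub_apply]; ring
    simp only [hrem, Pi.sub_apply, this, ← mul_assoc, ← Finset.sum_mul]
    ring
  rw [e]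
  have i12 : Integrable (fun ω => rem ω * g ω + ∑ l, D i j l * ((S.X r ω - c) l * g ω)) S.P :=
    r1.1.add (integrable_finsetSum _ i2)
  refine ⟨i12.add r3.1, ?_⟩
  rw [integral_add i12 r3.1, integral_add r1.1 (integrable_finsetSum _ i2),
    integral_finsetSum _ i2]
  simp only [integral_const_mul (D i j _)]
  have b2 : |∑ l, D i j l * ∫ ω, (S.X r ω - c) l * g ω ∂S.P| ≤ d * (K * (M₂ * Q * H)) := by
    refine (Finset.abs_sum_le_sum_abs _ _).trans ?_
    refine (Finset.sum_le_sum fun l _ => (?_ : _ ≤ K * (M₂ * Q * H))).trans (le_of_eq (by simp))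
    rw [abs_mul]
    refine mul_le_mul (hD i j l) ((h₂ l).2.trans ?_) (abs_nonneg _) hK0.le
    exact mul_le_mul_of_nonneg_right (mul_le_mul_of_nonneg_left hQ' hM₂.le) hH.le
  have n1 : τ ^ ((1 + α - 5) / 2) ≤ B * Q :=
    (rpow_le_mul_rpow hτ hτB hB1 (by linarith) (by linarith)).trans (mul_le_mul_of_nonneg_left hQ hB0.le)
  have n3 : τ * τ ^ (((0:ℝ) - 5) / 2) ≤ B * Q := by
    have : τ * τ ^ (((0:ℝ) - 5) / 2) = τ ^ (-(3:ℝ) / 2) := by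
      nth_rw 1 [← Real.rpow_one τ]
      rw [← Real.rpow_add hτ]; norm_num
    rw [this]
    exact (rpow_le_mul_rpow hτ hτB hB1 (by linarith) (by linarith)).trans (mul_le_mul_of_nonneg_left hQ hB0.le)
  have b1 : |∫ ω, rem ω * g ω ∂S.P| ≤ 2 * K * M₁ * B * Q * H := by
    refine r1.2.trans ?_
    calc _ = (2 * K * M₁ * H) * τ ^ ((1 + α - 5) / 2) := by ring
      _ ≤ (2 * K * M₁ * H) * (B * Q) := mul_le_mul_of_nonneg_left n1 (by positivity)
      _ = _ := by ring
  have b3 : |∫ ω, κ * g ω ∂S.P| ≤ 2 * (d * K * K) * M₁ * B * Q * H := by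
    refine r3.2.trans ?_
    calc _ = (2 * (d * K * K) * M₁ * H) * (τ * τ ^ (((0:ℝ) - 5) / 2)) := by ring
      _ ≤ (2 * (d * K * K) * M₁ * H) * (B * Q) := mul_le_mul_of_nonneg_left n3 (by positivity)
      _ = _ := by ring
  refine (abs_add_le _ _).trans ((add_le_add ((abs_add_le _ _).trans (add_le_add b1 b2)) b3).trans (le_of_eq ?_))
  ring

/-- Third derivatives of the smoothed law at the end point of the reference path. -/
theorem exists_third_moment (d : ℕ) (T K α β : ℝ) (hT : 0 < T) (hK : 1 ≤ K) (hα : 0 < α) (hα1 : α ≤ 1)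
    (hβ : 0 < β) (hβ1 : β ≤ 1) :
    ∃ M l : ℝ, 0 < M ∧ 0 < l ∧ ∀ S : Setup d T K α β, ∀ δ, 0 < δ → δ ≤ T → ∀ L : List (Fin d), L.length = 3 →
      |∫ ω, gaussD L (scalCov d δ) (S.X S.t ω - S.θ S.t) ∂S.P|
        ≤ M * ((δ + (S.t - S.s)) ^ (-(3:ℝ) / 2) + δ ^ (-1 + min α β / 2)
          + δ ^ (-(1:ℝ) / 2) * (δ + (S.t - S.s)) ^ (-(1:ℝ) / 2)) * S.heat l (δ + (S.t - S.s)) := by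
  set k := K * √(2 * T) with hk
  have hK0 : 0 < K := by linarith
  have hk0 : 0 ≤ k := by positivity
  obtain ⟨M₀, l₀, hM₀, hl₀, -, h₀⟩ := exists_kernel_bound d K hK k 3
  obtain ⟨M₁, l₁, hM₁, hl₁, h₁⟩ := exists_abs_moment d T K α β hT hK k 5
  obtain ⟨M₂, l₂, hM₂, hl₂, h₂⟩ := exists_coord_moment d T K α β hT hK k hk0 5
  set ε := min α β / 2 with hε
  have hε0 : 0 < ε := by positivity
  have hεα : ε ≤ α / 2 := by rw [hε]; linarith [min_le_left α β]
  have hεβ : ε ≤ β / 2 := by rw [hε]; linarith [min_le_right α β]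
  set B := 2 * T + 1 with hB
  set W := 2 * K * M₁ * B + d * K * M₂ + 2 * (d * K * K) * M₁ * B with hW
  have hB0 : 0 < B := by positivity
  set M' := d * (2 * K * M₁ * B) + d * (d * W) with hM'
  refine ⟨M₀ + 2 * M', min l₀ (min l₁ l₂), by positivity, by positivity, fun S δ hδ hδT L hL => ?_⟩
  set τs := δ + (S.t - S.s) with hτs
  have hst := S.hst
  have hST := S.hT
  have hτs0 : 0 < τs := by linarith
  set l := min l₀ (min l₁ l₂) with hl
  set H := S.heat l τs with hH
  have hH0 : 0 < H := S.heat_pos _ hτs0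
  have htt : S.t ∈ Icc S.s S.t := ⟨hst.le, le_rfl⟩
  obtain ⟨c, c', hc, hct, hc', hcθ⟩ := S.exists_center hK
  have hC := covBetween_scalCov (d := d) hK hδ
  have hck : ∀ u ∈ Icc S.s S.t, ‖c u - S.θ u‖ ≤ K * (δ + S.t - u) ∧ ‖c u - S.θ u‖ ≤ k * √(δ + S.t - u) := by
    intro u hu
    have h1 : ‖c u - S.θ u‖ ≤ K * (δ + S.t - u) :=
      (hcθ u hu).trans (mul_le_mul_of_nonneg_left (by linarith) hK0.le)
    refine ⟨h1, h1.trans ?_⟩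
    have h0 : 0 ≤ δ + S.t - u := by linarith [hu.2]
    rw [hk, mul_assoc]
    refine mul_le_mul_of_nonneg_left ?_ hK0.le
    nth_rw 1 [← Real.mul_self_sqrt h0]
    exact mul_le_mul_of_nonneg_right (Real.sqrt_le_sqrt (by linarith [hu.1])) (Real.sqrt_nonneg _)
  have hcont : ∀ p : ℝ, IntervalIntegrable (fun u => (δ + S.t - u) ^ p) volume S.s S.t := fun p =>
    ContinuousOn.intervalIntegrable (by rw [uIcc_of_le hst.le]; exact continuousOn_rpow_shift hδ p)
  have hmain := S.abs_integral_gaussD_le hK htt hδ hC hc L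
    (G := fun u => M' * H * (δ + S.t - u) ^ (-2 + ε) + M' * H * τs ^ (-(1:ℝ) / 2) * (δ + S.t - u) ^ (-(3:ℝ) / 2))
    (((hcont _).const_mul _).add ((hcont _).const_mul _)) ?_
  · rw [hct, intervalIntegral.integral_add ((hcont _).const_mul _) ((hcont _).const_mul _),
      intervalIntegral.integral_const_mul, intervalIntegral.integral_const_mul] at hmain
    refine hmain.trans ?_
    have a0 : |gaussD L (S.cov (scalCov d δ) S.t S.s) (S.x - c S.s)| ≤ M₀ * τs ^ (-(3:ℝ) / 2) * H := by
      have hs : S.s ∈ Icc S.s S.t := ⟨le_rfl, hst.le⟩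
      have := h₀ _ _ (by linarith) (S.covBetween_cov hK hC htt hs) L hL.le 0 le_rfl (by norm_num) S.x
        (c S.s) (S.θ S.s) (hck _ hs).2
      rw [Real.rpow_zero, one_mul, hL, add_sub_assoc] at this
      refine this.trans ?_
      have e : τs ^ (((0:ℝ) - (3:ℕ) - d) / 2) * Real.exp (-l₀ * ‖S.x - S.θ S.s‖ ^ 2 / τs)
          = τs ^ (-(3:ℝ) / 2) * S.heat l₀ τs := by
        rw [heat, dist, ← mul_assoc, ← Real.rpow_add hτs0]; congr 2; push_cast; ring
      rw [mul_assoc, e, mul_assoc]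
      refine mul_le_mul_of_nonneg_left (mul_le_mul_of_nonneg_left (S.heat_anti (min_le_left _ _) hτs0) ?_) hM₀.le
      positivity
    have a1 : ∫ u in S.s..S.t, (δ + S.t - u) ^ (-2 + ε) ≤ 2 * δ ^ (-1 + ε) := by
      refine (integral_rpow_shift_le_of_lt hδ hst.le (by linarith)).trans ?_
      rw [show -2 + ε + 1 = -1 + ε by ring, div_le_iff₀ (by linarith)]
      have : 0 < δ ^ (-1 + ε) := by positivity
      nlinarith
    have a2 : ∫ u in S.s..S.t, (δ + S.t - u) ^ (-(3:ℝ) / 2) ≤ 2 * δ ^ (-(1:ℝ) / 2) := by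
      refine (integral_rpow_shift_le_of_lt hδ hst.le (by norm_num)).trans (le_of_eq ?_)
      norm_num; ring
    have hM'0 : 0 ≤ M' := by positivity
    calc _ ≤ M₀ * τs ^ (-(3:ℝ) / 2) * H + (M' * H * (2 * δ ^ (-1 + ε))
          + M' * H * τs ^ (-(1:ℝ) / 2) * (2 * δ ^ (-(1:ℝ) / 2))) :=
          add_le_add a0 (add_le_add (mul_le_mul_of_nonneg_left a1 (by positivity))
            (mul_le_mul_of_nonneg_left a2 (by positivity)))
      _ ≤ M₀ * τs ^ (-(3:ℝ) / 2) * H + (M' * H * (2 * δ ^ (-1 + ε))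
          + M' * H * τs ^ (-(1:ℝ) / 2) * (2 * δ ^ (-(1:ℝ) / 2)))
          + (2 * M' * τs ^ (-(3:ℝ) / 2) * H + M₀ * (δ ^ (-1 + ε) + δ ^ (-(1:ℝ) / 2) * τs ^ (-(1:ℝ) / 2)) * H) :=
          le_add_of_nonneg_right (by positivity)
      _ = _ := by ring
  · intro u hu
    have hut : u ∈ Icc S.s S.t := ⟨hu.1.le, hu.2⟩
    have hτ0 : 0 < δ + S.t - u := by linarith [hu.2]
    have hCu := S.covBetween_cov hK hC htt hut
    set τ := δ + S.t - u with hτ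
    have hτT : τ ≤ 2 * T := by linarith [hu.1]
    have hτB : τ ≤ B := by linarith
    have hτus : τ + (u - S.s) = τs := by rw [hτ, hτs]; ring
    obtain ⟨hc1, hc2⟩ := hck u hut
    set Q := τ ^ (-2 + ε) + τs ^ (-(1:ℝ) / 2) * τ ^ (-(3:ℝ) / 2) with hQ
    have hQ1 : τ ^ (-2 + ε) ≤ Q := le_add_of_nonneg_right (by positivity)
    have hQ2 : τ ^ (-(3:ℝ) / 2) * τs ^ (-(1:ℝ) / 2) ≤ Q := by
      rw [mul_comm]; exact le_add_of_nonneg_left (by positivity)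
    have hQ0 : 0 < Q := by positivity
    have hH1 : S.heat l₁ (τ + (u - S.s)) ≤ H := by
      rw [hτus]; exact S.heat_anti ((min_le_right _ _).trans (min_le_left _ _)) hτs0
    have hH2 : S.heat l₂ (τ + (u - S.s)) ≤ H := by
      rw [hτus]; exact S.heat_anti ((min_le_right _ _).trans (min_le_right _ _)) hτs0
    set g : List (Fin d) → S.Ω → ℝ := fun L' ω => gaussD L' (S.cov (scalCov d δ) S.t u) (S.X u ω - c u) with hg
    have hgm : ∀ L', Measurable (g L') := fun L' => by
      have : Continuous (gaussD L' (S.cov (scalCov d δ) S.t u)) :=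
        continuous_iff_continuousAt.2 fun m =>
          (hasFDerivAt_gaussD (by positivity : 0 < τ / K) hCu.lower L' m).continuousAt
      exact this.measurable.comp (S.measurable_center u (c u))
    have hmb : ∀ i, Measurable fun ω => (S.b u (S.X u ω) - S.b u (S.θ u)) i := fun i => by
      have e := S.diff.meas_b.comp (measurable_const (a := u) |>.prodMk (S.diff.meas_Xt u))
      have e' : Measurable fun ω => S.b u (S.X u ω) := by
        simpa only [Function.comp_def, Function.uncurry, id] using e
      exact (coordR i).continuous.measurable.comp (e'.sub measurable_const)
    have d1 : ∀ i ∈ Finset.univ, Integrable (fun ω => (S.b u (S.X u ω) - S.b u (S.θ u)) i * g (i :: L) ω) S.P ∧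
        |∫ ω, (S.b u (S.X u ω) - S.b u (S.θ u)) i * g (i :: L) ω ∂S.P| ≤ 2 * K * M₁ * B * Q * H := by
      intro i _
      have hlen : (((i :: L).length : ℕ) : ℝ) = 4 := by norm_num [hL]
      have := h₁ S u hut τ hτ0 _ hCu (c u) hc2 (i :: L) (by simp [hL]) β ⟨hβ.le, by linarith⟩ 1
        ⟨by norm_num, by norm_num⟩ K hK0.le _ ((hmb i).mul (hgm (i :: L))) (fun ω => by
          rw [Pi.mul_apply, abs_mul]
          refine mul_le_mul_of_nonneg_right ?_ (abs_nonneg _)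
          rw [← Real.norm_eq_abs]
          refine (PiLp.norm_apply_le _ i).trans ((S.drift_holder u hut _ _).trans ?_)
          refine mul_le_mul_of_nonneg_left ?_ hK0.le
          rw [Real.rpow_one]
          exact max_le (le_add_of_nonneg_right (by positivity)) (le_add_of_nonneg_left (by positivity)))
      refine ⟨this.1, this.2.trans ?_⟩
      rw [hlen]
      have n1 : τ ^ ((β - 4) / 2) ≤ B * Q :=
        (rpow_le_mul_rpow hτ0 hτB (by linarith) (by linarith) (by linarith)).trans
          (mul_le_mul_of_nonneg_left hQ1 hB0.le)
      have n2 : τ ^ (((1:ℝ) - 4) / 2) ≤ B * Q :=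
        (rpow_le_mul_rpow hτ0 hτB (by linarith) (by linarith) (by linarith)).trans
          (mul_le_mul_of_nonneg_left hQ1 hB0.le)
      calc _ ≤ K * M₁ * (B * Q + B * Q) * H :=
            mul_le_mul (mul_le_mul_of_nonneg_left (add_le_add n1 n2) (by positivity)) hH1
              (S.heat_pos _ (by rw [hτus]; exact hτs0)).le (by positivity)
        _ = _ := by ring
    have d2 : ∀ i ∈ Finset.univ, ∀ j ∈ Finset.univ,
        Integrable (fun ω => (S.a u (S.X u ω) - S.a u (S.θ u)) i j * g (i :: j :: L) ω) S.P ∧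
        |∫ ω, (S.a u (S.X u ω) - S.a u (S.θ u)) i j * g (i :: j :: L) ω ∂S.P| ≤ W * Q * H := by
      intro i _ j _
      have hlen' : (i :: j :: L).length = 5 := by simp [hL]
      have hlen : (((i :: j :: L).length : ℕ) : ℝ) = 5 := by rw [hlen']; norm_num
      refine S.second_order_moment hK hα hα1 hM₁ hM₂ hτ0 hτB (by linarith) hH0 hut hεα hε0 hQ1 hQ2 (c u) hc1
        (i :: j :: L) hlen' _ (hgm _) ?_ ?_ i j
      · intro γ hγ γ' hγ' A hA f hf hle
        have := h₁ S u hut τ hτ0 _ hCu (c u) hc2 (i :: j :: L) hlen'.le γ hγ γ' hγ' A hA f hf hle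
        rw [hlen] at this
        exact ⟨this.1, this.2.trans (mul_le_mul_of_nonneg_left hH1 (by positivity))⟩
      · intro l'
        have := h₂ S u hut τ hτ0 hτT _ hCu (c u) hc2 (i :: j :: L) hlen'.le (by simp [hL]) l'
        rw [hlen, show ((2:ℝ) - 5) / 2 = -3 / 2 by norm_num, hτus] at this
        refine ⟨this.1, this.2.trans ?_⟩
        rw [hτus] at hH2
        exact mul_le_mul_of_nonneg_left hH2 (by positivity)
    simp only [genD, zero_mul, zero_add, hc' u hut]
    have I1 := integrable_finsetSum Finset.univ fun i hi => (d1 i hi).1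
    have I2 := integrable_finsetSum Finset.univ fun i hi =>
      integrable_finsetSum Finset.univ fun j hj => (d2 i hi j hj).1
    have I3 := I2.const_mul (1 / 2)
    have key := integral_add I1 I3
    rw [integral_const_mul, integral_finsetSum _ fun i hi => (d1 i hi).1,
      integral_finsetSum _ fun i hi => integrable_finsetSum Finset.univ fun j hj => (d2 i hi j hj).1] at key
    refine (le_of_eq (congrArg abs key)).trans ?_
    have b1 : |∑ i, ∫ ω, (S.b u (S.X u ω) - S.b u (S.θ u)) i * g (i :: L) ω ∂S.P| ≤ d * (2 * K * M₁ * B * Q * H) :=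
      (Finset.abs_sum_le_sum_abs _ _).trans ((Finset.sum_le_sum fun i hi => (d1 i hi).2).trans (le_of_eq (by simp)))
    have b2 : |∑ i, ∫ ω, ∑ j, (S.a u (S.X u ω) - S.a u (S.θ u)) i j * g (i :: j :: L) ω ∂S.P|
        ≤ d * (d * (W * Q * H)) := by
      refine (Finset.abs_sum_le_sum_abs _ _).trans
        ((Finset.sum_le_sum fun i hi => (?_ : _ ≤ d * (W * Q * H))).trans (le_of_eq (by simp)))
      rw [integral_finsetSum _ fun j hj => (d2 i hi j hj).1]
      exact (Finset.abs_sum_le_sum_abs _ _).trans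
        ((Finset.sum_le_sum fun j hj => (d2 i hi j hj).2).trans (le_of_eq (by simp)))
    refine (abs_add_le _ _).trans ?_
    rw [abs_mul, abs_of_pos (by norm_num : (0:ℝ) < 1 / 2)]
    have hW0 : 0 ≤ d * (d * (W * Q * H)) := by positivity
    refine (add_le_add b1 (by linarith [abs_nonneg (∑ i, ∫ ω, ∑ j, (S.a u (S.X u ω) - S.a u (S.θ u)) i j * g (i :: j :: L) ω ∂S.P)] : _ ≤ d * (d * (W * Q * H)))).trans
      (le_of_eq ?_)
    rw [hM', hQ]; ring

end Setup

/-- A process that does not move is a diffusion. -/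
lemma isDiffusion_const {d : ℕ} {Ω : Type*} [MeasurableSpace Ω] {P : Measure Ω} [IsProbabilityMeasure P]
    {Y : Ω → Vec d} (hY : Measurable Y) (hi : Integrable (fun ω => ‖Y ω‖) P) (s t : ℝ) :
    IsDiffusion P (fun _ => Y) (fun _ _ => 0) (fun _ _ => 0) s t (∫ ω, ‖Y ω‖ ∂P) where
  prob := inferInstance
  meas_X := hY.comp measurable_snd
  meas_b := measurable_const
  meas_a := measurable_const
  bound_b r _ z := by rw [norm_zero]; exact mul_nonneg (integral_nonneg fun _ => norm_nonneg _) (by positivity)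
  bound_a r _ z i j := by simp; exact integral_nonneg fun _ => norm_nonneg _
  integrable_norm _ _ := hi
  moment _ _ := le_rfl
  dyn k v _ := by simp [genSymb, quadForm]

/-- Heat equation for Gaussian smoothings of a law. -/
lemma integral_gaussD_scalCov_sub {d : ℕ} {Ω : Type*} [MeasurableSpace Ω] {P : Measure Ω} [IsProbabilityMeasure P]
    {Y : Ω → Vec d} (hY : Measurable Y) (hi : Integrable (fun ω => ‖Y ω‖) P) (y : Vec d) (L : List (Fin d))
    {δ δ' : ℝ} (hδ : 0 < δ) (h : δ ≤ δ') :
    ∫ ω, gaussD L (scalCov d δ') (Y ω - y) ∂P = ∫ ω, gaussD L (scalCov d δ) (Y ω - y) ∂P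
      + ∫ u in δ..δ', ∫ ω, genD 0 0 (scalCov d 1) L (scalCov d u) (Y ω - y) ∂P := by
  have := (isDiffusion_const hY hi δ δ').integral_gaussD (r := δ') ⟨h, le_rfl⟩ (IsPath.const (0:ℝ) δ δ')
    (IsPath.const y δ δ') ((IsPath.of_hasDerivAt (f := fun u : ℝ => u) (f' := fun _ => 1)
      (fun u => hasDerivAt_id u) continuous_const δ δ').scalCov (d := d)) hδ
    (fun u hu k => by rw [quadForm_scalCov]; exact mul_le_mul_of_nonneg_right hu.1 (sq_nonneg _)) L
  simpa only [Real.exp_zero, one_mul, sub_zero, zero_add] using this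

lemma integral_rate_le {τ ε δ δ' : ℝ} (hτ : 0 < τ) (hε : 0 < ε) (hδ : 0 < δ) (h : δ ≤ δ') :
    IntervalIntegrable (fun u => τ ^ (-(3:ℝ) / 2) + u ^ (-1 + ε) + u ^ (-(1:ℝ) / 2) * τ ^ (-(1:ℝ) / 2)) volume δ δ' ∧
    ∫ u in δ..δ', (τ ^ (-(3:ℝ) / 2) + u ^ (-1 + ε) + u ^ (-(1:ℝ) / 2) * τ ^ (-(1:ℝ) / 2))
      ≤ δ' * τ ^ (-(3:ℝ) / 2) + δ' ^ ε / ε + 2 * δ' ^ ((1:ℝ) / 2) * τ ^ (-(1:ℝ) / 2) := by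
  have i1 : ∀ p : ℝ, -1 < p → IntervalIntegrable (fun u : ℝ => u ^ p) volume δ δ' := fun p hp =>
    intervalIntegral.intervalIntegrable_rpow' hp
  have c1 : IntervalIntegrable (fun _ : ℝ => τ ^ (-(3:ℝ) / 2)) volume δ δ' := intervalIntegrable_const
  have c2 := i1 (-1 + ε) (by linarith)
  have c3 := (i1 (-(1:ℝ) / 2) (by norm_num)).mul_const (τ ^ (-(1:ℝ) / 2))
  refine ⟨(c1.add c2).add c3, ?_⟩
  rw [intervalIntegral.integral_add (c1.add c2) c3, intervalIntegral.integral_add c1 c2,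
    intervalIntegral.integral_mul_const, intervalIntegral.integral_const, integral_rpow (Or.inl (by linarith)),
    integral_rpow (Or.inl (by norm_num)), smul_eq_mul]
  refine add_le_add (add_le_add ?_ ?_) ?_
  · exact mul_le_mul_of_nonneg_right (by linarith) (by positivity)
  · rw [show -1 + ε + 1 = ε by ring]
    refine div_le_div_of_nonneg_right ?_ hε.le
    have : 0 < δ ^ ε := by positivity
    linarith
  · refine mul_le_mul_of_nonneg_right ?_ (by positivity)
    rw [show -(1:ℝ) / 2 + 1 = 1 / 2 by norm_num]
    have : 0 < δ ^ ((1:ℝ) / 2) := by positivity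
    linarith

namespace Setup
variable {d : ℕ} {T K α β : ℝ}

/-- Gradient bounds for Gaussian smoothings of the law, uniform in the smoothing parameter, and
quantitative convergence as the smoothing parameter vanishes. -/
theorem exists_gradient_bound (d : ℕ) (T K α β : ℝ) (hT : 0 < T) (hK : 1 ≤ K) (hα : 0 < α) (hα1 : α ≤ 1)
    (hβ : 0 < β) (hβ1 : β ≤ 1) :
    ∃ M l : ℝ, 0 < M ∧ 0 < l ∧ ∀ S : Setup d T K α β, ∀ i,
      (∀ δ, 0 < δ → δ ≤ S.t - S.s → |∫ ω, gaussD [i] (scalCov d δ) (S.X S.t ω - S.θ S.t) ∂S.P|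
        ≤ M * (S.t - S.s) ^ (-(1:ℝ) / 2) * S.heat l (S.t - S.s)) ∧
      ∀ δ δ', 0 < δ → δ ≤ δ' → δ' ≤ S.t - S.s →
        |∫ ω, gaussD [i] (scalCov d δ') (S.X S.t ω - S.θ S.t) ∂S.P
          - ∫ ω, gaussD [i] (scalCov d δ) (S.X S.t ω - S.θ S.t) ∂S.P|
        ≤ M * (δ' * (S.t - S.s) ^ (-(3:ℝ) / 2) + δ' ^ (min α β / 2) / (min α β / 2)
            + 2 * δ' ^ ((1:ℝ) / 2) * (S.t - S.s) ^ (-(1:ℝ) / 2)) * S.heat l (S.t - S.s) := by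
  obtain ⟨M₁, l₁, hM₁, hl₁, h₁⟩ := exists_abs_moment d T K α β hT hK 0 1
  obtain ⟨M₂, l₂, hM₂, hl₂, h₂⟩ := exists_third_moment d T K α β hT hK hα hα1 hβ hβ1
  set ε := min α β / 2 with hε
  have hε0 : 0 < ε := by positivity
  have hε1 : ε ≤ 1 / 2 := by rw [hε]; linarith [min_le_left α β]
  set B := T + 1 with hB
  have hB0 : 0 < B := by positivity
  set M₃ := d * d * M₂ with hM₃
  have hM₃0 : 0 ≤ M₃ := by positivity
  set l := min l₁ l₂ / 2 with hl
  refine ⟨2 * M₁ + (M₃ * (1 + B / ε + 2 * B) + M₃), l, by positivity, by positivity, fun S i => ?_⟩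
  have hst := S.hst
  have hST := S.hT
  have htt : S.t ∈ Icc S.s S.t := ⟨hst.le, le_rfl⟩
  have hprob := S.diff.prob
  set τ := S.t - S.s with hτ
  have hτ0 : 0 < τ := by linarith
  set H := S.heat l τ with hH
  have hH0 : 0 < H := S.heat_pos _ hτ0
  have hheat : ∀ l', min l₁ l₂ ≤ l' → ∀ δ, 0 < δ → δ ≤ τ → S.heat l' (δ + τ) ≤ H := fun l' hl' δ hδ hδτ => by
    refine (S.heat_anti hl' (by linarith)).trans ?_
    refine mul_le_mul ?_ (Real.exp_le_exp.2 ?_) (Real.exp_pos _).le (by positivity)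
    · refine Real.rpow_le_rpow_of_nonpos hτ0 (by linarith) ?_
      rw [neg_div]; exact neg_nonpos.2 (by positivity)
    · rw [neg_mul, neg_mul, neg_div, neg_div, neg_le_neg_iff, hl, div_mul_eq_mul_div, div_div]
      refine div_le_div_of_nonneg_left (by positivity) (by linarith) (by linarith)
  have hcauchy : ∀ δ δ', 0 < δ → δ ≤ δ' → δ' ≤ τ →
        |∫ ω, gaussD [i] (scalCov d δ') (S.X S.t ω - S.θ S.t) ∂S.P
          - ∫ ω, gaussD [i] (scalCov d δ) (S.X S.t ω - S.θ S.t) ∂S.P|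
        ≤ M₃ * (δ' * τ ^ (-(3:ℝ) / 2) + δ' ^ ε / ε + 2 * δ' ^ ((1:ℝ) / 2) * τ ^ (-(1:ℝ) / 2)) * H := by
    intro δ δ' hδ hδδ' hδ'
    rw [integral_gaussD_scalCov_sub (S.diff.meas_Xt S.t) (S.diff.integrable_norm S.t htt) _ _ hδ hδδ',
      add_sub_cancel_left]
    obtain ⟨ri, rle⟩ := integral_rate_le hτ0 hε0 hδ hδδ'
    rw [← Real.norm_eq_abs]
    have hb := intervalIntegral.norm_integral_le_of_norm_le (f := fun u => ∫ ω, genD 0 0 (scalCov d 1) [i]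
      (scalCov d u) (S.X S.t ω - S.θ S.t) ∂S.P) hδδ' (Filter.Eventually.of_forall fun u hu => (?_ : _ ≤
        M₃ * H * (τ ^ (-(3:ℝ) / 2) + u ^ (-1 + ε) + u ^ (-(1:ℝ) / 2) * τ ^ (-(1:ℝ) / 2)))) (ri.const_mul _)
    · refine hb.trans ?_
      rw [intervalIntegral.integral_const_mul]
      refine (mul_le_mul_of_nonneg_left rle (by positivity)).trans (le_of_eq (by ring))
    · have hu0 : 0 < u := hδ.trans hu.1
      have huτ : u ≤ τ := hu.2.trans hδ'
      have hi : ∀ L' : List (Fin d), Integrable (fun ω => gaussD L' (scalCov d u) (S.X S.t ω - S.θ S.t)) S.P :=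
        fun L' => integrable_gaussD_comp hK hu0 (covBetween_scalCov hK hu0) (S.measurable_center S.t _) L'
      simp only [genD, zero_mul, zero_add, PiLp.zero_apply, Finset.sum_const_zero]
      rw [integral_const_mul, integral_finsetSum _ fun i' _ => integrable_finsetSum _ fun j _ => (hi _).const_mul _]
      rw [Real.norm_eq_abs, abs_mul, abs_of_pos (by norm_num : (0:ℝ) < 1 / 2)]
      set Z := M₂ * (τ ^ (-(3:ℝ) / 2) + u ^ (-1 + ε) + u ^ (-(1:ℝ) / 2) * τ ^ (-(1:ℝ) / 2)) * H with hZ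
      have hZ0 : 0 < Z := by positivity
      have hterm : ∀ i' j, |scalCov d 1 i' j * ∫ ω, gaussD (i' :: j :: [i]) (scalCov d u)
          (S.X S.t ω - S.θ S.t) ∂S.P| ≤ Z := fun i' j => by
        rw [abs_mul]
        have s1 : |scalCov d 1 i' j| ≤ 1 := by unfold scalCov; split_ifs <;> simp
        have s2 := h₂ S u hu0 (by linarith) (i' :: j :: [i]) rfl
        refine (mul_le_of_le_one_left (abs_nonneg _) s1).trans (s2.trans ?_)
        have q : ∀ p : ℝ, p ≤ 0 → (u + τ) ^ p ≤ τ ^ p := fun p hp =>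
          Real.rpow_le_rpow_of_nonpos hτ0 (by linarith) hp
        refine mul_le_mul (mul_le_mul_of_nonneg_left (add_le_add (add_le_add (q _ (by norm_num)) le_rfl)
          (mul_le_mul_of_nonneg_left (q _ (by norm_num)) (by positivity))) hM₂.le)
          (hheat _ (min_le_right _ _) u hu0 huτ) (S.heat_pos _ (by linarith)).le (by positivity)
      have hsum : |∑ i', ∫ ω, ∑ j, scalCov d 1 i' j * gaussD (i' :: j :: [i]) (scalCov d u)
          (S.X S.t ω - S.θ S.t) ∂S.P| ≤ d * (d * Z) := by
        refine (Finset.abs_sum_le_sum_abs _ _).trans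
          ((Finset.sum_le_sum fun i' _ => (?_ : _ ≤ d * Z)).trans (le_of_eq (by simp)))
        rw [integral_finsetSum _ fun j _ => (hi _).const_mul _]
        simp only [integral_const_mul]
        exact (Finset.abs_sum_le_sum_abs _ _).trans
          ((Finset.sum_le_sum fun j _ => hterm i' j).trans (le_of_eq (by simp)))
      have : M₃ * H * (τ ^ (-(3:ℝ) / 2) + u ^ (-1 + ε) + u ^ (-(1:ℝ) / 2) * τ ^ (-(1:ℝ) / 2)) = d * (d * Z) := by
        rw [hM₃, hZ]; ring
      rw [this]
      have h0 : 0 ≤ d * (d * Z) := by positivity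
      linarith
  have hstart : |∫ ω, gaussD [i] (scalCov d τ) (S.X S.t ω - S.θ S.t) ∂S.P| ≤ 2 * M₁ * τ ^ (-(1:ℝ) / 2) * H := by
    have hm : Measurable fun ω => gaussD [i] (scalCov d τ) (S.X S.t ω - S.θ S.t) := by
      have : Continuous (gaussD [i] (scalCov d τ)) := continuous_iff_continuousAt.2 fun m =>
        (hasFDerivAt_gaussD hτ0 (fun k => (quadForm_scalCov τ k).ge) [i] m).continuousAt
      exact this.measurable.comp (S.measurable_center S.t _)
    have := (h₁ S S.t htt τ hτ0 _ (covBetween_scalCov hK hτ0) (S.θ S.t) (by simp) [i] (by simp) 0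
      ⟨le_rfl, by norm_num⟩ 0 ⟨le_rfl, by norm_num⟩ 1 zero_le_one _ hm (fun ω => by
        simp only [Real.rpow_zero]
        have := abs_nonneg (gaussD [i] (scalCov d τ) (S.X S.t ω - S.θ S.t))
        linarith)).2
    refine this.trans ?_
    have e : ((0:ℝ) - (([i] : List (Fin d)).length : ℕ)) / 2 = -(1:ℝ) / 2 := by norm_num
    rw [e]
    refine (mul_le_mul_of_nonneg_left (hheat _ (min_le_left _ _) τ hτ0 le_rfl) (by positivity)).trans (le_of_eq ?_)
    ring
  constructor
  · intro δ hδ hδτ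
    have hR : τ * τ ^ (-(3:ℝ) / 2) + τ ^ ε / ε + 2 * τ ^ ((1:ℝ) / 2) * τ ^ (-(1:ℝ) / 2)
        ≤ (1 + B / ε + 2 * B) * τ ^ (-(1:ℝ) / 2) := by
      have e1 : τ * τ ^ (-(3:ℝ) / 2) = τ ^ (-(1:ℝ) / 2) := by
        nth_rw 1 [← Real.rpow_one τ]
        rw [← Real.rpow_add hτ0]; norm_num
      have e2 : τ ^ ε ≤ B * τ ^ (-(1:ℝ) / 2) :=
        rpow_le_mul_rpow hτ0 (by linarith) (by linarith) (by linarith) (by linarith)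
      have e3 : τ ^ ((1:ℝ) / 2) * τ ^ (-(1:ℝ) / 2) ≤ B * τ ^ (-(1:ℝ) / 2) := by
        rw [← Real.rpow_add hτ0]
        exact rpow_le_mul_rpow hτ0 (by linarith) (by linarith) (by norm_num) (by norm_num)
      have e4 : τ ^ ε / ε ≤ B * τ ^ (-(1:ℝ) / 2) / ε := div_le_div_of_nonneg_right e2 hε0.le
      calc _ ≤ τ ^ (-(1:ℝ) / 2) + B * τ ^ (-(1:ℝ) / 2) / ε + 2 * (B * τ ^ (-(1:ℝ) / 2)) := by
            rw [e1, mul_assoc]; linarith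
        _ = _ := by ring
    have h1 := hcauchy δ τ hδ hδτ le_rfl
    have h2 := mul_le_mul_of_nonneg_right (mul_le_mul_of_nonneg_left hR hM₃0) hH0.le
    have h3 : 0 ≤ M₃ * τ ^ (-(1:ℝ) / 2) * H := by positivity
    have h4 := abs_sub_abs_le_abs_sub (∫ ω, gaussD [i] (scalCov d δ) (S.X S.t ω - S.θ S.t) ∂S.P)
      (∫ ω, gaussD [i] (scalCov d τ) (S.X S.t ω - S.θ S.t) ∂S.P)
    rw [abs_sub_comm] at h4
    calc _ ≤ 2 * M₁ * τ ^ (-(1:ℝ) / 2) * H + M₃ * ((1 + B / ε + 2 * B) * τ ^ (-(1:ℝ) / 2)) * H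
          + M₃ * τ ^ (-(1:ℝ) / 2) * H := by linarith
      _ = _ := by ring
  · intro δ δ' hδ hδδ' hδ'
    refine (hcauchy δ δ' hδ hδδ' hδ').trans ?_
    refine mul_le_mul_of_nonneg_right (mul_le_mul_of_nonneg_right ?_ ?_) hH0.le
    · have : 0 ≤ M₃ * (1 + B / ε + 2 * B) := by positivity
      linarith
    · have : 0 < δ' := hδ.trans_le hδδ'
      positivity

end Setup

namespace Setup
variable {d : ℕ} {T K α β : ℝ}

/-- A polynomial lower bound for the smoothed mass near an arbitrary point, by transport along
the straight line joining the starting point to it. -/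
theorem exists_smoothed_mass_ge (S : Setup d T K α β) (hK : 1 ≤ K) (y : Vec d) :
    ∃ c₀ q₀ n : ℝ, 0 < c₀ ∧ 0 < q₀ ∧ 0 ≤ n ∧ ∀ δ, 0 < δ → δ ≤ q₀ →
      c₀ * δ ^ n ≤ ∫ ω, Real.exp (-‖S.X S.t ω - y‖ ^ 2 / (2 * δ)) ∂S.P := by
  have hK0 : 0 < K := by linarith
  set h := S.t - S.s with hh
  have hh0 : 0 < h := sub_pos.2 S.hst
  have hN := S.diff.N_nonneg S.hst.le
  set e : Vec d := h⁻¹ • (y - S.x) with he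
  set c : ℝ → Vec d := fun u => S.x + (u - S.s) • e with hc
  set V : ℝ := S.N * (1 + (‖S.x‖ + h * ‖e‖)) + ‖e‖ + 1 with hV
  have hV0 : 0 < V := by
    have : 0 ≤ S.N * (1 + (‖S.x‖ + h * ‖e‖)) := by positivity
    have := norm_nonneg e
    linarith
  have hcp : IsPath c (fun _ => e) S.s S.t :=
    { meas := by simp only [hc]; fun_prop
      meas' := measurable_const
      bdd := ⟨‖e‖, fun _ _ => le_rfl⟩
      eq := fun v _ => by simp [hc] }
  have hcy : c S.t = y := by
    simp only [hc, he, ← hh]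
    rw [smul_smul, mul_inv_cancel₀ hh0.ne', one_smul]; abel
  have hcs : c S.s = S.x := by simp [hc]
  have hdrift : ∀ u ∈ Icc S.s S.t, ∀ z, ‖S.b u z - e‖ ≤ V * (1 + ‖z - c u‖) := fun u hu z => by
    have h1 := S.diff.bound_b u hu z
    have h2 : ‖c u‖ ≤ ‖S.x‖ + h * ‖e‖ := by
      refine (norm_add_le _ _).trans (add_le_add le_rfl ?_)
      rw [norm_smul, Real.norm_of_nonneg (by linarith [hu.1])]
      exact mul_le_mul_of_nonneg_right (by linarith [hu.2]) (norm_nonneg _)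
    have h3 : ‖z‖ ≤ ‖z - c u‖ + ‖c u‖ := by simpa using norm_add_le (z - c u) (c u)
    have h4 : 0 ≤ ‖z - c u‖ := norm_nonneg _
    have h5 := norm_sub_le (S.b u z) e
    have h6 : S.N * (1 + ‖z‖) ≤ S.N * (1 + (‖z - c u‖ + (‖S.x‖ + h * ‖e‖))) :=
      mul_le_mul_of_nonneg_left (by linarith) hN
    have h7 : 0 ≤ S.N * (‖S.x‖ + h * ‖e‖) := by positivity
    have h8 : 0 ≤ (S.N * (‖S.x‖ + h * ‖e‖)) * ‖z - c u‖ := mul_nonneg h7 h4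
    have h9 : 0 ≤ ‖e‖ * ‖z - c u‖ := by positivity
    simp only [hV]
    nlinarith
  set κ : ℝ := K⁻¹ / 2 with hκ
  have hκ0 : 0 < κ := by positivity
  set n : ℝ := d * K ^ 2 with hn
  have hn0 : 0 ≤ n := by positivity
  have hnκ : n * κ = d * K / 2 := by simp only [hn, hκ]; field_simp
  set B : ℝ := V ^ 2 * K + 2 * V * n with hB
  set q₀ : ℝ := κ / (2 * V) with hq₀
  have hq₀0 : 0 < q₀ := by positivity
  refine ⟨Real.exp (-(B * h)) * q₀ ^ (-n), q₀, n, by positivity, hq₀0, hn0, fun δ hδ hδq => ?_⟩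
  set q : ℝ → ℝ := fun u => q₀ + (δ - q₀) * Real.exp (2 * V * (u - S.t)) with hq
  set q' : ℝ → ℝ := fun u => -κ + 2 * V * q u with hq'
  have hqd : ∀ u, HasDerivAt q (q' u) u := fun u => by
    have h1 : HasDerivAt (fun u => 2 * V * (u - S.t)) (2 * V) u := by
      simpa using ((hasDerivAt_id u).sub_const S.t).const_mul (2 * V)
    refine ((h1.exp.const_mul (δ - q₀)).const_add q₀).congr_deriv ?_
    simp only [hq', hq, hq₀]; field_simp; ring
  have hqc : Continuous q := continuous_iff_continuousAt.2 fun u => (hqd u).continuousAt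
  have hq'c : Continuous q' := by simp only [hq']; fun_prop
  have hqt : q S.t = δ := by simp [hq]
  have hexp : ∀ u ∈ Icc S.s S.t, Real.exp (2 * V * (u - S.t)) ≤ 1 := fun u hu => by
    rw [Real.exp_le_one_iff]
    exact mul_nonpos_of_nonneg_of_nonpos (by positivity) (by linarith [hu.2])
  have hqδ : ∀ u ∈ Icc S.s S.t, δ ≤ q u := fun u hu => by
    have := hexp u hu
    simp only [hq]
    nlinarith
  have hqs : q S.s ≤ q₀ := by
    simp only [hq]
    nlinarith [Real.exp_pos (2 * V * (S.s - S.t))]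
  set w : ℝ → ℝ := fun u => (B * (u - S.t) - n * Real.log (q u)) + d / 2 * Real.log (q u) with hw
  set w' : ℝ → ℝ := fun u => (B - n * (q' u / q u)) + d / 2 * (q' u / q u) with hw'
  have hwp : IsPath w w' S.s S.t := by
    refine IsPath.comp_real (f := w) (f' := w') (fun u hu => ?_) ?_ ?_ ?_
    · have h1 : HasDerivAt (fun u => B * (u - S.t)) B u := by
        simpa using ((hasDerivAt_id u).sub_const S.t).const_mul B
      have h2 := (hqd u).log (hδ.trans_le (hqδ u hu)).ne'
      exact (h1.sub (h2.const_mul _)).add (h2.const_mul _)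
    · have := hqc.measurable; fun_prop
    · have := hqc.measurable; have := hq'c.measurable; fun_prop
    · have h3 : ContinuousOn (fun u => q' u / q u) (Icc S.s S.t) :=
        hq'c.continuousOn.div hqc.continuousOn fun u hu => (hδ.trans_le (hqδ u hu)).ne'
      fun_prop
  have key := S.diff.integral_gaussD ⟨S.hst.le, le_rfl⟩ hwp hcp
    ((IsPath.of_hasDerivAt hqd hq'c S.s S.t).scalCov (d := d)) hδ
    (fun u hu k => by rw [quadForm_scalCov]; exact mul_le_mul_of_nonneg_right (hqδ u hu) (sq_nonneg _)) []
  have hpos : 0 ≤ ∫ u in S.s..S.t, ∫ ω, Real.exp (w u) *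
            genD (w' u) (S.b u (S.X u ω) - e) (S.a u (S.X u ω) + scalCov d (q' u)) [] (scalCov d (q u))
              (S.X u ω - c u) ∂S.P := by
    refine intervalIntegral.integral_nonneg S.hst.le fun u hu => integral_nonneg fun ω => ?_
    have hqu : 0 < q u := hδ.trans_le (hqδ u hu)
    simp only [hw', Pi.zero_apply]
    rw [genD_nil_scalCov hqu]
    set m := S.X u ω - c u with hm
    have hg : 0 ≤ gaussD [] (scalCov d (q u)) m := by rw [gaussD_nil_scalCov hqu]; positivity
    refine mul_nonneg (Real.exp_pos _).le (mul_nonneg hg ?_)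
    have b1 : |∑ i, m i * (S.b u (S.X u ω) - e) i| ≤ ‖m‖ * (V * (1 + ‖m‖)) :=
      (abs_sum_mul_le _ _).trans (mul_le_mul_of_nonneg_left (hdrift u hu _) (norm_nonneg _))
    have b2 : K⁻¹ * ‖m‖ ^ 2 / q u ^ 2 ≤ quadForm (S.a u (S.X u ω)) m / q u ^ 2 :=
      div_le_div_of_nonneg_right (S.ell u hu _ m) (by positivity)
    have b3 : (∑ i, S.a u (S.X u ω) i i) / q u ≤ d * K / q u := by
      refine div_le_div_of_nonneg_right ?_ hqu.le
      calc ∑ i, S.a u (S.X u ω) i i ≤ ∑ _i : Fin d, K :=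
            Finset.sum_le_sum fun i _ => (le_abs_self _).trans (S.bd u hu _ i i)
        _ = d * K := by simp
    have b5 : (∑ i, m i * (S.b u (S.X u ω) - e) i) / q u ≤ (‖m‖ * (V * (1 + ‖m‖))) / q u :=
      div_le_div_of_nonneg_right ((le_abs_self _).trans b1) hqu.le
    have e1 : q' u * ‖m‖ ^ 2 / q u ^ 2 = -κ * (‖m‖ / q u) ^ 2 + 2 * V * (‖m‖ ^ 2 / q u) := by
      simp only [hq']; field_simp
    have e2 : (‖m‖ * (V * (1 + ‖m‖))) / q u = V * (‖m‖ / q u) + V * (‖m‖ ^ 2 / q u) := by ring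
    have e3 : K⁻¹ * ‖m‖ ^ 2 / q u ^ 2 = K⁻¹ * (‖m‖ / q u) ^ 2 := by ring
    have e4 : B - n * (q' u / q u) = V ^ 2 * K + d * K / q u / 2 := by
      have : n * (q' u / q u) = -(n * κ) / q u + 2 * V * n := by
        simp only [hq']; field_simp
      rw [this, hnκ, hB]; ring
    have e5 : K⁻¹ / 4 * (‖m‖ / q u) ^ 2 - V * (‖m‖ / q u) + V ^ 2 * K
        = K⁻¹ / 4 * (‖m‖ / q u - 2 * V * K) ^ 2 := by field_simp; ring
    have e6 : 0 ≤ K⁻¹ / 4 * (‖m‖ / q u - 2 * V * K) ^ 2 := by positivity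
    rw [e2] at b5
    rw [e3] at b2
    rw [e1, e4]
    have e7 : κ * (‖m‖ / q u) ^ 2 = K⁻¹ / 2 * (‖m‖ / q u) ^ 2 := rfl
    linarith
  have hqs0 : 0 < q S.s := hδ.trans_le (hqδ _ ⟨le_rfl, S.hst.le⟩)
  have e1 : w S.t = -(n * Real.log δ) + d / 2 * Real.log δ := by simp [hw, hqt]
  have e2 : ∫ ω, Real.exp (w S.t) * gaussD [] (scalCov d (q S.t)) (S.X S.t ω - c S.t) ∂S.P
      = (2 * Real.pi) ^ ((d : ℝ) / 2) * Real.exp (-(n * Real.log δ)) *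
        ∫ ω, Real.exp (-‖S.X S.t ω - y‖ ^ 2 / (2 * δ)) ∂S.P := by
    simp only [hqt, hcy, e1, exp_log_mul_gaussD hδ, integral_const_mul]
  have e3 : ∫ ω, Real.exp (w S.s) * gaussD [] (scalCov d (q S.s)) (S.X S.s ω - c S.s) ∂S.P
      = (2 * Real.pi) ^ ((d : ℝ) / 2) * Real.exp (-(B * h) - n * Real.log (q S.s)) := by
    rw [S.integral_start fun z => Real.exp (w S.s) * gaussD [] (scalCov d (q S.s)) (z - c S.s)]
    simp only [hw, exp_log_mul_gaussD hqs0, hcs]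
    rw [sub_self, norm_zero, show -(0:ℝ) ^ 2 / (2 * q S.s) = 0 by simp, Real.exp_zero, mul_one,
      show B * (S.s - S.t) = -(B * h) by rw [hh]; ring]
  rw [e2, e3] at key
  have hpi : (0:ℝ) < (2 * Real.pi) ^ ((d : ℝ) / 2) := by positivity
  have h5 : Real.exp (-(B * h) - n * Real.log (q S.s)) ≤ Real.exp (-(n * Real.log δ)) *
      ∫ ω, Real.exp (-‖S.X S.t ω - y‖ ^ 2 / (2 * δ)) ∂S.P := by
    refine le_of_mul_le_mul_left ?_ hpi
    linarith
  have h6 : Real.exp (-(B * h)) * q₀ ^ (-n) ≤ Real.exp (-(B * h) - n * Real.log (q S.s)) := by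
    rw [Real.rpow_def_of_pos hq₀0, ← Real.exp_add]
    refine Real.exp_le_exp.2 ?_
    have := mul_le_mul_of_nonneg_left (Real.log_le_log hqs0 hqs) hn0
    linarith
  have h7 : Real.exp (-(n * Real.log δ)) * δ ^ n = 1 := by
    rw [Real.rpow_def_of_pos hδ, ← Real.exp_add]; simp [mul_comm]
  calc _ ≤ (Real.exp (-(n * Real.log δ)) * ∫ ω, Real.exp (-‖S.X S.t ω - y‖ ^ 2 / (2 * δ)) ∂S.P) * δ ^ n :=
        mul_le_mul_of_nonneg_right (h6.trans h5) (by positivity)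
    _ = _ := by rw [mul_right_comm, h7, one_mul]

/-- The law at the final time charges every ball. -/
theorem measure_ball_ne_zero (S : Setup d T K α β) (hK : 1 ≤ K) (y : Vec d) {r : ℝ} (hr : 0 < r) :
    S.P.map (S.X S.t) (Metric.ball y r) ≠ 0 := by
  intro h0
  obtain ⟨c₀, q₀, n, hc₀, hq₀, hn, H⟩ := S.exists_smoothed_mass_ge hK y
  rw [Measure.map_apply (S.diff.meas_Xt S.t) Metric.isOpen_ball.measurableSet] at h0
  have hae : ∀ᵐ ω ∂S.P, r ≤ ‖S.X S.t ω - y‖ := by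
    have : ∀ᵐ ω ∂S.P, ω ∉ S.X S.t ⁻¹' Metric.ball y r := measure_eq_zero_iff_ae_notMem.1 h0
    filter_upwards [this] with ω hω
    simpa [dist_eq_norm] using hω
  have hle : ∀ δ, 0 < δ → δ ≤ q₀ → c₀ * δ ^ n ≤ Real.exp (-(r ^ 2 / 2) / δ) := fun δ hδ hδq => by
    refine (H δ hδ hδq).trans ?_
    calc _ ≤ ∫ _ω, Real.exp (-(r ^ 2 / 2) / δ) ∂S.P := by
          refine integral_mono_of_nonneg (Filter.Eventually.of_forall fun ω => (Real.exp_pos _).le)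
            (integrable_const _) ?_
          filter_upwards [hae] with ω hω
          refine Real.exp_le_exp.2 ?_
          have e : -‖S.X S.t ω - y‖ ^ 2 / (2 * δ) = -(‖S.X S.t ω - y‖ ^ 2 / 2) / δ := by field_simp
          rw [e]
          exact div_le_div_of_nonneg_right (by nlinarith) hδ.le
      _ = _ := by simp
  obtain ⟨M, hM, hM'⟩ : ∃ M : ℝ, 0 < M ∧ ∀ δ : ℝ, 0 < δ → δ ≤ q₀ → c₀ ≤ M * δ := by
    have h1 := tendsto_rpow_mul_exp_neg_mul_atTop_nhds_zero (n + 1) (r ^ 2 / 2) (by positivity)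
    obtain ⟨A, hA⟩ := (Filter.eventually_atTop.1 (h1.eventually (gt_mem_nhds one_pos)))
    refine ⟨max 1 (c₀ * max A 1), lt_max_of_lt_left one_pos, fun δ hδ hδq => ?_⟩
    by_cases hAd : A ≤ 1 / δ
    · have h2 := hA _ hAd
      have h3 := hle δ hδ hδq
      have h4 : (1 / δ) ^ (n + 1) = (δ ^ n * δ)⁻¹ := by
        rw [Real.div_rpow zero_le_one hδ.le, Real.one_rpow, Real.rpow_add_one hδ.ne', one_div]
      have h5 : -(r ^ 2 / 2) * (1 / δ) = -(r ^ 2 / 2) / δ := by ring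
      rw [h4, h5, inv_mul_lt_iff₀ (by positivity), mul_one] at h2
      have h6 : c₀ < δ := by
        have h7 : δ ^ n * c₀ < δ ^ n * δ := by linarith
        exact lt_of_mul_lt_mul_left h7 (by positivity)
      nlinarith [le_max_left 1 (c₀ * max A 1)]
    · have h2 : 1 / δ < max A 1 := (not_le.1 hAd).trans_le (le_max_left _ _)
      rw [div_lt_iff₀ hδ] at h2
      have h3 : c₀ * 1 ≤ c₀ * (max A 1 * δ) := mul_le_mul_of_nonneg_left h2.le hc₀.le
      nlinarith [le_max_right 1 (c₀ * max A 1)]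
  have h1 := hM' (min q₀ (c₀ / (2 * M))) (by positivity) (min_le_left _ _)
  have h2 := mul_le_mul_of_nonneg_left (min_le_right q₀ (c₀ / (2 * M))) hM.le
  have h3 : M * (c₀ / (2 * M)) = c₀ / 2 := by field_simp
  linarith

/-- A continuous density of the law at the final time is nonnegative. -/
theorem density_nonneg (S : Setup d T K α β) (hK : 1 ≤ K) {p : Vec d → ℝ} (hp : Continuous p)
    (hd : S.P.map (S.X S.t) = volume.withDensity fun y => ENNReal.ofReal (p y)) (y : Vec d) : 0 ≤ p y := by
  by_contra hy
  have ho : IsOpen {z | p z < 0} := isOpen_lt hp continuous_const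
  obtain ⟨r, hr, hb⟩ := Metric.isOpen_iff.1 ho y (not_le.1 hy)
  refine S.measure_ball_ne_zero hK y hr ?_
  rw [hd, withDensity_apply _ Metric.isOpen_ball.measurableSet]
  rw [setLIntegral_congr_fun (g := fun _ => 0) Metric.isOpen_ball.measurableSet
    (fun z hz => ENNReal.ofReal_of_nonpos (le_of_lt (hb hz)))]
  simp

end Setup

lemma norm_coordR_le {d : ℕ} (i : Fin d) : ‖(coordR i : Vec d →L[ℝ] ℝ)‖ ≤ 1 :=
  ContinuousLinearMap.opNorm_le_bound _ zero_le_one fun x => by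
    simpa using PiLp.norm_apply_le x i

lemma norm_sum_smul_coordR_le {d : ℕ} (g : Fin d → ℝ) {B : ℝ} (h : ∀ i, |g i| ≤ B) :
    ‖∑ i, g i • (coordR i : Vec d →L[ℝ] ℝ)‖ ≤ d * B := by
  calc _ ≤ ∑ _i : Fin d, B := norm_sum_le_of_le _ fun i _ => by
        rw [norm_smul, Real.norm_eq_abs]
        exact (mul_le_of_le_one_right (abs_nonneg _) (norm_coordR_le i)).trans (h i)
    _ = d * B := by simp

section Density
variable {d : ℕ} {ν : Measure (Vec d)} [IsProbabilityMeasure ν]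

lemma exists_abs_gaussD_scalCov_le (L : List (Fin d)) {δ : ℝ} (hδ : 0 < δ) :
    ∃ B : ℝ, ∀ m, |gaussD L (scalCov d δ) m| ≤ B := by
  obtain ⟨K, l, hK, hl, h⟩ := exists_gaussD_le_of_length_le d 1 le_rfl L.length
  refine ⟨K * δ ^ ((-(L.length : ℝ) - d) / 2), fun m => (h δ _ hδ (covBetween_scalCov le_rfl hδ) L le_rfl m).trans ?_⟩
  refine mul_le_of_le_one_right (by positivity) (Real.exp_le_one_iff.2 ?_)
  rw [neg_mul, neg_div]
  exact neg_nonpos.2 (by positivity)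

lemma hasFDerivAt_gaussD_scalCov (L : List (Fin d)) {δ : ℝ} (hδ : 0 < δ) (m : Vec d) :
    HasFDerivAt (gaussD L (scalCov d δ)) (∑ i, gaussD (i :: L) (scalCov d δ) m • coordR i) m :=
  hasFDerivAt_gaussD hδ (fun k => by rw [quadForm_scalCov]) L m

lemma continuous_gaussD_scalCov (L : List (Fin d)) {δ : ℝ} (hδ : 0 < δ) :
    Continuous (gaussD L (scalCov d δ)) :=
  continuous_iff_continuousAt.2 fun m => (hasFDerivAt_gaussD_scalCov L hδ m).continuousAt

/-- The Gaussian smoothing of a probability measure is continuous. -/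
lemma continuous_smoothing (L : List (Fin d)) {δ : ℝ} (hδ : 0 < δ) :
    Continuous fun y => ∫ z, gaussD L (scalCov d δ) (z - y) ∂ν := by
  obtain ⟨B, hB⟩ := exists_abs_gaussD_scalCov_le L hδ
  have hc := continuous_gaussD_scalCov L hδ
  refine continuous_of_dominated (bound := fun _ => B) (fun y => ?_) (fun y => ?_) (integrable_const _) ?_
  · exact (hc.comp (continuous_sub_right y)).aestronglyMeasurable
  · exact Filter.Eventually.of_forall fun z => hB _
  · exact Filter.Eventually.of_forall fun z => hc.comp (continuous_sub_left z)

/-- Differentiation of the Gaussian smoothing of a probability measure. -/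
lemma hasFDerivAt_smoothing {δ : ℝ} (hδ : 0 < δ) (y : Vec d) :
    HasFDerivAt (fun y => ∫ z, gaussD [] (scalCov d δ) (z - y) ∂ν)
      (∑ i, (-∫ z, gaussD [i] (scalCov d δ) (z - y) ∂ν) • coordR i) y := by
  choose B hB using fun i : Fin d => exists_abs_gaussD_scalCov_le [i] hδ
  have hc := continuous_gaussD_scalCov (d := d) [] hδ
  have hint : ∀ L : List (Fin d), ∀ y, Integrable (fun z => gaussD L (scalCov d δ) (z - y)) ν := fun L y =>
    integrable_gaussD_comp le_rfl hδ (covBetween_scalCov le_rfl hδ) (measurable_id.sub_const y) L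
  have key := hasFDerivAt_integral_of_dominated_of_fderiv_le (𝕜 := ℝ) (μ := ν)
    (F := fun y z => gaussD [] (scalCov d δ) (z - y))
    (F' := fun y z => ∑ i, (-gaussD [i] (scalCov d δ) (z - y)) • coordR i) (x₀ := y)
    (s := univ) (bound := fun _ => ∑ i : Fin d, B i) Filter.univ_mem
    (Filter.Eventually.of_forall fun y => (hint [] y).aestronglyMeasurable) (hint [] y)
    (Continuous.aestronglyMeasurable (by
      have := fun i : Fin d => (continuous_gaussD_scalCov [i] hδ).comp (continuous_sub_right y)
      exact continuous_finsetSum _ fun i _ => (this i).neg.smul continuous_const))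
    (Filter.Eventually.of_forall fun z y _ => norm_sum_le_of_le _ fun i _ => by
      rw [norm_smul, norm_neg, Real.norm_eq_abs]
      exact (mul_le_of_le_one_right (abs_nonneg _) (norm_coordR_le i)).trans (hB i _))
    (integrable_const _)
    (Filter.Eventually.of_forall fun z y _ => by
      have h1 : HasFDerivAt (fun y => z - y) (-ContinuousLinearMap.id ℝ (Vec d)) y := by
        simpa using (hasFDerivAt_id y).const_sub z
      refine ((hasFDerivAt_gaussD_scalCov [] hδ (z - y)).comp y h1).congr_fderiv ?_
      ext v
      simp [_root_.sum_apply])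
  refine key.congr_fderiv ?_
  have hi : ∀ i : Fin d, Integrable (fun z => (-gaussD [i] (scalCov d δ) (z - y)) • (coordR i : Vec d →L[ℝ] ℝ)) ν :=
    fun i => (hint [i] y).neg.smul_const _
  rw [integral_finsetSum _ fun i _ => hi i]
  refine Finset.sum_congr rfl fun i _ => ?_
  rw [integral_smul_const, integral_neg]

/-- The Gaussian smoothings of a continuous density converge to a multiple of the density. -/
lemma tendsto_smoothing {p : Vec d → ℝ} (hp : Continuous p) (h0 : ∀ y, 0 ≤ p y)
    (hν : ν = volume.withDensity fun y => ENNReal.ofReal (p y)) (y : Vec d) :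
    Filter.Tendsto (fun c : ℝ => ∫ z, gaussD [] (scalCov d (c ^ 2)⁻¹) (z - y) ∂ν) Filter.atTop
      (nhds ((2 * Real.pi) ^ d * p y)) := by
  have hpi : 0 < 2 * Real.pi := by positivity
  have hint : Integrable p volume := by
    refine ⟨hp.aestronglyMeasurable, ?_⟩
    have h1 : ∫⁻ y, ENNReal.ofReal (p y) = 1 := by
      have := measure_univ (μ := ν)
      rw [hν, withDensity_apply _ MeasurableSet.univ, Measure.restrict_univ] at this
      exact this
    rw [hasFiniteIntegral_iff_ofReal (Filter.Eventually.of_forall h0), h1]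
    exact ENNReal.one_lt_top
  set φ : Vec d → ℝ := fun z => ((2 * Real.pi) ^ ((d : ℝ) / 2))⁻¹ * Real.exp (-(1 / 2) * ‖z‖ ^ 2) with hφ
  have hφ1 : ∫ z, φ z = 1 := by
    simp only [hφ, integral_const_mul]
    rw [GaussianFourier.integral_rexp_neg_mul_sq_norm (by norm_num : (0:ℝ) < 1 / 2)]
    rw [finrank_euclideanSpace_fin, show Real.pi / (1 / 2) = 2 * Real.pi by ring]
    exact inv_mul_cancel₀ (by positivity)
  have hφt : Filter.Tendsto (fun z : Vec d => ‖z‖ ^ Module.finrank ℝ (Vec d) * φ z) (Bornology.cobounded _) (nhds 0) := by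
    have h1 := tendsto_rpow_mul_exp_neg_mul_atTop_nhds_zero (d : ℝ) (1 / 2) (by norm_num)
    have h2 : Filter.Tendsto (fun r : ℝ => r ^ d * (((2 * Real.pi) ^ ((d : ℝ) / 2))⁻¹ * Real.exp (-(1 / 2) * r ^ 2)))
        Filter.atTop (nhds 0) := by
      have h3 := h1.const_mul ((2 * Real.pi) ^ ((d : ℝ) / 2))⁻¹
      rw [mul_zero] at h3
      refine squeeze_zero' ?_ ?_ h3
      · filter_upwards [Filter.eventually_ge_atTop (1:ℝ)] with r hr
        positivity
      · filter_upwards [Filter.eventually_ge_atTop (1:ℝ)] with r hr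
        rw [Real.rpow_natCast, mul_left_comm]
        refine mul_le_mul_of_nonneg_left (mul_le_mul_of_nonneg_left (Real.exp_le_exp.2 ?_) (by positivity)) (by positivity)
        nlinarith
    rw [finrank_euclideanSpace_fin]
    exact h2.comp tendsto_norm_cobounded_atTop
  have key := tendsto_integral_comp_smul_smul_of_integrable' (μ := volume) (φ := φ)
    (fun z => by simp only [hφ]; positivity) hφ1 hφt hint hp.continuousAt (x₀ := y)
  refine (key.const_mul ((2 * Real.pi) ^ d)).congr' ?_
  filter_upwards [Filter.eventually_gt_atTop (0:ℝ)] with c hc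
  rw [hν, integral_withDensity_eq_integral_toReal_smul₀ (hp.measurable.ennreal_ofReal.aemeasurable)
    (Filter.Eventually.of_forall fun _ => ENNReal.ofReal_lt_top), ← integral_const_mul]
  refine integral_congr_ae (Filter.Eventually.of_forall fun z => ?_)
  simp only [ENNReal.toReal_ofReal (h0 z), smul_eq_mul, hφ]
  rw [gaussD_nil_scalCov (by positivity), finrank_euclideanSpace_fin, norm_smul, Real.norm_of_nonneg hc.le]
  have e1 : (2 * Real.pi / (c ^ 2)⁻¹) ^ ((d : ℝ) / 2) = (2 * Real.pi) ^ ((d : ℝ) / 2) * c ^ d := by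
    rw [div_inv_eq_mul, Real.mul_rpow hpi.le (by positivity), ← Real.rpow_natCast c 2, ← Real.rpow_mul hc.le,
      ← Real.rpow_natCast c d]
    congr 2; push_cast; ring
  have e2 : (2 * Real.pi) ^ d = (2 * Real.pi) ^ ((d : ℝ) / 2) * (2 * Real.pi) ^ ((d : ℝ) / 2) := by
    rw [← Real.rpow_add hpi, add_halves, Real.rpow_natCast]
  have e3 : -‖z - y‖ ^ 2 / (2 * (c ^ 2)⁻¹) = -(1 / 2) * (c * ‖y - z‖) ^ 2 := by
    rw [norm_sub_rev z y]; field_simp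
  rw [e1, e2, e3]
  have : (2 * Real.pi) ^ ((d : ℝ) / 2) ≠ 0 := by positivity
  field_simp

/-- If the gradients of the Gaussian smoothings converge uniformly, then the density is `C¹`. -/
theorem contDiff_density {p : Vec d → ℝ} (hp : Continuous p) (h0 : ∀ y, 0 ≤ p y)
    (hν : ν = volume.withDensity fun y => ENNReal.ofReal (p y)) {τ : ℝ} (hτ : 0 < τ) {ε : ℝ → ℝ}
    (hε : Filter.Tendsto ε (nhdsWithin 0 (Ioi 0)) (nhds 0))
    (hC : ∀ y i δ δ', 0 < δ → δ ≤ δ' → δ' ≤ τ →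
      |∫ z, gaussD [i] (scalCov d δ') (z - y) ∂ν - ∫ z, gaussD [i] (scalCov d δ) (z - y) ∂ν| ≤ ε δ')
    {F : Vec d → ℝ} (hF : ∀ y i δ, 0 < δ → δ ≤ τ → |∫ z, gaussD [i] (scalCov d δ) (z - y) ∂ν| ≤ F y) :
    ContDiff ℝ 1 p ∧ ∀ y, ‖fderiv ℝ p y‖ ≤ d * F y := by
  obtain ⟨n₀, hn₀⟩ := exists_nat_gt (1 / τ + 1)
  have hn1 : 1 / τ + 1 < (n₀ : ℝ) := hn₀
  have hτi : 0 < 1 / τ := by positivity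
  set c : ℕ → ℝ := fun n => (n : ℝ) + n₀ with hc
  have hc1 : ∀ n, 1 / τ + 1 < c n := fun n => by
    have : (0:ℝ) ≤ n := n.cast_nonneg
    simp only [hc]; linarith
  have hcat : Filter.Tendsto c Filter.atTop Filter.atTop :=
    Filter.tendsto_atTop_add_const_right _ _ tendsto_natCast_atTop_atTop
  set δ : ℕ → ℝ := fun n => (c n ^ 2)⁻¹ with hδ
  have hδ0 : ∀ n, 0 < δ n := fun n => by
    have := hc1 n
    have : 0 < c n := by linarith
    positivity
  have hδτ : ∀ n, δ n ≤ τ := fun n => by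
    have h1 := hc1 n
    have h2 : τ⁻¹ ≤ c n ^ 2 := by rw [← one_div]; nlinarith
    simpa [hδ] using inv_anti₀ (by positivity : 0 < τ⁻¹) h2
  have hδm : ∀ m n, m ≤ n → δ n ≤ δ m := fun m n hmn => by
    have h1 := hc1 m
    have h2 : c m ≤ c n := by simp only [hc]; exact add_le_add_left (Nat.cast_le.2 hmn) _
    refine inv_anti₀ (by nlinarith) ?_
    nlinarith
  have hδt : Filter.Tendsto δ Filter.atTop (nhdsWithin 0 (Ioi 0)) := by
    refine tendsto_nhdsWithin_iff.2 ⟨?_, Filter.Eventually.of_forall hδ0⟩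
    exact tendsto_inv_atTop_zero.comp ((Filter.tendsto_pow_atTop two_ne_zero).comp hcat)
  have hεt := hε.comp hδt
  set G : Fin d → ℕ → Vec d → ℝ := fun i n y => ∫ z, gaussD [i] (scalCov d (δ n)) (z - y) ∂ν with hG
  have hGC : ∀ i y m n, m ≤ n → |G i m y - G i n y| ≤ ε (δ m) := fun i y m n hmn =>
    hC y i _ _ (hδ0 n) (hδm m n hmn) (hδτ m)
  have hcau : ∀ i y, ∃ g, Filter.Tendsto (fun n => G i n y) Filter.atTop (nhds g) := fun i y => by
    refine cauchySeq_tendsto_of_complete (Metric.cauchySeq_iff'.2 fun η hη => ?_)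
    obtain ⟨m, hm⟩ := (hεt.eventually (gt_mem_nhds hη)).exists
    refine ⟨m, fun n hn => ?_⟩
    rw [dist_comm, Real.dist_eq]
    exact (hGC i y m n hn).trans_lt hm
  choose g hg using hcau
  have hGg : ∀ i y m, |G i m y - g i y| ≤ ε (δ m) := fun i y m => by
    refine le_of_tendsto ((hg i y).const_sub (G i m y)).abs ?_
    filter_upwards [Filter.eventually_ge_atTop m] with n hn using hGC i y m n hn
  have hgF : ∀ i y, |g i y| ≤ F y := fun i y =>
    le_of_tendsto (hg i y).abs (Filter.Eventually.of_forall fun n => hF y i _ (hδ0 n) (hδτ n))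
  have hunif : ∀ i, TendstoUniformly (G i) (g i) Filter.atTop := fun i =>
    Metric.tendstoUniformly_iff.2 fun η hη => by
      filter_upwards [hεt.eventually (gt_mem_nhds hη)] with n hn y
      rw [dist_comm, Real.dist_eq]
      exact (hGg i y n).trans_lt hn
  have hgc : ∀ i, Continuous (g i) := fun i =>
    (hunif i).continuous (Filter.Frequently.of_forall fun n => continuous_smoothing [i] (hδ0 n))
  have hunif' : TendstoUniformly (fun n y => ∑ i, (-G i n y) • (coordR i : Vec d →L[ℝ] ℝ))
      (fun y => ∑ i, (-g i y) • (coordR i : Vec d →L[ℝ] ℝ)) Filter.atTop := by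
    refine Metric.tendstoUniformly_iff.2 fun η hη => ?_
    have h1 : Filter.Tendsto (fun n => (d : ℝ) * ε (δ n)) Filter.atTop (nhds 0) := by
      simpa using hεt.const_mul (d : ℝ)
    filter_upwards [h1.eventually (gt_mem_nhds hη)] with n hn y
    have e : (∑ i, (-g i y) • (coordR i : Vec d →L[ℝ] ℝ)) - ∑ i, (-G i n y) • (coordR i : Vec d →L[ℝ] ℝ)
        = ∑ i, (-g i y - -G i n y) • (coordR i : Vec d →L[ℝ] ℝ) := by
      rw [← Finset.sum_sub_distrib]
      exact Finset.sum_congr rfl fun i _ => (sub_smul _ _ _).symm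
    rw [dist_eq_norm, e]
    refine (norm_sum_smul_coordR_le _ fun i => ?_).trans_lt hn
    rw [show -g i y - -G i n y = G i n y - g i y by ring]
    exact hGg i y n
  have hder : ∀ y, HasFDerivAt (fun y => (2 * Real.pi) ^ d * p y) (∑ i, (-g i y) • coordR i) y := fun y =>
    hasFDerivAt_of_tendstoUniformly hunif' (fun n y => hasFDerivAt_smoothing (hδ0 n) y)
      (fun y => (tendsto_smoothing hp h0 hν y).comp hcat) y
  have hpi : (1:ℝ) ≤ (2 * Real.pi) ^ d := one_le_pow₀ (by linarith [Real.pi_gt_three])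
  have hder' : ∀ y, HasFDerivAt p (((2 * Real.pi) ^ d)⁻¹ • ∑ i, (-g i y) • coordR i) y := fun y => by
    have h1 := (hder y).const_mul ((2 * Real.pi) ^ d)⁻¹
    have : (2 * Real.pi) ^ d ≠ 0 := by positivity
    simpa [← mul_assoc, inv_mul_cancel₀ this] using h1
  have hfd : fderiv ℝ p = fun y => ((2 * Real.pi) ^ d)⁻¹ • ∑ i, (-g i y) • coordR i :=
    funext fun y => (hder' y).fderiv
  refine ⟨contDiff_one_iff_fderiv.2 ⟨fun y => (hder' y).differentiableAt, ?_⟩, fun y => ?_⟩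
  · rw [hfd]
    have h1 : Continuous fun y => ∑ i, (-g i y) • (coordR i : Vec d →L[ℝ] ℝ) :=
      continuous_finsetSum _ fun i _ => (hgc i).neg.smul continuous_const
    exact h1.const_smul (((2 * Real.pi) ^ d)⁻¹ : ℝ)
  · rw [hfd, norm_smul]
    refine (mul_le_of_le_one_left (norm_nonneg _) ?_).trans (norm_sum_smul_coordR_le _ fun i => ?_)
    · rw [norm_inv, Real.norm_of_nonneg (by positivity)]
      exact inv_le_one_of_one_le₀ hpi
    · rw [abs_neg]; exact hgF i y

end Density

/-- Gradient bound for a continuous density, given reference paths ending at every point. -/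
theorem Setup.exists_density_gradient_bound (d : ℕ) (T K α β : ℝ) (hT : 0 < T) (hK : 1 ≤ K) (hα : 0 < α)
    (hα1 : α ≤ 1) (hβ : 0 < β) (hβ1 : β ≤ 1) :
    ∃ M l : ℝ, 0 < M ∧ 0 < l ∧ ∀ (τ : ℝ) (ν : Measure (Vec d)) (p : Vec d → ℝ), Continuous p →
      (ν = volume.withDensity fun y => ENNReal.ofReal (p y)) →
      ∀ S : Vec d → Setup d T K α β, (∀ y, (S y).t - (S y).s = τ) →
      (∀ y, (S y).P.map ((S y).X (S y).t) = ν) → (∀ y, (S y).θ (S y).t = y) →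
      ContDiff ℝ 1 p ∧ ∀ y, ‖fderiv ℝ p y‖ ≤ M * τ ^ (-(1:ℝ) / 2) * (S y).heat l τ := by
  obtain ⟨M, l, hM, hl, H⟩ := Setup.exists_gradient_bound d T K α β hT hK hα hα1 hβ hβ1
  refine ⟨d * M + 1, l, by positivity, hl, fun τ ν p hp hν S hτ hS hθ => ?_⟩
  have hτ0 : 0 < τ := by rw [← hτ 0]; exact sub_pos.2 (S 0).hst
  have h0 : ∀ y, 0 ≤ p y := (S 0).density_nonneg hK hp ((hS 0).trans hν)
  haveI : IsProbabilityMeasure ν := by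
    rw [← hS 0]; exact Measure.isProbabilityMeasure_map ((S 0).diff.meas_Xt _).aemeasurable
  have hint : ∀ y i δ, 0 < δ → ∫ z, gaussD [i] (scalCov d δ) (z - y) ∂ν
      = ∫ ω, gaussD [i] (scalCov d δ) ((S y).X (S y).t ω - (S y).θ (S y).t) ∂(S y).P := fun y i δ hδ => by
    rw [← hS y, hθ y, integral_map ((S y).diff.meas_Xt _).aemeasurable]
    exact ((continuous_gaussD_scalCov [i] hδ).comp (continuous_sub_right y)).aestronglyMeasurable
  have hheat : ∀ y, (S y).heat l τ ≤ τ ^ (-(d : ℝ) / 2) := fun y => by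
    refine mul_le_of_le_one_right (by positivity) (Real.exp_le_one_iff.2 ?_)
    rw [neg_mul, neg_div]
    exact neg_nonpos.2 (by positivity)
  set γ := min α β / 2 with hγ
  have hγ0 : 0 < γ := by have := lt_min hα hβ; positivity
  set ε : ℝ → ℝ := fun δ => M * (δ * τ ^ (-(3:ℝ) / 2) + δ ^ γ / γ + 2 * δ ^ ((1:ℝ) / 2) * τ ^ (-(1:ℝ) / 2))
    * τ ^ (-(d : ℝ) / 2) with hε
  have hεt : Filter.Tendsto ε (nhdsWithin 0 (Ioi 0)) (nhds 0) := by
    have h1 : ContinuousAt ε 0 := by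
      have h2 : ContinuousAt (fun δ : ℝ => δ ^ γ) 0 := Real.continuousAt_rpow_const _ _ (Or.inr hγ0.le)
      have h3 : ContinuousAt (fun δ : ℝ => δ ^ ((1:ℝ) / 2)) 0 :=
        Real.continuousAt_rpow_const _ _ (Or.inr (by norm_num))
      simp only [hε]
      fun_prop
    have h4 : ε 0 = 0 := by
      simp [hε, Real.zero_rpow hγ0.ne', Real.zero_rpow (by norm_num : (2:ℝ)⁻¹ ≠ 0)]
    have := h1.tendsto
    rw [h4] at this
    exact this.mono_left nhdsWithin_le_nhds
  obtain ⟨h1, h2⟩ := contDiff_density (ν := ν) hp h0 hν hτ0 hεt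
    (fun y i δ δ' hδ hδδ hδτ => by
      have h := (H (S y) i).2 δ δ' hδ hδδ (by rwa [hτ y])
      rw [hτ y] at h
      rw [hint y i δ hδ, hint y i δ' (hδ.trans_le hδδ)]
      have : 0 < δ' := hδ.trans_le hδδ
      exact h.trans (mul_le_mul_of_nonneg_left (hheat y) (by positivity)))
    (F := fun y => M * τ ^ (-(1:ℝ) / 2) * (S y).heat l τ)
    (fun y i δ hδ hδτ => by
      have h := (H (S y) i).1 δ hδ (by rwa [hτ y])
      rw [hτ y] at h
      rwa [hint y i δ hδ])
  refine ⟨h1, fun y => (h2 y).trans ?_⟩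
  have := (S y).heat_pos l hτ0
  have h3 : 0 ≤ τ ^ (-(1:ℝ) / 2) * (S y).heat l τ := by positivity
  nlinarith

lemma quadForm_sqMat {d : ℕ} (σ : ℝ → Vec d → Matrix (Fin d) (Fin d) ℝ) (t : ℝ) (z k : Vec d) :
    quadForm (fun i j => sqMat d σ t z i j) k = (sqMat d σ t z).mulVec (fun i => k i) ⬝ᵥ fun i => k i := by
  simp only [quadForm, mulVec, dotProduct, Finset.sum_mul]
  exact Finset.sum_congr rfl fun i _ => Finset.sum_congr rfl fun j _ => by ring

lemma dotProduct_self_eq_norm_sq {d : ℕ} (k : Vec d) : (fun i => k i) ⬝ᵥ (fun i => k i) = ‖k‖ ^ 2 := by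
  rw [EuclideanSpace.real_norm_sq_eq]
  exact Finset.sum_congr rfl fun i _ => by ring

/-- First order Taylor expansion of a function with Hölder continuous derivative. -/
lemma abs_taylor_le {E : Type*} [NormedAddCommGroup E] [NormedSpace ℝ E] {f : E → ℝ} {C α : ℝ} (hα : 0 ≤ α)
    (hC : 0 ≤ C) (hf : Differentiable ℝ f) (h : ∀ z w, ‖fderiv ℝ f z - fderiv ℝ f w‖ ≤ C * ‖z - w‖ ^ α) (z w : E) :
    |f z - f w - fderiv ℝ f w (z - w)| ≤ C * ‖z - w‖ ^ α * ‖z - w‖ := by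
  refine (convex_closedBall w ‖z - w‖).norm_image_sub_le_of_norm_fderiv_le' (𝕜 := ℝ) (f := f)
    (φ := fderiv ℝ f w) (fun x _ => hf x) (fun x hx => (h x w).trans ?_) (by simp) (by simp [dist_eq_norm])
  refine mul_le_mul_of_nonneg_left (Real.rpow_le_rpow (norm_nonneg _) ?_ hα) hC
  simpa [dist_eq_norm] using hx

namespace EllipticHolder
variable {d : ℕ} {σ : ℝ → Vec d → Matrix (Fin d) (Fin d) ℝ} {κ₀ κ₂ α : ℝ}

lemma measurable_sqMat (h : EllipticHolder d σ κ₀ α) :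
    Measurable (Function.uncurry fun r z => fun i j => sqMat d σ r z i j) := by
  refine measurable_pi_iff.2 fun i => measurable_pi_iff.2 fun j => ?_
  simp only [Function.uncurry, sqMat, mul_apply, transpose_apply]
  exact Finset.measurable_sum _ fun l _ => (h.1 i l).mul (h.1 j l)

lemma le_quadForm (h : EllipticHolder d σ κ₀ α) {r : ℝ} (hr : 0 ≤ r) (z k : Vec d) :
    κ₀⁻¹ * ‖k‖ ^ 2 ≤ quadForm (fun i j => sqMat d σ r z i j) k := by
  rw [quadForm_sqMat, ← dotProduct_self_eq_norm_sq]
  exact (h.2.1 r hr z _).1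

lemma abs_le (h : EllipticHolder d σ κ₀ α) (hκ : 1 ≤ κ₀) {r : ℝ} (hr : 0 ≤ r) (z : Vec d) (i j : Fin d) :
    |σ r z i j| ≤ κ₀ := by
  have h1 := (h.2.1 r hr z (fun l => if l = i then 1 else 0)).2
  have e1 : (sqMat d σ r z).mulVec (fun l => if l = i then 1 else 0) ⬝ᵥ (fun l => if l = i then (1:ℝ) else 0)
      = ∑ l, σ r z i l * σ r z i l := by
    simp [mulVec, dotProduct, sqMat, mul_apply]
  have e2 : (fun l => if l = i then (1:ℝ) else 0) ⬝ᵥ (fun l => if l = i then (1:ℝ) else 0) = 1 := by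
    simp [dotProduct]
  rw [e1, e2, mul_one] at h1
  have h2 : σ r z i j * σ r z i j ≤ κ₀ :=
    (Finset.single_le_sum (f := fun l => σ r z i l * σ r z i l) (fun l _ => mul_self_nonneg _)
      (Finset.mem_univ j)).trans h1
  refine abs_le_of_sq_le_sq ?_ (by linarith)
  nlinarith

lemma abs_sqMat_le (h : EllipticHolder d σ κ₀ α) (hκ : 1 ≤ κ₀) {r : ℝ} (hr : 0 ≤ r) (z : Vec d) (i j : Fin d) :
    |sqMat d σ r z i j| ≤ d * κ₀ ^ 2 := by
  simp only [sqMat, mul_apply, transpose_apply]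
  refine (Finset.abs_sum_le_sum_abs _ _).trans ?_
  calc _ ≤ ∑ _l : Fin d, κ₀ ^ 2 := Finset.sum_le_sum fun l _ => by
        rw [abs_mul, sq]
        exact mul_le_mul (h.abs_le hκ hr z i l) (h.abs_le hκ hr z j l) (abs_nonneg _) (by linarith)
    _ = _ := by simp

lemma abs_sub_le_of_fderiv (hd : ∀ t' : ℝ, 0 ≤ t' → ∀ i j : Fin d, Differentiable ℝ fun z => σ t' z i j)
    (hb : ∀ t' : ℝ, 0 ≤ t' → ∀ z : Vec d, ∀ i j : Fin d, ‖fderiv ℝ (fun w => σ t' w i j) z‖ ≤ κ₂)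
    {r : ℝ} (hr : 0 ≤ r) (z w : Vec d) (i j : Fin d) : |σ r z i j - σ r w i j| ≤ κ₂ * ‖z - w‖ :=
  convex_univ.norm_image_sub_le_of_norm_fderiv_le (𝕜 := ℝ) (f := fun z => σ r z i j)
    (fun x _ => hd r hr i j x) (fun x _ => hb r hr x i j) (mem_univ w) (mem_univ z)

lemma abs_sqMat_sub_le (h : EllipticHolder d σ κ₀ α) (hκ : 1 ≤ κ₀)
    (hd : ∀ t' : ℝ, 0 ≤ t' → ∀ i j : Fin d, Differentiable ℝ fun z => σ t' z i j)
    (hb : ∀ t' : ℝ, 0 ≤ t' → ∀ z : Vec d, ∀ i j : Fin d, ‖fderiv ℝ (fun w => σ t' w i j) z‖ ≤ κ₂)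
    {r : ℝ} (hr : 0 ≤ r) (z w : Vec d) (i j : Fin d) :
    |sqMat d σ r z i j - sqMat d σ r w i j| ≤ 2 * d * κ₀ * κ₂ * ‖z - w‖ := by
  simp only [sqMat, mul_apply, transpose_apply]
  rw [← Finset.sum_sub_distrib]
  refine (Finset.abs_sum_le_sum_abs _ _).trans ?_
  calc _ ≤ ∑ _l : Fin d, 2 * κ₀ * κ₂ * ‖z - w‖ := Finset.sum_le_sum fun l _ => by
        have e : σ r z i l * σ r z j l - σ r w i l * σ r w j l
            = σ r z i l * (σ r z j l - σ r w j l) + σ r w j l * (σ r z i l - σ r w i l) := by ring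
        rw [e]
        refine (abs_add_le _ _).trans ?_
        rw [abs_mul, abs_mul]
        have h1 := mul_le_mul (h.abs_le hκ hr z i l) (abs_sub_le_of_fderiv hd hb hr z w j l) (abs_nonneg _)
          (by linarith)
        have h2 := mul_le_mul (h.abs_le hκ hr w j l) (abs_sub_le_of_fderiv hd hb hr z w i l) (abs_nonneg _)
          (by linarith)
        linarith
    _ = _ := by simp; ring

lemma exists_sqMat_expansion (h : EllipticHolder d σ κ₀ α) (hκ : 1 ≤ κ₀) (hκ₂ : 0 ≤ κ₂) (hα : 0 ≤ α)
    (hd : ∀ t' : ℝ, 0 ≤ t' → ∀ i j : Fin d, Differentiable ℝ fun z => σ t' z i j)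
    (hb : ∀ t' : ℝ, 0 ≤ t' → ∀ z : Vec d, ∀ i j : Fin d, ‖fderiv ℝ (fun w => σ t' w i j) z‖ ≤ κ₂)
    (hh : ∀ t' : ℝ, 0 ≤ t' → ∀ z w : Vec d, ∀ i j : Fin d,
      ‖fderiv ℝ (fun v => σ t' v i j) z - fderiv ℝ (fun v => σ t' v i j) w‖ ≤ κ₂ * ‖z - w‖ ^ α)
    {r : ℝ} (hr : 0 ≤ r) (w : Vec d) :
    ∃ D : Fin d → Fin d → Fin d → ℝ, (∀ i j l, |D i j l| ≤ 3 * d * κ₀ * κ₂) ∧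
      ∀ z i j, |sqMat d σ r z i j - sqMat d σ r w i j - ∑ l, D i j l * (z - w) l|
        ≤ 3 * d * κ₀ * κ₂ * ‖z - w‖ ^ (1 + α) := by
  set g : Fin d → Fin d → (Vec d →L[ℝ] ℝ) := fun i j => fderiv ℝ (fun v => σ r v i j) w with hg
  set e : Fin d → Vec d := fun l => EuclideanSpace.single l 1 with he
  have hgl : ∀ i j l, |g i j (e l)| ≤ κ₂ := fun i j l => by
    have := (g i j).le_opNorm (e l)
    rw [show ‖e l‖ = 1 by simp [he], mul_one] at this
    exact this.trans (hb r hr w i j)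
  have hgs : ∀ i j (v : Vec d), g i j v = ∑ l, g i j (e l) * v l := fun i j v => by
    have hv : v = ∑ l, v l • e l := by
      ext m; simp [he, Pi.single_apply]
    conv_lhs => rw [hv]
    simp only [map_sum, map_smul, smul_eq_mul]
    exact Finset.sum_congr rfl fun l _ => mul_comm _ _
  have hκ0 : 0 ≤ κ₀ := by linarith
  refine ⟨fun i j l => ∑ m, (σ r w i m * g j m (e l) + σ r w j m * g i m (e l)), fun i j l => ?_, fun z i j => ?_⟩
  · refine (Finset.abs_sum_le_sum_abs _ _).trans ?_
    calc _ ≤ ∑ _m : Fin d, 3 * κ₀ * κ₂ := Finset.sum_le_sum fun m _ => by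
          refine (abs_add_le _ _).trans ?_
          rw [abs_mul, abs_mul]
          have h1 := mul_le_mul (h.abs_le hκ hr w i m) (hgl j m l) (abs_nonneg _) hκ0
          have h2 := mul_le_mul (h.abs_le hκ hr w j m) (hgl i m l) (abs_nonneg _) hκ0
          nlinarith [mul_nonneg hκ0 hκ₂]
      _ = _ := by simp; ring
  · have e1 : ∑ l, (∑ m, (σ r w i m * g j m (e l) + σ r w j m * g i m (e l))) * (z - w) l
        = ∑ m, (σ r w i m * g j m (z - w) + σ r w j m * g i m (z - w)) := by
      simp only [hgs _ _ (z - w), Finset.mul_sum, Finset.sum_mul, ← Finset.sum_add_distrib]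
      rw [Finset.sum_comm]
      exact Finset.sum_congr rfl fun m _ => Finset.sum_congr rfl fun l _ => by ring
    have e2 : ‖z - w‖ ^ (1 + α) = ‖z - w‖ ^ α * ‖z - w‖ := by
      rw [Real.rpow_add' (norm_nonneg _) (by linarith), Real.rpow_one, mul_comm]
    rw [e1]
    simp only [sqMat, mul_apply, transpose_apply]
    rw [← Finset.sum_sub_distrib, ← Finset.sum_sub_distrib]
    refine (Finset.abs_sum_le_sum_abs _ _).trans ?_
    calc _ ≤ ∑ _m : Fin d, 3 * κ₀ * κ₂ * ‖z - w‖ ^ (1 + α) := Finset.sum_le_sum fun m _ => by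
          have e3 : σ r z i m * σ r z j m - σ r w i m * σ r w j m
              - (σ r w i m * g j m (z - w) + σ r w j m * g i m (z - w))
              = σ r w i m * (σ r z j m - σ r w j m - g j m (z - w))
                + σ r w j m * (σ r z i m - σ r w i m - g i m (z - w))
                + (σ r z i m - σ r w i m) * (σ r z j m - σ r w j m) := by ring
          rw [e3]
          refine (abs_add_le _ _).trans ((add_le_add (abs_add_le _ _) le_rfl).trans ?_)
          rw [abs_mul, abs_mul, abs_mul, e2]
          have h1 := mul_le_mul (h.abs_le hκ hr w i m)
            (abs_taylor_le hα hκ₂ (hd r hr j m) (fun z w => hh r hr z w j m) z w) (abs_nonneg _) hκ0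
          have h2 := mul_le_mul (h.abs_le hκ hr w j m)
            (abs_taylor_le hα hκ₂ (hd r hr i m) (fun z w => hh r hr z w i m) z w) (abs_nonneg _) hκ0
          have h3 := mul_le_mul (h.2.2 r hr z w i m) (abs_sub_le_of_fderiv hd hb hr z w j m) (abs_nonneg _)
            (by positivity)
          calc _ ≤ κ₀ * (κ₂ * ‖z - w‖ ^ α * ‖z - w‖) + κ₀ * (κ₂ * ‖z - w‖ ^ α * ‖z - w‖)
                + κ₀ * ‖z - w‖ ^ α * (κ₂ * ‖z - w‖) := add_le_add (add_le_add h1 h2) h3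
            _ = _ := by ring
      _ = _ := by simp; ring

end EllipticHolder

/-- Integral form of Gronwall's inequality for continuous functions. -/
lemma gronwall_integral {u : ℝ → ℝ} {a k V : ℝ} (hV : 0 ≤ V) (hk : 0 ≤ k) (hu : ContinuousOn u (Icc 0 V))
    (h : ∀ v ∈ Icc 0 V, u v ≤ a + k * ∫ w in (0:ℝ)..v, u w) : ∀ v ∈ Icc 0 V, u v ≤ a * Real.exp (k * v) := by
  set g : ℝ → ℝ := IccExtend hV ((Icc 0 V).domRestrict u) with hg
  have hgc : Continuous g := (continuousOn_iff_continuous_domRestrict.1 hu).Icc_extend'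
  have hgu : ∀ v ∈ Icc 0 V, g v = u v := fun v hv => by
    rw [hg, IccExtend_of_mem hV _ hv, domRestrict_apply]
  have hint : ∀ v ∈ Icc 0 V, ∫ w in (0:ℝ)..v, u w = ∫ w in (0:ℝ)..v, g w := fun v hv => by
    refine intervalIntegral.integral_congr fun w hw => ?_
    rw [uIcc_of_le hv.1] at hw
    exact (hgu w ⟨hw.1, hw.2.trans hv.2⟩).symm
  set U : ℝ → ℝ := fun v => a + k * ∫ w in (0:ℝ)..v, g w with hU
  have hd : ∀ v, HasDerivAt U (k * g v) v := fun v =>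
    ((hgc.integral_hasStrictDerivAt 0 v).hasDerivAt.const_mul k).const_add a
  have hW : ∀ v, HasDerivAt (fun v => Real.exp (-(k * v)) * U v)
      (Real.exp (-(k * v)) * (k * (g v - U v))) v := fun v => by
    have h1 : HasDerivAt (fun v : ℝ => Real.exp (-(k * v))) (Real.exp (-(k * v)) * (-(k * 1))) v :=
      ((((hasDerivAt_id v).const_mul k).neg).exp)
    exact (h1.mul (hd v)).congr_deriv (by ring)
  have hanti : AntitoneOn (fun v => Real.exp (-(k * v)) * U v) (Icc 0 V) := by
    refine antitoneOn_of_deriv_nonpos (convex_Icc 0 V) (fun v _ => (hW v).continuousAt.continuousWithinAt)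
      (fun v _ => (hW v).differentiableAt.differentiableWithinAt) fun v hv => ?_
    rw [(hW v).deriv]
    rw [interior_Icc] at hv
    have hv' : v ∈ Icc 0 V := ⟨hv.1.le, hv.2.le⟩
    have := h v hv'
    rw [hint v hv', ← hgu v hv'] at this
    exact mul_nonpos_of_nonneg_of_nonpos (Real.exp_pos _).le
      (mul_nonpos_of_nonneg_of_nonpos hk (by simp only [hU]; linarith))
  intro v hv
  have h1 := hanti (left_mem_Icc.2 hV) hv hv.1
  simp only [hU, mul_zero, neg_zero, Real.exp_zero, intervalIntegral.integral_same, add_zero, one_mul] at h1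
  have h2 : u v ≤ U v := by
    have := h v hv
    rwa [hint v hv] at this
  calc u v ≤ U v := h2
    _ = Real.exp (k * v) * (Real.exp (-(k * v)) * U v) := by
        rw [← mul_assoc, ← Real.exp_add]; simp
    _ ≤ Real.exp (k * v) * a := mul_le_mul_of_nonneg_left h1 (Real.exp_pos _).le
    _ = _ := mul_comm _ _

lemma max_rpow_le_one {x β : ℝ} (hx : 0 ≤ x) (hx1 : x ≤ 1) (hβ : 0 ≤ β) : max (x ^ β) x ≤ 1 :=
  max_le (Real.rpow_le_one hx hx1 hβ) hx1

lemma max_rpow_le_of_one_le {x y β : ℝ} (hx : 0 ≤ x) (hxy : x ≤ y) (hy : 1 ≤ y) (hβ : 0 ≤ β) (hβ1 : β ≤ 1) :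
    max (x ^ β) x ≤ y :=
  max_le ((Real.rpow_le_rpow hx hxy hβ).trans ((Real.rpow_le_rpow_of_exponent_le hy hβ1).trans_eq
    (Real.rpow_one y))) hxy

namespace IsMollifier
variable {d : ℕ} {ρ : Vec d → ℝ}

lemma hasCompactSupport (h : IsMollifier d ρ) : HasCompactSupport ρ :=
  HasCompactSupport.intro (isCompact_closedBall 0 1) fun x hx => by
    by_contra h'
    exact hx (h.support_subset h')

lemma norm_le_one (h : IsMollifier d ρ) {z : Vec d} (hz : ρ z ≠ 0) : ‖z‖ ≤ 1 := by
  simpa using h.support_subset hz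

lemma integrable (h : IsMollifier d ρ) : Integrable ρ :=
  h.smooth.continuous.integrable_of_hasCompactSupport h.hasCompactSupport

lemma integrable_sub (h : IsMollifier d ρ) (z : Vec d) : Integrable fun y => ρ (z - y) :=
  h.integrable.comp_sub_left z

lemma integral_sub (h : IsMollifier d ρ) (z : Vec d) : ∫ y, ρ (z - y) = 1 := by
  rw [integral_sub_left_eq_self ρ volume z, h.integral_eq_one]

lemma exists_lipschitz (h : IsMollifier d ρ) : ∃ L : ℝ, 0 ≤ L ∧ ∀ z w, |ρ z - ρ w| ≤ L * ‖z - w‖ := by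
  obtain ⟨L, hL⟩ := ContDiff.lipschitzWith_of_hasCompactSupport h.hasCompactSupport h.smooth (by simp)
  exact ⟨L, L.2, fun z w => by simpa [dist_eq_norm, Real.dist_eq] using hL.dist_le_mul z w⟩

end IsMollifier

lemma mollifiedDrift_one {d : ℕ} (ρ : Vec d → ℝ) (b : ℝ → Vec d → Vec d) (r : ℝ) (z : Vec d) :
    mollifiedDrift d ρ 1 b r z = ∫ y, ρ (z - y) • b r y := by
  simp [mollifiedDrift]

namespace HolderDrift
variable {d : ℕ} {ρ : Vec d → ℝ} {b : ℝ → Vec d → Vec d} {κ₁ β : ℝ}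

lemma norm_le (h : HolderDrift d b κ₁ β) (hκ : 0 ≤ κ₁) (hβ : 0 ≤ β) (hβ1 : β ≤ 1) {r : ℝ} (hr : 0 ≤ r) (z : Vec d) :
    ‖b r z‖ ≤ 2 * κ₁ * (1 + ‖z‖) := by
  have h1 := h.2.2 r hr z 0
  rw [sub_zero] at h1
  have h2 := max_rpow_le_of_one_le (norm_nonneg z) (show ‖z‖ ≤ 1 + ‖z‖ by linarith)
    (by linarith [norm_nonneg z]) hβ hβ1
  have h3 : ‖b r z‖ ≤ ‖b r z - b r 0‖ + ‖b r 0‖ := by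
    simpa using norm_add_le (b r z - b r 0) (b r 0)
  have h4 := mul_le_mul_of_nonneg_left h2 hκ
  nlinarith [h.2.1 r hr, norm_nonneg z]

lemma integrable_mollifier_smul (h : HolderDrift d b κ₁ β) (hρ : IsMollifier d ρ) (hκ : 0 ≤ κ₁) (hβ : 0 ≤ β)
    (hβ1 : β ≤ 1) {r : ℝ} (hr : 0 ≤ r) (z : Vec d) : Integrable fun y => ρ (z - y) • b r y := by
  have hm : Measurable fun y => b r y := h.1.comp measurable_prodMk_left
  refine Integrable.mono' ((hρ.integrable_sub z).mul_const (2 * κ₁ * (2 + ‖z‖)))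
    ((hρ.smooth.continuous.measurable.comp (measurable_const.sub measurable_id)).smul hm).aestronglyMeasurable
    (Filter.Eventually.of_forall fun y => ?_)
  rw [norm_smul, Real.norm_of_nonneg (hρ.nonneg _)]
  by_cases h0 : ρ (z - y) = 0
  · simp [h0]
  · have h1 := hρ.norm_le_one h0
    have h2 : ‖y‖ ≤ ‖z - y‖ + ‖z‖ := by
      simpa [norm_sub_rev] using norm_add_le (y - z) z
    exact mul_le_mul_of_nonneg_left ((h.norm_le hκ hβ hβ1 hr y).trans
      (mul_le_mul_of_nonneg_left (by linarith) (by positivity))) (hρ.nonneg _)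

lemma norm_mollifiedDrift_sub_le (h : HolderDrift d b κ₁ β) (hρ : IsMollifier d ρ) (hκ : 0 ≤ κ₁) (hβ : 0 ≤ β)
    (hβ1 : β ≤ 1) {r : ℝ} (hr : 0 ≤ r) (z : Vec d) : ‖mollifiedDrift d ρ 1 b r z - b r z‖ ≤ κ₁ := by
  have e : mollifiedDrift d ρ 1 b r z - b r z = ∫ y, ρ (z - y) • (b r y - b r z) := by
    simp only [smul_sub]
    rw [MeasureTheory.integral_sub (h.integrable_mollifier_smul hρ hκ hβ hβ1 hr z)
      ((hρ.integrable_sub z).smul_const _), integral_smul_const, hρ.integral_sub, one_smul, mollifiedDrift_one]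
  rw [e]
  refine (norm_integral_le_of_norm_le ((hρ.integrable_sub z).mul_const κ₁)
    (Filter.Eventually.of_forall fun y => ?_)).trans_eq ?_
  · rw [norm_smul, Real.norm_of_nonneg (hρ.nonneg _)]
    by_cases h0 : ρ (z - y) = 0
    · simp [h0]
    · have h1 := hρ.norm_le_one h0
      rw [norm_sub_rev] at h1
      exact mul_le_mul_of_nonneg_left ((h.2.2 r hr y z).trans
        (mul_le_of_le_one_right hκ (max_rpow_le_one (norm_nonneg _) h1 hβ))) (hρ.nonneg _)
  · rw [integral_mul_const, hρ.integral_sub, one_mul]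

lemma measurable_mollifiedDrift (h : HolderDrift d b κ₁ β) (hρ : IsMollifier d ρ) :
    Measurable (Function.uncurry (mollifiedDrift d ρ 1 b)) := by
  have e : Function.uncurry (mollifiedDrift d ρ 1 b)
      = fun q : ℝ × Vec d => ∫ y, ρ (q.2 - y) • b q.1 y := by
    funext q; exact mollifiedDrift_one ρ b q.1 q.2
  rw [e]
  have hm : Measurable fun q : (ℝ × Vec d) × Vec d => ρ (q.1.2 - q.2) • b q.1.1 q.2 := by
    refine (hρ.smooth.continuous.measurable.comp ((measurable_fst.snd).sub measurable_snd)).smul ?_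
    exact h.1.comp ((measurable_fst.fst).prodMk measurable_snd)
  exact (hm.stronglyMeasurable.integral_prod_right').measurable

end HolderDrift

lemma exists_lipschitz_mollifiedDrift (d : ℕ) (ρ : Vec d → ℝ) (hρ : IsMollifier d ρ) (κ₁ β : ℝ) (hκ : 0 ≤ κ₁)
    (hβ : 0 ≤ β) (hβ1 : β ≤ 1) : ∃ L, 0 ≤ L ∧ ∀ b, HolderDrift d b κ₁ β → ∀ r : ℝ, 0 ≤ r → ∀ z w,
      ‖mollifiedDrift d ρ 1 b r z - mollifiedDrift d ρ 1 b r w‖ ≤ L * ‖z - w‖ := by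
  obtain ⟨L, hL0, hL⟩ := hρ.exists_lipschitz
  set V := volume.real (Metric.closedBall (0 : Vec d) 2) with hV
  refine ⟨max (3 * κ₁) (L * (κ₁ * 2) * V), le_max_of_le_left (by positivity), fun b h r hr z w => ?_⟩
  rcases le_total 1 ‖z - w‖ with h1 | h1
  · refine le_trans ?_ (mul_le_mul_of_nonneg_right (le_max_left _ _) (norm_nonneg _))
    have e : mollifiedDrift d ρ 1 b r z - mollifiedDrift d ρ 1 b r w
        = (mollifiedDrift d ρ 1 b r z - b r z) + (b r z - b r w) - (mollifiedDrift d ρ 1 b r w - b r w) := by abel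
    rw [e]
    refine (norm_sub_le _ _).trans ((add_le_add (norm_add_le _ _) le_rfl).trans ?_)
    have h2 := h.norm_mollifiedDrift_sub_le hρ hκ hβ hβ1 hr z
    have h3 := h.norm_mollifiedDrift_sub_le hρ hκ hβ hβ1 hr w
    have h4 := (h.2.2 r hr z w).trans (mul_le_mul_of_nonneg_left
      (max_rpow_le_of_one_le (norm_nonneg _) le_rfl h1 hβ hβ1) hκ)
    nlinarith
  · refine le_trans ?_ (mul_le_mul_of_nonneg_right (le_max_right _ _) (norm_nonneg _))
    have e : mollifiedDrift d ρ 1 b r z - mollifiedDrift d ρ 1 b r w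
        = ∫ y, (ρ (z - y) - ρ (w - y)) • (b r y - b r w) := by
      have i1 := h.integrable_mollifier_smul hρ hκ hβ hβ1 hr z
      have i2 := h.integrable_mollifier_smul hρ hκ hβ hβ1 hr w
      have i3 : Integrable fun y => (ρ (z - y) - ρ (w - y)) • b r w :=
        ((hρ.integrable_sub z).sub (hρ.integrable_sub w)).smul_const _
      have i4 : Integrable fun y => ρ (z - y) • b r y - ρ (w - y) • b r y := i1.sub i2
      have e0 : ∀ y, (ρ (z - y) - ρ (w - y)) • (b r y - b r w)
          = (ρ (z - y) • b r y - ρ (w - y) • b r y) - (ρ (z - y) - ρ (w - y)) • b r w := fun y => by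
        rw [smul_sub, sub_smul]
      simp only [e0]
      rw [MeasureTheory.integral_sub i4 i3, MeasureTheory.integral_sub i1 i2, integral_smul_const,
        MeasureTheory.integral_sub (hρ.integrable_sub z) (hρ.integrable_sub w), hρ.integral_sub, hρ.integral_sub,
        mollifiedDrift_one, mollifiedDrift_one]
      simp
    rw [e, ← setIntegral_eq_integral_of_forall_compl_eq_zero (s := Metric.closedBall w 2)]
    · refine (norm_setIntegral_le_of_norm_le_const (C := L * ‖z - w‖ * (κ₁ * 2)) measure_closedBall_lt_top
        fun y hy => ?_).trans_eq ?_
      · rw [norm_smul]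
        rw [mem_closedBall_iff_norm] at hy
        refine mul_le_mul ?_ ((h.2.2 r hr y w).trans (mul_le_mul_of_nonneg_left
          (max_rpow_le_of_one_le (norm_nonneg _) hy (by norm_num) hβ hβ1) hκ)) (norm_nonneg _) (by positivity)
        have := hL (z - y) (w - y)
        simpa using this
      · have : volume.real (Metric.closedBall w 2) = V := by
          rw [hV, Measure.real, Measure.real, Measure.addHaar_closedBall_center]
        rw [this]; ring
    · intro y hy
      rw [mem_closedBall_iff_norm, not_le] at hy
      have h2 : ρ (w - y) = 0 := by
        by_contra h0
        have := hρ.norm_le_one h0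
        rw [norm_sub_rev] at this
        linarith
      have h3 : ρ (z - y) = 0 := by
        by_contra h0
        have h5 := hρ.norm_le_one h0
        have h6 : ‖y - w‖ ≤ ‖z - y‖ + ‖z - w‖ := by
          have := norm_add_le (y - z) (z - w)
          rwa [sub_add_sub_cancel, norm_sub_rev y z] at this
        linarith
      simp [h2, h3]

/-- Solutions of integral equations with measurable coefficients of linear growth, where the integral
takes the default value `0` off its domain, are genuine solutions. -/
lemma integrable_of_integral_equation {d : ℕ} {F : ℝ → Vec d → Vec d} {φ : ℝ → Vec d} {x : Vec d} {C L : ℝ}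
    (hC : 0 ≤ C) (hm : Measurable (Function.uncurry F))
    (hF : ∀ v ∈ Icc 0 L, ∀ z, ‖F v z‖ ≤ C * (1 + ‖z‖))
    (hφ : ∀ v ∈ Icc 0 L, φ v = x + ∫ u in (0:ℝ)..v, F u (φ u)) (hL : 0 ≤ L) :
    IntegrableOn (fun u => F u (φ u)) (Icc 0 L) := by
  set G : ℝ → Vec d := fun u => F u (φ u) with hG
  set A : Set ℝ := {v | v ∈ Icc 0 L ∧ IntegrableOn G (Icc 0 v)} with hA
  have hA0 : (0:ℝ) ∈ A := ⟨left_mem_Icc.2 hL, by simp⟩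
  have hbdd : BddAbove A := ⟨L, fun v hv => hv.1.2⟩
  set m := sSup A with hmdef
  have hm0 : 0 ≤ m := le_csSup hbdd hA0
  have hcont : ∀ v ∈ A, ContinuousOn φ (Icc 0 v) := fun v hv => by
    have h1 := intervalIntegral.continuousOn_primitive_interval (μ := volume) (f := G) (a := 0) (b := v)
      (by rw [uIcc_of_le hv.1.1]; exact hv.2)
    rw [uIcc_of_le hv.1.1] at h1
    exact (h1.const_add x).congr fun u hu => hφ u ⟨hu.1, hu.2.trans hv.1.2⟩
  set B := (1 + ‖x‖) * Real.exp (C * L) with hB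
  have hx0 := norm_nonneg x
  have hbound : ∀ v ∈ A, ‖φ v‖ ≤ B := fun v hv => by
    have hcn : ContinuousOn (fun u => 1 + ‖φ u‖) (Icc 0 v) := (hcont v hv).norm.const_add 1
    have := gronwall_integral (u := fun u => 1 + ‖φ u‖) (a := 1 + ‖x‖) (k := C) hv.1.1 hC hcn
      (fun w hw => by
        have hw' : w ∈ Icc 0 L := ⟨hw.1, hw.2.trans hv.1.2⟩
        have h2 : ‖∫ u in (0:ℝ)..w, F u (φ u)‖ ≤ ∫ u in (0:ℝ)..w, C * (1 + ‖φ u‖) := by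
          refine intervalIntegral.norm_integral_le_of_norm_le hw.1
            (Filter.Eventually.of_forall fun u hu => hF u ⟨hu.1.le, hu.2.trans hw'.2⟩ _) ?_
          refine ContinuousOn.intervalIntegrable ?_
          rw [uIcc_of_le hw.1]
          exact (hcn.mono (Icc_subset_Icc_right hw.2)).const_smul C
        rw [intervalIntegral.integral_const_mul] at h2
        have h3 := norm_add_le x (∫ u in (0:ℝ)..w, F u (φ u))
        rw [← hφ w hw'] at h3
        linarith) v (right_mem_Icc.2 hv.1.1)
    have h4 : Real.exp (C * v) ≤ Real.exp (C * L) :=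
      Real.exp_le_exp.2 (mul_le_mul_of_nonneg_left hv.1.2 hC)
    have h5 := mul_le_mul_of_nonneg_left h4 (show 0 ≤ 1 + ‖x‖ by linarith)
    simp only [hB]
    linarith
  have hlt : ∀ v, 0 ≤ v → v < m → v ∈ A := fun v hv0 hv => by
    obtain ⟨w, hw, hvw⟩ := exists_lt_of_lt_csSup ⟨0, hA0⟩ hv
    exact ⟨⟨hv0, hvw.le.trans hw.1.2⟩, hw.2.mono_set (Icc_subset_Icc_right hvw.le)⟩
  have hgt : ∀ v, m < v → v ≤ L → φ v = x := fun v hv hvL => by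
    have hv' : v ∈ Icc 0 L := ⟨hm0.trans hv.le, hvL⟩
    rw [hφ v hv', intervalIntegral.integral_undef, add_zero]
    rw [intervalIntegrable_iff_integrableOn_Icc_of_le hv'.1]
    exact fun hi => absurd (le_csSup hbdd ⟨hv', hi⟩) (not_le.2 hv)
  have hmeas : AEMeasurable φ (volume.restrict (Icc 0 L)) := by
    set φ' : ℝ → Vec d := fun v => if v ∈ Ico 0 m then φ v else x with hφ'
    have h1 : Measurable φ' := by
      refine measurable_of_restrict_of_restrict_compl (s := Ico 0 m) measurableSet_Ico ?_ ?_
      · have hc : ContinuousOn φ (Ico 0 m) := fun v hv => by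
          obtain ⟨w, hw, hwm⟩ := exists_between hv.2
          have hwA := hlt w (hv.1.trans hw.le) hwm
          refine ((hcont w hwA) v ⟨hv.1, hw.le⟩).mono_of_mem_nhdsWithin ?_
          refine mem_nhdsWithin.2 ⟨Iio w, isOpen_Iio, hw, fun u hu => ⟨hu.2.1, hu.1.le⟩⟩
        have := continuousOn_iff_continuous_domRestrict.1 hc
        have e : (Ico 0 m).domRestrict φ' = (Ico 0 m).domRestrict φ := funext fun v => if_pos v.2
        rw [e]
        exact this.measurable
      · have e : (Ico 0 m)ᶜ.domRestrict φ' = fun _ => x := funext fun v => if_neg v.2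
        rw [e]
        exact measurable_const
    refine ⟨φ', h1, ?_⟩
    rw [Filter.EventuallyEq, ae_restrict_iff' measurableSet_Icc]
    have hne : ∀ᵐ v : ℝ, v ≠ m := by
      simp [ae_iff]
    filter_upwards [hne] with v hv hvL
    by_cases h2 : v ∈ Ico 0 m
    · simp only [hφ']; rw [if_pos h2]
    · simp only [hφ']; rw [if_neg h2]
      refine hgt v (lt_of_le_of_ne ?_ (Ne.symm hv)) hvL.2
      by_contra h3
      exact h2 ⟨hvL.1, not_le.1 h3⟩
  have hGm : AEStronglyMeasurable G (volume.restrict (Icc 0 L)) :=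
    (hm.comp_aemeasurable (aemeasurable_id.prodMk hmeas)).aestronglyMeasurable
  refine Integrable.mono' (g := fun _ => C * (1 + B)) (integrableOn_const (by simp)) hGm ?_
  have hne : ∀ᵐ v : ℝ, v ≠ m := by
    simp [ae_iff]
  rw [ae_restrict_iff' measurableSet_Icc]
  filter_upwards [hne] with v hv hvL
  refine (hF v hvL _).trans (mul_le_mul_of_nonneg_left (add_le_add le_rfl ?_) hC)
  rcases lt_or_gt_of_ne hv with h | h
  · exact hbound v (hlt v hvL.1 h)
  · rw [hgt v h hvL.2]
    have : (1:ℝ) ≤ Real.exp (C * L) := Real.one_le_exp (by positivity)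
    simp only [hB]
    nlinarith

namespace IsFlow
variable {d : ℕ} {B : ℝ → Vec d → Vec d} {θ : ℝ → ℝ → Vec d → Vec d} {C L : ℝ}

lemma self (h : IsFlow d B θ) {s : ℝ} (hs : 0 ≤ s) (x : Vec d) : θ s s x = x := by
  rw [h s s hs hs x]; simp

lemma intervalIntegrable_forward (h : IsFlow d B θ) (hC : 0 ≤ C) (hm : Measurable (Function.uncurry B))
    (hB : ∀ r : ℝ, 0 ≤ r → ∀ z, ‖B r z‖ ≤ C * (1 + ‖z‖)) {s t : ℝ} (hs : 0 ≤ s) (hst : s ≤ t) (x : Vec d) :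
    IntervalIntegrable (fun r => B r (θ r s x)) volume s t := by
  have h1 := integrable_of_integral_equation (F := fun u z => B (s + u) z) (φ := fun u => θ (s + u) s x)
    (x := x) (L := t - s) hC
    (hm.comp ((measurable_fst.const_add s).prodMk measurable_snd))
    (fun v hv z => hB _ (by linarith [hv.1]) z)
    (fun v hv => by
      rw [h s (s + v) hs (by linarith [hv.1]) x,
        intervalIntegral.integral_comp_add_left (fun r => B r (θ r s x)) s, add_zero]) (by linarith)
  rw [← intervalIntegrable_iff_integrableOn_Icc_of_le (by linarith)] at h1
  have h2 := h1.comp_sub_right s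
  simpa using h2

lemma intervalIntegrable_backward (h : IsFlow d B θ) (hC : 0 ≤ C) (hm : Measurable (Function.uncurry B))
    (hB : ∀ r : ℝ, 0 ≤ r → ∀ z, ‖B r z‖ ≤ C * (1 + ‖z‖)) {s t : ℝ} (hs : 0 ≤ s) (hst : s ≤ t) (y : Vec d) :
    IntervalIntegrable (fun r => B r (θ r t y)) volume s t := by
  have h1 := integrable_of_integral_equation (F := fun u z => -B (t - u) z) (φ := fun u => θ (t - u) t y)
    (x := y) (L := t - s) hC
    (hm.comp ((measurable_fst.const_sub t).prodMk measurable_snd)).neg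
    (fun v hv z => by rw [norm_neg]; exact hB _ (by linarith [hv.2]) z)
    (fun v hv => by
      rw [h t (t - v) (hs.trans hst) (by linarith [hv.2]) y, intervalIntegral.integral_neg,
        intervalIntegral.integral_comp_sub_left (fun r => B r (θ r t y)) t, sub_zero,
        intervalIntegral.integral_symm]) (by linarith)
  rw [← intervalIntegrable_iff_integrableOn_Icc_of_le (by linarith)] at h1
  have h2 := (h1.comp_sub_left t).neg.symm
  simpa [Pi.neg_def] using h2

lemma eq_add_integral (h : IsFlow d B θ) {s t : ℝ} (hs : 0 ≤ s) {y : Vec d}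
    (hi : IntervalIntegrable (fun r => B r (θ r t y)) volume s t) {v : ℝ} (hv : v ∈ Icc s t) :
    θ v t y = θ s t y + ∫ r in s..v, B r (θ r t y) := by
  have ht : 0 ≤ t := by linarith [hv.1, hv.2]
  rw [h t v ht (by linarith [hv.1]) y, h t s ht hs y, add_assoc, intervalIntegral.integral_add_adjacent_intervals]
  · exact hi.symm
  · refine hi.mono_set ?_
    rw [uIcc_of_le hv.1, uIcc_of_le (hv.1.trans hv.2)]
    exact Icc_subset_Icc_right hv.2

lemma isPath (h : IsFlow d B θ) (hC : 0 ≤ C) (hm : Measurable (Function.uncurry B))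
    (hB : ∀ r : ℝ, 0 ≤ r → ∀ z, ‖B r z‖ ≤ C * (1 + ‖z‖)) {s t : ℝ} (hs : 0 ≤ s) (hst : s ≤ t) (y : Vec d) :
    IsPath (fun r => θ (max s (min r t)) t y) (fun r => B r (θ (max s (min r t)) t y)) s t := by
  have hi := h.intervalIntegrable_backward hC hm hB hs hst y
  have hcl : ∀ r ∈ Icc s t, max s (min r t) = r := fun r hr => by
    rw [min_eq_left hr.2, max_eq_right hr.1]
  have hco : ContinuousOn (fun r => θ r t y) (Icc s t) := by
    have h1 := intervalIntegral.continuousOn_primitive_interval (μ := volume) (f := fun r => B r (θ r t y)) (a := s)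
      (b := t) (by rw [uIcc_of_le hst]; exact (intervalIntegrable_iff_integrableOn_Icc_of_le hst).1 hi)
    rw [uIcc_of_le hst] at h1
    exact (h1.const_add (θ s t y)).congr fun u hu => h.eq_add_integral hs hi hu
  have hmem : ∀ r : ℝ, max s (min r t) ∈ Icc s t := fun r => ⟨le_max_left _ _, max_le hst (min_le_right _ _)⟩
  have hcc : Continuous fun r => θ (max s (min r t)) t y :=
    hco.comp_continuous (by fun_prop) hmem
  have hmm : Measurable fun r => B r (θ (max s (min r t)) t y) :=
    hm.comp (measurable_id.prodMk hcc.measurable)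
  obtain ⟨N, hN⟩ := isCompact_Icc.exists_bound_of_continuousOn hco
  refine ⟨hcc.measurable, hmm, ⟨C * (1 + N), fun u hu => ?_⟩, fun v hv => ?_⟩
  · refine (hB u (hs.trans hu.1) _).trans (mul_le_mul_of_nonneg_left (add_le_add le_rfl (hN _ (hmem u))) hC)
  · rw [hcl v hv, hcl s (left_mem_Icc.2 hst), h.eq_add_integral hs hi hv]
    congr 1
    refine intervalIntegral.integral_congr fun r hr => ?_
    rw [uIcc_of_le hv.1] at hr
    simp only [hcl r ⟨hr.1, hr.2.trans hv.2⟩]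

/-- The forward and the backward flow are comparable. -/
lemma norm_forward_sub_le (h : IsFlow d B θ) (hC : 0 ≤ C) (hm : Measurable (Function.uncurry B))
    (hB : ∀ r : ℝ, 0 ≤ r → ∀ z, ‖B r z‖ ≤ C * (1 + ‖z‖)) (hL : 0 ≤ L)
    (hLip : ∀ r : ℝ, 0 ≤ r → ∀ z w, ‖B r z - B r w‖ ≤ L * ‖z - w‖) {s t : ℝ} (hs : 0 ≤ s) (hst : s ≤ t)
    (x y : Vec d) : ‖θ t s x - y‖ ≤ Real.exp (L * (t - s)) * ‖x - θ s t y‖ := by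
  have hf := h.intervalIntegrable_forward hC hm hB hs hst x
  have hi := h.intervalIntegrable_backward hC hm hB hs hst y
  set Φ : ℝ → Vec d := fun r => θ r s x - θ r t y with hΦ
  have hsub : ∀ v ∈ Icc s t, uIcc s v ⊆ uIcc s t := fun v hv => by
    rw [uIcc_of_le hv.1, uIcc_of_le hst]
    exact Icc_subset_Icc_right hv.2
  have hg := hf.sub hi
  have heq : ∀ v ∈ Icc s t, Φ v = Φ s + ∫ r in s..v, (B r (θ r s x) - B r (θ r t y)) := fun v hv => by
    rw [intervalIntegral.integral_sub (hf.mono_set (hsub v hv)) (hi.mono_set (hsub v hv))]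
    simp only [hΦ]
    rw [h s v hs (hs.trans hv.1) x, h.eq_add_integral hs hi hv, h.self hs x]
    abel
  have hco : ContinuousOn Φ (Icc s t) := by
    have h1 := intervalIntegral.continuousOn_primitive_interval (μ := volume)
      (f := fun r => B r (θ r s x) - B r (θ r t y)) (a := s)
      (b := t) (by rw [uIcc_of_le hst]; exact (intervalIntegrable_iff_integrableOn_Icc_of_le hst).1 hg)
    rw [uIcc_of_le hst] at h1
    exact (h1.const_add (Φ s)).congr heq
  have hmap : MapsTo (fun v : ℝ => s + v) (Icc 0 (t - s)) (Icc s t) := fun v hv =>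
    ⟨by linarith [hv.1], by linarith [hv.2]⟩
  have hcv : ContinuousOn (fun v => ‖Φ (s + v)‖) (Icc 0 (t - s)) :=
    (hco.comp (by fun_prop) hmap).norm
  have := gronwall_integral (u := fun v => ‖Φ (s + v)‖) (a := ‖Φ s‖) (k := L) (V := t - s) (by linarith) hL hcv
    (fun v hv => by
      have hv' := hmap hv
      have hle : s ≤ s + v := hv'.1
      have h2 : ‖∫ r in s..s + v, (B r (θ r s x) - B r (θ r t y))‖ ≤ ∫ r in s..s + v, L * ‖Φ r‖ := by
        refine intervalIntegral.norm_integral_le_of_norm_le hle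
          (Filter.Eventually.of_forall fun u hu => hLip u (hs.trans hu.1.le) _ _) ?_
        refine ContinuousOn.intervalIntegrable ?_
        rw [uIcc_of_le hle]
        exact (hco.norm.mono (Icc_subset_Icc_right hv'.2)).const_smul L
      rw [intervalIntegral.integral_const_mul] at h2
      have h3 := norm_add_le (Φ s) (∫ r in s..s + v, (B r (θ r s x) - B r (θ r t y)))
      rw [← heq _ hv'] at h3
      rw [intervalIntegral.integral_comp_add_left (fun r => ‖Φ r‖) s, add_zero]
      linarith) (t - s) ⟨by linarith, le_rfl⟩
  simp only [hΦ, add_sub_cancel, h.self hs x, h.self (hs.trans hst) y] at this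
  linarith

end IsFlow

open Filter Topology

/-- Partial derivative in the `i`-th coordinate. -/
def pd {d : ℕ} (i : Fin d) (f : Vec d → ℝ) (z : Vec d) : ℝ :=
  fderiv ℝ f z (EuclideanSpace.single i (1 : ℝ))

section pd
variable {d : ℕ} {f g : Vec d → ℝ}

lemma contDiff_pd (i : Fin d) (hf : ContDiff ℝ (⊤ : ℕ∞) f) : ContDiff ℝ (⊤ : ℕ∞) (pd i f) :=
  (hf.fderiv_right (m := (⊤ : ℕ∞)) (by simp)).clm_apply contDiff_const

lemma differentiable_of_smooth (hf : ContDiff ℝ (⊤ : ℕ∞) f) : Differentiable ℝ f :=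
  hf.differentiable (by simp)

lemma iteratedFDeriv_two_eq_pd (hf : ContDiff ℝ (⊤ : ℕ∞) f) (i j : Fin d) (z : Vec d) :
    iteratedFDeriv ℝ 2 f z ![EuclideanSpace.single i (1 : ℝ), EuclideanSpace.single j (1 : ℝ)]
      = pd i (pd j f) z := by
  rw [iteratedFDeriv_two_apply]
  have h1 : DifferentiableAt ℝ (fderiv ℝ f) z :=
    (hf.fderiv_right (m := (⊤ : ℕ∞)) (by simp)).differentiable (by simp) z
  unfold pd
  rw [fderiv_clm_apply h1 (differentiableAt_const _)]
  simp

lemma pd_mul (i : Fin d) (hf : ContDiff ℝ (⊤ : ℕ∞) f) (hg : ContDiff ℝ (⊤ : ℕ∞) g) :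
    pd i (fun z => f z * g z) = fun z => pd i f z * g z + f z * pd i g z := by
  funext z
  unfold pd
  rw [fderiv_fun_mul (differentiable_of_smooth hf z) (differentiable_of_smooth hg z)]
  simp
  ring

lemma pd_add (i : Fin d) (hf : ContDiff ℝ (⊤ : ℕ∞) f) (hg : ContDiff ℝ (⊤ : ℕ∞) g) :
    pd i (fun z => f z + g z) = fun z => pd i f z + pd i g z := by
  funext z
  unfold pd
  rw [fderiv_fun_add (differentiable_of_smooth hf z) (differentiable_of_smooth hg z)]
  simp

lemma pd_pd_mul (i j : Fin d) (hf : ContDiff ℝ (⊤ : ℕ∞) f) (hg : ContDiff ℝ (⊤ : ℕ∞) g) (z : Vec d) :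
    pd i (pd j fun z => f z * g z) z = pd i (pd j f) z * g z + pd j f z * pd i g z
      + (pd i f z * pd j g z + f z * pd i (pd j g) z) := by
  rw [pd_mul j hf hg, pd_add i ((contDiff_pd j hf).mul hg) (hf.mul (contDiff_pd j hg)),
    pd_mul i (contDiff_pd j hf) hg, pd_mul i hf (contDiff_pd j hg)]

lemma pd_comp_smul (i : Fin d) (hf : Differentiable ℝ f) (c : ℝ) :
    pd i (fun z => f (c • z)) = fun z => c * pd i f (c • z) := by
  funext z
  have h1 : HasFDerivAt (fun z : Vec d => c • z) (c • ContinuousLinearMap.id ℝ (Vec d)) z :=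
    (hasFDerivAt_id z).const_smul c
  have h2 := (hf (c • z)).hasFDerivAt.comp z h1
  unfold pd
  rw [show (fun z => f (c • z)) = f ∘ fun z => c • z from rfl, h2.fderiv]
  simp

lemma pd_const_mul (i : Fin d) (hf : Differentiable ℝ f) (c : ℝ) :
    pd i (fun z => c * f z) = fun z => c * pd i f z := by
  funext z
  unfold pd
  rw [fderiv_const_mul (hf z)]
  simp

lemma exists_bound_of_smooth_of_hasCompactSupport (hf : ContDiff ℝ (⊤ : ℕ∞) f) (hc : HasCompactSupport f) :
    ∃ M, 0 ≤ M ∧ (∀ z, |f z| ≤ M) ∧ (∀ i z, |pd i f z| ≤ M) ∧ (∀ i j z, |pd i (pd j f) z| ≤ M) := by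
  have h : ∀ g : Vec d → ℝ, Continuous g → HasCompactSupport g → ∃ M, 0 ≤ M ∧ ∀ z, |g z| ≤ M := fun g hg hgc => by
    obtain ⟨M, hM⟩ := hgc.exists_bound_of_continuous hg
    exact ⟨M, (norm_nonneg _).trans (hM 0), hM⟩
  have hci : ∀ i, HasCompactSupport (pd i f) := fun i => hc.fderiv_apply ℝ _
  have hcij : ∀ i j, HasCompactSupport (pd i (pd j f)) := fun i j => (hci j).fderiv_apply ℝ _
  obtain ⟨M₀, h0, hM₀⟩ := h f hf.continuous hc
  choose M₁ h1 hM₁ using fun i => h _ (contDiff_pd i hf).continuous (hci i)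
  choose M₂ h2 hM₂ using fun i j => h _ (contDiff_pd i (contDiff_pd j hf)).continuous (hcij i j)
  refine ⟨M₀ + ∑ i, M₁ i + ∑ i, ∑ j, M₂ i j, add_nonneg (add_nonneg h0 (Finset.sum_nonneg fun i _ => h1 i))
    (Finset.sum_nonneg fun i _ => Finset.sum_nonneg fun j _ => h2 i j), fun z => ?_, fun i z => ?_, fun i j z => ?_⟩
  · have e1 : 0 ≤ ∑ i, M₁ i := Finset.sum_nonneg fun i _ => h1 i
    have e2 : 0 ≤ ∑ i, ∑ j, M₂ i j := Finset.sum_nonneg fun i _ => Finset.sum_nonneg fun j _ => h2 i j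
    linarith [hM₀ z]
  · have e1 : M₁ i ≤ ∑ i, M₁ i := Finset.single_le_sum (f := M₁) (fun i _ => h1 i) (Finset.mem_univ i)
    have e2 : 0 ≤ ∑ i, ∑ j, M₂ i j := Finset.sum_nonneg fun i _ => Finset.sum_nonneg fun j _ => h2 i j
    linarith [hM₁ i z]
  · have e1 : 0 ≤ ∑ i, M₁ i := Finset.sum_nonneg fun i _ => h1 i
    have e2 : M₂ i j ≤ ∑ j, M₂ i j := Finset.single_le_sum (f := M₂ i) (fun j _ => h2 i j) (Finset.mem_univ j)
    have e3 : ∑ j, M₂ i j ≤ ∑ i, ∑ j, M₂ i j := Finset.single_le_sum (f := fun i => ∑ j, M₂ i j)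
      (fun i _ => Finset.sum_nonneg fun j _ => h2 i j) (Finset.mem_univ i)
    linarith [hM₂ i j z]

/-- Smooth cutoff functions at scale `n + 1` whose derivatives decay with the scale. -/
lemma exists_cutoff (d : ℕ) : ∃ (χ : ℕ → Vec d → ℝ) (M : ℝ), 0 ≤ M ∧ ∀ n, ContDiff ℝ (⊤ : ℕ∞) (χ n) ∧
    HasCompactSupport (χ n) ∧ (∀ z, ‖z‖ ≤ n + 1 → χ n z = 1) ∧ (∀ z, |χ n z| ≤ 1) ∧
    (∀ i z, (1 + ‖z‖) * |pd i (χ n) z| ≤ M) ∧ ∀ i j z, |pd i (pd j (χ n)) z| ≤ M := by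
  let ψ : ContDiffBump (0 : Vec d) := ⟨1, 2, by norm_num, by norm_num⟩
  have hs : ContDiff ℝ (⊤ : ℕ∞) ψ := ψ.contDiff
  obtain ⟨M, hM, -, hM1, hM2⟩ := exists_bound_of_smooth_of_hasCompactSupport hs ψ.hasCompactSupport
  have hR : ∀ n : ℕ, (1:ℝ) ≤ n + 1 := fun n => by linarith [Nat.cast_nonneg (α := ℝ) n]
  refine ⟨fun n z => ψ ((n + 1 : ℝ)⁻¹ • z), 3 * M, by positivity, fun n => ?_⟩
  have hn := hR n
  have hn0 : (0:ℝ) < n + 1 := by linarith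
  have hinv : (n + 1 : ℝ)⁻¹ ≤ 1 := inv_le_one_of_one_le₀ hn
  have hinv0 : 0 < (n + 1 : ℝ)⁻¹ := by positivity
  have hnorm : ∀ z : Vec d, ‖(n + 1 : ℝ)⁻¹ • z‖ = (n + 1 : ℝ)⁻¹ * ‖z‖ := fun z => by
    rw [norm_smul, Real.norm_of_nonneg hinv0.le]
  have hp1 : ∀ i, pd i (fun z => ψ ((n + 1 : ℝ)⁻¹ • z)) = fun z => (n + 1 : ℝ)⁻¹ * pd i ψ ((n + 1 : ℝ)⁻¹ • z) :=
    fun i => pd_comp_smul i (differentiable_of_smooth hs) _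
  refine ⟨hs.comp (contDiff_const_smul _), ?_, fun z hz => ?_, fun z => ?_, fun i z => ?_, fun i j z => ?_⟩
  · exact ψ.hasCompactSupport.comp_homeomorph (Homeomorph.smulOfNeZero _ hinv0.ne')
  · refine ψ.one_of_mem_closedBall ?_
    rw [mem_closedBall_zero_iff, hnorm, inv_mul_le_iff₀ hn0]
    exact hz.trans_eq (mul_one _).symm
  · rw [abs_of_nonneg ψ.nonneg]; exact ψ.le_one
  · rw [hp1, abs_mul, abs_of_pos hinv0]
    by_cases hz : ‖z‖ ≤ 2 * (n + 1)
    · have h1 : (1 + ‖z‖) * (n + 1 : ℝ)⁻¹ ≤ 3 := by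
        rw [← div_eq_mul_inv, div_le_iff₀ hn0]; linarith
      calc _ = (1 + ‖z‖) * (n + 1 : ℝ)⁻¹ * |pd i ψ ((n + 1 : ℝ)⁻¹ • z)| := by ring
        _ ≤ 3 * M := mul_le_mul h1 (hM1 i _) (abs_nonneg _) (by norm_num)
    · have h1 : pd i ψ ((n + 1 : ℝ)⁻¹ • z) = 0 := by
        have h2 : (n + 1 : ℝ)⁻¹ • z ∉ tsupport ψ := by
          rw [ψ.tsupport_eq, mem_closedBall_zero_iff, hnorm, inv_mul_le_iff₀ hn0]
          intro h3
          exact hz (by linarith)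
        have h3 : fderiv ℝ ψ ((n + 1 : ℝ)⁻¹ • z) = 0 := fderiv_of_notMem_tsupport ℝ h2
        simp [pd, h3]
      rw [h1]; simp; exact hM
  · have hd : Differentiable ℝ fun z => pd j ψ ((n + 1 : ℝ)⁻¹ • z) :=
      (differentiable_of_smooth (contDiff_pd j hs)).comp
        (by fun_prop : Differentiable ℝ fun z : Vec d => (n + 1 : ℝ)⁻¹ • z)
    rw [hp1, pd_const_mul i hd,
      pd_comp_smul i (differentiable_of_smooth (contDiff_pd j hs)), abs_mul, abs_mul, abs_of_pos hinv0]
    have h1 := hM2 i j ((n + 1 : ℝ)⁻¹ • z)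
    have h2 : (n + 1 : ℝ)⁻¹ * |pd i (pd j ψ) ((n + 1 : ℝ)⁻¹ • z)| ≤ 1 * M :=
      mul_le_mul hinv h1 (abs_nonneg _) zero_le_one
    have h3 := mul_le_mul hinv h2 (by positivity) zero_le_one
    linarith

end pd

/-- Coefficients of linear growth (drift) and bounded (diffusion matrix) at nonnegative times. -/
structure GrowthBound {d : ℕ} (b : ℝ → Vec d → Vec d) (σ : ℝ → Vec d → Matrix (Fin d) (Fin d) ℝ) (C : ℝ) :
    Prop where
  measurable_b : Measurable (Function.uncurry b)
  measurable_a : Measurable (Function.uncurry fun r z => fun i j => sqMat d σ r z i j)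
  nonneg : 0 ≤ C
  norm_b : ∀ r : ℝ, 0 ≤ r → ∀ z, ‖b r z‖ ≤ C * (1 + ‖z‖)
  abs_a : ∀ r : ℝ, 0 ≤ r → ∀ z i j, |sqMat d σ r z i j| ≤ C

namespace GrowthBound
variable {d : ℕ} {b : ℝ → Vec d → Vec d} {σ : ℝ → Vec d → Matrix (Fin d) (Fin d) ℝ} {C : ℝ} {f : Vec d → ℝ}

lemma genApply_eq (hf : ContDiff ℝ (⊤ : ℕ∞) f) (r : ℝ) (z : Vec d) :
    genApply d b σ r f z = (∑ i, b r z i * pd i f z) + (1 / 2) * ∑ i, ∑ j, sqMat d σ r z i j * pd i (pd j f) z := by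
  simp only [genApply, iteratedFDeriv_two_eq_pd hf]
  rfl

lemma abs_genApply_le (h : GrowthBound b σ C) (hf : ContDiff ℝ (⊤ : ℕ∞) f) {r : ℝ} (hr : 0 ≤ r) {z : Vec d} {A B : ℝ}
    (h1 : ∀ i, (1 + ‖z‖) * |pd i f z| ≤ A) (h2 : ∀ i j, |pd i (pd j f) z| ≤ B) :
    |genApply d b σ r f z| ≤ d * (C * A) + d ^ 2 * (C * B) := by
  rw [genApply_eq hf]
  have hC := h.nonneg
  have e1 : |∑ i, b r z i * pd i f z| ≤ d * (C * A) := by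
    refine (Finset.abs_sum_le_sum_abs _ _).trans ?_
    calc _ ≤ ∑ _i : Fin d, C * A := Finset.sum_le_sum fun i _ => by
          rw [abs_mul]
          calc _ ≤ C * (1 + ‖z‖) * |pd i f z| := mul_le_mul_of_nonneg_right
                ((PiLp.norm_apply_le (b r z) i).trans (h.norm_b r hr z)) (abs_nonneg _)
            _ = C * ((1 + ‖z‖) * |pd i f z|) := by ring
            _ ≤ _ := mul_le_mul_of_nonneg_left (h1 i) hC
      _ = _ := by simp
  have e2 : |∑ i, ∑ j, sqMat d σ r z i j * pd i (pd j f) z| ≤ d ^ 2 * (C * B) := by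
    refine (Finset.abs_sum_le_sum_abs _ _).trans ?_
    calc _ ≤ ∑ _i : Fin d, ∑ _j : Fin d, C * B := Finset.sum_le_sum fun i _ =>
          (Finset.abs_sum_le_sum_abs _ _).trans (Finset.sum_le_sum fun j _ => by
            rw [abs_mul]
            exact mul_le_mul (h.abs_a r hr z i j) (h2 i j) (abs_nonneg _) hC)
      _ = _ := by simp; ring
  refine (abs_add_le _ _).trans ?_
  rw [abs_mul, abs_of_nonneg (by norm_num : (0:ℝ) ≤ 1 / 2)]
  linarith [abs_nonneg (∑ i, ∑ j, sqMat d σ r z i j * pd i (pd j f) z)]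

lemma measurable_genApply (h : GrowthBound b σ C) (hf : ContDiff ℝ (⊤ : ℕ∞) f) :
    Measurable (Function.uncurry fun r z => genApply d b σ r f z) := by
  have e : (Function.uncurry fun r z => genApply d b σ r f z) = fun q : ℝ × Vec d =>
      (∑ i, b q.1 q.2 i * pd i f q.2) + (1 / 2) * ∑ i, ∑ j, sqMat d σ q.1 q.2 i j * pd i (pd j f) q.2 := by
    funext q; exact genApply_eq hf q.1 q.2
  rw [e]
  have hb : ∀ i, Measurable fun q : ℝ × Vec d => b q.1 q.2 i := fun i => by
    have hi : Continuous fun v : Vec d => v i := by fun_prop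
    exact hi.measurable.comp h.measurable_b
  have ha : ∀ i j, Measurable fun q : ℝ × Vec d => sqMat d σ q.1 q.2 i j := fun i j =>
    measurable_pi_iff.1 (measurable_pi_iff.1 h.measurable_a i) j
  refine (Finset.measurable_sum _ fun i _ => (hb i).mul
    ((contDiff_pd i hf).continuous.measurable.comp measurable_snd)).add
    ((Finset.measurable_sum _ fun i _ => Finset.measurable_sum _ fun j _ => (ha i j).mul
    ((contDiff_pd i (contDiff_pd j hf)).continuous.measurable.comp measurable_snd)).const_mul _)

end GrowthBound

namespace MartingaleProblemSolution
variable {d : ℕ} {b : ℝ → Vec d → Vec d} {σ : ℝ → Vec d → Matrix (Fin d) (Fin d) ℝ} {s t : ℝ} {x : Vec d}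
  {Ω : Type*} [MeasurableSpace Ω] {P : Measure Ω} {X : ℝ → Ω → Vec d} {C : ℝ} {f : Vec d → ℝ}

lemma measurable_stopped (hX : MartingaleProblemSolution d b σ s x P X) :
    Measurable (Function.uncurry fun r ω => X (max r s) ω) :=
  measurable_uncurry_of_continuous_of_measurable
    (fun ω => (hX.cont_paths ω).comp_continuous (by fun_prop) fun r => le_max_right r s)
    fun _ => hX.measurable_X _

lemma measurable_genApply_stopped (hX : MartingaleProblemSolution d b σ s x P X) (h : GrowthBound b σ C)
    (hf : ContDiff ℝ (⊤ : ℕ∞) f) : Measurable (Function.uncurry fun r ω => genApply d b σ r f (X (max r s) ω)) := by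
  exact (h.measurable_genApply hf).comp (measurable_fst.prodMk hX.measurable_stopped)

lemma integrable_comp (hX : MartingaleProblemSolution d b σ s x P X) (hf : Continuous f) {A : ℝ}
    (hA : ∀ z, |f z| ≤ A) (r : ℝ) : Integrable (fun ω => f (X r ω)) P := by
  have := hX.isProb
  exact Integrable.of_bound (hf.measurable.comp (hX.measurable_X r)).aestronglyMeasurable A
    (Eventually.of_forall fun ω => hA _)

/-- Dynkin's formula for compactly supported test functions. -/
lemma dynkin_of_hasCompactSupport (hX : MartingaleProblemSolution d b σ s x P X) (h : GrowthBound b σ C)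
    (hs : 0 ≤ s) (hf : ContDiff ℝ (⊤ : ℕ∞) f) (hc : HasCompactSupport f) {v : ℝ} (hv : s ≤ v) :
    ∫ ω, f (X v ω) ∂P = ∫ ω, f (X s ω) ∂P + ∫ r in s..v, ∫ ω, genApply d b σ r f (X (max r s) ω) ∂P := by
  have := hX.isProb
  obtain ⟨M, hM, hM0, hM1, hM2⟩ := exists_bound_of_smooth_of_hasCompactSupport hf hc
  obtain ⟨R, hR⟩ := hc.isBounded.subset_closedBall 0
  have hR1 : ∀ i z, (1 + ‖z‖) * |pd i f z| ≤ (1 + |R|) * M := fun i z => by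
    by_cases hz : z ∈ tsupport f
    · have h1 := hR hz
      rw [mem_closedBall_zero_iff] at h1
      exact mul_le_mul (by linarith [le_abs_self R]) (hM1 i z) (abs_nonneg _) (by positivity)
    · have h3 : fderiv ℝ f z = 0 := fderiv_of_notMem_tsupport ℝ hz
      have : pd i f z = 0 := by simp [pd, h3]
      rw [this, abs_zero, mul_zero]; positivity
  set Q := d * (C * ((1 + |R|) * M)) + d ^ 2 * (C * M) with hQ
  have hbd : ∀ r : ℝ, 0 ≤ r → ∀ z, |genApply d b σ r f z| ≤ Q := fun r hr z =>
    h.abs_genApply_le hf hr (fun i => hR1 i z) fun i j => hM2 i j z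
  have hint : ∀ r, Integrable (fun ω => f (X r ω)) P := hX.integrable_comp hf.continuous hM0
  have h1 := hX.martingale f hf hc s v le_rfl hv univ MeasurableSet.univ
  simp only [Measure.restrict_univ, intervalIntegral.integral_same, sub_zero] at h1
  have hI : Integrable (fun ω => ∫ r in s..v, genApply d b σ r f (X r ω)) P := by
    have h2 := (hint v).sub (hX.integrable f hf hc v hv)
    refine h2.congr (Eventually.of_forall fun ω => ?_)
    simp
  rw [integral_sub (hint v) hI] at h1
  rw [← h1]
  have h3 : ∫ r in s..v, ∫ ω, genApply d b σ r f (X (max r s) ω) ∂P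
      = ∫ ω, (∫ r in s..v, genApply d b σ r f (X (max r s) ω)) ∂P := by
    refine intervalIntegral_integral_swap ?_
    rw [uIoc_of_le hv]
    refine Integrable.of_bound (hX.measurable_genApply_stopped h hf).aestronglyMeasurable Q ?_
    have : ∀ᵐ q ∂((volume.restrict (Ioc s v)).prod P), q.1 ∈ Ioc s v := by
      have h4 : ∀ᵐ r ∂(volume.restrict (Ioc s v)), r ∈ Ioc s v := ae_restrict_mem measurableSet_Ioc
      exact Measure.quasiMeasurePreserving_fst.ae h4
    filter_upwards [this] with q hq
    exact hbd _ (hs.trans hq.1.le) _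
  have h5 : ∀ ω, ∫ r in s..v, genApply d b σ r f (X (max r s) ω) = ∫ r in s..v, genApply d b σ r f (X r ω) :=
    fun ω => by
      refine intervalIntegral.integral_congr fun r hr => ?_
      rw [uIcc_of_le hv] at hr
      simp only [max_eq_left hr.1]
  rw [h3]
  simp only [h5]
  ring

lemma integrable_genApply (hX : MartingaleProblemSolution d b σ s x P X) (h : GrowthBound b σ C) (hs : 0 ≤ s)
    (hf : ContDiff ℝ (⊤ : ℕ∞) f) {W : Vec d → ℝ} {A : ℝ} (hA : 0 ≤ A) (hW1 : ∀ z, 1 ≤ W z)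
    (h1 : ∀ i z, (1 + ‖z‖) * |pd i f z| ≤ A * W z) (h2 : ∀ i j z, |pd i (pd j f) z| ≤ A)
    {r : ℝ} (hr : s ≤ r) (hW : Integrable (fun ω => W (X r ω)) P) :
    Integrable (fun ω => genApply d b σ r f (X (max r s) ω)) P := by
  refine Integrable.mono' (hW.const_mul (d * (C * A) + d ^ 2 * (C * A)))
    ((hX.measurable_genApply_stopped h hf).comp measurable_prodMk_left).aestronglyMeasurable
    (Eventually.of_forall fun ω => ?_)
  rw [max_eq_left hr]
  refine (h.abs_genApply_le hf (hs.trans hr) (fun i => h1 i _)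
    fun i j => (h2 i j _).trans (le_mul_of_one_le_right hA (hW1 (X r ω)))).trans_eq ?_
  ring

lemma intervalIntegrable_genApply (hX : MartingaleProblemSolution d b σ s x P X) (h : GrowthBound b σ C) (hs : 0 ≤ s)
    (hf : ContDiff ℝ (⊤ : ℕ∞) f) {W : Vec d → ℝ} {A N : ℝ} (hA : 0 ≤ A) (hW1 : ∀ z, 1 ≤ W z)
    (h1 : ∀ i z, (1 + ‖z‖) * |pd i f z| ≤ A * W z) (h2 : ∀ i j z, |pd i (pd j f) z| ≤ A)
    (hW : ∀ r ∈ Icc s t, Integrable (fun ω => W (X r ω)) P) (hN : ∀ r ∈ Icc s t, ∫ ω, W (X r ω) ∂P ≤ N)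
    {v : ℝ} (hv : v ∈ Icc s t) :
    IntervalIntegrable (fun r => ∫ ω, genApply d b σ r f (X (max r s) ω) ∂P) volume s v := by
  have := hX.isProb
  rw [intervalIntegrable_iff_integrableOn_Ioc_of_le hv.1]
  refine Integrable.mono' (g := fun _ => (d * (C * A) + d ^ 2 * (C * A)) * N) (integrableOn_const (by simp))
    ((hX.measurable_genApply_stopped h hf).stronglyMeasurable.integral_prod_right).aestronglyMeasurable
    (ae_restrict_of_forall_mem measurableSet_Ioc fun r hr => ?_)
  have hr' : r ∈ Icc s t := ⟨hr.1.le, hr.2.trans hv.2⟩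
  have hC := h.nonneg
  refine (norm_integral_le_of_norm_le ((hW r hr').const_mul (d * (C * A) + d ^ 2 * (C * A)))
    (Eventually.of_forall fun ω => ?_)).trans ?_
  · rw [max_eq_left hr'.1]
    refine (h.abs_genApply_le hf (hs.trans hr'.1) (fun i => h1 i _)
      fun i j => (h2 i j _).trans (le_mul_of_one_le_right hA (hW1 (X r ω)))).trans_eq ?_
    ring
  · rw [integral_const_mul]
    exact mul_le_mul_of_nonneg_left (hN r hr') (by positivity)

set_option maxHeartbeats 1000000 in
/-- Dynkin's formula for bounded test functions whose derivatives are controlled by an integrable weight. -/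
lemma dynkin (hX : MartingaleProblemSolution d b σ s x P X) (h : GrowthBound b σ C) (hs : 0 ≤ s)
    (hf : ContDiff ℝ (⊤ : ℕ∞) f) {W : Vec d → ℝ} {A N : ℝ} (hA : 0 ≤ A) (hW1 : ∀ z, 1 ≤ W z) (h0 : ∀ z, |f z| ≤ A)
    (h1 : ∀ i z, (1 + ‖z‖) * |pd i f z| ≤ A * W z) (h2 : ∀ i j z, |pd i (pd j f) z| ≤ A)
    (hW : ∀ r ∈ Icc s t, Integrable (fun ω => W (X r ω)) P) (hN : ∀ r ∈ Icc s t, ∫ ω, W (X r ω) ∂P ≤ N)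
    {v : ℝ} (hv : v ∈ Icc s t) :
    ∫ ω, f (X v ω) ∂P = ∫ ω, f (X s ω) ∂P + ∫ r in s..v, ∫ ω, genApply d b σ r f (X (max r s) ω) ∂P := by
  have := hX.isProb
  have hC := h.nonneg
  obtain ⟨χ, M, hM, hχ⟩ := exists_cutoff d
  choose hχs hχc hχ1 hχb hχp hχpp using hχ
  set F : ℕ → Vec d → ℝ := fun n z => f z * χ n z with hF
  have hFs : ∀ n, ContDiff ℝ (⊤ : ℕ∞) (F n) := fun n => hf.mul (hχs n)
  have hFc : ∀ n, HasCompactSupport (F n) := fun n => (hχc n).mul_left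
  have hF0 : ∀ n z, |F n z| ≤ A := fun n z => by
    simp only [hF, abs_mul]
    simpa using mul_le_mul (h0 z) (hχb n z) (abs_nonneg _) hA
  have hFe : ∀ z, ∀ᶠ n in atTop, F n =ᶠ[𝓝 z] f := fun z => by
    filter_upwards [eventually_ge_atTop ⌈‖z‖⌉₊] with n hn
    have h3 : ‖z‖ < n + 1 := by
      have := (Nat.ceil_le.1 hn)
      linarith
    filter_upwards [(isOpen_lt continuous_norm continuous_const).mem_nhds h3] with w hw
    simp only [hF]
    rw [hχ1 n w (le_of_lt hw), mul_one]
  set A' := A * (1 + 3 * M) with hA'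
  have hAA' : 0 ≤ A' := by positivity
  have hpd : ∀ i z, |pd i f z| ≤ A * W z := fun i z => by
    refine le_trans ?_ (h1 i z)
    nlinarith [abs_nonneg (pd i f z), norm_nonneg z]
  have hχpd : ∀ n i z, |pd i (χ n) z| ≤ M := fun n i z => by
    refine le_trans ?_ (hχp n i z)
    nlinarith [abs_nonneg (pd i (χ n) z), norm_nonneg z]
  have hF1 : ∀ n i z, (1 + ‖z‖) * |pd i (F n) z| ≤ A' * W z := fun n i z => by
    simp only [hF]
    rw [pd_mul i hf (hχs n)]
    have e1 : (1 + ‖z‖) * |pd i f z * χ n z| ≤ A * W z := by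
      rw [abs_mul, ← mul_assoc]
      have := mul_le_mul (h1 i z) (hχb n z) (abs_nonneg _) (by have := hW1 z; positivity)
      linarith
    have e2 : (1 + ‖z‖) * |f z * pd i (χ n) z| ≤ A * M := by
      rw [abs_mul, mul_left_comm]
      exact mul_le_mul (h0 z) (hχp n i z) (by positivity) hA
    have e3 : A * M ≤ A * M * W z := le_mul_of_one_le_right (by positivity) (hW1 z)
    calc _ ≤ (1 + ‖z‖) * (|pd i f z * χ n z| + |f z * pd i (χ n) z|) :=
          mul_le_mul_of_nonneg_left (abs_add_le _ _) (by positivity)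
      _ ≤ A * W z + A * M * W z := by rw [mul_add]; linarith
      _ ≤ A' * W z := by
          have : 0 ≤ A * M * W z := by have := hW1 z; positivity
          simp only [hA']; nlinarith
  have hF2 : ∀ n i j z, |pd i (pd j (F n)) z| ≤ A' * W z := fun n i j z => by
    simp only [hF]
    rw [pd_pd_mul i j hf (hχs n)]
    have hWz := hW1 z
    have e1 : |pd i (pd j f) z * χ n z| ≤ A * 1 := by
      rw [abs_mul]; exact mul_le_mul (h2 i j z) (hχb n z) (abs_nonneg _) hA
    have e2 : |pd j f z * pd i (χ n) z| ≤ A * W z * M := by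
      rw [abs_mul]; exact mul_le_mul (hpd j z) (hχpd n i z) (abs_nonneg _) (by positivity)
    have e3 : |pd i f z * pd j (χ n) z| ≤ A * W z * M := by
      rw [abs_mul]; exact mul_le_mul (hpd i z) (hχpd n j z) (abs_nonneg _) (by positivity)
    have e4 : |f z * pd i (pd j (χ n)) z| ≤ A * M := by
      rw [abs_mul]; exact mul_le_mul (h0 z) (hχpp n i j z) (abs_nonneg _) hA
    have e5 : A ≤ A * W z := le_mul_of_one_le_right hA hWz
    have e6 : A * M ≤ A * M * W z := le_mul_of_one_le_right (by positivity) hWz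
    refine (abs_add_le _ _).trans ((add_le_add (abs_add_le _ _) (abs_add_le _ _)).trans ?_)
    simp only [hA']
    linarith
  have hgen : ∀ n, ∀ r ∈ Icc s t, ∀ ω, ‖genApply d b σ r (F n) (X (max r s) ω)‖
      ≤ (d * (C * A') + d ^ 2 * (C * A')) * W (X r ω) := fun n r hr ω => by
    rw [max_eq_left hr.1]
    refine (h.abs_genApply_le (hFs n) (hs.trans hr.1) (fun i => hF1 n i _) fun i j => hF2 n i j _).trans_eq ?_
    ring
  have hlimE : ∀ r, Tendsto (fun n => ∫ ω, F n (X r ω) ∂P) atTop (𝓝 (∫ ω, f (X r ω) ∂P)) := fun r => by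
    refine tendsto_integral_of_dominated_convergence (fun _ => A)
      (fun n => ((hFs n).continuous.measurable.comp (hX.measurable_X r)).aestronglyMeasurable) (integrable_const _)
      (fun n => Eventually.of_forall fun ω => hF0 n _) (Eventually.of_forall fun ω => ?_)
    refine tendsto_const_nhds.congr' ?_
    filter_upwards [hFe (X r ω)] with n hn
    exact hn.eq_of_nhds.symm
  have hlimG : ∀ r ∈ Icc s t, Tendsto (fun n => ∫ ω, genApply d b σ r (F n) (X (max r s) ω) ∂P) atTop
      (𝓝 (∫ ω, genApply d b σ r f (X (max r s) ω) ∂P)) := fun r hr => by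
    refine tendsto_integral_of_dominated_convergence
      (fun ω => (d * (C * A') + d ^ 2 * (C * A')) * W (X r ω))
      (fun n => ((hX.measurable_genApply_stopped h (hFs n)).comp measurable_prodMk_left).aestronglyMeasurable)
      ((hW r hr).const_mul _) (fun n => Eventually.of_forall fun ω => hgen n r hr ω)
      (Eventually.of_forall fun ω => ?_)
    refine tendsto_const_nhds.congr' ?_
    filter_upwards [hFe (X (max r s) ω)] with n hn
    have e1 : ∀ i, pd i f =ᶠ[𝓝 (X (max r s) ω)] pd i (F n) := fun i => by
      filter_upwards [hn.fderiv (𝕜 := ℝ)] with z hz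
      simp only [pd, hz]
    rw [GrowthBound.genApply_eq hf, GrowthBound.genApply_eq (hFs n)]
    congr 1
    · exact Finset.sum_congr rfl fun i _ => by rw [(e1 i).eq_of_nhds]
    · congr 1
      refine Finset.sum_congr rfl fun i _ => Finset.sum_congr rfl fun j _ => ?_
      congr 1
      show fderiv ℝ _ _ _ = fderiv ℝ _ _ _
      rw [(e1 j).fderiv_eq]
  have hlimI : Tendsto (fun n => ∫ r in s..v, ∫ ω, genApply d b σ r (F n) (X (max r s) ω) ∂P) atTop
      (𝓝 (∫ r in s..v, ∫ ω, genApply d b σ r f (X (max r s) ω) ∂P)) := by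
    refine intervalIntegral.tendsto_integral_filter_of_dominated_convergence
      (fun _ => (d * (C * A') + d ^ 2 * (C * A')) * N)
      (Eventually.of_forall fun n =>
        ((hX.measurable_genApply_stopped h (hFs n)).stronglyMeasurable.integral_prod_right).aestronglyMeasurable)
      (Eventually.of_forall fun n => Eventually.of_forall fun r hr => ?_) intervalIntegrable_const
      (Eventually.of_forall fun r hr => ?_)
    all_goals
      rw [uIoc_of_le hv.1] at hr
      have hr' : r ∈ Icc s t := ⟨hr.1.le, hr.2.trans hv.2⟩
    · refine (norm_integral_le_of_norm_le ((hW r hr').const_mul _)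
        (Eventually.of_forall fun ω => hgen n r hr' ω)).trans ?_
      rw [integral_const_mul]
      exact mul_le_mul_of_nonneg_left (hN r hr') (by positivity)
    · exact hlimG r hr'
  refine tendsto_nhds_unique (hlimE v) (((hlimE s).add hlimI).congr fun n => ?_)
  exact (hX.dynkin_of_hasCompactSupport h hs (hFs n) (hFc n) hv.1).symm

end MartingaleProblemSolution

/-- A bounded smooth approximation of `1 + ‖z‖ ^ 2`. -/
def quadCap {d : ℕ} (ε : ℝ) (z : Vec d) : ℝ := (1 + ‖z‖ ^ 2) / (1 + ε * (1 + ‖z‖ ^ 2))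

section quadCap
variable {d : ℕ} {ε : ℝ}

lemma one_le_capDen (hε : 0 < ε) (z : Vec d) : 1 ≤ 1 + ε * (1 + ‖z‖ ^ 2) := by
  have : 0 ≤ ε * (1 + ‖z‖ ^ 2) := by positivity
  linarith

lemma quadCap_nonneg (hε : 0 < ε) (z : Vec d) : 0 ≤ quadCap ε z := by
  unfold quadCap; positivity

lemma quadCap_le (hε : 0 < ε) (z : Vec d) : quadCap ε z ≤ 1 + ‖z‖ ^ 2 :=
  div_le_self (by positivity) (one_le_capDen hε z)

lemma quadCap_le_inv (hε : 0 < ε) (z : Vec d) : quadCap ε z ≤ 1 / ε := by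
  unfold quadCap
  rw [div_le_div_iff₀ (by positivity) hε]
  nlinarith

lemma contDiff_quadCap (hε : 0 < ε) : ContDiff ℝ (⊤ : ℕ∞) (quadCap ε : Vec d → ℝ) := by
  have h : ContDiff ℝ (⊤ : ℕ∞) fun z : Vec d => 1 + ‖z‖ ^ 2 := contDiff_const.add (contDiff_norm_sq ℝ)
  exact h.div (contDiff_const.add (contDiff_const.mul h)) fun z => by have := one_le_capDen hε z; positivity

lemma hasFDerivAt_one_add_norm_sq (z : Vec d) :
    HasFDerivAt (fun z : Vec d => 1 + ‖z‖ ^ 2) (2 • innerSL ℝ z) z :=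
  (hasStrictFDerivAt_norm_sq z).hasFDerivAt.const_add 1

lemma pd_quadCap (hε : 0 < ε) (i : Fin d) :
    pd i (quadCap ε) = fun z : Vec d => 2 * z i * ((1 + ε * (1 + ‖z‖ ^ 2)) ^ 2)⁻¹ := by
  funext z
  have hD : 1 + ε * (1 + ‖z‖ ^ 2) ≠ 0 := by have := one_le_capDen hε z; positivity
  have h1 : HasDerivAt (fun x : ℝ => x / (1 + ε * x)) (((1 + ε * (1 + ‖z‖ ^ 2)) ^ 2)⁻¹) (1 + ‖z‖ ^ 2) := by
    have := (hasDerivAt_id (1 + ‖z‖ ^ 2)).fun_div (((hasDerivAt_id (1 + ‖z‖ ^ 2)).const_mul ε).const_add 1) hD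
    refine this.congr_deriv ?_
    simp only [id]
    field_simp
    ring
  have h2 := h1.comp_hasFDerivAt z (hasFDerivAt_one_add_norm_sq z)
  unfold pd
  rw [show quadCap ε = (fun x : ℝ => x / (1 + ε * x)) ∘ fun z : Vec d => 1 + ‖z‖ ^ 2 from rfl, h2.fderiv]
  simp [EuclideanSpace.inner_single_right]
  ring

lemma pd_pd_quadCap (hε : 0 < ε) (j i : Fin d) (z : Vec d) :
    pd j (pd i (quadCap ε)) z = 2 * (if i = j then 1 else 0) * ((1 + ε * (1 + ‖z‖ ^ 2)) ^ 2)⁻¹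
      - 8 * ε * (z i * z j) * ((1 + ε * (1 + ‖z‖ ^ 2)) ^ 3)⁻¹ := by
  rw [pd_quadCap hε]
  have hD : 1 + ε * (1 + ‖z‖ ^ 2) ≠ 0 := by have := one_le_capDen hε z; positivity
  have h1 : HasDerivAt (fun x : ℝ => ((1 + ε * x) ^ 2)⁻¹) (-2 * ε * ((1 + ε * (1 + ‖z‖ ^ 2)) ^ 3)⁻¹) (1 + ‖z‖ ^ 2) := by
    have := ((((hasDerivAt_id (1 + ‖z‖ ^ 2)).const_mul ε).const_add 1).fun_pow 2).fun_inv (by simpa using hD)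
    refine this.congr_deriv ?_
    simp only [id]
    field_simp
    norm_num
    ring
  have h2 := h1.comp_hasFDerivAt z (hasFDerivAt_one_add_norm_sq z)
  have h3 : HasFDerivAt (fun z : Vec d => 2 * z i) ((2 : ℝ) • (EuclideanSpace.proj i : Vec d →L[ℝ] ℝ)) z :=
    (EuclideanSpace.proj i : Vec d →L[ℝ] ℝ).hasFDerivAt.const_mul 2
  have h4 := h3.fun_mul h2
  unfold pd
  simp only [Function.comp_def] at h4
  rw [h4.fderiv]
  simp [PiLp.single_apply, EuclideanSpace.inner_single_right]
  split_ifs <;> ring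

lemma abs_pd_quadCap_le (hε : 0 < ε) (i : Fin d) (z : Vec d) :
    (1 + ‖z‖) * |pd i (quadCap ε) z| ≤ 4 * quadCap ε z := by
  rw [pd_quadCap hε]
  have hD := one_le_capDen hε z
  set D := 1 + ε * (1 + ‖z‖ ^ 2)
  have hD0 : 0 < D := by linarith
  have h1 : |z i| ≤ ‖z‖ := PiLp.norm_apply_le z i
  have h2 : (D ^ 2)⁻¹ ≤ D⁻¹ := inv_anti₀ hD0 (by nlinarith)
  show (1 + ‖z‖) * |2 * z i * (D ^ 2)⁻¹| ≤ 4 * ((1 + ‖z‖ ^ 2) / D)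
  rw [abs_mul, abs_mul, abs_of_pos (show (0:ℝ) < 2 by norm_num), abs_of_pos (show 0 < (D ^ 2)⁻¹ by positivity)]
  calc (1 + ‖z‖) * (2 * |z i| * (D ^ 2)⁻¹) = (1 + ‖z‖) * (2 * |z i|) * (D ^ 2)⁻¹ := by ring
    _ ≤ (4 * (1 + ‖z‖ ^ 2)) * D⁻¹ := by
        refine mul_le_mul ?_ h2 (by positivity) (by positivity)
        have : (1 + ‖z‖) * (2 * |z i|) ≤ (1 + ‖z‖) * (2 * ‖z‖) :=
          mul_le_mul_of_nonneg_left (by linarith) (by positivity)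
        nlinarith [sq_nonneg (‖z‖ - 1)]
    _ = _ := by rw [div_eq_mul_inv]; ring

lemma abs_pd_pd_quadCap_le (hε : 0 < ε) (j i : Fin d) (z : Vec d) :
    |pd j (pd i (quadCap ε)) z| ≤ 10 * quadCap ε z := by
  rw [pd_pd_quadCap hε]
  have hD := one_le_capDen hε z
  have hεD : ε * ‖z‖ ^ 2 ≤ 1 + ε * (1 + ‖z‖ ^ 2) := by nlinarith
  set D := 1 + ε * (1 + ‖z‖ ^ 2)
  have hD0 : 0 < D := by linarith
  have h1 : |z i| ≤ ‖z‖ := PiLp.norm_apply_le z i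
  have h1' : |z j| ≤ ‖z‖ := PiLp.norm_apply_le z j
  have h2 : (D ^ 2)⁻¹ ≤ D⁻¹ := inv_anti₀ hD0 (by nlinarith)
  have e1 : |2 * (if i = j then 1 else 0) * (D ^ 2)⁻¹| ≤ 2 * D⁻¹ := by
    rw [abs_mul, abs_of_pos (show 0 < (D ^ 2)⁻¹ by positivity)]
    refine mul_le_mul ?_ h2 (by positivity) (by norm_num)
    split_ifs <;> norm_num
  have e2 : |8 * ε * (z i * z j) * (D ^ 3)⁻¹| ≤ 8 * D⁻¹ := by
    have h3 : |8 * ε * (z i * z j)| ≤ 8 * D := by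
      rw [abs_mul, abs_of_pos (show 0 < 8 * ε by positivity), abs_mul]
      have : |z i| * |z j| ≤ ‖z‖ * ‖z‖ := mul_le_mul h1 h1' (abs_nonneg _) (norm_nonneg _)
      nlinarith
    rw [abs_mul, abs_of_pos (show 0 < (D ^ 3)⁻¹ by positivity)]
    calc _ ≤ 8 * D * (D ^ 3)⁻¹ := mul_le_mul_of_nonneg_right h3 (by positivity)
      _ = 8 * (D ^ 2)⁻¹ := by field_simp
      _ ≤ _ := by linarith
  show _ ≤ 10 * ((1 + ‖z‖ ^ 2) / D)
  have h5 : D⁻¹ ≤ (1 + ‖z‖ ^ 2) / D := by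
    rw [div_eq_mul_inv]
    exact le_mul_of_one_le_left (by positivity) (by nlinarith [sq_nonneg ‖z‖])
  refine (abs_sub _ _).trans ?_
  linarith

end quadCap

namespace MartingaleProblemSolution
variable {d : ℕ} {b : ℝ → Vec d → Vec d} {σ : ℝ → Vec d → Matrix (Fin d) (Fin d) ℝ} {s t : ℝ} {x : Vec d}
  {Ω : Type*} [MeasurableSpace Ω] {P : Measure Ω} {X : ℝ → Ω → Vec d} {C : ℝ}

lemma integral_quadCap_le (hX : MartingaleProblemSolution d b σ s x P X) (h : GrowthBound b σ C)
    (hs : 0 ≤ s) {ε : ℝ} (hε : 0 < ε) {r : ℝ} (hr : r ∈ Icc s t) :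
    ∫ ω, quadCap ε (X r ω) ∂P
      ≤ (1 + ‖x‖ ^ 2) * Real.exp ((d * (C * 4) + d ^ 2 * (C * 10)) * (t - s)) := by
  have := hX.isProb
  have hC := h.nonneg
  set k : ℝ := d * (C * 4) + d ^ 2 * (C * 10) with hk
  have hk0 : 0 ≤ k := by positivity
  set e : ℝ → ℝ := fun v => ∫ ω, quadCap ε (X (max v s) ω) ∂P with he
  have hU := contDiff_quadCap (d := d) hε
  have habs : ∀ z : Vec d, |quadCap ε z| ≤ 1 / ε := fun z => by
    rw [abs_of_nonneg (quadCap_nonneg hε z)]; exact quadCap_le_inv hε z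
  have hint : ∀ r, Integrable (fun ω => quadCap ε (X r ω)) P := hX.integrable_comp hU.continuous habs
  have hcont : Continuous e := by
    refine continuous_of_dominated (bound := fun _ => 1 / ε)
      (fun v => (hint _).aestronglyMeasurable) (fun v => Eventually.of_forall fun ω => habs _)
      (integrable_const _) (Eventually.of_forall fun ω => ?_)
    exact hU.continuous.comp ((hX.cont_paths ω).comp_continuous (by fun_prop) fun r => le_max_right r s)
  have hstart : e s ≤ 1 + ‖x‖ ^ 2 := by
    have : e s = ∫ ω, quadCap ε x ∂P := by
      refine integral_congr_ae ?_
      filter_upwards [hX.start] with ω hω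
      rw [max_self, hω]
    rw [this]
    simpa using quadCap_le hε x
  have hbound : ∀ v ∈ Icc s t, e v ≤ (1 + ‖x‖ ^ 2) + k * ∫ r in s..v, e r := fun v hv => by
    have hpos : (0:ℝ) < 1 / ε := by positivity
    have hd := hX.dynkin (t := t) h hs hU (W := fun _ => 1) (A := 10 / ε) (N := 1) (by positivity) (fun _ => le_rfl)
      (fun z => (habs z).trans (div_le_div_of_nonneg_right (by norm_num) hε.le))
      (fun i z => (abs_pd_quadCap_le hε i z).trans (by
        have := quadCap_le_inv hε z
        have e1 : 10 / ε = 10 * (1 / ε) := by ring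
        rw [e1]; linarith))
      (fun i j z => (abs_pd_pd_quadCap_le hε i j z).trans (by
        have := quadCap_le_inv hε z
        have e1 : 10 / ε = 10 * (1 / ε) := by ring
        rw [e1]; linarith))
      (fun r _ => integrable_const _) (fun r _ => by simp) hv
    have hG : ∀ r, s ≤ r → ∫ ω, genApply d b σ r (quadCap ε) (X (max r s) ω) ∂P ≤ k * e r := fun r hr => by
      refine (Real.le_norm_self _).trans ?_
      show _ ≤ k * ∫ ω, quadCap ε (X (max r s) ω) ∂P
      rw [← integral_const_mul]
      refine norm_integral_le_of_norm_le ((hint _).const_mul k) (Eventually.of_forall fun ω => ?_)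
      refine (h.abs_genApply_le hU (hs.trans hr) (fun i => abs_pd_quadCap_le hε i _)
        fun i j => abs_pd_pd_quadCap_le hε i j _).trans_eq ?_
      rw [hk]; ring
    have e1 : e v = ∫ ω, quadCap ε (X v ω) ∂P := by rw [he]; simp only [max_eq_left hv.1]
    have e2 : e s = ∫ ω, quadCap ε (X s ω) ∂P := by rw [he]; simp only [max_self]
    rw [e1, hd, ← e2, ← intervalIntegral.integral_const_mul]
    refine add_le_add hstart (intervalIntegral.integral_mono_on hv.1 ?_ ((hcont.const_mul k).intervalIntegrable _ _)
      fun r hr => hG r hr.1)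
    exact hX.intervalIntegrable_genApply (t := t) h hs hU (W := fun _ => 1) (A := 10 / ε) (N := 1) (by positivity)
      (fun _ => le_rfl)
      (fun i z => (abs_pd_quadCap_le hε i z).trans (by
        have := quadCap_le_inv hε z
        have e1 : 10 / ε = 10 * (1 / ε) := by ring
        rw [e1]; linarith))
      (fun i j z => (abs_pd_pd_quadCap_le hε i j z).trans (by
        have := quadCap_le_inv hε z
        have e1 : 10 / ε = 10 * (1 / ε) := by ring
        rw [e1]; linarith))
      (fun r _ => integrable_const _) (fun r _ => by simp) hv
  have hst : s ≤ t := hr.1.trans hr.2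
  have hg := gronwall_integral (u := fun w => e (s + w)) (a := 1 + ‖x‖ ^ 2) (k := k) (V := t - s)
    (by linarith) hk0 (hcont.comp (continuous_const.add continuous_id)).continuousOn (fun v hv => by
      rw [intervalIntegral.integral_comp_add_left, add_zero]
      exact hbound (s + v) ⟨by linarith [hv.1], by linarith [hv.2]⟩) (r - s) ⟨by linarith [hr.1], by linarith [hr.2]⟩
  have e1 : e (s + (r - s)) = ∫ ω, quadCap ε (X r ω) ∂P := by
    rw [he]; simp only [add_sub_cancel, max_eq_left hr.1]
  rw [← e1]
  refine hg.trans (mul_le_mul_of_nonneg_left (Real.exp_le_exp.2 ?_) (by positivity))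
  exact mul_le_mul_of_nonneg_left (by linarith [hr.2]) hk0

/-- Second moments of solutions are finite. -/
lemma integrable_sq (hX : MartingaleProblemSolution d b σ s x P X) (h : GrowthBound b σ C) (hs : 0 ≤ s)
    {r : ℝ} (hr : r ∈ Icc s t) :
    Integrable (fun ω => 1 + ‖X r ω‖ ^ 2) P ∧ ∫ ω, (1 + ‖X r ω‖ ^ 2) ∂P
      ≤ (1 + ‖x‖ ^ 2) * Real.exp ((d * (C * 4) + d ^ 2 * (C * 10)) * (t - s)) := by
  have := hX.isProb
  set M := (1 + ‖x‖ ^ 2) * Real.exp ((d * (C * 4) + d ^ 2 * (C * 10)) * (t - s)) with hM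
  have hM0 : 0 ≤ M := by positivity
  have hε : ∀ n : ℕ, 0 < 1 / ((n : ℝ) + 1) := fun n => Nat.one_div_pos_of_nat
  have hmX := hX.measurable_X r
  have hmeas : ∀ n : ℕ, Measurable fun ω => ENNReal.ofReal (quadCap (1 / ((n : ℝ) + 1)) (X r ω)) := fun n =>
    ((contDiff_quadCap (hε n)).continuous.measurable.comp hmX).ennreal_ofReal
  have hlim : ∀ ω, Tendsto (fun n : ℕ => ENNReal.ofReal (quadCap (1 / ((n : ℝ) + 1)) (X r ω))) atTop
      (𝓝 (ENNReal.ofReal (1 + ‖X r ω‖ ^ 2))) := fun ω => by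
    refine ENNReal.tendsto_ofReal ?_
    have h1 : Tendsto (fun n : ℕ => (1 + ‖X r ω‖ ^ 2) / (1 + 1 / ((n : ℝ) + 1) * (1 + ‖X r ω‖ ^ 2))) atTop
        (𝓝 ((1 + ‖X r ω‖ ^ 2) / (1 + 0 * (1 + ‖X r ω‖ ^ 2)))) :=
      tendsto_const_nhds.div (tendsto_const_nhds.add (tendsto_one_div_add_atTop_nhds_zero_nat.mul_const _)) (by simp)
    simpa [quadCap] using h1
  have hle : ∫⁻ ω, ENNReal.ofReal (1 + ‖X r ω‖ ^ 2) ∂P ≤ ENNReal.ofReal M := by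
    calc ∫⁻ ω, ENNReal.ofReal (1 + ‖X r ω‖ ^ 2) ∂P
        = ∫⁻ ω, liminf (fun n : ℕ => ENNReal.ofReal (quadCap (1 / ((n : ℝ) + 1)) (X r ω))) atTop ∂P :=
          lintegral_congr fun ω => (hlim ω).liminf_eq.symm
      _ ≤ liminf (fun n : ℕ => ∫⁻ ω, ENNReal.ofReal (quadCap (1 / ((n : ℝ) + 1)) (X r ω)) ∂P) atTop :=
          lintegral_liminf_le hmeas
      _ ≤ ENNReal.ofReal M := by
          refine liminf_le_of_le (by isBoundedDefault) fun c hc => ?_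
          obtain ⟨n, hn⟩ := hc.exists
          refine hn.trans ?_
          rw [← ofReal_integral_eq_lintegral_ofReal]
          · exact ENNReal.ofReal_le_ofReal (hX.integral_quadCap_le h hs (hε n) hr)
          · refine hX.integrable_comp (contDiff_quadCap (hε n)).continuous (A := 1 / (1 / ((n : ℝ) + 1))) (fun z => ?_) r
            rw [abs_of_nonneg (quadCap_nonneg (hε n) z)]; exact quadCap_le_inv (hε n) z
          · exact Eventually.of_forall fun ω => quadCap_nonneg (hε n) _
  have hms : AEStronglyMeasurable (fun ω => 1 + ‖X r ω‖ ^ 2) P :=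
    (measurable_const.add (hmX.norm.pow_const 2)).aestronglyMeasurable
  have hnn : 0 ≤ᵐ[P] fun ω => 1 + ‖X r ω‖ ^ 2 := Eventually.of_forall fun ω => by
    show (0:ℝ) ≤ 1 + ‖X r ω‖ ^ 2
    positivity
  refine ⟨⟨hms, ?_⟩, ?_⟩
  · rw [hasFiniteIntegral_iff_ofReal hnn]
    exact hle.trans_lt ENNReal.ofReal_lt_top
  · rw [integral_eq_lintegral_of_nonneg_ae hnn hms]
    exact ENNReal.toReal_le_of_le_ofReal hM0 hle

end MartingaleProblemSolution

section phase
variable {d : ℕ} (k : Vec d)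

lemma hasFDerivAt_phase (z : Vec d) : HasFDerivAt (fun z : Vec d => ∑ i, k i * z i)
    (∑ i, k i • (EuclideanSpace.proj i : Vec d →L[ℝ] ℝ)) z :=
  HasFDerivAt.fun_sum fun i _ => (EuclideanSpace.proj i : Vec d →L[ℝ] ℝ).hasFDerivAt.const_mul (k i)

lemma contDiff_phase : ContDiff ℝ (⊤ : ℕ∞) fun z : Vec d => ∑ i, k i * z i :=
  ContDiff.sum fun i _ => contDiff_const.mul (EuclideanSpace.proj i : Vec d →L[ℝ] ℝ).contDiff

lemma contDiff_cos_phase : ContDiff ℝ (⊤ : ℕ∞) fun z : Vec d => Real.cos (∑ i, k i * z i) :=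
  Real.contDiff_cos.comp (contDiff_phase k)

lemma contDiff_sin_phase : ContDiff ℝ (⊤ : ℕ∞) fun z : Vec d => Real.sin (∑ i, k i * z i) :=
  Real.contDiff_sin.comp (contDiff_phase k)

lemma pd_cos_phase (i : Fin d) :
    pd i (fun z : Vec d => Real.cos (∑ i, k i * z i)) = fun z => -k i * Real.sin (∑ i, k i * z i) := by
  funext z
  unfold pd
  rw [(hasFDerivAt_phase k z).cos.fderiv]
  simp [PiLp.single_apply, _root_.sum_apply]
  ring

lemma pd_sin_phase (i : Fin d) :
    pd i (fun z : Vec d => Real.sin (∑ i, k i * z i)) = fun z => k i * Real.cos (∑ i, k i * z i) := by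
  funext z
  unfold pd
  rw [(hasFDerivAt_phase k z).sin.fderiv]
  simp [PiLp.single_apply, _root_.sum_apply]
  ring

lemma pd_pd_cos_phase (i j : Fin d) (z : Vec d) :
    pd i (pd j fun z : Vec d => Real.cos (∑ i, k i * z i)) z = -(k i * k j) * Real.cos (∑ i, k i * z i) := by
  rw [pd_cos_phase, pd_const_mul i (differentiable_of_smooth (contDiff_sin_phase k)), pd_sin_phase]
  ring

lemma pd_pd_sin_phase (i j : Fin d) (z : Vec d) :
    pd i (pd j fun z : Vec d => Real.sin (∑ i, k i * z i)) z = -(k i * k j) * Real.sin (∑ i, k i * z i) := by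
  rw [pd_sin_phase, pd_const_mul i (differentiable_of_smooth (contDiff_cos_phase k)), pd_cos_phase]
  ring

lemma exp_phase (φ : ℝ) : Complex.exp (Complex.I * (φ : ℂ)) = (Real.cos φ : ℂ) + Complex.I * (Real.sin φ : ℂ) := by
  rw [mul_comm, Complex.exp_mul_I, Complex.ofReal_cos, Complex.ofReal_sin]; ring

lemma genSymb_mul_exp_phase (b : ℝ → Vec d → Vec d) (σ : ℝ → Vec d → Matrix (Fin d) (Fin d) ℝ) (r : ℝ) (z : Vec d) :
    genSymb 0 (b r z) (fun i j => sqMat d σ r z i j) k * Complex.exp (Complex.I * ((∑ i, k i * z i : ℝ) : ℂ))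
      = (genApply d b σ r (fun z : Vec d => Real.cos (∑ i, k i * z i)) z : ℂ)
        + Complex.I * (genApply d b σ r (fun z : Vec d => Real.sin (∑ i, k i * z i)) z : ℂ) := by
  have e1 : genApply d b σ r (fun z : Vec d => Real.cos (∑ i, k i * z i)) z
      = -(∑ i, k i * b r z i) * Real.sin (∑ i, k i * z i)
        - quadForm (fun i j => sqMat d σ r z i j) k / 2 * Real.cos (∑ i, k i * z i) := by
    rw [GrowthBound.genApply_eq (contDiff_cos_phase k)]
    simp only [pd_pd_cos_phase, quadForm]
    simp only [pd_cos_phase]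
    simp only [sub_eq_add_neg, Finset.sum_div, Finset.sum_mul, Finset.mul_sum, ← Finset.sum_neg_distrib]
    congr 1
    · exact Finset.sum_congr rfl fun i _ => by ring
    · exact Finset.sum_congr rfl fun i _ => Finset.sum_congr rfl fun j _ => by ring
  have e2 : genApply d b σ r (fun z : Vec d => Real.sin (∑ i, k i * z i)) z
      = (∑ i, k i * b r z i) * Real.cos (∑ i, k i * z i)
        - quadForm (fun i j => sqMat d σ r z i j) k / 2 * Real.sin (∑ i, k i * z i) := by
    rw [GrowthBound.genApply_eq (contDiff_sin_phase k)]
    simp only [pd_pd_sin_phase, quadForm]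
    simp only [pd_sin_phase]
    simp only [sub_eq_add_neg, Finset.sum_div, Finset.sum_mul, Finset.mul_sum, ← Finset.sum_neg_distrib]
    congr 1
    · exact Finset.sum_congr rfl fun i _ => by ring
    · exact Finset.sum_congr rfl fun i _ => Finset.sum_congr rfl fun j _ => by ring
  rw [e1, e2, exp_phase]
  unfold genSymb
  simp only [Complex.ofReal_sub, Complex.ofReal_mul, Complex.ofReal_neg, Complex.ofReal_zero]
  linear_combination ((∑ i, k i * b r z i : ℝ) : ℂ) * (Real.sin (∑ i, k i * z i) : ℂ) * Complex.I_mul_I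

end phase

lemma integral_ofReal_add_I_mul {α : Type*} [MeasurableSpace α] {μ : Measure α} {f g : α → ℝ}
    (hf : Integrable f μ) (hg : Integrable g μ) :
    ∫ a, ((f a : ℂ) + Complex.I * (g a : ℂ)) ∂μ = ((∫ a, f a ∂μ : ℝ) : ℂ) + Complex.I * ((∫ a, g a ∂μ : ℝ) : ℂ) := by
  rw [integral_add hf.ofReal (hg.ofReal.const_mul _), integral_const_mul, integral_complex_ofReal,
    integral_complex_ofReal]

namespace MartingaleProblemSolution
variable {d : ℕ} {b : ℝ → Vec d → Vec d} {σ : ℝ → Vec d → Matrix (Fin d) (Fin d) ℝ} {s t : ℝ} {x : Vec d}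
  {Ω : Type*} [MeasurableSpace Ω] {P : Measure Ω} {X : ℝ → Ω → Vec d} {C : ℝ}

lemma exists_integrable_norm (hX : MartingaleProblemSolution d b σ s x P X) (h : GrowthBound b σ C) (hs : 0 ≤ s)
    (t : ℝ) : ∃ N, ∀ r ∈ Icc s t, Integrable (fun ω => 1 + ‖X r ω‖) P ∧ ∫ ω, (1 + ‖X r ω‖) ∂P ≤ N := by
  have := hX.isProb
  refine ⟨1 + (1 + ‖x‖ ^ 2) * Real.exp ((d * (C * 4) + d ^ 2 * (C * 10)) * (t - s)), fun r hr => ?_⟩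
  obtain ⟨h1, h2⟩ := hX.integrable_sq h hs hr
  have hle : ∀ ω, ‖X r ω‖ ≤ 1 + ‖X r ω‖ ^ 2 := fun ω => by nlinarith [sq_nonneg (‖X r ω‖ - 1)]
  have h3 : Integrable (fun ω => ‖X r ω‖) P := h1.mono' (hX.measurable_X r).norm.aestronglyMeasurable
    (Eventually.of_forall fun ω => by rw [norm_norm]; exact hle ω)
  refine ⟨(integrable_const 1).add h3, ?_⟩
  rw [integral_add (integrable_const 1) h3]
  simpa using (integral_mono h3 h1 hle).trans h2

set_option maxHeartbeats 1000000 in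
lemma integral_exp_phase (hX : MartingaleProblemSolution d b σ s x P X) (h : GrowthBound b σ C) (hs : 0 ≤ s)
    (k : Vec d) {v : ℝ} (hv : v ∈ Icc s t) :
    ∫ ω, Complex.exp (Complex.I * ((∑ i, k i * X v ω i : ℝ) : ℂ)) ∂P
      = ∫ ω, Complex.exp (Complex.I * ((∑ i, k i * X s ω i : ℝ) : ℂ)) ∂P
        + ∫ u in s..v, ∫ ω, genSymb 0 (b u (X (max u s) ω)) (fun i j => sqMat d σ u (X (max u s) ω) i j) k
            * Complex.exp (Complex.I * ((∑ i, k i * X (max u s) ω i : ℝ) : ℂ)) ∂P := by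
  have := hX.isProb
  obtain ⟨N, hN⟩ := hX.exists_integrable_norm h hs t
  set A : ℝ := 1 + ‖k‖ + ‖k‖ ^ 2 with hA
  have hA0 : 0 ≤ A := by positivity
  have hk : ∀ i, |k i| ≤ ‖k‖ := fun i => PiLp.norm_apply_le k i
  have hW1 : ∀ z : Vec d, 1 ≤ 1 + ‖z‖ := fun z => by linarith [norm_nonneg z]
  have hkA : ∀ i, |k i| ≤ A := fun i => (hk i).trans (by nlinarith [norm_nonneg k])
  have hkk : ∀ i j, |k i| * |k j| ≤ A := fun i j =>
    (mul_le_mul (hk i) (hk j) (abs_nonneg _) (norm_nonneg _)).trans (by nlinarith [norm_nonneg k])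
  have hc := contDiff_cos_phase k
  have hsn := contDiff_sin_phase k
  have hc0 : ∀ z : Vec d, |Real.cos (∑ i, k i * z i)| ≤ A := fun z =>
    (Real.abs_cos_le_one _).trans (by nlinarith [norm_nonneg k])
  have hs0 : ∀ z : Vec d, |Real.sin (∑ i, k i * z i)| ≤ A := fun z =>
    (Real.abs_sin_le_one _).trans (by nlinarith [norm_nonneg k])
  have hc1 : ∀ i (z : Vec d), (1 + ‖z‖) * |pd i (fun z : Vec d => Real.cos (∑ i, k i * z i)) z| ≤ A * (1 + ‖z‖) :=
    fun i z => by
      rw [pd_cos_phase, abs_mul, abs_neg, mul_comm A]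
      refine mul_le_mul_of_nonneg_left ?_ (by positivity)
      exact (mul_le_of_le_one_right (abs_nonneg _) (Real.abs_sin_le_one _)).trans (hkA i)
  have hs1 : ∀ i (z : Vec d), (1 + ‖z‖) * |pd i (fun z : Vec d => Real.sin (∑ i, k i * z i)) z| ≤ A * (1 + ‖z‖) :=
    fun i z => by
      rw [pd_sin_phase, abs_mul, mul_comm A]
      refine mul_le_mul_of_nonneg_left ?_ (by positivity)
      exact (mul_le_of_le_one_right (abs_nonneg _) (Real.abs_cos_le_one _)).trans (hkA i)
  have hc2 : ∀ i j (z : Vec d), |pd i (pd j fun z : Vec d => Real.cos (∑ i, k i * z i)) z| ≤ A := fun i j z => by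
    rw [pd_pd_cos_phase, abs_mul, abs_neg, abs_mul]
    exact (mul_le_of_le_one_right (by positivity) (Real.abs_cos_le_one _)).trans (hkk i j)
  have hs2 : ∀ i j (z : Vec d), |pd i (pd j fun z : Vec d => Real.sin (∑ i, k i * z i)) z| ≤ A := fun i j z => by
    rw [pd_pd_sin_phase, abs_mul, abs_neg, abs_mul]
    exact (mul_le_of_le_one_right (by positivity) (Real.abs_sin_le_one _)).trans (hkk i j)
  have hWi : ∀ r ∈ Icc s t, Integrable (fun ω => 1 + ‖X r ω‖) P := fun r hr => (hN r hr).1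
  have hWN : ∀ r ∈ Icc s t, ∫ ω, (1 + ‖X r ω‖) ∂P ≤ N := fun r hr => (hN r hr).2
  have hE : ∀ r, ∫ ω, Complex.exp (Complex.I * ((∑ i, k i * X r ω i : ℝ) : ℂ)) ∂P
      = ((∫ ω, Real.cos (∑ i, k i * X r ω i) ∂P : ℝ) : ℂ)
        + Complex.I * ((∫ ω, Real.sin (∑ i, k i * X r ω i) ∂P : ℝ) : ℂ) := fun r => by
    rw [← integral_ofReal_add_I_mul (hX.integrable_comp hc.continuous hc0 r)
      (hX.integrable_comp hsn.continuous hs0 r)]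
    exact integral_congr_ae (Eventually.of_forall fun ω => exp_phase _)
  have hG : ∫ u in s..v, ∫ ω, genSymb 0 (b u (X (max u s) ω)) (fun i j => sqMat d σ u (X (max u s) ω) i j) k
            * Complex.exp (Complex.I * ((∑ i, k i * X (max u s) ω i : ℝ) : ℂ)) ∂P
      = ((∫ u in s..v, ∫ ω, genApply d b σ u (fun z : Vec d => Real.cos (∑ i, k i * z i)) (X (max u s) ω) ∂P : ℝ) : ℂ)
        + Complex.I * ((∫ u in s..v, ∫ ω,
          genApply d b σ u (fun z : Vec d => Real.sin (∑ i, k i * z i)) (X (max u s) ω) ∂P : ℝ) : ℂ) := by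
    have hIc := hX.intervalIntegrable_genApply h hs hc hA0 hW1 hc1 hc2 hWi hWN hv
    have hIs := hX.intervalIntegrable_genApply h hs hsn hA0 hW1 hs1 hs2 hWi hWN hv
    rw [intervalIntegrable_iff_integrableOn_Ioc_of_le hv.1] at hIc hIs
    rw [intervalIntegral.integral_of_le hv.1, intervalIntegral.integral_of_le hv.1,
      intervalIntegral.integral_of_le hv.1, ← integral_ofReal_add_I_mul hIc hIs]
    refine setIntegral_congr_fun measurableSet_Ioc fun u hu => ?_
    have hu' : u ∈ Icc s t := ⟨hu.1.le, hu.2.trans hv.2⟩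
    show ∫ ω, _ ∂P = _
    rw [← integral_ofReal_add_I_mul
      (hX.integrable_genApply h hs hc hA0 hW1 hc1 hc2 hu'.1 (hWi u hu'))
      (hX.integrable_genApply h hs hsn hA0 hW1 hs1 hs2 hu'.1 (hWi u hu'))]
    exact integral_congr_ae (Eventually.of_forall fun ω => genSymb_mul_exp_phase k b σ u _)
  have hDc := hX.dynkin h hs hc hA0 hW1 hc0 hc1 hc2 hWi hWN hv
  have hDs := hX.dynkin h hs hsn hA0 hW1 hs0 hs1 hs2 hWi hWN hv
  rw [hE v, hE s, hG, hDc, hDs, Complex.ofReal_add, Complex.ofReal_add]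
  ring

/-- Solutions of the martingale problem satisfy the Fourier-side description of a diffusion. -/
lemma exists_isDiffusion (hX : MartingaleProblemSolution d b σ s x P X) (h : GrowthBound b σ C) (hs : 0 ≤ s)
    (t : ℝ) : ∃ N, IsDiffusion P (fun r ω => X (max r s) ω) b (fun r z i j => sqMat d σ r z i j) s t N := by
  have := hX.isProb
  obtain ⟨N, hN⟩ := hX.exists_integrable_norm h hs t
  have hI : ∀ r ∈ Icc s t, Integrable (fun ω => ‖X r ω‖) P := fun r hr =>
    (hN r hr).1.mono' (hX.measurable_X r).norm.aestronglyMeasurable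
      (Eventually.of_forall fun ω => by rw [norm_norm]; linarith)
  refine ⟨max C N, hX.isProb, hX.measurable_stopped, h.measurable_b, h.measurable_a, fun r hr z => ?_,
    fun r hr z i j => ?_, fun r hr => ?_, fun r hr => ?_, fun k v hv => ?_⟩
  · exact (h.norm_b r (hs.trans hr.1) z).trans (mul_le_mul_of_nonneg_right (le_max_left _ _) (by positivity))
  · exact (h.abs_a r (hs.trans hr.1) z i j).trans (le_max_left _ _)
  · simpa only [max_eq_left hr.1] using hI r hr
  · simp only [max_eq_left hr.1]
    exact (integral_mono (hI r hr) (hN r hr).1 fun ω => by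
      show ‖X r ω‖ ≤ 1 + ‖X r ω‖
      linarith).trans ((hN r hr).2.trans (le_max_right _ _))
  · simpa only [max_eq_left hv.1, max_self] using hX.integral_exp_phase h hs k hv

end MartingaleProblemSolution

lemma sqMat_symm {d : ℕ} (σ : ℝ → Vec d → Matrix (Fin d) (Fin d) ℝ) (r : ℝ) (z : Vec d) (i j : Fin d) :
    sqMat d σ r z i j = sqMat d σ r z j i := by
  simp only [sqMat, mul_apply, transpose_apply]
  exact Finset.sum_congr rfl fun l _ => mul_comm _ _

namespace HolderDrift
variable {d : ℕ} {ρ : Vec d → ℝ} {b : ℝ → Vec d → Vec d} {κ₁ β : ℝ}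

lemma norm_mollifiedDrift_le (h : HolderDrift d b κ₁ β) (hρ : IsMollifier d ρ) (hκ : 0 ≤ κ₁) (hβ : 0 ≤ β)
    (hβ1 : β ≤ 1) {r : ℝ} (hr : 0 ≤ r) (z : Vec d) : ‖mollifiedDrift d ρ 1 b r z‖ ≤ 3 * κ₁ * (1 + ‖z‖) := by
  have h1 := h.norm_mollifiedDrift_sub_le hρ hκ hβ hβ1 hr z
  have h2 := h.norm_le hκ hβ hβ1 hr z
  have h3 := norm_sub_norm_le (mollifiedDrift d ρ 1 b r z) (b r z)
  nlinarith [mul_nonneg hκ (norm_nonneg z)]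

lemma norm_sub_mollifiedDrift_le (h : HolderDrift d b κ₁ β) (hρ : IsMollifier d ρ) (hκ : 0 ≤ κ₁) (hβ : 0 ≤ β)
    (hβ1 : β ≤ 1) {r : ℝ} (hr : 0 ≤ r) (z w : Vec d) :
    ‖b r z - mollifiedDrift d ρ 1 b r w‖ ≤ 2 * κ₁ * (1 + ‖z - w‖) := by
  have h1 := h.norm_mollifiedDrift_sub_le hρ hκ hβ hβ1 hr w
  rw [norm_sub_rev] at h1
  have h2 := h.2.2 r hr z w
  have h3 : max (‖z - w‖ ^ β) ‖z - w‖ ≤ 1 + ‖z - w‖ := by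
    refine max_le ?_ (by linarith [norm_nonneg (z - w)])
    exact (Real.rpow_le_rpow (norm_nonneg _) (by linarith) hβ).trans
      (Real.rpow_le_self_of_one_le (by linarith [norm_nonneg (z - w)]) hβ1)
  have h4 := norm_sub_le_norm_sub_add_norm_sub (b r z) (b r w) (mollifiedDrift d ρ 1 b r w)
  have h5 := mul_le_mul_of_nonneg_left h3 hκ
  nlinarith [mul_nonneg hκ (norm_nonneg (z - w))]

end HolderDrift

set_option maxHeartbeats 1000000 in
/-- **Gradient estimate in the forward variable.** Under (H^σ_α) with
`α ∈ (0,1)`, (H^b_β) with `β ∈ (0,1]`, and assuming `σ` is differentiable in space with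
`‖∇σ‖_∞ ≤ κ₂` and α-Hölder `∇σ`, for `(s,t) ∈ 𝔻^T_0` and any family of
martingale-problem solutions with jointly continuous density `p(s,·,t,·)`, the map
`y ↦ p(s,x,t,y)` is `C¹` and there are `λ₃ ∈ (0,1]`, `C₃ ≥ 1` depending only on
`Θ = (T,α,β,κ₀,κ₁,d)` and `κ₂` with
`|∇_y p(s,x,t,y)| ≤ C₃ (t−s)^{−1/2} g_{λ₃}(t−s, θ^{(1)}_{t,s}(x)−y)`. -/
theorem gradient_estimate_forward
    (d : ℕ) (T α β κ₀ κ₁ κ₂ : ℝ) (hT : 0 < T) (hα : α ∈ Set.Ioo (0 : ℝ) 1)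
    (hβ : β ∈ Set.Ioc (0 : ℝ) 1) (hκ₀ : 1 ≤ κ₀) (hκ₁ : 0 < κ₁) (hκ₂ : 0 < κ₂)
    (ρ : Vec d → ℝ) (hρ : IsMollifier d ρ) :
    ∃ l₃ ∈ Set.Ioc (0 : ℝ) 1, ∃ C₃ : ℝ, 1 ≤ C₃ ∧
      ∀ (b : ℝ → Vec d → Vec d) (σ : ℝ → Vec d → Matrix (Fin d) (Fin d) ℝ)
        (θ1 : ℝ → ℝ → Vec d → Vec d),
        EllipticHolder d σ κ₀ α → HolderDrift d b κ₁ β →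
        (∀ t' : ℝ, 0 ≤ t' → ∀ i j : Fin d, Differentiable ℝ fun z => σ t' z i j) →
        (∀ t' : ℝ, 0 ≤ t' → ∀ z : Vec d, ∀ i j : Fin d,
          ‖fderiv ℝ (fun w => σ t' w i j) z‖ ≤ κ₂) →
        (∀ t' : ℝ, 0 ≤ t' → ∀ z w : Vec d, ∀ i j : Fin d,
          ‖fderiv ℝ (fun v => σ t' v i j) z - fderiv ℝ (fun v => σ t' v i j) w‖ ≤
            κ₂ * ‖z - w‖ ^ α) →
        IsFlow d (mollifiedDrift d ρ 1 b) θ1 →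
      ∀ s t : ℝ, 0 ≤ s → s < t → t - s < T →
      ∀ (Ω : Type) (mΩ : MeasurableSpace Ω)
        (P : Vec d → MeasureTheory.Measure Ω) (X : ℝ → Ω → Vec d),
        (∀ x : Vec d, MartingaleProblemSolution d b σ s x (P x) X) →
      ∀ p : Vec d → Vec d → ℝ,
        Continuous (fun q : Vec d × Vec d => p q.1 q.2) →
        (∀ x : Vec d,
          MeasureTheory.Measure.map (X t) (P x) =
            MeasureTheory.volume.withDensity fun y => ENNReal.ofReal (p x y)) →
        (∀ x : Vec d, ContDiff ℝ 1 fun y => p x y) ∧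
        ∀ x y : Vec d,
          ‖fderiv ℝ (fun y' => p x y') y‖ ≤
            C₃ * (t - s) ^ (-(1 : ℝ) / 2) * gaussk d l₃ (t - s) (θ1 t s x - y) := by
  have hκ₀' : 0 < κ₀ := by linarith
  set K : ℝ := 1 + κ₀ + d * κ₀ ^ 2 + 2 * d * κ₀ * κ₂ + 3 * d * κ₀ * κ₂ + 2 * κ₁ with hK
  have n1 : 0 ≤ d * κ₀ ^ 2 := by positivity
  have n2 : 0 ≤ 2 * d * κ₀ * κ₂ := by positivity
  have n3 : 0 ≤ 3 * d * κ₀ * κ₂ := by positivity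
  have hK1 : 1 ≤ K := by linarith
  obtain ⟨L, hL, hLip⟩ := exists_lipschitz_mollifiedDrift d ρ hρ κ₁ β hκ₁.le hβ.1.le hβ.2
  obtain ⟨M, l, hM, hl, H⟩ := Setup.exists_density_gradient_bound d T K α β hT hK1 hα.1 hα.2.le hβ.1 hβ.2
  set E : ℝ := Real.exp (L * T) with hE
  have hE0 : 0 < E := Real.exp_pos _
  refine ⟨min (l / E ^ 2) 1, ⟨by positivity, min_le_right _ _⟩, max M 1, le_max_right _ _, ?_⟩
  intro b σ θ1 hσ hb hσd hσb hσh hflow s t hs hst hsT Ω mΩ P X hX p hp hmap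
  have ht : 0 ≤ t := hs.trans hst.le
  have hB : ∀ r : ℝ, 0 ≤ r → ∀ z, ‖mollifiedDrift d ρ 1 b r z‖ ≤ 3 * κ₁ * (1 + ‖z‖) :=
    fun r hr z => hb.norm_mollifiedDrift_le hρ hκ₁.le hβ.1.le hβ.2 hr z
  have hmB := hb.measurable_mollifiedDrift hρ
  have hG : GrowthBound b σ K := ⟨hb.1, hσ.measurable_sqMat, by linarith, fun r hr z =>
    (hb.norm_le hκ₁.le hβ.1.le hβ.2 hr z).trans (mul_le_mul_of_nonneg_right (by linarith) (by positivity)),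
    fun r hr z i j => (hσ.abs_sqMat_le hκ₀ hr z i j).trans (by linarith)⟩
  have key : ∀ x, ContDiff ℝ 1 (fun y => p x y) ∧ ∀ y, ‖fderiv ℝ (fun y' => p x y') y‖
      ≤ M * (t - s) ^ (-(1:ℝ) / 2) * ((t - s) ^ (-(d:ℝ) / 2) * Real.exp (-l * ‖x - θ1 s t y‖ ^ 2 / (t - s))) := by
    intro x
    obtain ⟨N, hN⟩ := (hX x).exists_isDiffusion hG hs t
    let S : Vec d → Setup d T K α β := fun y =>
      { Ω := Ω, mΩ := mΩ, P := P x, X := fun r ω => X (max r s) ω, b := b, a := fun r z i j => sqMat d σ r z i j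
        s := s, t := t, N := N, x := x
        θ := fun r => θ1 (max s (min r t)) t y
        θ' := fun r => mollifiedDrift d ρ 1 b r (θ1 (max s (min r t)) t y)
        diff := hN
        hst := hst
        hT := hsT.le
        start := by simpa only [max_self] using (hX x).start
        path := hflow.isPath (by positivity) hmB hB hs hst.le y
        drift_path := fun r hr z =>
          (hb.norm_sub_mollifiedDrift_le hρ hκ₁.le hβ.1.le hβ.2 (hs.trans hr.1) z _).trans
            (mul_le_mul_of_nonneg_right (by linarith) (by positivity))
        drift_holder := fun r hr z w => (hb.2.2 r (hs.trans hr.1) z w).trans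
          (mul_le_mul_of_nonneg_right (by linarith) (le_max_of_le_right (norm_nonneg _)))
        symm := fun r _ z i j => sqMat_symm σ r z i j
        ell := fun r hr z k => (mul_le_mul_of_nonneg_right (inv_anti₀ hκ₀' (by linarith)) (by positivity)).trans
          (hσ.le_quadForm (hs.trans hr.1) z k)
        bd := fun r hr z i j => (hσ.abs_sqMat_le hκ₀ (hs.trans hr.1) z i j).trans (by linarith)
        lip := fun r hr z w i j => (hσ.abs_sqMat_sub_le hκ₀ hσd hσb (hs.trans hr.1) z w i j).trans
          (mul_le_mul_of_nonneg_right (by linarith) (norm_nonneg _))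
        expansion := fun r hr => by
          obtain ⟨D, hD, hD'⟩ := hσ.exists_sqMat_expansion hκ₀ hκ₂.le hα.1.le hσd hσb hσh (hs.trans hr.1)
            (θ1 (max s (min r t)) t y)
          exact ⟨D, fun i j l => (hD i j l).trans (by linarith), fun z i j => (hD' z i j).trans
            (mul_le_mul_of_nonneg_right (by linarith) (by positivity))⟩ }
    have hend : max s (min t t) = t := by rw [min_self, max_eq_right hst.le]
    have hbeg : max s (min s t) = s := by rw [min_eq_left hst.le, max_self]
    have hmap' : (P x).map (fun ω => X (max t s) ω) = (P x).map (X t) := by rw [max_eq_left hst.le]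
    obtain ⟨h1, h2⟩ := H (t - s) ((P x).map (X t)) (fun y => p x y)
      (hp.comp (continuous_const.prodMk continuous_id)) (hmap x) S (fun _ => rfl) (fun _ => hmap') (fun y => by
        show θ1 (max s (min t t)) t y = y
        rw [hend, hflow.self ht])
    refine ⟨h1, fun y => (h2 y).trans_eq ?_⟩
    have hd : (S y).dist = ‖x - θ1 s t y‖ := by
      show ‖x - θ1 (max s (min s t)) t y‖ = _
      rw [hbeg]
    rw [Setup.heat, hd]
  refine ⟨fun x => (key x).1, fun x y => ((key x).2 y).trans ?_⟩
  have hτ : 0 < t - s := by linarith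
  have hfw := hflow.norm_forward_sub_le (by positivity) hmB hB hL (hLip b hb) hs hst.le x y
  have hfw' : ‖θ1 t s x - y‖ ≤ E * ‖x - θ1 s t y‖ := hfw.trans
    (mul_le_mul_of_nonneg_right (Real.exp_le_exp.2 (mul_le_mul_of_nonneg_left hsT.le hL)) (norm_nonneg _))
  have hexp : min (l / E ^ 2) 1 * ‖θ1 t s x - y‖ ^ 2 ≤ l * ‖x - θ1 s t y‖ ^ 2 := by
    calc _ ≤ l / E ^ 2 * (E * ‖x - θ1 s t y‖) ^ 2 :=
          mul_le_mul (min_le_left _ _) (pow_le_pow_left₀ (norm_nonneg _) hfw' 2) (by positivity) (by positivity)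
      _ = _ := by field_simp
  unfold gaussk
  refine mul_le_mul (mul_le_mul_of_nonneg_right (le_max_left _ _) (by positivity))
    (mul_le_mul_of_nonneg_left (Real.exp_le_exp.2 ?_) (by positivity)) (by positivity) (by positivity)
  exact div_le_div_of_nonneg_right (by linarith) hτ.le
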